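/- Let d ≥ 2 be even and let n = p + q > d with p, q ≥ 1, and let 0 < κ < n − d. Let {I_t}_{t>0} be a decreasing family of bounded measurable subsets of ℝ with Lebesgue measures |I_t| = c·t^{−κ} for some constant c > 0. Then for any exponent ν with 0 < ν < 2(n−d−κ)/(n²+n+4), for almost all F ∈ Y_{p,q}^{(d)} there is a constant c_F > 0 and a constant C_F > 0 such that for all sufficiently large t: | #{v ∈ ℤⁿ : F(v) ∈ I_t and ‖v‖ ≤ t} − c_F·|I_t|·t^{n−d} | ≤ C_F·t^{n−d−κ−ν}. -/

import Mathlib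

open MeasureTheory Matrix Filter

noncomputable section

/-- `SL_n(ℝ)`. -/
abbrev SLR (n : ℕ) := Matrix.SpecialLinearGroup (Fin n) ℝ

instance (n : ℕ) : TopologicalSpace (SLR n) :=
  TopologicalSpace.induced (fun g => (g : Matrix (Fin n) (Fin n) ℝ)) inferInstance

instance (n : ℕ) : MeasurableSpace (SLR n) := borel _

/-- Euclidean norm on `ℝⁿ`. -/
def eucNorm {n : ℕ} (v : Fin n → ℝ) : ℝ := Real.sqrt (∑ i, v i ^ 2)

/-- `F₀(v) = Σ_{i=1}^p v_i^d − Σ_{i=p+1}^n v_i^d` on `ℝ^{p+q}`. -/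
def F0 (p q d : ℕ) (v : Fin (p + q) → ℝ) : ℝ :=
  ∑ i : Fin (p + q), (if (i : ℕ) < p then (1 : ℝ) else -1) * v i ^ d

/-- The polynomial `F = g·F₀`, i.e. `F(v) = F₀(v g)` (row vectors, right action). -/
def Fg (p q d : ℕ) (g : SLR (p + q)) (v : Fin (p + q) → ℝ) : ℝ :=
  F0 p q d (Matrix.vecMul v (g : Matrix (Fin (p + q)) (Fin (p + q)) ℝ))

/-- The coercion `ℤⁿ → ℝⁿ`. -/
def intVec {n : ℕ} (v : Fin n → ℤ) : Fin n → ℝ := fun i => (v i : ℝ)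

/-- `#{v ∈ ℤⁿ : F(v) ∈ I, ‖v‖ ≤ t}` for `F = g·F₀`. -/
def NF (p q d : ℕ) (g : SLR (p + q)) (I : Set ℝ) (t : ℝ) : ℕ :=
  Nat.card {v : Fin (p + q) → ℤ | Fg p q d g (intVec v) ∈ I ∧ eucNorm (intVec v) ≤ t}

/-- The primitive `s ↦ |I ∩ (-∞, s]|` of the indicator function of `I`. -/
def cumul (I : Set ℝ) (s : ℝ) : ℝ := (volume (I ∩ Set.Iic s)).toReal

lemma intervalIntegral_indicator_comp_mul_deriv_aux {P P' : ℝ → ℝ} (hP : ∀ x, HasDerivAt P (P' x) x)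
    (hc : Continuous P') {I : Set ℝ} (hI : MeasurableSet I) {a b : ℝ} (hab : a ≤ b) :
    (∫ x in a..b, I.indicator 1 (P x) * P' x) = ∫ s in P a..P b, I.indicator 1 s := by
  have hPc : Continuous P := continuous_iff_continuousAt.2 fun x => (hP x).continuousAt
  have hPm : Measurable P := hPc.measurable
  set p : ℝ → ENNReal := fun x => ENNReal.ofReal (P' x) with hp
  set q : ℝ → ENNReal := fun x => ENNReal.ofReal (-P' x) with hq
  have hpm : Measurable p := hc.measurable.ennreal_ofReal
  have hqm : Measurable q := hc.measurable.neg.ennreal_ofReal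
  have hfin : ∀ f : ℝ → ℝ, Continuous f →
      IsFiniteMeasure ((volume.restrict (Set.Ioc a b)).withDensity fun x => ENNReal.ofReal (f x)) := by
    intro f hf
    have hi : IntegrableOn f (Set.Ioc a b) := (hf.integrableOn_Icc).mono_set Set.Ioc_subset_Icc_self
    exact isFiniteMeasure_withDensity_ofReal hi.2
  have h1 := hfin P' hc
  have h2 := hfin (fun x => -P' x) hc.neg
  set μ₁ := (((volume.restrict (Set.Ioc a b)).withDensity p).map P) with hμ₁
  set μ₂ := (((volume.restrict (Set.Ioc a b)).withDensity q).map P) with hμ₂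
  set μ₃ := (volume.restrict (Set.Ioc (P a) (P b))) with hμ₃
  set μ₄ := (volume.restrict (Set.Ioc (P b) (P a))) with hμ₄
  have key : ∀ f : ℝ → ℝ, Measurable f → (∃ C, ∀ x, ‖f x‖ ≤ C) →
      ((∫ x, f x ∂μ₁) - (∫ x, f x ∂μ₂) = ∫ x in a..b, f (P x) * P' x) := by
    rintro f hf ⟨C, hC⟩
    rw [hμ₁, hμ₂, integral_map hPm.aemeasurable hf.aestronglyMeasurable,
      integral_map hPm.aemeasurable hf.aestronglyMeasurable,
      integral_withDensity_eq_integral_toReal_smul hpm (by simp [hp]),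
      integral_withDensity_eq_integral_toReal_smul hqm (by simp [hq]),
      intervalIntegral.integral_of_le hab, ← integral_sub]
    · refine integral_congr_ae (Eventually.of_forall fun x => ?_)
      simp only [hp, hq, smul_eq_mul, ENNReal.toReal_ofReal']
      rcases le_total 0 (P' x) with h | h
      · rw [max_eq_left h, max_eq_right (by linarith)]; ring
      · rw [max_eq_right h, max_eq_left (by linarith)]; ring
    · simp only [smul_eq_mul, hp, ENNReal.toReal_ofReal']
      refine Integrable.mul_bdd (c := C) ?_ (hf.comp hPm).aestronglyMeasurable
        (Eventually.of_forall fun x => hC _)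
      exact (((hc.max continuous_const).integrableOn_Icc)).mono_set Set.Ioc_subset_Icc_self
    · simp only [smul_eq_mul, hq, ENNReal.toReal_ofReal']
      refine Integrable.mul_bdd (c := C) ?_ (hf.comp hPm).aestronglyMeasurable
        (Eventually.of_forall fun x => hC _)
      exact (((hc.neg.max continuous_const).integrableOn_Icc)).mono_set Set.Ioc_subset_Icc_self
  have hmeas : μ₁ + μ₄ = μ₂ + μ₃ := by
    refine ext_of_forall_integral_eq_of_IsFiniteMeasure fun f => ?_
    have hfi : ∀ (ν : Measure ℝ) [IsFiniteMeasure ν], Integrable (fun x => f x) ν := fun ν _ =>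
      f.integrable ν
    rw [integral_add_measure (hfi _) (hfi _), integral_add_measure (hfi _) (hfi _)]
    have e1 := key f f.continuous.measurable ⟨‖f‖, f.norm_coe_le_norm⟩
    have e2 : (∫ x in a..b, f (P x) * P' x) = ∫ s in P a..P b, f s :=
      intervalIntegral.integral_comp_mul_deriv (fun x _ => hP x) hc.continuousOn f.continuous
    rw [e2, intervalIntegral] at e1
    linarith
  have hbd : ∀ x, ‖I.indicator (1 : ℝ → ℝ) x‖ ≤ 1 := fun x => by
    by_cases h : x ∈ I <;> simp [h]
  have hfm : Measurable (I.indicator (1 : ℝ → ℝ)) := measurable_one.indicator hI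
  rw [← key _ hfm ⟨1, hbd⟩, intervalIntegral]
  have hfi : ∀ (ν : Measure ℝ) [IsFiniteMeasure ν], Integrable (I.indicator (1 : ℝ → ℝ)) ν :=
    fun ν _ => Integrable.of_bound hfm.aestronglyMeasurable 1 (Eventually.of_forall hbd)
  have := congrArg (fun ν => ∫ x, I.indicator (1 : ℝ → ℝ) x ∂ν) hmeas
  simp only [integral_add_measure (hfi _) (hfi _)] at this
  linarith

lemma cumul_sub {I : Set ℝ} (hI : MeasurableSet I) (hf : volume I ≠ ⊤) {a b : ℝ} (hab : a ≤ b) :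
    cumul I b - cumul I a = (volume (I ∩ Set.Ioc a b)).toReal := by
  have : I ∩ Set.Iic b = (I ∩ Set.Iic a) ∪ (I ∩ Set.Ioc a b) := by
    rw [← Set.inter_union_distrib_left, Set.Iic_union_Ioc_eq_Iic hab]
  have h1 : volume (I ∩ Set.Iic a) ≠ ⊤ := ne_top_of_le_ne_top hf (measure_mono Set.inter_subset_left)
  have h2 : volume (I ∩ Set.Ioc a b) ≠ ⊤ := ne_top_of_le_ne_top hf (measure_mono Set.inter_subset_left)
  rw [cumul, cumul, this, measure_union _ (hI.inter measurableSet_Ioc), ENNReal.toReal_add h1 h2]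
  · ring
  · refine Set.disjoint_left.2 fun x hx hy => ?_
    exact absurd hx.2 (not_le.2 hy.2.1)

lemma cumul_mono {I : Set ℝ} (hI : MeasurableSet I) (hf : volume I ≠ ⊤) : Monotone (cumul I) := by
  intro a b hab
  have := cumul_sub hI hf hab
  have h2 : 0 ≤ (volume (I ∩ Set.Ioc a b)).toReal := ENNReal.toReal_nonneg
  linarith

lemma intervalIntegral_indicator {I : Set ℝ} (hI : MeasurableSet I) (hf : volume I ≠ ⊤) (a b : ℝ) :
    (∫ s in a..b, I.indicator (1 : ℝ → ℝ) s) = cumul I b - cumul I a := by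
  wlog hab : a ≤ b generalizing a b
  · rw [intervalIntegral.integral_symm, this b a (le_of_not_ge hab)]; ring
  rw [cumul_sub hI hf hab, intervalIntegral.integral_of_le hab, integral_indicator_one hI,
    measureReal_restrict_apply hI, Measure.real]

lemma cumul_lipschitz {I : Set ℝ} (hI : MeasurableSet I) (hf : volume I ≠ ⊤) :
    LipschitzWith 1 (cumul I) := by
  refine LipschitzWith.of_le_add_mul 1 fun x y => ?_
  rcases le_total x y with h | h
  · have := cumul_mono hI hf h
    have h2 := dist_nonneg (x := x) (y := y)
    simp; linarith
  · have := cumul_sub hI hf h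
    have h2 : (volume (I ∩ Set.Ioc y x)).toReal ≤ x - y := by
      have := measure_mono (μ := volume) (Set.inter_subset_right (s := I) (t := Set.Ioc y x))
      have := ENNReal.toReal_mono (by simp) this
      simpa [h] using this
    rw [Real.dist_eq, abs_of_nonneg (by linarith)]; simp; linarith

lemma cumul_nonneg (I : Set ℝ) (s : ℝ) : 0 ≤ cumul I s := ENNReal.toReal_nonneg

lemma cumul_le {I : Set ℝ} (hf : volume I ≠ ⊤) (s : ℝ) : cumul I s ≤ (volume I).toReal :=
  ENNReal.toReal_mono hf (measure_mono Set.inter_subset_left)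

lemma cumul_of_lt {I : Set ℝ} {M s : ℝ} (h : I ⊆ Set.Icc (-M) M) (hs : s < -M) : cumul I s = 0 := by
  have : I ∩ Set.Iic s = ∅ := by
    ext x; simp only [Set.mem_inter_iff, Set.mem_Iic, Set.mem_empty_iff_false, iff_false, not_and]
    intro hx; have := (h hx).1; linarith
  simp [cumul, this]

lemma cumul_of_gt {I : Set ℝ} {M s : ℝ} (h : I ⊆ Set.Icc (-M) M) (hs : M ≤ s) :
    cumul I s = (volume I).toReal := by
  have : I ∩ Set.Iic s = I := by
    refine Set.inter_eq_left.2 fun x hx => ?_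
    exact (h hx).2.trans hs
  rw [cumul, this]

/-- Integration by parts against the indicator function of a measurable set. -/
lemma integral_indicator_comp_mul_deriv_mul {P P' e e' : ℝ → ℝ} (hP : ∀ x, HasDerivAt P (P' x) x)
    (hc : Continuous P') (he : ∀ x, HasDerivAt e (e' x) x) (hce : Continuous e') {r : ℝ}
    (hes : ∀ x, r ≤ |x| → e x = 0) {I : Set ℝ} (hI : MeasurableSet I) (hf : volume I ≠ ⊤) :
    (∫ x, I.indicator 1 (P x) * P' x * e x) = - ∫ x, cumul I (P x) * e' x := by
  have hes' : ∀ x, r < |x| → e' x = 0 := by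
    intro x hx
    refine (he x).unique ?_
    have h0 : (fun _ => (0 : ℝ)) =ᶠ[nhds x] e := by
      filter_upwards [continuous_abs.continuousAt.eventually_const_lt hx] with y hy
      exact (hes y hy.le).symm
    exact (hasDerivAt_const x (0:ℝ)).congr_of_eventuallyEq h0.symm
  set a := -(|r| + 1)
  set b := |r| + 1
  have hab : a ≤ b := by simp only [a, b]; linarith [abs_nonneg r]
  have hout : ∀ x, x ∉ Set.Ioc a b → r < |x| := by
    intro x hx
    have := le_abs_self r
    by_contra! h
    have h2 := abs_le.1 h
    exact hx ⟨by simp only [a]; linarith, by simp only [b]; linarith⟩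
  have hPc : Continuous P := continuous_iff_continuousAt.2 fun x => (hP x).continuousAt
  have e1 : (∫ x, I.indicator 1 (P x) * P' x * e x) = ∫ x in a..b, (I.indicator 1 (P x) * P' x) * e x := by
    rw [intervalIntegral.integral_of_le hab, setIntegral_eq_integral_of_forall_compl_eq_zero]
    intro x hx; rw [hes x (hout x hx).le, mul_zero]
  have e2 : (∫ x, cumul I (P x) * e' x) = ∫ x in a..b, cumul I (P x) * e' x := by
    rw [intervalIntegral.integral_of_le hab, setIntegral_eq_integral_of_forall_compl_eq_zero]
    intro x hx; rw [hes' x (hout x hx), mul_zero]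
  rw [e1, e2]
  have hu : ∀ x y, (∫ t in x..y, I.indicator 1 (P t) * P' t) = cumul I (P y) - cumul I (P x) := by
    intro x y
    wlog hxy : x ≤ y generalizing x y
    · rw [intervalIntegral.integral_symm, this y x (le_of_not_ge hxy)]; ring
    rw [intervalIntegral_indicator_comp_mul_deriv_aux hP hc hI hxy, intervalIntegral_indicator hI hf]
  have hii : IntervalIntegrable (fun t => I.indicator 1 (P t) * P' t) volume a b := by
    rw [intervalIntegrable_iff_integrableOn_Ioc_of_le hab]
    refine Integrable.bdd_mul (c := 1) ((hc.integrableOn_Icc).mono_set Set.Ioc_subset_Icc_self)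
      ((measurable_one.indicator hI).comp hPc.measurable).aestronglyMeasurable
      (Eventually.of_forall fun x => ?_)
    by_cases h : P x ∈ I <;> simp [h]
  have hec : Continuous e := continuous_iff_continuousAt.2 fun x => (he x).continuousAt
  have had := hii.ae_hasDerivAt_integral
  have hPl : AbsolutelyContinuousOnInterval (fun x => cumul I (P x)) a b := by
    have := hii.absolutelyContinuousOnInterval_intervalIntegral (c := a) (Set.left_mem_uIcc)
    have h2 : (fun x => cumul I (P x)) = fun x => (∫ t in a..x, I.indicator 1 (P t) * P' t) + cumul I (P a) := by
      funext x; rw [hu]; ring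
    rw [h2]
    refine this.add ?_
    exact (LipschitzWith.const (cumul I (P a)) : LipschitzWith 0 fun _ : ℝ => _).lipschitzOnWith.absolutelyContinuousOnInterval
  have hel : AbsolutelyContinuousOnInterval e a b := by
    have h3 := (hce.intervalIntegrable a b).absolutelyContinuousOnInterval_intervalIntegral (c := a) (Set.left_mem_uIcc)
    have h2 : e = fun x => (∫ t in a..x, e' t) + e a := by
      funext x
      rw [intervalIntegral.integral_eq_sub_of_hasDerivAt (fun y _ => he y) (hce.intervalIntegrable _ _)]; ring
    rw [h2]
    refine h3.add ?_
    exact (LipschitzWith.const (e a) : LipschitzWith 0 fun _ : ℝ => _).lipschitzOnWith.absolutelyContinuousOnInterval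
  have hpar := hPl.integral_mul_deriv_eq_deriv_mul hel
  have hea : e a = 0 := hes a (by simp only [a, abs_neg]; rw [abs_of_nonneg (by positivity)]; linarith [le_abs_self r])
  have heb : e b = 0 := hes b (by simp only [b]; rw [abs_of_nonneg (by positivity)]; linarith [le_abs_self r])
  rw [hea, heb] at hpar
  have hde : deriv e = e' := funext fun x => (he x).deriv
  rw [hde] at hpar
  rw [hpar]
  have : (∫ x in a..b, deriv (fun x => cumul I (P x)) x * e x) = ∫ x in a..b, (I.indicator 1 (P x) * P' x) * e x := by
    refine intervalIntegral.integral_congr_ae ?_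
    filter_upwards [had] with x hx hxm
    congr 1
    have hx' := hx (Set.uIoc_subset_uIcc hxm) a Set.left_mem_uIcc
    simp only [hu] at hx'
    exact (by simpa using hx'.add_const (cumul I (P a)) : HasDerivAt (fun x => cumul I (P x)) _ x).deriv
  rw [this]; ring

lemma exists_centers_of_polynomial {p : Polynomial ℝ} {d : ℕ} (hd : 1 ≤ d) (hp : p.natDegree = d) :
    ∃ s : Finset ℝ, s.card ≤ d ∧ ∀ x δ : ℝ, 0 ≤ δ → |p.eval x| ≤ δ →
      ∃ r ∈ s, |x - r| ≤ (δ / |p.leadingCoeff|) ^ (1 / d : ℝ) := by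
  classical
  have hp0 : p ≠ 0 := by rintro rfl; simp at hp; omega
  have hA : 0 < |p.leadingCoeff| := abs_pos.2 (Polynomial.leadingCoeff_ne_zero.2 hp0)
  set P := p.map (algebraMap ℝ ℂ) with hP
  have hs : P.Splits := IsAlgClosed.splits P
  have hcard : Multiset.card P.roots = d := by
    rw [← hs.natDegree_eq_card_roots, hP, Polynomial.natDegree_map, hp]
  refine ⟨(P.roots.map Complex.re).toFinset, ?_, ?_⟩
  · exact (Multiset.toFinset_card_le _).trans (by rw [Multiset.card_map, hcard])
  intro x δ hδ hx
  by_contra! hcon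
  set ρ := (δ / |p.leadingCoeff|) ^ (1 / d : ℝ) with hρ
  have hρ0 : 0 ≤ ρ := by positivity
  have hρd : ρ ^ d = δ / |p.leadingCoeff| := by
    rw [hρ, ← Real.rpow_natCast, ← Real.rpow_mul (by positivity)]
    rw [one_div_mul_cancel (by positivity), Real.rpow_one]
  have heval : |p.eval x| = |p.leadingCoeff| * (P.roots.map fun z => ‖(x : ℂ) - z‖).prod := by
    have h1 : ‖P.eval (x : ℂ)‖ = |p.eval x| := by
      rw [hP]
      have : (p.map (algebraMap ℝ ℂ)).eval (x : ℂ) = ((p.eval x : ℝ) : ℂ) := by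
        have := Polynomial.eval_map_apply (f := algebraMap ℝ ℂ) (p := p) x
        simpa using this
      rw [this, Complex.norm_real, Real.norm_eq_abs]
    rw [← h1, hs.eval_eq_prod_roots, norm_mul, hP, Polynomial.leadingCoeff_map]
    congr 1
    · simp
    · have := map_multiset_prod (normHom : ℂ →*₀ ℝ) (Multiset.map (fun a => (x : ℂ) - a) P.roots)
      simpa [Multiset.map_map, Function.comp_def] using this
  have hlt : ∀ z ∈ P.roots, ρ < ‖(x : ℂ) - z‖ := by
    intro z hz
    have h1 := hcon z.re (by simp only [Multiset.mem_toFinset, Multiset.mem_map]; exact ⟨z, hz, rfl⟩)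
    have h2 := Complex.abs_re_le_norm ((x : ℂ) - z)
    simp at h2
    linarith
  have hprod : ρ ^ d < (P.roots.map fun z => ‖(x : ℂ) - z‖).prod := by
    have gen : ∀ S : Multiset ℂ, (∀ z ∈ S, ρ < ‖(x : ℂ) - z‖) → 
        (1 ≤ Multiset.card S → ρ ^ Multiset.card S < (S.map fun z => ‖(x : ℂ) - z‖).prod) := by
      intro S
      induction S using Multiset.induction with
      | empty => intro _ h; simp at h
      | cons z S ih =>
        intro hS _
        have hz := hS z (Multiset.mem_cons_self z S)
        have hS' := fun w hw => hS w (Multiset.mem_cons_of_mem hw)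
        rw [Multiset.card_cons, Multiset.map_cons, Multiset.prod_cons, pow_succ']
        rcases Nat.eq_zero_or_pos (Multiset.card S) with h0 | h0
        · rw [Multiset.card_eq_zero] at h0; simpa [h0] using hz
        · exact mul_lt_mul'' hz (ih hS' h0) hρ0 (by positivity)
    have := gen P.roots hlt (by omega)
    rwa [hcard] at this
  rw [hρd, div_lt_iff₀ hA] at hprod
  rw [heval] at hx
  linarith

lemma exists_centers {ι : Type*} [Fintype ι] {ε a : ι → ℝ} (c : ι → ℝ) {d : ℕ} (hd : 1 ≤ d)
    (hA : ∑ i, ε i * a i ^ d ≠ 0) :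
    ∃ s : Finset ℝ, s.card ≤ d ∧ ∀ x δ : ℝ, 0 ≤ δ → |∑ i, ε i * (x * a i + c i) ^ d| ≤ δ →
      ∃ r ∈ s, |x - r| ≤ (δ / |∑ i, ε i * a i ^ d|) ^ (1 / d : ℝ) := by
  set p : Polynomial ℝ := ∑ i, Polynomial.C (ε i) * (Polynomial.C (a i) * Polynomial.X + Polynomial.C (c i)) ^ d
    with hp
  have hdeg1 : ∀ i, (Polynomial.C (a i) * Polynomial.X + Polynomial.C (c i)).natDegree ≤ 1 := fun i =>
    Polynomial.natDegree_linear_le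
  have hle : p.natDegree ≤ d := by
    refine Polynomial.natDegree_sum_le_of_forall_le _ _ fun i _ => ?_
    refine (Polynomial.natDegree_C_mul_le _ _).trans ?_
    refine (Polynomial.natDegree_pow_le).trans ?_
    simpa using Nat.mul_le_mul_left d (hdeg1 i)
  have hcoeff : p.coeff d = ∑ i, ε i * a i ^ d := by
    rw [hp, Polynomial.finsetSum_coeff]
    refine Finset.sum_congr rfl fun i _ => ?_
    rw [Polynomial.coeff_C_mul]
    have := Polynomial.coeff_pow_of_natDegree_le (hdeg1 i) (m := d)
    rw [mul_one] at this
    rw [this]; simp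
  have hdeg : p.natDegree = d := by
    refine le_antisymm hle (Polynomial.le_natDegree_of_ne_zero ?_)
    rwa [hcoeff]
  have hlead : p.leadingCoeff = ∑ i, ε i * a i ^ d := by
    rw [Polynomial.leadingCoeff, hdeg, hcoeff]
  obtain ⟨s, hs, h⟩ := exists_centers_of_polynomial hd hdeg
  refine ⟨s, hs, fun x δ hδ hx => ?_⟩
  rw [hlead] at h
  refine h x δ hδ ?_
  have : p.eval x = ∑ i, ε i * (x * a i + c i) ^ d := by
    rw [hp, Polynomial.eval_finsetSum]
    refine Finset.sum_congr rfl fun i _ => ?_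
    simp; left; ring
  rwa [this]

lemma volume_sublevel_le {ι : Type*} [Fintype ι] {ε a : ι → ℝ} (c : ι → ℝ) {d : ℕ} (hd : 1 ≤ d)
    (hA : ∑ i, ε i * a i ^ d ≠ 0) {δ : ℝ} (hδ : 0 ≤ δ) :
    volume {x : ℝ | |∑ i, ε i * (x * a i + c i) ^ d| ≤ δ}
      ≤ ENNReal.ofReal (2 * d * (δ / |∑ i, ε i * a i ^ d|) ^ (1 / d : ℝ)) := by
  obtain ⟨s, hs, h⟩ := exists_centers c hd hA
  set ρ := (δ / |∑ i, ε i * a i ^ d|) ^ (1 / d : ℝ)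
  have hρ : 0 ≤ ρ := by positivity
  calc _ ≤ volume (⋃ r ∈ s, Metric.closedBall r ρ) := by
        refine measure_mono fun x hx => ?_
        obtain ⟨r, hr, hr'⟩ := h x δ hδ hx
        simp only [Set.mem_iUnion]
        exact ⟨r, hr, by rw [Metric.mem_closedBall, Real.dist_eq]; exact hr'⟩
    _ ≤ ∑ r ∈ s, volume (Metric.closedBall r ρ) := measure_biUnion_finset_le _ _
    _ = s.card * ENNReal.ofReal (2 * ρ) := by simp
    _ ≤ d * ENNReal.ofReal (2 * ρ) := by gcongr
    _ = _ := by
        rw [← ENNReal.ofReal_natCast, ← ENNReal.ofReal_mul (by positivity)]; congr 1; ring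

/-- The number of integer points in a translate of a sublevel set is bounded. -/
lemma ncard_sublevel_le {ι : Type*} [Fintype ι] {ε a : ι → ℝ} (c : ι → ℝ) {d : ℕ} (hd : 1 ≤ d)
    (hA : ∑ i, ε i * a i ^ d ≠ 0) {δ : ℝ} (hδ : 0 ≤ δ) (θ : ℝ) :
    ∃ F : Finset ℤ, (F.card : ℝ) ≤ d * (2 * (δ / |∑ i, ε i * a i ^ d|) ^ (1 / d : ℝ) + 1) ∧
      ∀ k : ℤ, |∑ i, ε i * ((k + θ) * a i + c i) ^ d| ≤ δ → k ∈ F := by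
  classical
  obtain ⟨s, hs, h⟩ := exists_centers c hd hA
  set ρ := (δ / |∑ i, ε i * a i ^ d|) ^ (1 / d : ℝ)
  have hρ : 0 ≤ ρ := by positivity
  refine ⟨s.biUnion fun r => Finset.Icc ⌈r - θ - ρ⌉ ⌊r - θ + ρ⌋, ?_, ?_⟩
  · calc (((s.biUnion fun r => Finset.Icc ⌈r - θ - ρ⌉ ⌊r - θ + ρ⌋).card : ℕ) : ℝ)
        ≤ ((∑ r ∈ s, (Finset.Icc ⌈r - θ - ρ⌉ ⌊r - θ + ρ⌋).card : ℕ) : ℝ) := by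
          exact_mod_cast Finset.card_biUnion_le
      _ = ∑ r ∈ s, ((Finset.Icc ⌈r - θ - ρ⌉ ⌊r - θ + ρ⌋).card : ℝ) := by push_cast; rfl
      _ ≤ ∑ r ∈ s, (2 * ρ + 1) := by
          refine Finset.sum_le_sum fun r _ => ?_
          rw [Int.card_Icc]
          have h1 := Int.le_ceil (r - θ - ρ)
          have h2 := Int.floor_le (r - θ + ρ)
          rcases le_total 0 (⌊r - θ + ρ⌋ + 1 - ⌈r - θ - ρ⌉) with h0 | h0
          · have : (((⌊r - θ + ρ⌋ + 1 - ⌈r - θ - ρ⌉).toNat : ℤ) : ℝ) = ⌊r - θ + ρ⌋ + 1 - ⌈r - θ - ρ⌉ := by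
              rw [Int.toNat_of_nonneg h0]; push_cast; ring
            rw [Int.cast_natCast] at this
            rw [this]; linarith
          · rw [Int.toNat_of_nonpos h0]; simp; linarith
      _ = s.card * (2 * ρ + 1) := by simp [mul_add]
      _ ≤ d * (2 * ρ + 1) := by gcongr
  · intro k hk
    obtain ⟨r, hr, hr'⟩ := h (k + θ) δ hδ hk
    rw [abs_le] at hr'
    simp only [Finset.mem_biUnion, Finset.mem_Icc]
    have hle := hr'.2
    exact ⟨r, hr, Int.ceil_le.2 (by linarith [hr'.1]), Int.le_floor.2 (by linarith)⟩

/-- The diagonal form `Σ εᵢ xᵢ^d` evaluated at `x = w h`. -/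
def form {n : ℕ} (ε : Fin n → ℝ) (d : ℕ) (h : Matrix (Fin n) (Fin n) ℝ) (w : Fin n → ℝ) : ℝ :=
  ∑ i, ε i * (w ᵥ* h) i ^ d

/-- The `k`-th partial derivative of `form ε d h`. -/
def formGrad {n : ℕ} (ε : Fin n → ℝ) (d : ℕ) (h : Matrix (Fin n) (Fin n) ℝ) (w : Fin n → ℝ)
    (k : Fin n) : ℝ :=
  d * ∑ i, ε i * (w ᵥ* h) i ^ (d - 1) * h k i

/-- The squared Euclidean norm. -/
def sqNorm {n : ℕ} (w : Fin n → ℝ) : ℝ := ∑ i, w i ^ 2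

/-- The fraction of the squared gradient which comes from the `j`-th coordinate. -/
def gradWeight {n : ℕ} (ε : Fin n → ℝ) (d : ℕ) (h : Matrix (Fin n) (Fin n) ℝ) (j : Fin n)
    (w : Fin n → ℝ) : ℝ :=
  formGrad ε d h w j ^ 2 / sqNorm (formGrad ε d h w)

/-- The vector with `j`-th coordinate `x` and remaining coordinates `y`. -/
def lineAt {m : ℕ} (j : Fin (m + 1)) (x : ℝ) (y : Fin m → ℝ) : Fin (m + 1) → ℝ :=
  j.insertNth x y

@[simp] lemma lineAt_self {m : ℕ} (j : Fin (m + 1)) (x : ℝ) (y : Fin m → ℝ) : lineAt j x y j = x := by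
  simp [lineAt]

@[simp] lemma lineAt_succAbove {m : ℕ} (j : Fin (m + 1)) (x : ℝ) (y : Fin m → ℝ) (k : Fin m) :
    lineAt j x y (j.succAbove k) = y k := by
  simp [lineAt]

/-- The unipotent matrix with `w ↦ w + (Σ u_k w_k) e_j`. -/
def shear {m : ℕ} (j : Fin (m + 1)) (u : Fin m → ℝ) : Matrix (Fin (m + 1)) (Fin (m + 1)) ℝ :=
  Matrix.updateCol 1 j (lineAt j 1 u)

/-- The restriction of `form` to a line in direction `e_j`. -/
lemma lineAt_vecMul {m : ℕ} (j : Fin (m + 1)) (x : ℝ) (y : Fin m → ℝ)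
    (h : Matrix (Fin (m + 1)) (Fin (m + 1)) ℝ) (i : Fin (m + 1)) :
    (lineAt j x y ᵥ* h) i = x * h j i + ∑ k, y k * h (j.succAbove k) i := by
  simp [Matrix.vecMul, dotProduct, Fin.sum_univ_succAbove _ j]

lemma sqNorm_nonneg {n : ℕ} (w : Fin n → ℝ) : 0 ≤ sqNorm w := Finset.sum_nonneg fun _ _ => sq_nonneg _

lemma sqNorm_eq_zero {n : ℕ} {w : Fin n → ℝ} : sqNorm w = 0 ↔ w = 0 := by
  rw [sqNorm, Finset.sum_eq_zero_iff_of_nonneg fun _ _ => sq_nonneg _]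
  simp [funext_iff]

lemma sqNorm_smul {n : ℕ} (r : ℝ) (w : Fin n → ℝ) : sqNorm (r • w) = r ^ 2 * sqNorm w := by
  simp [sqNorm, mul_pow, Finset.mul_sum]

lemma sq_le_sqNorm {n : ℕ} (w : Fin n → ℝ) (i : Fin n) : w i ^ 2 ≤ sqNorm w :=
  Finset.single_le_sum (f := fun i => w i ^ 2) (fun _ _ => sq_nonneg _) (Finset.mem_univ i)

lemma gradWeight_nonneg {n : ℕ} (ε : Fin n → ℝ) (d : ℕ) (h : Matrix (Fin n) (Fin n) ℝ) (j : Fin n)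
    (w : Fin n → ℝ) : 0 ≤ gradWeight ε d h j w := div_nonneg (sq_nonneg _) (sqNorm_nonneg _)

lemma gradWeight_le_one {n : ℕ} (ε : Fin n → ℝ) (d : ℕ) (h : Matrix (Fin n) (Fin n) ℝ) (j : Fin n)
    (w : Fin n → ℝ) : gradWeight ε d h j w ≤ 1 :=
  div_le_one_of_le₀ (sq_le_sqNorm _ _) (sqNorm_nonneg _)

lemma form_smul {n : ℕ} (ε : Fin n → ℝ) (d : ℕ) (h : Matrix (Fin n) (Fin n) ℝ) (r : ℝ)
    (w : Fin n → ℝ) : form ε d h (r • w) = r ^ d * form ε d h w := by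
  simp only [form, Matrix.smul_vecMul, Pi.smul_apply, smul_eq_mul, mul_pow, Finset.mul_sum]
  exact Finset.sum_congr rfl fun _ _ => by ring

lemma formGrad_smul {n : ℕ} (ε : Fin n → ℝ) (d : ℕ) (h : Matrix (Fin n) (Fin n) ℝ) (r : ℝ)
    (w : Fin n → ℝ) : formGrad ε d h (r • w) = r ^ (d - 1) • formGrad ε d h w := by
  funext k
  simp only [formGrad, Matrix.smul_vecMul, Pi.smul_apply, smul_eq_mul, mul_pow, Finset.mul_sum]
  exact Finset.sum_congr rfl fun _ _ => by ring

lemma gradWeight_smul {n : ℕ} (ε : Fin n → ℝ) (d : ℕ) (h : Matrix (Fin n) (Fin n) ℝ) (j : Fin n)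
    {r : ℝ} (hr : r ≠ 0) (w : Fin n → ℝ) : gradWeight ε d h j (r • w) = gradWeight ε d h j w := by
  rw [gradWeight, gradWeight, formGrad_smul, sqNorm_smul, Pi.smul_apply, smul_eq_mul, mul_pow,
    mul_div_mul_left]
  positivity

lemma formGrad_mul {n : ℕ} (ε : Fin n → ℝ) (d : ℕ) (A h : Matrix (Fin n) (Fin n) ℝ)
    (v : Fin n → ℝ) : formGrad ε d (A * h) v = A *ᵥ formGrad ε d h (v ᵥ* A) := by
  funext k
  simp only [formGrad, ← Matrix.vecMul_vecMul, Matrix.mulVec, dotProduct, Matrix.mul_apply,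
    Finset.mul_sum]
  rw [Finset.sum_comm]
  exact Finset.sum_congr rfl fun _ _ => Finset.sum_congr rfl fun _ _ => by ring

lemma form_mul {n : ℕ} (ε : Fin n → ℝ) (d : ℕ) (A h : Matrix (Fin n) (Fin n) ℝ)
    (v : Fin n → ℝ) : form ε d (A * h) v = form ε d h (v ᵥ* A) := by
  simp [form, Matrix.vecMul_vecMul]

lemma formGrad_eq_zero {n : ℕ} {ε : Fin n → ℝ} (hε : ∀ i, ε i ≠ 0) {d : ℕ} (hd : 2 ≤ d)
    {h : Matrix (Fin n) (Fin n) ℝ} (hh : h.det ≠ 0) {w : Fin n → ℝ} :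
    formGrad ε d h w = 0 ↔ w = 0 := by
  have hu : IsUnit h := (Matrix.isUnit_iff_isUnit_det h).2 hh.isUnit
  constructor
  · intro h0
    have h1 : h *ᵥ (fun i => ε i * (w ᵥ* h) i ^ (d - 1)) = h *ᵥ 0 := by
      rw [Matrix.mulVec_zero]
      funext k
      have := congrFun h0 k
      simp only [formGrad, Pi.zero_apply, mul_eq_zero, Nat.cast_eq_zero] at this
      have h2 := this.resolve_left (by omega)
      simp only [Matrix.mulVec, dotProduct, Pi.zero_apply]
      rw [← h2]; exact Finset.sum_congr rfl fun _ _ => by ring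
    have h2 := Matrix.mulVec_injective_of_isUnit hu h1
    have h3 : w ᵥ* h = 0 ᵥ* h := by
      rw [Matrix.zero_vecMul]
      funext i
      have := congrFun h2 i
      simp only [Pi.zero_apply, mul_eq_zero, hε i, false_or] at this
      exact eq_zero_of_pow_eq_zero this
    exact Matrix.vecMul_injective_of_isUnit hu h3
  · rintro rfl
    funext k
    have : d - 1 ≠ 0 := by omega
    simp [formGrad, this]

lemma hasDerivAt_form {m : ℕ} (ε : Fin (m + 1) → ℝ) (d : ℕ)
    (h : Matrix (Fin (m + 1)) (Fin (m + 1)) ℝ) (j : Fin (m + 1)) (y : Fin m → ℝ) (x : ℝ) :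
    HasDerivAt (fun x => form ε d h (lineAt j x y)) (formGrad ε d h (lineAt j x y) j) x := by
  simp only [form, formGrad, lineAt_vecMul, Finset.mul_sum]
  refine HasDerivAt.fun_sum fun i _ => ?_
  have h1 : HasDerivAt (fun x => x * h j i + ∑ k, y k * h (j.succAbove k) i) (h j i) x := by
    simpa using ((hasDerivAt_id x).mul_const (h j i)).add_const (∑ k, y k * h (j.succAbove k) i)
  refine ((h1.fun_pow d).const_mul (ε i)).congr_deriv ?_
  ring

lemma continuous_vecMul_mat {n : ℕ} : Continuous fun q : Matrix (Fin n) (Fin n) ℝ × (Fin n → ℝ) => q.2 ᵥ* q.1 :=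
  continuous_snd.matrix_vecMul continuous_fst

lemma continuous_form {n : ℕ} (ε : Fin n → ℝ) (d : ℕ) :
    Continuous fun q : Matrix (Fin n) (Fin n) ℝ × (Fin n → ℝ) => form ε d q.1 q.2 := by
  unfold form
  refine continuous_finsetSum _ fun i _ => continuous_const.mul (Continuous.pow ?_ _)
  exact (continuous_apply i).comp continuous_vecMul_mat

lemma continuous_formGrad {n : ℕ} (ε : Fin n → ℝ) (d : ℕ) :
    Continuous fun q : Matrix (Fin n) (Fin n) ℝ × (Fin n → ℝ) => formGrad ε d q.1 q.2 := by
  unfold formGrad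
  refine continuous_pi fun k => continuous_const.mul (continuous_finsetSum _ fun i _ => ?_)
  refine (continuous_const.mul (Continuous.pow ?_ _)).mul ?_
  · exact (continuous_apply i).comp continuous_vecMul_mat
  · exact (continuous_fst.matrix_elem k i)

lemma continuous_sqNorm {n : ℕ} : Continuous fun w : Fin n → ℝ => sqNorm w := by
  unfold sqNorm; fun_prop

lemma measurable_formGrad {α : Type*} [MeasurableSpace α] {n : ℕ} (ε : Fin n → ℝ) (d : ℕ)
    {A : α → Matrix (Fin n) (Fin n) ℝ} {w : α → Fin n → ℝ} (hA : ∀ i k, Measurable fun a => A a i k)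
    (hw : Measurable w) (k : Fin n) : Measurable fun a => formGrad ε d (A a) (w a) k := by
  have hw' : ∀ i, Measurable fun a => w a i := fun i => (measurable_pi_apply i).comp hw
  unfold formGrad Matrix.vecMul dotProduct
  refine measurable_const.mul (Finset.measurable_sum _ fun i _ => ?_)
  refine (measurable_const.mul ((Finset.measurable_sum _ fun l _ => ?_).pow_const _)).mul (hA k i)
  exact (hw' l).mul (hA l i)

lemma measurable_form {α : Type*} [MeasurableSpace α] {n : ℕ} (ε : Fin n → ℝ) (d : ℕ)
    {A : α → Matrix (Fin n) (Fin n) ℝ} {w : α → Fin n → ℝ} (hA : ∀ i k, Measurable fun a => A a i k)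
    (hw : Measurable w) : Measurable fun a => form ε d (A a) (w a) := by
  have hw' : ∀ i, Measurable fun a => w a i := fun i => (measurable_pi_apply i).comp hw
  unfold form Matrix.vecMul dotProduct
  refine Finset.measurable_sum _ fun i _ => measurable_const.mul (Measurable.pow_const ?_ _)
  exact Finset.measurable_sum _ fun l _ => (hw' l).mul (hA l i)

lemma measurable_gradWeight {α : Type*} [MeasurableSpace α] {n : ℕ} (ε : Fin n → ℝ) (d : ℕ)
    {A : α → Matrix (Fin n) (Fin n) ℝ} {w : α → Fin n → ℝ} (hA : ∀ i k, Measurable fun a => A a i k)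
    (hw : Measurable w) (j : Fin n) : Measurable fun a => gradWeight ε d (A a) j (w a) := by
  unfold gradWeight sqNorm
  refine ((measurable_formGrad ε d hA hw j).pow_const 2).div (Finset.measurable_sum _ fun i _ => ?_)
  exact (measurable_formGrad ε d hA hw i).pow_const 2

lemma measurable_gradWeight_right {n : ℕ} (ε : Fin n → ℝ) (d : ℕ) (j : Fin n)
    (h : Matrix (Fin n) (Fin n) ℝ) : Measurable fun w => gradWeight ε d h j w :=
  measurable_gradWeight ε d (A := fun _ => h) (w := fun w => w) (fun _ _ => measurable_const) measurable_id j

lemma continuous_form_right {n : ℕ} (ε : Fin n → ℝ) (d : ℕ) (h : Matrix (Fin n) (Fin n) ℝ) :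
    Continuous fun w => form ε d h w :=
  (continuous_form ε d).comp (Continuous.prodMk_right h)

lemma sum_gradWeight {n : ℕ} {ε : Fin n → ℝ} (hε : ∀ i, ε i ≠ 0) {d : ℕ} (hd : 2 ≤ d)
    {h : Matrix (Fin n) (Fin n) ℝ} (hh : h.det ≠ 0) {w : Fin n → ℝ} (hw : w ≠ 0) :
    ∑ j, gradWeight ε d h j w = 1 := by
  simp only [gradWeight, ← Finset.sum_div]
  refine div_self ?_
  rw [← sqNorm, Ne, sqNorm_eq_zero, formGrad_eq_zero hε hd hh]
  exact hw

lemma vecMul_shear {m : ℕ} (j : Fin (m + 1)) (u : Fin m → ℝ) (x : ℝ) (y : Fin m → ℝ) :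
    lineAt j x y ᵥ* shear j u = lineAt j (x + u ⬝ᵥ y) y := by
  funext i
  rw [lineAt_vecMul]
  by_cases hi : i = j
  · subst hi
    simp only [shear, Matrix.updateCol_self, lineAt_self,
      lineAt_succAbove, mul_one, dotProduct]
    simp only [mul_comm]
  · obtain ⟨k, rfl⟩ := Fin.exists_succAbove_eq hi
    simp only [shear, Matrix.updateCol_ne hi, lineAt_succAbove, Matrix.one_apply,
      (Fin.succAbove_right_injective).eq_iff, Fin.ne_succAbove, if_false, mul_zero, zero_add, mul_ite,
      mul_one, Finset.sum_ite_eq', Finset.mem_univ, if_true]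

lemma det_shear {m : ℕ} (j : Fin (m + 1)) (u : Fin m → ℝ) : (shear j u).det = 1 := by
  rw [shear, ← Matrix.cramer_apply, Matrix.cramer_one]; simp

lemma shear_mulVec {m : ℕ} (j : Fin (m + 1)) (u : Fin m → ℝ) (b : Fin (m + 1) → ℝ) :
    shear j u *ᵥ b = lineAt j (b j) (fun k => b (j.succAbove k) + u k * b j) := by
  funext i
  refine Fin.succAboveCases j ?_ (fun k => ?_) i
  · simp [shear, Matrix.mulVec, dotProduct, Fin.sum_univ_succAbove _ j]
  · simp [shear, Matrix.mulVec, dotProduct, Fin.sum_univ_succAbove _ j, Matrix.one_apply]; ring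

lemma eq_of_vecMul_eq {n : ℕ} {A B : Matrix (Fin n) (Fin n) ℝ} (h : ∀ v, v ᵥ* A = v ᵥ* B) : A = B := by
  ext i k
  have := congrFun (h (Pi.single i 1)) k
  simpa using this

lemma lineAt_removeNth {m : ℕ} (j : Fin (m + 1)) (w : Fin (m + 1) → ℝ) :
    lineAt j (w j) (fun k => w (j.succAbove k)) = w := by
  funext i
  refine Fin.succAboveCases j ?_ (fun k => ?_) i <;> simp

lemma shear_add {m : ℕ} (j : Fin (m + 1)) (u v : Fin m → ℝ) :
    shear j (u + v) = shear j u * shear j v := by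
  refine eq_of_vecMul_eq fun w => ?_
  rw [← lineAt_removeNth j w, ← Matrix.vecMul_vecMul, vecMul_shear, vecMul_shear, vecMul_shear,
    add_dotProduct, add_assoc]

lemma shear_zero {m : ℕ} (j : Fin (m + 1)) : shear j (0 : Fin m → ℝ) = 1 := by
  refine eq_of_vecMul_eq fun w => ?_
  rw [← lineAt_removeNth j w, vecMul_shear]; simp

lemma shear_mul_row {m : ℕ} (j : Fin (m + 1)) (u : Fin m → ℝ) (h : Matrix (Fin (m + 1)) (Fin (m + 1)) ℝ) :
    (shear j u * h) j = h j := by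
  funext i
  simp [shear, Matrix.mul_apply, Fin.sum_univ_succAbove _ j]

lemma exists_bound_of_contDiffOn {E : Type*} [NormedAddCommGroup E] [NormedSpace ℝ E] {f : E → ℝ}
    {U K : Set E} (hU : IsOpen U) (hK : IsCompact K) (hKU : K ⊆ U) (hf : ContDiffOn ℝ 1 f U) :
    ∃ C : ℝ, 0 ≤ C ∧ (∀ x ∈ K, |f x| ≤ C) ∧ ∀ x ∈ K, ∀ y ∈ K, |f x - f y| ≤ C * ‖x - y‖ := by
  obtain ⟨C, hC⟩ := hK.exists_bound_of_continuousOn (hf.continuousOn.mono hKU)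
  have hl : LocallyLipschitzOn K f := by
    intro x hx
    obtain ⟨L, t, ht, hL⟩ := ((hf x (hKU hx)).contDiffAt (hU.mem_nhds (hKU hx))).exists_lipschitzOnWith
    exact ⟨L, t, mem_nhdsWithin_of_mem_nhds ht, hL⟩
  obtain ⟨L, hL⟩ := hl.exists_lipschitzOnWith_of_compact hK
  refine ⟨max C L, le_max_of_le_right L.2, fun x hx => (hC x hx).trans (le_max_left _ _), ?_⟩
  intro x hx y hy
  have := hL.dist_le_mul x hx y hy
  rw [Real.dist_eq, dist_eq_norm] at this
  exact this.trans (mul_le_mul_of_nonneg_right (le_max_right _ _) (norm_nonneg _))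

lemma exists_bound_deriv_smoothTransition :
    ∃ C : ℝ, 1 ≤ C ∧ (∀ x, |deriv Real.smoothTransition x| ≤ C) ∧
      (∀ x y, |deriv Real.smoothTransition x - deriv Real.smoothTransition y| ≤ C * |x - y|) ∧
      ∀ x y, |Real.smoothTransition x - Real.smoothTransition y| ≤ C * |x - y| := by
  have hcd : ContDiff ℝ 1 (deriv Real.smoothTransition) :=
    (contDiff_succ_iff_deriv.1 (Real.smoothTransition.contDiff (n := 2) : ContDiff ℝ (1 + 1) _)).2.2
  have hsupp : HasCompactSupport (deriv Real.smoothTransition) := by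
    refine HasCompactSupport.intro (K := Set.Icc 0 1) isCompact_Icc fun x hx => ?_
    rw [Set.mem_Icc, not_and_or, not_le, not_le] at hx
    rcases hx with hx | hx
    · have : Real.smoothTransition =ᶠ[nhds x] fun _ => 0 := by
        filter_upwards [gt_mem_nhds hx] with y hy using Real.smoothTransition.zero_of_nonpos (le_of_lt hy)
      rw [this.deriv_eq, deriv_const]
    · have : Real.smoothTransition =ᶠ[nhds x] fun _ => 1 := by
        filter_upwards [lt_mem_nhds hx] with y hy using Real.smoothTransition.one_of_one_le (le_of_lt hy)
      rw [this.deriv_eq, deriv_const]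
  obtain ⟨C, hC⟩ := hcd.continuous.bounded_above_of_compact_support hsupp
  obtain ⟨L, hL⟩ := hcd.lipschitzWith_of_hasCompactSupport hsupp (by simp)
  refine ⟨max 1 (max C L), le_max_left _ _, fun x => (hC x).trans ((le_max_left _ _).trans (le_max_right _ _)), ?_, ?_⟩
  · intro x y
    have := hL.dist_le_mul x y
    rw [Real.dist_eq, Real.dist_eq] at this
    exact this.trans (mul_le_mul_of_nonneg_right ((le_max_right _ _).trans (le_max_right _ _)) (abs_nonneg _))
  · intro x y
    have hd : Differentiable ℝ Real.smoothTransition :=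
      (Real.smoothTransition.contDiff (n := 1)).differentiable (by simp)
    have := Convex.norm_image_sub_le_of_norm_deriv_le (f := Real.smoothTransition) (C := C) (s := Set.univ) 
      (fun z _ => hd z) (fun z _ => hC z) convex_univ (Set.mem_univ y) (Set.mem_univ x)
    refine this.trans (mul_le_mul_of_nonneg_right ((le_max_left _ _).trans (le_max_right _ _)) (abs_nonneg _))

/-- The function `∂ⱼH / |∇H|²`, regularised near the origin. -/
def divKernel {n : ℕ} (ε : Fin n → ℝ) (d : ℕ) (j : Fin n) (q : (Fin n → Fin n → ℝ) × (Fin n → ℝ)) : ℝ :=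
  formGrad ε d (Matrix.of q.1) q.2 j /
    (sqNorm (formGrad ε d (Matrix.of q.1) q.2) + Real.smoothTransition (2 - 16 * sqNorm q.2))

/-- The derivative of `divKernel` in the direction `e_j`. -/
def divKernel' {n : ℕ} (ε : Fin n → ℝ) (d : ℕ) (j : Fin n) (q : (Fin n → Fin n → ℝ) × (Fin n → ℝ)) : ℝ :=
  fderiv ℝ (divKernel ε d j) q (0, Pi.single j 1)

lemma divKernel_denom_pos {n : ℕ} {ε : Fin n → ℝ} (hε : ∀ i, ε i ≠ 0) {d : ℕ} (hd : 2 ≤ d)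
    {h : Matrix (Fin n) (Fin n) ℝ} (hh : h.det ≠ 0) (z : Fin n → ℝ) :
    0 < sqNorm (formGrad ε d h z) + Real.smoothTransition (2 - 16 * sqNorm z) := by
  by_cases hz : z = 0
  · have : (0 : ℝ) < Real.smoothTransition (2 - 16 * sqNorm z) := by
      apply Real.smoothTransition.pos_of_pos
      rw [sqNorm_eq_zero.2 hz]; norm_num
    linarith [sqNorm_nonneg (formGrad ε d h z)]
  · have : 0 < sqNorm (formGrad ε d h z) := by
      refine lt_of_le_of_ne (sqNorm_nonneg _) (Ne.symm ?_)
      rwa [Ne, sqNorm_eq_zero, formGrad_eq_zero hε hd hh]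
    linarith [Real.smoothTransition.nonneg (2 - 16 * sqNorm z)]

lemma contDiff_formGrad {n : ℕ} (ε : Fin n → ℝ) (d : ℕ) (k : Fin n) {N : WithTop ℕ∞} :
    ContDiff ℝ N fun q : (Fin n → Fin n → ℝ) × (Fin n → ℝ) => formGrad ε d (Matrix.of q.1) q.2 k := by
  unfold formGrad Matrix.vecMul dotProduct
  simp only [Matrix.of_apply]
  fun_prop

lemma contDiff_sqNorm {n : ℕ} {N : WithTop ℕ∞} : ContDiff ℝ N fun z : Fin n → ℝ => sqNorm z := by
  unfold sqNorm
  fun_prop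

lemma isOpen_det_ne_zero {n : ℕ} :
    IsOpen {q : (Fin n → Fin n → ℝ) × (Fin n → ℝ) | (Matrix.of q.1).det ≠ 0} := by
  have : Continuous fun q : (Fin n → Fin n → ℝ) × (Fin n → ℝ) => (Matrix.of q.1).det := by
    refine Continuous.matrix_det ?_
    exact continuous_fst
  exact isOpen_ne_fun this continuous_const

lemma contDiffOn_divKernel {n : ℕ} {ε : Fin n → ℝ} (hε : ∀ i, ε i ≠ 0) {d : ℕ} (hd : 2 ≤ d)
    (j : Fin n) : ContDiffOn ℝ 2 (divKernel ε d j)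
      {q : (Fin n → Fin n → ℝ) × (Fin n → ℝ) | (Matrix.of q.1).det ≠ 0} := by
  unfold divKernel
  refine ContDiffOn.div (contDiff_formGrad ε d j).contDiffOn ?_ ?_
  · refine ContDiff.contDiffOn (ContDiff.add ?_ ?_)
    · unfold sqNorm
      exact ContDiff.sum fun i _ => (contDiff_formGrad ε d i).pow 2
    · refine (Real.smoothTransition.contDiff (n := 2)).comp ?_
      refine contDiff_const.sub (contDiff_const.mul (contDiff_sqNorm.comp contDiff_snd))
  · intro q hq
    exact (divKernel_denom_pos hε hd hq _).ne'

lemma contDiffOn_divKernel' {n : ℕ} {ε : Fin n → ℝ} (hε : ∀ i, ε i ≠ 0) {d : ℕ} (hd : 2 ≤ d)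
    (j : Fin n) : ContDiffOn ℝ 1 (divKernel' ε d j)
      {q : (Fin n → Fin n → ℝ) × (Fin n → ℝ) | (Matrix.of q.1).det ≠ 0} := by
  unfold divKernel'
  exact ((contDiffOn_divKernel hε hd j).fderiv_of_isOpen isOpen_det_ne_zero (by norm_num)).clm_apply
    contDiffOn_const

lemma lineAt_add_smul {m : ℕ} (j : Fin (m + 1)) (x : ℝ) (y : Fin m → ℝ) :
    lineAt j x y = lineAt j 0 y + x • Pi.single j 1 := by
  rw [← lineAt_removeNth j (lineAt j 0 y + x • Pi.single j 1)]
  congr 1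
  · simp
  · funext k; simp

lemma hasDerivAt_lineAt {m : ℕ} (j : Fin (m + 1)) (x : ℝ) (y : Fin m → ℝ) :
    HasDerivAt (fun x => lineAt j x y) (Pi.single j 1) x := by
  have : (fun x => lineAt j x y) = fun x => lineAt j 0 y + x • (Pi.single j 1 : Fin (m + 1) → ℝ) :=
    funext fun x => lineAt_add_smul j x y
  rw [this]
  simpa using ((hasDerivAt_id x).smul_const (Pi.single j 1 : Fin (m + 1) → ℝ)).const_add (lineAt j 0 y)

lemma hasDerivAt_divKernel {m : ℕ} {ε : Fin (m + 1) → ℝ} (hε : ∀ i, ε i ≠ 0) {d : ℕ} (hd : 2 ≤ d)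
    (j : Fin (m + 1)) {h : Fin (m + 1) → Fin (m + 1) → ℝ} (hh : (Matrix.of h).det ≠ 0) (x : ℝ)
    (y : Fin m → ℝ) :
    HasDerivAt (fun x => divKernel ε d j (h, lineAt j x y)) (divKernel' ε d j (h, lineAt j x y)) x := by
  have h1 : DifferentiableAt ℝ (divKernel ε d j) (h, lineAt j x y) :=
    ((contDiffOn_divKernel hε hd j).contDiffAt (isOpen_det_ne_zero.mem_nhds hh)).differentiableAt (by simp)
  have h2 : HasDerivAt (fun x => (h, lineAt j x y)) ((0 : Fin (m + 1) → Fin (m + 1) → ℝ), (Pi.single j 1 : Fin (m + 1) → ℝ)) x :=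
    (hasDerivAt_const x h).prodMk (hasDerivAt_lineAt j x y)
  exact h1.hasFDerivAt.comp_hasDerivAt x h2

/-- The matrices of determinant one with entries bounded by `R`. -/
def boundedSL (n : ℕ) (R : ℝ) : Set (Fin n → Fin n → ℝ) :=
  {h | (Matrix.of h).det = 1 ∧ ∀ i k, |h i k| ≤ R}

lemma isCompact_boundedSL (n : ℕ) (R : ℝ) : IsCompact (boundedSL n R) := by
  have h0 : boundedSL n R = {h | (Matrix.of h).det = 1} ∩ ⋂ i, ⋂ k, {h | |h i k| ≤ R} := by
    ext h; simp [boundedSL]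
  have h1 : IsClosed (boundedSL n R) := by
    rw [h0]
    refine IsClosed.inter ?_ ?_
    · exact isClosed_eq (Continuous.matrix_det continuous_id) continuous_const
    · refine isClosed_iInter fun i => isClosed_iInter fun k => ?_
      exact isClosed_le (by fun_prop) continuous_const
  refine Metric.isCompact_of_isClosed_isBounded h1 ?_
  refine (Metric.isBounded_closedBall (x := 0) (r := max R 0)).subset fun h hh => ?_
  rw [mem_closedBall_zero_iff, pi_norm_le_iff_of_nonneg (le_max_right _ _)]
  intro i
  rw [pi_norm_le_iff_of_nonneg (le_max_right _ _)]
  exact fun k => (hh.2 i k).trans (le_max_left _ _)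

lemma exists_bound_divKernel {n : ℕ} {ε : Fin n → ℝ} (hε : ∀ i, ε i ≠ 0) {d : ℕ} (hd : 2 ≤ d)
    (j : Fin n) (R : ℝ) : ∃ C : ℝ, 1 ≤ C ∧ ∀ h ∈ boundedSL n R, ∀ z z' : Fin n → ℝ, ‖z‖ ≤ 4 → ‖z'‖ ≤ 4 →
      |divKernel ε d j (h, z)| ≤ C ∧ |divKernel' ε d j (h, z)| ≤ C ∧
      |divKernel ε d j (h, z) - divKernel ε d j (h, z')| ≤ C * ‖z - z'‖ ∧
      |divKernel' ε d j (h, z) - divKernel' ε d j (h, z')| ≤ C * ‖z - z'‖ := by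
  have hK := (isCompact_boundedSL n R).prod (isCompact_closedBall (0 : Fin n → ℝ) 4)
  have hKU : boundedSL n R ×ˢ Metric.closedBall (0 : Fin n → ℝ) 4 ⊆
      {q : (Fin n → Fin n → ℝ) × (Fin n → ℝ) | (Matrix.of q.1).det ≠ 0} := by
    rintro ⟨h, z⟩ ⟨hh, -⟩
    have := hh.1
    simp only [Set.mem_ofPred_eq]
    rw [this]; exact one_ne_zero
  obtain ⟨C₁, -, h1, h2⟩ := exists_bound_of_contDiffOn isOpen_det_ne_zero hK hKU
    ((contDiffOn_divKernel hε hd j).of_le (by norm_num))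
  obtain ⟨C₂, -, h3, h4⟩ := exists_bound_of_contDiffOn isOpen_det_ne_zero hK hKU
    (contDiffOn_divKernel' hε hd j)
  refine ⟨max 1 (max C₁ C₂), le_max_left _ _, fun h hh z z' hz hz' => ?_⟩
  have m1 : (h, z) ∈ boundedSL n R ×ˢ Metric.closedBall (0 : Fin n → ℝ) 4 := ⟨hh, by simpa using hz⟩
  have m2 : (h, z') ∈ boundedSL n R ×ˢ Metric.closedBall (0 : Fin n → ℝ) 4 := ⟨hh, by simpa using hz'⟩
  have hn : ‖(h, z) - (h, z')‖ = ‖z - z'‖ := by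
    rw [Prod.mk_sub_mk, Prod.norm_mk, sub_self, norm_zero, max_eq_right (norm_nonneg _)]
  have c1 : C₁ ≤ max 1 (max C₁ C₂) := (le_max_left _ _).trans (le_max_right _ _)
  have c2 : C₂ ≤ max 1 (max C₁ C₂) := (le_max_right _ _).trans (le_max_right _ _)
  refine ⟨(h1 _ m1).trans c1, (h3 _ m1).trans c2, ?_, ?_⟩
  · have := h2 _ m1 _ m2
    rw [hn] at this
    exact this.trans (mul_le_mul_of_nonneg_right c1 (norm_nonneg _))
  · have := h4 _ m1 _ m2
    rw [hn] at this
    exact this.trans (mul_le_mul_of_nonneg_right c2 (norm_nonneg _))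

/-- A smooth cutoff: `1` on the unit ball and `0` where `|z|² ≥ 1 + 1/lam`. -/
def cutoff {n : ℕ} (lam : ℝ) (z : Fin n → ℝ) : ℝ := Real.smoothTransition (1 + lam * (1 - sqNorm z))

/-- The `j`-th partial derivative of `cutoff`. -/
def cutoff' {n : ℕ} (lam : ℝ) (j : Fin n) (z : Fin n → ℝ) : ℝ :=
  deriv Real.smoothTransition (1 + lam * (1 - sqNorm z)) * (-2 * lam * z j)

/-- A smooth dyadic annulus. -/
def annulus {n : ℕ} (lam : ℝ) (z : Fin n → ℝ) : ℝ := cutoff lam z - cutoff lam ((2 : ℝ) • z)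

/-- The `j`-th partial derivative of `annulus`. -/
def annulus' {n : ℕ} (lam : ℝ) (j : Fin n) (z : Fin n → ℝ) : ℝ :=
  cutoff' lam j z - 2 * cutoff' lam j ((2 : ℝ) • z)

/-- The function which multiplies `∂ⱼH` in the annular weight. -/
def annKer {n : ℕ} (ε : Fin n → ℝ) (d : ℕ) (j : Fin n) (lam : ℝ) (h : Fin n → Fin n → ℝ) (z : Fin n → ℝ) : ℝ :=
  annulus lam z * divKernel ε d j (h, z)

/-- The `j`-th partial derivative of `annKer`. -/
def annKer' {n : ℕ} (ε : Fin n → ℝ) (d : ℕ) (j : Fin n) (lam : ℝ) (h : Fin n → Fin n → ℝ) (z : Fin n → ℝ) : ℝ :=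
  annulus' lam j z * divKernel ε d j (h, z) + annulus lam z * divKernel' ε d j (h, z)

lemma cutoff_nonneg {n : ℕ} (lam : ℝ) (z : Fin n → ℝ) : 0 ≤ cutoff lam z := Real.smoothTransition.nonneg _

lemma cutoff_le_one {n : ℕ} (lam : ℝ) (z : Fin n → ℝ) : cutoff lam z ≤ 1 := Real.smoothTransition.le_one _

lemma cutoff_eq_one {n : ℕ} {lam : ℝ} (hl : 0 ≤ lam) {z : Fin n → ℝ} (hz : sqNorm z ≤ 1) : cutoff lam z = 1 := by
  refine Real.smoothTransition.one_of_one_le ?_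
  nlinarith

lemma cutoff_eq_zero {n : ℕ} {lam : ℝ} (hl : 1 ≤ lam) {z : Fin n → ℝ} (hz : 1 + 1 / lam ≤ sqNorm z) :
    cutoff lam z = 0 := by
  refine Real.smoothTransition.zero_of_nonpos ?_
  have : lam * (1 + 1 / lam) = lam + 1 := by field_simp
  nlinarith

lemma cutoff_eq_zero_of_two_le {n : ℕ} {lam : ℝ} (hl : 1 ≤ lam) {z : Fin n → ℝ} (hz : 2 ≤ sqNorm z) :
    cutoff lam z = 0 := by
  refine cutoff_eq_zero hl (le_trans ?_ hz)
  have : 1 / lam ≤ 1 := by rw [div_le_one (by linarith)]; exact hl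
  linarith

lemma annulus_nonneg {n : ℕ} {lam : ℝ} (hl : 0 ≤ lam) (z : Fin n → ℝ) : 0 ≤ annulus lam z := by
  refine sub_nonneg.2 (Real.smoothTransition.monotone ?_)
  rw [sqNorm_smul]
  nlinarith [sqNorm_nonneg z, mul_nonneg hl (sqNorm_nonneg z)]

lemma annulus_le_one {n : ℕ} (lam : ℝ) (z : Fin n → ℝ) : annulus lam z ≤ 1 := by
  have := cutoff_le_one lam z
  have := cutoff_nonneg lam ((2 : ℝ) • z)
  unfold annulus; linarith

lemma annulus_eq_zero {n : ℕ} {lam : ℝ} (hl : 1 ≤ lam) {z : Fin n → ℝ} (hz : sqNorm z ≤ 1 / 4 ∨ 2 ≤ sqNorm z) :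
    annulus lam z = 0 := by
  unfold annulus
  rcases hz with hz | hz
  · rw [cutoff_eq_one (by linarith) (by linarith), cutoff_eq_one (by linarith), sub_self]
    rw [sqNorm_smul]; linarith
  · rw [cutoff_eq_zero_of_two_le hl hz, cutoff_eq_zero_of_two_le hl, sub_self]
    rw [sqNorm_smul]; linarith

lemma deriv_smoothTransition_eq_zero {x : ℝ} (hx : x < 0) : deriv Real.smoothTransition x = 0 := by
  have : Real.smoothTransition =ᶠ[nhds x] fun _ => 0 := by
    filter_upwards [gt_mem_nhds hx] with y hy using Real.smoothTransition.zero_of_nonpos (le_of_lt hy)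
  rw [this.deriv_eq, deriv_const]

lemma cutoff'_eq_zero {n : ℕ} {lam : ℝ} (hl : 1 ≤ lam) (j : Fin n) {z : Fin n → ℝ} (hz : 2 < sqNorm z) :
    cutoff' lam j z = 0 := by
  unfold cutoff'
  rw [deriv_smoothTransition_eq_zero, zero_mul]
  nlinarith

lemma annKer_eq_zero {n : ℕ} (ε : Fin n → ℝ) (d : ℕ) (j : Fin n) {lam : ℝ} (hl : 1 ≤ lam)
    (h : Fin n → Fin n → ℝ) {z : Fin n → ℝ} (hz : 2 ≤ sqNorm z) : annKer ε d j lam h z = 0 := by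
  rw [annKer, annulus_eq_zero hl (Or.inr hz), zero_mul]

lemma annKer'_eq_zero {n : ℕ} (ε : Fin n → ℝ) (d : ℕ) (j : Fin n) {lam : ℝ} (hl : 1 ≤ lam)
    (h : Fin n → Fin n → ℝ) {z : Fin n → ℝ} (hz : 2 < sqNorm z) : annKer' ε d j lam h z = 0 := by
  rw [annKer', annulus_eq_zero hl (Or.inr hz.le), zero_mul, annulus', cutoff'_eq_zero hl j hz,
    cutoff'_eq_zero hl j]
  · ring
  · rw [sqNorm_smul]; linarith

lemma formGrad_mul_annKer {n : ℕ} (ε : Fin n → ℝ) (d : ℕ) (j : Fin n) {lam : ℝ} (hl : 1 ≤ lam)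
    (h : Fin n → Fin n → ℝ) (z : Fin n → ℝ) :
    formGrad ε d (Matrix.of h) z j * annKer ε d j lam h z = annulus lam z * gradWeight ε d (Matrix.of h) j z := by
  by_cases hz : sqNorm z ≤ 1 / 4
  · rw [annKer, annulus_eq_zero hl (Or.inl hz)]; ring
  · rw [annKer, divKernel, Real.smoothTransition.zero_of_nonpos (by linarith), gradWeight]
    simp only [add_zero]
    ring

lemma sqNorm_line {m : ℕ} (j : Fin (m + 1)) (x : ℝ) (y : Fin m → ℝ) :
    sqNorm (lineAt j x y) = x ^ 2 + sqNorm y := by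
  simp [sqNorm, Fin.sum_univ_succAbove _ j]

lemma hasDerivAt_cutoff {m : ℕ} (lam c : ℝ) (j : Fin (m + 1)) (x : ℝ) (y : Fin m → ℝ) :
    HasDerivAt (fun x => cutoff lam (c • lineAt j x y)) (c * cutoff' lam j (c • lineAt j x y)) x := by
  unfold cutoff cutoff'
  simp only [sqNorm_smul, sqNorm_line, Pi.smul_apply, lineAt_self, smul_eq_mul]
  have h1 : HasDerivAt (fun x => 1 + lam * (1 - c ^ 2 * (x ^ 2 + sqNorm y))) (c * (-2 * lam * (c * x))) x := by
    have := (((((hasDerivAt_pow 2 x).add_const (sqNorm y)).const_mul (c ^ 2)).const_sub 1).const_mul lam).const_add 1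
    refine this.congr_deriv ?_
    norm_num; ring
  have hd : Differentiable ℝ Real.smoothTransition :=
    (Real.smoothTransition.contDiff (n := 1)).differentiable (by simp)
  have := (hd (1 + lam * (1 - c ^ 2 * (x ^ 2 + sqNorm y)))).hasDerivAt.comp x h1
  refine this.congr_deriv ?_
  ring

lemma hasDerivAt_annulus {m : ℕ} (lam : ℝ) (j : Fin (m + 1)) (x : ℝ) (y : Fin m → ℝ) :
    HasDerivAt (fun x => annulus lam (lineAt j x y)) (annulus' lam j (lineAt j x y)) x := by
  have h1 := hasDerivAt_cutoff lam 1 j x y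
  have h2 := hasDerivAt_cutoff lam 2 j x y
  simp only [one_smul, one_mul] at h1
  exact h1.sub h2

lemma hasDerivAt_annKer {m : ℕ} {ε : Fin (m + 1) → ℝ} (hε : ∀ i, ε i ≠ 0) {d : ℕ} (hd : 2 ≤ d)
    (j : Fin (m + 1)) (lam : ℝ) {h : Fin (m + 1) → Fin (m + 1) → ℝ} (hh : (Matrix.of h).det ≠ 0) (x : ℝ)
    (y : Fin m → ℝ) :
    HasDerivAt (fun x => annKer ε d j lam h (lineAt j x y)) (annKer' ε d j lam h (lineAt j x y)) x :=
  (hasDerivAt_annulus lam j x y).mul (hasDerivAt_divKernel hε hd j hh x y)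

lemma abs_apply_le {n : ℕ} (z : Fin n → ℝ) (i : Fin n) : |z i| ≤ ‖z‖ := norm_le_pi_norm z i

lemma sqNorm_sub_le {n : ℕ} {z z' : Fin n → ℝ} {r : ℝ} (hz : ‖z‖ ≤ r) (hz' : ‖z'‖ ≤ r) :
    |sqNorm z - sqNorm z'| ≤ 2 * r * n * ‖z - z'‖ := by
  unfold sqNorm
  rw [← Finset.sum_sub_distrib]
  calc |∑ i, (z i ^ 2 - z' i ^ 2)| ≤ ∑ i, |z i ^ 2 - z' i ^ 2| := Finset.abs_sum_le_sum_abs _ _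
    _ ≤ ∑ i : Fin n, 2 * r * ‖z - z'‖ := by
        refine Finset.sum_le_sum fun i _ => ?_
        have e : z i ^ 2 - z' i ^ 2 = (z i + z' i) * (z - z') i := by rw [Pi.sub_apply]; ring
        rw [e, abs_mul]
        have h1 := abs_apply_le z i
        have h2 := abs_apply_le z' i
        have h3 := abs_apply_le (z - z') i
        have h4 := abs_add_le (z i) (z' i)
        exact mul_le_mul (by linarith) h3 (abs_nonneg _) (by linarith [norm_nonneg z])
    _ = _ := by simp; ring

lemma norm_le_of_sqNorm {n : ℕ} {z : Fin n → ℝ} {r : ℝ} (hr : 0 ≤ r) (hz : sqNorm z ≤ r ^ 2) : ‖z‖ ≤ r := by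
  rw [pi_norm_le_iff_of_nonneg hr]
  intro i
  exact abs_le_of_sq_le_sq ((sq_le_sqNorm z i).trans hz) hr

lemma abs_mul_sub_mul_le {a b a' b' A B da db : ℝ} (ha : |a'| ≤ A) (hb : |b| ≤ B) (h1 : |a - a'| ≤ da)
    (h2 : |b - b'| ≤ db) : |a * b - a' * b'| ≤ da * B + A * db := by
  have e : a * b - a' * b' = (a - a') * b + a' * (b - b') := by ring
  rw [e]
  refine (abs_add_le _ _).trans (add_le_add ?_ ?_)
  · rw [abs_mul]; exact mul_le_mul h1 hb (abs_nonneg _) ((abs_nonneg _).trans h1)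
  · rw [abs_mul]; exact mul_le_mul ha h2 (abs_nonneg _) ((abs_nonneg _).trans ha)

lemma exists_bound_cutoff (n : ℕ) : ∃ C : ℝ, 1 ≤ C ∧ ∀ lam : ℝ, 1 ≤ lam → ∀ (j : Fin n) (z z' : Fin n → ℝ),
    ‖z‖ ≤ 8 → ‖z'‖ ≤ 8 → |cutoff' lam j z| ≤ C * lam ∧ |cutoff lam z - cutoff lam z'| ≤ C * lam * ‖z - z'‖ ∧
      |cutoff' lam j z - cutoff' lam j z'| ≤ C * lam ^ 2 * ‖z - z'‖ := by
  obtain ⟨C, hC, h1, h2, h3⟩ := exists_bound_deriv_smoothTransition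
  refine ⟨(256 * n + 16) * C, by nlinarith [Nat.cast_nonneg (α := ℝ) n], fun lam hl j z z' hz hz' => ?_⟩
  have hsq := sqNorm_sub_le hz hz'
  have hn := norm_nonneg (z - z')
  have hn0 : (0 : ℝ) ≤ n := Nat.cast_nonneg n
  have harg : |(1 + lam * (1 - sqNorm z)) - (1 + lam * (1 - sqNorm z'))| ≤ lam * (16 * n * ‖z - z'‖) := by
    have : (1 + lam * (1 - sqNorm z)) - (1 + lam * (1 - sqNorm z')) = - (lam * (sqNorm z - sqNorm z')) := by ring
    rw [this, abs_neg, abs_mul, abs_of_nonneg (by linarith : (0:ℝ) ≤ lam)]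
    refine mul_le_mul_of_nonneg_left (hsq.trans (le_of_eq (by ring))) (by linarith)
  have hb : ∀ w : Fin n → ℝ, ‖w‖ ≤ 8 → |(-2 * lam * w j)| ≤ 16 * lam := by
    intro w hw
    rw [abs_mul, abs_mul, abs_of_nonneg (by linarith : (0:ℝ) ≤ lam)]
    have := abs_apply_le w j
    norm_num
    nlinarith
  have hdb : |(-2 * lam * z j) - (-2 * lam * z' j)| ≤ 2 * lam * ‖z - z'‖ := by
    have e : (-2 * lam * z j) - (-2 * lam * z' j) = (-2 * lam) * (z - z') j := by rw [Pi.sub_apply]; ring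
    rw [e, abs_mul, abs_mul, abs_of_nonneg (by linarith : (0:ℝ) ≤ lam)]
    have := abs_apply_le (z - z') j
    rw [abs_neg, abs_two]
    exact mul_le_mul_of_nonneg_left this (by linarith)
  refine ⟨?_, ?_, ?_⟩
  · unfold cutoff'
    rw [abs_mul]
    calc _ ≤ C * (16 * lam) := mul_le_mul (h1 _) (hb z hz) (abs_nonneg _) (by linarith)
      _ ≤ _ := by nlinarith [mul_nonneg (mul_nonneg hn0 (by linarith : (0:ℝ) ≤ C)) (by linarith : (0:ℝ) ≤ lam)]
  · unfold cutoff
    calc _ ≤ C * (lam * (16 * n * ‖z - z'‖)) := (h3 _ _).trans (mul_le_mul_of_nonneg_left harg (by linarith))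
      _ = (16 * n) * (C * lam * ‖z - z'‖) := by ring
      _ ≤ (256 * n + 16) * (C * lam * ‖z - z'‖) := by
          refine mul_le_mul_of_nonneg_right (by linarith) ?_
          positivity
      _ = _ := by ring
  · unfold cutoff'
    have hll : lam ≤ lam ^ 2 := by nlinarith
    calc _ ≤ C * (lam * (16 * n * ‖z - z'‖)) * (16 * lam) + C * (2 * lam * ‖z - z'‖) :=
          abs_mul_sub_mul_le (h1 _) (hb z hz) ((h2 _ _).trans (mul_le_mul_of_nonneg_left harg (by linarith))) hdb
      _ = 256 * n * (C * lam ^ 2 * ‖z - z'‖) + 2 * (C * lam * ‖z - z'‖) := by ring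
      _ ≤ 256 * n * (C * lam ^ 2 * ‖z - z'‖) + 16 * (C * lam ^ 2 * ‖z - z'‖) := by
          have : C * lam * ‖z - z'‖ ≤ C * lam ^ 2 * ‖z - z'‖ := by gcongr
          have h0 : 0 ≤ C * lam * ‖z - z'‖ := by positivity
          linarith
      _ = _ := by ring

lemma exists_bound_annKer {n : ℕ} {ε : Fin n → ℝ} (hε : ∀ i, ε i ≠ 0) {d : ℕ} (hd : 2 ≤ d)
    (j : Fin n) (R : ℝ) : ∃ C : ℝ, 1 ≤ C ∧ ∀ h ∈ boundedSL n R, ∀ lam : ℝ, 1 ≤ lam → ∀ z z' : Fin n → ℝ,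
      |annKer' ε d j lam h z| ≤ C * lam ∧
      |annKer' ε d j lam h z - annKer' ε d j lam h z'| ≤ C * lam ^ 2 * ‖z - z'‖ := by
  obtain ⟨C, hC, hCb⟩ := exists_bound_cutoff n
  obtain ⟨D, hD, hDb⟩ := exists_bound_divKernel hε hd j R
  refine ⟨40 * (C * D), by nlinarith, fun h hh lam hl => ?_⟩
  have key : ∀ z z' : Fin n → ℝ, ‖z‖ ≤ 4 → ‖z'‖ ≤ 4 → |annKer' ε d j lam h z| ≤ 10 * (C * D) * lam ∧
      |annKer' ε d j lam h z - annKer' ε d j lam h z'| ≤ 40 * (C * D) * lam ^ 2 * ‖z - z'‖ := by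
    have norm2 : ∀ w : Fin n → ℝ, ‖(2 : ℝ) • w‖ = 2 * ‖w‖ := fun w => by
      rw [norm_smul]; norm_num
    have hann' : ∀ z : Fin n → ℝ, ‖z‖ ≤ 4 → |annulus' lam j z| ≤ 3 * C * lam := by
      intro z hz
      have h1 := (hCb lam hl j z z (by linarith) (by linarith)).1
      have h2 := (hCb lam hl j ((2:ℝ) • z) z (by rw [norm2]; linarith) (by linarith)).1
      unfold annulus'
      refine (abs_sub _ _).trans ?_
      rw [abs_mul]; norm_num; linarith
    have hann1 : ∀ z : Fin n → ℝ, |annulus lam z| ≤ 1 := fun z =>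
      abs_le.2 ⟨by linarith [annulus_nonneg (by linarith : (0:ℝ) ≤ lam) z], annulus_le_one _ _⟩
    intro z z' hz hz'
    have hn := norm_nonneg (z - z')
    have c1 := hCb lam hl j z z' (by linarith) (by linarith)
    have c2 := hCb lam hl j ((2:ℝ) • z) ((2:ℝ) • z') (by rw [norm2]; linarith) (by rw [norm2]; linarith)
    rw [← smul_sub, norm2] at c2
    have d1 := hDb h hh z z' hz hz'
    have hda : |annulus lam z - annulus lam z'| ≤ 3 * C * lam * ‖z - z'‖ := by
      have e : annulus lam z - annulus lam z' = (cutoff lam z - cutoff lam z') -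
        (cutoff lam ((2:ℝ) • z) - cutoff lam ((2:ℝ) • z')) := by unfold annulus; ring
      rw [e]
      refine (abs_sub _ _).trans ?_
      linarith [c1.2.1, c2.2.1]
    have hda' : |annulus' lam j z - annulus' lam j z'| ≤ 5 * C * lam ^ 2 * ‖z - z'‖ := by
      have e : annulus' lam j z - annulus' lam j z' = (cutoff' lam j z - cutoff' lam j z') -
        2 * (cutoff' lam j ((2:ℝ) • z) - cutoff' lam j ((2:ℝ) • z')) := by unfold annulus'; ring
      rw [e]
      refine (abs_sub _ _).trans ?_
      rw [abs_mul, abs_two]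
      linarith [c1.2.2, c2.2.2]
    have hCD : 1 ≤ C * D := by nlinarith
    have hDCD : D ≤ C * D := by nlinarith
    have hll : lam ≤ lam ^ 2 := by nlinarith
    refine ⟨?_, ?_⟩
    · unfold annKer'
      refine (abs_add_le _ _).trans ?_
      rw [abs_mul, abs_mul]
      calc _ ≤ 3 * C * lam * D + 1 * D :=
            add_le_add (mul_le_mul (hann' z hz) d1.1 (abs_nonneg _) (by positivity))
              (mul_le_mul (hann1 z) d1.2.1 (abs_nonneg _) (by norm_num))
        _ ≤ _ := by nlinarith
    · have e1 := abs_mul_sub_mul_le (hann' z' hz') d1.1 hda' d1.2.2.1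
      have e2 := abs_mul_sub_mul_le (hann1 z') d1.2.1 hda d1.2.2.2
      have e : annKer' ε d j lam h z - annKer' ε d j lam h z' =
        (annulus' lam j z * divKernel ε d j (h, z) - annulus' lam j z' * divKernel ε d j (h, z')) +
        (annulus lam z * divKernel' ε d j (h, z) - annulus lam z' * divKernel' ε d j (h, z')) := by
        unfold annKer'; ring
      rw [e]
      refine (abs_add_le _ _).trans ((add_le_add e1 e2).trans ?_)
      have f1 : 5 * C * lam ^ 2 * ‖z - z'‖ * D + 3 * C * lam * (D * ‖z - z'‖) +
          (3 * C * lam * ‖z - z'‖ * D + 1 * (D * ‖z - z'‖)) =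
        (5 * (C * D) * lam ^ 2 + 6 * (C * D) * lam + D) * ‖z - z'‖ := by ring
      rw [f1]
      refine mul_le_mul_of_nonneg_right ?_ hn
      nlinarith
  intro z z'
  have hCD : 0 < C * D := by nlinarith
  have far : ∀ w : Fin n → ℝ, 2 < ‖w‖ → annKer' ε d j lam h w = 0 := by
    intro w hw
    refine annKer'_eq_zero ε d j hl h ?_
    by_contra! hcon
    have := norm_le_of_sqNorm (r := 2) (by norm_num) (hcon.trans (by norm_num))
    linarith
  have bd : ∀ w : Fin n → ℝ, |annKer' ε d j lam h w| ≤ 10 * (C * D) * lam := by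
    intro w
    by_cases hw : ‖w‖ ≤ 4
    · exact (key w w hw hw).1
    · rw [far w (by linarith)]; simp; positivity
  refine ⟨(bd z).trans (by nlinarith), ?_⟩
  have hll : lam ≤ lam ^ 2 := by nlinarith
  have hfar2 : ∀ w w' : Fin n → ℝ, 4 < ‖w'‖ → 
      |annKer' ε d j lam h w - annKer' ε d j lam h w'| ≤ 40 * (C * D) * lam ^ 2 * ‖w - w'‖ := by
    intro w w' hw'
    rw [far w' (by linarith), sub_zero]
    by_cases hw : ‖w‖ ≤ 2
    · have : 2 ≤ ‖w - w'‖ := by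
        have := norm_sub_norm_le w' w
        rw [norm_sub_rev] at this; linarith
      calc _ ≤ 10 * (C * D) * lam := bd w
        _ ≤ 10 * (C * D) * lam ^ 2 := by gcongr
        _ ≤ 40 * (C * D) * lam ^ 2 * 2 := by nlinarith [mul_pos hCD (by positivity : 0 < lam ^ 2)]
        _ ≤ _ := by gcongr
    · rw [far w (by linarith)]; simp; positivity
  by_cases hz' : ‖z'‖ ≤ 4
  · by_cases hz : ‖z‖ ≤ 4
    · exact (key z z' hz hz').2
    · rw [abs_sub_comm, norm_sub_rev]
      exact hfar2 z' z (by linarith)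
  · exact hfar2 z z' (by linarith)

lemma continuous_cutoff {n : ℕ} (lam : ℝ) : Continuous fun z : Fin n → ℝ => cutoff lam z :=
  Real.smoothTransition.continuous.comp
    (continuous_const.add (continuous_const.mul (continuous_const.sub continuous_sqNorm)))

lemma continuous_annulus {n : ℕ} (lam : ℝ) : Continuous fun z : Fin n → ℝ => annulus lam z :=
  (continuous_cutoff lam).sub ((continuous_cutoff lam).comp (continuous_const_smul _))

lemma continuous_annKer' {n : ℕ} {ε : Fin n → ℝ} (hε : ∀ i, ε i ≠ 0) {d : ℕ} (hd : 2 ≤ d)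
    (j : Fin n) {R : ℝ} {lam : ℝ} (hl : 1 ≤ lam) {h : Fin n → Fin n → ℝ} (hh : h ∈ boundedSL n R) :
    Continuous fun z => annKer' ε d j lam h z := by
  obtain ⟨C, hC, hb⟩ := exists_bound_annKer hε hd j R
  refine (LipschitzWith.of_dist_le_mul (K := ⟨C * lam ^ 2, by positivity⟩) fun z y => ?_).continuous
  rw [Real.dist_eq, dist_eq_norm]
  exact (hb h hh lam hl z y).2

/-- The smooth weight of the annulus at scale `T` attached to the direction `e_j`. -/
def shellWeight {n : ℕ} (ε : Fin n → ℝ) (d : ℕ) (j : Fin n) (lam T : ℝ) (h : Fin n → Fin n → ℝ)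
    (w : Fin n → ℝ) : ℝ :=
  annulus lam (T⁻¹ • w) * gradWeight ε d (Matrix.of h) j w

/-- The weight `shellWeight` restricted to the region where the form takes values in `I`. -/
def shellFun {n : ℕ} (ε : Fin n → ℝ) (d : ℕ) (j : Fin n) (lam T : ℝ) (h : Fin n → Fin n → ℝ) (I : Set ℝ)
    (w : Fin n → ℝ) : ℝ :=
  I.indicator 1 (form ε d (Matrix.of h) w) * shellWeight ε d j lam T h w

/-- The integral of `shellFun` over a line in direction `e_j`. -/
def fiber {m : ℕ} (ε : Fin (m + 1) → ℝ) (d : ℕ) (j : Fin (m + 1)) (lam T : ℝ)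
    (h : Fin (m + 1) → Fin (m + 1) → ℝ) (I : Set ℝ) (y : Fin m → ℝ) : ℝ :=
  ∫ x, shellFun ε d j lam T h I (lineAt j x y)

lemma shellWeight_nonneg {n : ℕ} (ε : Fin n → ℝ) (d : ℕ) (j : Fin n) {lam : ℝ} (hl : 1 ≤ lam) (T : ℝ)
    (h : Fin n → Fin n → ℝ) (w : Fin n → ℝ) : 0 ≤ shellWeight ε d j lam T h w :=
  mul_nonneg (annulus_nonneg (by linarith) _) (gradWeight_nonneg _ _ _ _ _)

lemma shellWeight_le_one {n : ℕ} (ε : Fin n → ℝ) (d : ℕ) (j : Fin n) (lam : ℝ) (T : ℝ)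
    (h : Fin n → Fin n → ℝ) (w : Fin n → ℝ) : shellWeight ε d j lam T h w ≤ 1 :=
  mul_le_one₀ (annulus_le_one _ _) (gradWeight_nonneg _ _ _ _ _) (gradWeight_le_one _ _ _ _ _)

lemma shellWeight_eq_zero {n : ℕ} (ε : Fin n → ℝ) (d : ℕ) (j : Fin n) {lam : ℝ} (hl : 1 ≤ lam) {T : ℝ}
    (hT : 0 < T) (h : Fin n → Fin n → ℝ) {w : Fin n → ℝ} (hw : 2 * T ≤ ‖w‖) :
    shellWeight ε d j lam T h w = 0 := by
  rw [shellWeight, annulus_eq_zero hl, zero_mul]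
  right
  by_contra! hcon
  have h1 : sqNorm (T⁻¹ • w) < 4 := by linarith
  obtain ⟨i, hi⟩ : ∃ i, 2 * T ≤ |w i| := by
    by_contra! hc
    have := (pi_norm_lt_iff (x := w) (by linarith : 0 < 2 * T)).2 hc
    linarith
  have h2 := sq_le_sqNorm (T⁻¹ • w) i
  have h3 : 2 ≤ |(T⁻¹ • w) i| := by
    rw [Pi.smul_apply, smul_eq_mul, abs_mul, abs_of_pos (inv_pos.2 hT), ← div_eq_inv_mul, le_div_iff₀ hT]
    exact hi
  have h4 : (2:ℝ) ^ 2 ≤ |(T⁻¹ • w) i| ^ 2 := by gcongr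
  rw [sq_abs] at h4
  linarith

lemma annKer'_smul_eq_zero {n : ℕ} (ε : Fin n → ℝ) (d : ℕ) (j : Fin n) {lam : ℝ} (hl : 1 ≤ lam) {T : ℝ}
    (hT : 0 < T) (h : Fin n → Fin n → ℝ) {w : Fin n → ℝ} {i : Fin n} (hw : 2 * T ≤ |w i|) :
    annKer' ε d j lam h (T⁻¹ • w) = 0 ∧ annKer ε d j lam h (T⁻¹ • w) = 0 := by
  have h2 := sq_le_sqNorm (T⁻¹ • w) i
  have h3 : 2 ≤ |(T⁻¹ • w) i| := by
    rw [Pi.smul_apply, smul_eq_mul, abs_mul, abs_of_pos (inv_pos.2 hT), ← div_eq_inv_mul, le_div_iff₀ hT]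
    exact hw
  have h4 : (2:ℝ) ^ 2 ≤ |(T⁻¹ • w) i| ^ 2 := by gcongr
  rw [sq_abs] at h4
  exact ⟨annKer'_eq_zero ε d j hl h (by linarith), annKer_eq_zero ε d j hl h (by linarith)⟩

lemma shellFun_nonneg {n : ℕ} (ε : Fin n → ℝ) (d : ℕ) (j : Fin n) {lam : ℝ} (hl : 1 ≤ lam) (T : ℝ)
    (h : Fin n → Fin n → ℝ) (I : Set ℝ) (w : Fin n → ℝ) : 0 ≤ shellFun ε d j lam T h I w :=
  mul_nonneg (Set.indicator_nonneg (fun _ _ => zero_le_one) _) (shellWeight_nonneg ε d j hl T h w)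

lemma shellFun_le_one {n : ℕ} (ε : Fin n → ℝ) (d : ℕ) (j : Fin n) {lam : ℝ} (hl : 1 ≤ lam) (T : ℝ)
    (h : Fin n → Fin n → ℝ) (I : Set ℝ) (w : Fin n → ℝ) : shellFun ε d j lam T h I w ≤ 1 :=
  mul_le_one₀ (Set.indicator_le_self' (fun _ _ => zero_le_one) _) (shellWeight_nonneg ε d j hl T h w)
    (shellWeight_le_one ε d j lam T h w)

lemma shellFun_eq_zero {n : ℕ} (ε : Fin n → ℝ) (d : ℕ) (j : Fin n) {lam : ℝ} (hl : 1 ≤ lam) {T : ℝ}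
    (hT : 0 < T) (h : Fin n → Fin n → ℝ) (I : Set ℝ) {w : Fin n → ℝ} (hw : 2 * T ≤ ‖w‖) :
    shellFun ε d j lam T h I w = 0 := by
  rw [shellFun, shellWeight_eq_zero ε d j hl hT h hw, mul_zero]

lemma measurable_shellFun {n : ℕ} (ε : Fin n → ℝ) (d : ℕ) (j : Fin n) (lam T : ℝ)
    (h : Fin n → Fin n → ℝ) {I : Set ℝ} (hI : MeasurableSet I) : Measurable (shellFun ε d j lam T h I) := by
  refine Measurable.mul ?_ (Measurable.mul ?_ ?_)
  · exact (measurable_one.indicator hI).comp (continuous_form_right ε d (Matrix.of h)).measurable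
  · exact ((continuous_annulus lam).comp (continuous_const_smul T⁻¹)).measurable
  · exact measurable_gradWeight_right ε d j (Matrix.of h)

lemma continuous_lineAt {m : ℕ} (j : Fin (m + 1)) (y : Fin m → ℝ) : Continuous fun x => lineAt j x y := by
  unfold lineAt
  fun_prop

lemma norm_le_norm_lineAt {m : ℕ} (j : Fin (m + 1)) (x : ℝ) (y : Fin m → ℝ) : ‖y‖ ≤ ‖lineAt j x y‖ := by
  rw [pi_norm_le_iff_of_nonneg (norm_nonneg _)]
  intro i
  have := norm_le_pi_norm (lineAt j x y) (j.succAbove i)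
  rwa [lineAt_succAbove] at this

lemma abs_le_norm_lineAt {m : ℕ} (j : Fin (m + 1)) (x : ℝ) (y : Fin m → ℝ) : |x| ≤ ‖lineAt j x y‖ := by
  have := norm_le_pi_norm (lineAt j x y) j
  rwa [lineAt_self] at this

lemma norm_lineAt_le {m : ℕ} (j : Fin (m + 1)) {x : ℝ} {y : Fin m → ℝ} {r : ℝ} (hx : |x| ≤ r) (hy : ‖y‖ ≤ r) :
    ‖lineAt j x y‖ ≤ r := by
  rw [pi_norm_le_iff_of_nonneg ((abs_nonneg x).trans hx)]
  intro i
  rcases Fin.eq_self_or_eq_succAbove j i with rfl | ⟨k, rfl⟩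
  · simpa using hx
  · simpa using (norm_le_pi_norm y k).trans hy

lemma fiber_eq {m : ℕ} {ε : Fin (m + 1) → ℝ} (hε : ∀ i, ε i ≠ 0) {d : ℕ} (hd : 2 ≤ d) (j : Fin (m + 1))
    {lam T R : ℝ} (hl : 1 ≤ lam) (hT : 0 < T) {h : Fin (m + 1) → Fin (m + 1) → ℝ} (hh : h ∈ boundedSL (m + 1) R)
    {I : Set ℝ} (hI : MeasurableSet I) (hf : volume I ≠ ⊤) (y : Fin m → ℝ) :
    fiber ε d j lam T h I y =
      - (T⁻¹ ^ d * ∫ x, cumul I (form ε d (Matrix.of h) (lineAt j x y)) * annKer' ε d j lam h (T⁻¹ • lineAt j x y)) := by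
  have hdet : (Matrix.of h).det ≠ 0 := by rw [hh.1]; exact one_ne_zero
  have hTi : T⁻¹ ≠ 0 := (inv_pos.2 hT).ne'
  have hsm : ∀ x, T⁻¹ • lineAt j x y = lineAt j (T⁻¹ * x) (T⁻¹ • y) := by
    intro x
    funext i
    rcases Fin.eq_self_or_eq_succAbove j i with rfl | ⟨k, rfl⟩ <;> simp
  have key : ∀ x, shellFun ε d j lam T h I (lineAt j x y) = T⁻¹ ^ (d - 1) *
      (I.indicator 1 (form ε d (Matrix.of h) (lineAt j x y)) * formGrad ε d (Matrix.of h) (lineAt j x y) j *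
        annKer ε d j lam h (T⁻¹ • lineAt j x y)) := by
    intro x
    have := formGrad_mul_annKer ε d j hl h (T⁻¹ • lineAt j x y)
    rw [gradWeight_smul _ _ _ _ hTi, formGrad_smul] at this
    rw [shellFun, shellWeight, ← this]
    simp only [Pi.smul_apply, smul_eq_mul]
    ring
  have he : ∀ x, HasDerivAt (fun x => annKer ε d j lam h (T⁻¹ • lineAt j x y))
      (T⁻¹ * annKer' ε d j lam h (T⁻¹ • lineAt j x y)) x := by
    intro x
    simp only [hsm]
    have h1 := hasDerivAt_annKer hε hd j lam hdet (T⁻¹ * x) (T⁻¹ • y)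
    have h2 : HasDerivAt (fun x : ℝ => T⁻¹ * x) T⁻¹ x := by simpa using (hasDerivAt_id x).const_mul T⁻¹
    exact (h1.comp x h2).congr_deriv (mul_comm _ _)
  have hc : Continuous fun x => T⁻¹ * annKer' ε d j lam h (T⁻¹ • lineAt j x y) :=
    continuous_const.mul ((continuous_annKer' hε hd j hl hh).comp ((continuous_const_smul T⁻¹).comp (continuous_lineAt j y)))
  have hP : ∀ x, HasDerivAt (fun x => form ε d (Matrix.of h) (lineAt j x y))
      (formGrad ε d (Matrix.of h) (lineAt j x y) j) x := fun x => hasDerivAt_form ε d (Matrix.of h) j y x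
  have hPc : Continuous fun x => formGrad ε d (Matrix.of h) (lineAt j x y) j := by
    have := continuous_formGrad (n := m + 1) ε d
    have h3 : Continuous fun x : ℝ => (Matrix.of h, lineAt j x y) := continuous_const.prodMk (continuous_lineAt j y)
    exact (continuous_apply j).comp (this.comp h3)
  have ibp := integral_indicator_comp_mul_deriv_mul hP hPc he hc (r := 2 * T)
    (fun x hx => (annKer'_smul_eq_zero ε d j hl hT h (i := j) (by simpa using hx)).2) hI hf
  rw [fiber, funext key, integral_const_mul, ibp]
  rw [← integral_const_mul, ← integral_neg, ← integral_neg, ← integral_const_mul]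
  refine integral_congr_ae (Eventually.of_forall fun x => ?_)
  obtain ⟨e, rfl⟩ : ∃ e, d = e + 1 := ⟨d - 1, by omega⟩
  simp only [Nat.add_sub_cancel]
  ring

lemma abs_vecMul_le {n : ℕ} {R r : ℝ} {h : Fin n → Fin n → ℝ} (hh : ∀ i k, |h i k| ≤ R) {w : Fin n → ℝ}
    (hw : ‖w‖ ≤ r) (i : Fin n) : |(w ᵥ* Matrix.of h) i| ≤ n * R * r := by
  unfold Matrix.vecMul dotProduct
  calc _ ≤ ∑ k, |w k * Matrix.of h k i| := Finset.abs_sum_le_sum_abs _ _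
    _ ≤ ∑ _k : Fin n, r * R := by
        refine Finset.sum_le_sum fun k _ => ?_
        rw [abs_mul]
        exact mul_le_mul ((abs_apply_le w k).trans hw) (hh k i) (abs_nonneg _) ((norm_nonneg _).trans hw)
    _ = _ := by simp; ring

lemma abs_form_sub_le {n : ℕ} (ε : Fin n → ℝ) (d : ℕ) {R r : ℝ} {h : Fin n → Fin n → ℝ}
    (hh : ∀ i k, |h i k| ≤ R) {w w' : Fin n → ℝ} (hw : ‖w‖ ≤ r) (hw' : ‖w'‖ ≤ r) :
    |form ε d (Matrix.of h) w - form ε d (Matrix.of h) w'| ≤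
      (∑ i, |ε i|) * (n * R * ‖w - w'‖ * d * (n * R * r) ^ (d - 1)) := by
  unfold form
  rw [← Finset.sum_sub_distrib, Finset.sum_mul]
  refine (Finset.abs_sum_le_sum_abs _ _).trans (Finset.sum_le_sum fun i _ => ?_)
  rw [← mul_sub, abs_mul]
  refine mul_le_mul_of_nonneg_left ?_ (abs_nonneg _)
  refine (abs_pow_sub_pow_le _ _ _).trans ?_
  have h1 := abs_vecMul_le hh hw i
  have h2 := abs_vecMul_le hh hw' i
  have h3 : |(w ᵥ* Matrix.of h) i - (w' ᵥ* Matrix.of h) i| ≤ n * R * ‖w - w'‖ := by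
    have := abs_vecMul_le hh (le_refl ‖w - w'‖) i
    rwa [Matrix.sub_vecMul, Pi.sub_apply] at this
  have h4 : max |(w ᵥ* Matrix.of h) i| |(w' ᵥ* Matrix.of h) i| ≤ n * R * r := max_le h1 h2
  have h5 := (abs_nonneg _).trans h3
  gcongr

lemma abs_cumul_sub_le {I : Set ℝ} {M : ℝ} (hM : I ⊆ Set.Icc (-M) M)
    (hf : volume I ≠ ⊤) {s s' δ : ℝ} (hs : |s - s'| ≤ δ) :
    |cumul I s - cumul I s'| ≤ Set.indicator {s | |s| ≤ M + δ} (fun _ => (volume I).toReal) s := by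
  have c0 := cumul_nonneg I s
  have c0' := cumul_nonneg I s'
  have c1 := cumul_le hf s
  have c1' := cumul_le hf s'
  have hδ := (abs_nonneg _).trans hs
  by_cases h : |s| ≤ M + δ
  · rw [Set.indicator_of_mem (show s ∈ {s | |s| ≤ M + δ} from h), abs_le]
    constructor <;> linarith
  · rw [Set.indicator_of_notMem (show s ∉ {s | |s| ≤ M + δ} from h)]
    rw [abs_le] at hs
    rw [not_le, lt_abs] at h
    rcases h with h | h
    · rw [cumul_of_gt hM (by linarith), cumul_of_gt hM (by linarith), sub_self, abs_zero]
    · rw [cumul_of_lt hM (by linarith), cumul_of_lt hM (by linarith), sub_self, abs_zero]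

lemma norm_lineAt_sub {m : ℕ} (j : Fin (m + 1)) (x : ℝ) (y y' : Fin m → ℝ) :
    ‖lineAt j x y - lineAt j x y'‖ ≤ ‖y - y'‖ := by
  have : lineAt j x y - lineAt j x y' = lineAt j 0 (y - y') := by
    funext i
    rcases Fin.eq_self_or_eq_succAbove j i with rfl | ⟨k, rfl⟩ <;> simp
  rw [this]
  exact norm_lineAt_le j (by simp) le_rfl

/-- A bound for integrals against a function supported on an interval. -/
lemma abs_integral_le_of_support {f : ℝ → ℝ} {r B : ℝ} (hr : 0 ≤ r) (hB : ∀ x, |f x| ≤ B)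
    (hz : ∀ x, r ≤ |x| → f x = 0) : |∫ x, f x| ≤ 2 * r * B := by
  rw [← setIntegral_eq_integral_of_forall_compl_eq_zero (s := Set.Icc (-r) r)]
  · have := norm_setIntegral_le_of_norm_le_const (μ := volume) (s := Set.Icc (-r) r) (f := f) (C := B)
      (by simp) (fun x _ => hB x)
    rw [Real.norm_eq_abs] at this
    refine this.trans (le_of_eq ?_)
    rw [Measure.real, Real.volume_Icc, ENNReal.toReal_ofReal (by linarith)]
    ring
  · intro x hx
    refine hz x ?_
    by_contra! hc
    exact hx (abs_le.1 hc.le)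

lemma abs_fiber_le {m : ℕ} {ε : Fin (m + 1) → ℝ} (hε : ∀ i, ε i ≠ 0) {d : ℕ} (hd : 2 ≤ d) (j : Fin (m + 1))
    (R : ℝ) : ∃ C : ℝ, 1 ≤ C ∧ ∀ h ∈ boundedSL (m + 1) R, ∀ lam T : ℝ, 1 ≤ lam → 0 < T → ∀ I : Set ℝ,
      MeasurableSet I → volume I ≠ ⊤ → ∀ y : Fin m → ℝ,
      |fiber ε d j lam T h I y| ≤ C * lam * (volume I).toReal * (T⁻¹ ^ d * T) := by
  obtain ⟨C, hC, hb⟩ := exists_bound_annKer hε hd j R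
  refine ⟨4 * C, by linarith, fun h hh lam T hl hT I hI hf y => ?_⟩
  rw [fiber_eq hε hd j hl hT hh hI hf, abs_neg, abs_mul, abs_of_nonneg (by positivity : 0 ≤ T⁻¹ ^ d)]
  have := abs_integral_le_of_support (r := 2 * T) (B := (volume I).toReal * (C * lam))
    (f := fun x => cumul I (form ε d (Matrix.of h) (lineAt j x y)) * annKer' ε d j lam h (T⁻¹ • lineAt j x y))
    (by linarith) (fun x => ?_) (fun x hx => ?_)
  · calc _ ≤ T⁻¹ ^ d * (2 * (2 * T) * ((volume I).toReal * (C * lam))) :=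
          mul_le_mul_of_nonneg_left this (by positivity)
      _ = _ := by ring
  · rw [abs_mul, abs_of_nonneg (cumul_nonneg _ _)]
    exact mul_le_mul (cumul_le hf _) (hb h hh lam hl _ 0).1 (abs_nonneg _) ENNReal.toReal_nonneg
  · rw [(annKer'_smul_eq_zero ε d j hl hT h (i := j) (by simpa using hx)).1, mul_zero]

lemma fiber_eq_zero {m : ℕ} (ε : Fin (m + 1) → ℝ) (d : ℕ) (j : Fin (m + 1)) {lam T : ℝ} (hl : 1 ≤ lam)
    (hT : 0 < T) (h : Fin (m + 1) → Fin (m + 1) → ℝ) (I : Set ℝ) {y : Fin m → ℝ} (hy : 2 * T ≤ ‖y‖) :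
    fiber ε d j lam T h I y = 0 := by
  rw [fiber, ← integral_zero ℝ ℝ]
  congr 1
  funext x
  exact shellFun_eq_zero ε d j hl hT h I (hy.trans (norm_le_norm_lineAt j x y))

lemma fiber_nonneg {m : ℕ} (ε : Fin (m + 1) → ℝ) (d : ℕ) (j : Fin (m + 1)) {lam : ℝ} (hl : 1 ≤ lam) (T : ℝ)
    (h : Fin (m + 1) → Fin (m + 1) → ℝ) (I : Set ℝ) (y : Fin m → ℝ) : 0 ≤ fiber ε d j lam T h I y :=
  integral_nonneg fun _ => shellFun_nonneg ε d j hl T h I _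

lemma integrable_cumul_mul {m : ℕ} {ε : Fin (m + 1) → ℝ} (hε : ∀ i, ε i ≠ 0) {d : ℕ} (hd : 2 ≤ d) (j : Fin (m + 1))
    {lam T R : ℝ} (hl : 1 ≤ lam) (hT : 0 < T) {h : Fin (m + 1) → Fin (m + 1) → ℝ} (hh : h ∈ boundedSL (m + 1) R)
    {I : Set ℝ} (hI : MeasurableSet I) (hf : volume I ≠ ⊤) (y : Fin m → ℝ) : Integrable fun x =>
      cumul I (form ε d (Matrix.of h) (lineAt j x y)) * annKer' ε d j lam h (T⁻¹ • lineAt j x y) := by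
  refine Continuous.integrable_of_hasCompactSupport (Continuous.mul ?_ ?_) ?_
  · exact (cumul_lipschitz hI hf).continuous.comp ((continuous_form_right ε d _).comp (continuous_lineAt j y))
  · exact (continuous_annKer' hε hd j hl hh).comp ((continuous_const_smul T⁻¹).comp (continuous_lineAt j y))
  · refine HasCompactSupport.intro (isCompact_Icc (a := -(2 * T)) (b := 2 * T)) fun x hx => ?_
    rw [(annKer'_smul_eq_zero ε d j hl hT h (i := j) (w := lineAt j x y) ?_).1, mul_zero]
    by_contra! hc
    exact hx (abs_le.1 (by simpa using hc.le))

lemma abs_fiber_sub_le {m : ℕ} {ε : Fin (m + 1) → ℝ} (hε : ∀ i, ε i ≠ 0) {d : ℕ} (hd : 2 ≤ d) (j : Fin (m + 1))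
    {R M : ℝ} (hR : 0 < R) (hM : 0 ≤ M) : ∃ C : ℝ, 1 ≤ C ∧ ∀ h ∈ boundedSL (m + 1) R, 1 / R ≤ |∑ i, ε i * h j i ^ d| →
      ∀ lam T : ℝ, 1 ≤ lam → 1 / 2 ≤ T → ∀ I : Set ℝ,
      MeasurableSet I → I ⊆ Set.Icc (-M) M → ∀ y y' : Fin m → ℝ, ‖y - y'‖ ≤ 1 →
      |fiber ε d j lam T h I y - fiber ε d j lam T h I y'| ≤
        C * (volume I).toReal * (T⁻¹ ^ d * (lam ^ 2 + lam * T ^ (1 - 1 / d : ℝ))) := by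
  obtain ⟨C, hC, hb⟩ := exists_bound_annKer hε hd j R
  set E := ∑ i, |ε i|
  have hE : 0 ≤ E := Finset.sum_nonneg fun _ _ => abs_nonneg _
  set n : ℝ := ((m + 1 : ℕ) : ℝ)
  have hn : 0 ≤ n := Nat.cast_nonneg _
  set D := E * (n * R * d * (n * R * 6) ^ (d - 1)) + M * 2 ^ (d - 1)
  have hD : 0 ≤ D := by positivity
  refine ⟨8 * C + C * (2 * d * (D * R) ^ (1 / d : ℝ)), ?_, ?_⟩
  · have : 0 ≤ C * (2 * d * (D * R) ^ (1 / d : ℝ)) := by positivity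
    linarith
  intro h hh hA lam T hl hT I hI hIM y y' hyy
  have hT0 : 0 < T := by linarith
  have hf : volume I ≠ ⊤ := ne_top_of_le_ne_top (by simp) (measure_mono hIM)
  set V := (volume I).toReal
  have hV : 0 ≤ V := ENNReal.toReal_nonneg
  wlog hy : ‖y‖ < 4 * T generalizing y y'
  · by_cases hy' : ‖y'‖ < 4 * T
    · rw [abs_sub_comm]
      exact this y' y (by rwa [norm_sub_rev]) hy'
    · rw [fiber_eq_zero ε d j hl hT0 h I (by linarith), fiber_eq_zero ε d j hl hT0 h I (by linarith)]
      simp only [sub_self, abs_zero]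
      positivity
  have hy' : ‖y'‖ ≤ 6 * T := by
    have := norm_sub_norm_le y' y
    rw [norm_sub_rev] at this
    linarith
  have hsupp : ∀ (z : Fin m → ℝ) (x : ℝ), 2 * T ≤ |x| → annKer' ε d j lam h (T⁻¹ • lineAt j x z) = 0 :=
    fun z x hx => (annKer'_smul_eq_zero ε d j hl hT0 h (i := j) (by simpa using hx)).1
  have hinteg := fun z => integrable_cumul_mul hε hd j hl hT0 hh hI hf z
  set S := {x : ℝ | |∑ i, ε i * (x * h j i + ∑ k, y k * h (j.succAbove k) i) ^ d| ≤ D * T ^ (d - 1)}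
  have hSv := volume_sublevel_le (ε := ε) (a := h j) (fun i => ∑ k, y k * h (j.succAbove k) i) (d := d) (by omega)
    (fun h0 => by rw [h0, abs_zero] at hA; exact absurd hA (not_le.2 (by positivity)))
    (δ := D * T ^ (d - 1)) (by positivity)
  have hS : MeasurableSet S := by
    refine measurableSet_le ?_ measurable_const
    exact (Measurable.abs (by fun_prop))
  have hform : ∀ x, form ε d (Matrix.of h) (lineAt j x y) =
      ∑ i, ε i * (x * h j i + ∑ k, y k * h (j.succAbove k) i) ^ d := by
    intro x; simp only [form, lineAt_vecMul, Matrix.of_apply]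
  have hSr : volume.real S ≤ 2 * d * (D * R) ^ (1 / d : ℝ) * T ^ (1 - 1 / d : ℝ) := by
    refine ENNReal.toReal_le_of_le_ofReal (by positivity) (hSv.trans (ENNReal.ofReal_le_ofReal ?_))
    have hd0 : (d : ℝ) ≠ 0 := by positivity
    have h1 : D * T ^ (d - 1) / |∑ i, ε i * h j i ^ d| ≤ D * R * T ^ (d - 1) := by
      rw [div_le_iff₀ (lt_of_lt_of_le (by positivity) hA)]
      have : 1 ≤ R * |∑ i, ε i * h j i ^ d| := by
        rw [div_le_iff₀ hR] at hA; linarith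
      calc D * T ^ (d - 1) = D * T ^ (d - 1) * 1 := by ring
        _ ≤ D * T ^ (d - 1) * (R * |∑ i, ε i * h j i ^ d|) := by gcongr
        _ = _ := by ring
    have h2 : (D * R * T ^ (d - 1)) ^ (1 / d : ℝ) = (D * R) ^ (1 / d : ℝ) * T ^ (1 - 1 / d : ℝ) := by
      rw [Real.mul_rpow (by positivity) (by positivity), ← Real.rpow_natCast, ← Real.rpow_mul hT0.le]
      congr 2
      rw [Nat.cast_sub (by omega)]; field_simp; simp
    calc _ ≤ 2 * d * (D * R * T ^ (d - 1)) ^ (1 / d : ℝ) := by gcongr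
      _ = _ := by rw [h2]; ring
  have hSfin : volume S ≠ ⊤ := ne_top_of_le_ne_top ENNReal.ofReal_ne_top hSv
  set g : ℝ → ℝ := fun x => S.indicator (fun _ => V * (C * lam)) x +
    (Set.Icc (-(2 * T)) (2 * T)).indicator (fun _ => V * (C * lam ^ 2 * T⁻¹)) x
  have hgi1 : Integrable (S.indicator (fun _ => V * (C * lam))) :=
    (integrable_indicator_iff hS).2 (integrableOn_const hSfin)
  have hgi2 : Integrable ((Set.Icc (-(2 * T)) (2 * T)).indicator (fun _ => V * (C * lam ^ 2 * T⁻¹))) :=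
    (integrable_indicator_iff measurableSet_Icc).2 (integrableOn_const (by simp))
  have hg0 : ∀ x, 0 ≤ g x := fun x => add_nonneg (Set.indicator_nonneg (fun _ _ => by positivity) _)
    (Set.indicator_nonneg (fun _ _ => by positivity) _)
  have hgint : ∫ x, g x = volume.real S * (V * (C * lam)) + 4 * T * (V * (C * lam ^ 2 * T⁻¹)) := by
    rw [integral_add hgi1 hgi2, integral_indicator_const _ hS, integral_indicator_const _ measurableSet_Icc]
    simp only [smul_eq_mul]
    congr 2
    rw [Measure.real, Real.volume_Icc, ENNReal.toReal_ofReal (by linarith)]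
    ring
  have hpt : ∀ x, ‖cumul I (form ε d (Matrix.of h) (lineAt j x y)) * annKer' ε d j lam h (T⁻¹ • lineAt j x y) -
      cumul I (form ε d (Matrix.of h) (lineAt j x y')) * annKer' ε d j lam h (T⁻¹ • lineAt j x y')‖ ≤ g x := by
    intro x
    rw [Real.norm_eq_abs]
    by_cases hx : 2 * T ≤ |x|
    · rw [hsupp y x hx, hsupp y' x hx]
      simpa using hg0 x
    push Not at hx
    have hxI : x ∈ Set.Icc (-(2 * T)) (2 * T) := abs_le.1 hx.le
    have b1 := (hb h hh lam hl (T⁻¹ • lineAt j x y) (T⁻¹ • lineAt j x y')).2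
    rw [← smul_sub, norm_smul, norm_inv, Real.norm_eq_abs, abs_of_pos hT0] at b1
    have b2 : |annKer' ε d j lam h (T⁻¹ • lineAt j x y) - annKer' ε d j lam h (T⁻¹ • lineAt j x y')| ≤
        C * lam ^ 2 * T⁻¹ := by
      refine b1.trans ?_
      have := (norm_lineAt_sub j x y y').trans hyy
      calc _ ≤ C * lam ^ 2 * (T⁻¹ * 1) := by gcongr
        _ = _ := by ring
    have f1 := abs_form_sub_le ε d hh.2 (norm_lineAt_le j (r := 6 * T) (by linarith) (by linarith) : ‖lineAt j x y‖ ≤ 6 * T)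
      (norm_lineAt_le j (r := 6 * T) (by linarith) hy' : ‖lineAt j x y'‖ ≤ 6 * T)
    have f2 : |form ε d (Matrix.of h) (lineAt j x y) - form ε d (Matrix.of h) (lineAt j x y')| ≤
        E * (n * R * 1 * d * (n * R * (6 * T)) ^ (d - 1)) := by
      refine f1.trans ?_
      have := (norm_lineAt_sub j x y y').trans hyy
      gcongr
    have f3 := abs_cumul_sub_le hIM hf f2
    have f4 : {s : ℝ | |s| ≤ M + E * (n * R * 1 * d * (n * R * (6 * T)) ^ (d - 1))} ⊆ {s : ℝ | |s| ≤ D * T ^ (d - 1)} := by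
      intro s hs
      refine le_trans (show |s| ≤ _ from hs) ?_
      have : 1 ≤ (2 * T) ^ (d - 1) := one_le_pow₀ (by linarith)
      calc _ = M * 1 + E * (n * R * d * (n * R * 6) ^ (d - 1)) * T ^ (d - 1) := by
            rw [show n * R * (6 * T) = n * R * 6 * T by ring, mul_pow (n * R * 6)]; ring
        _ ≤ M * (2 * T) ^ (d - 1) + E * (n * R * d * (n * R * 6) ^ (d - 1)) * T ^ (d - 1) := by gcongr
        _ = _ := by rw [mul_pow]; ring
    have f5 := f3.trans (Set.indicator_le_indicator_of_subset f4 (fun _ => hV) _)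
    have f6 : ({s : ℝ | |s| ≤ D * T ^ (d - 1)}.indicator (fun _ => (volume I).toReal)
        (form ε d (Matrix.of h) (lineAt j x y))) = S.indicator (fun _ => V) x := by
      simp only [Set.indicator, S, Set.mem_ofPred_eq, hform, V]
    rw [f6] at f5
    have key := abs_mul_sub_mul_le (a' := cumul I (form ε d (Matrix.of h) (lineAt j x y')))
      (A := V) (B := C * lam) (b := annKer' ε d j lam h (T⁻¹ • lineAt j x y))
      (by rw [abs_of_nonneg (cumul_nonneg _ _)]; exact cumul_le hf _) (hb h hh lam hl _ 0).1 f5 b2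
    refine key.trans (le_of_eq ?_)
    simp only [g]
    rw [Set.indicator_of_mem hxI]
    congr 1
    by_cases hxS : x ∈ S
    · simp [hxS]
    · simp [hxS]
  rw [fiber_eq hε hd j hl hT0 hh hI hf, fiber_eq hε hd j hl hT0 hh hI hf]
  have e : ∀ a b : ℝ, -(T⁻¹ ^ d * a) - -(T⁻¹ ^ d * b) = - (T⁻¹ ^ d * (a - b)) := fun a b => by ring
  rw [e, ← integral_sub (hinteg y) (hinteg y'), abs_neg, abs_mul, abs_of_nonneg (by positivity : 0 ≤ T⁻¹ ^ d)]
  have hfin := norm_integral_le_of_norm_le (hgi1.add hgi2) (Eventually.of_forall hpt)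
  rw [Real.norm_eq_abs] at hfin
  have hfin2 := hfin.trans (le_of_eq hgint)
  have h4 : 4 * T * (V * (C * lam ^ 2 * T⁻¹)) = 4 * (V * (C * lam ^ 2)) := by field_simp
  rw [h4] at hfin2
  set Q := 2 * d * (D * R) ^ (1 / d : ℝ)
  have hQ : 0 ≤ Q := by positivity
  set T' := T ^ (1 - 1 / d : ℝ)
  have hT' : 0 ≤ T' := by positivity
  calc _ ≤ T⁻¹ ^ d * (Q * T' * (V * (C * lam)) + 4 * (V * (C * lam ^ 2))) := by
        refine mul_le_mul_of_nonneg_left (hfin2.trans ?_) (by positivity)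
        gcongr
    _ ≤ T⁻¹ ^ d * ((8 * C + C * Q) * V * (lam ^ 2 + lam * T')) := by
        refine mul_le_mul_of_nonneg_left ?_ (by positivity)
        have p1 : 0 ≤ V * C * lam ^ 2 := by positivity
        have p2 : 0 ≤ V * C * lam * T' := by positivity
        have p3 : 0 ≤ C * Q * V * lam ^ 2 := by positivity
        nlinarith
    _ = _ := by ring

/-- The integer vectors with all coordinates bounded by `K`. -/
def intBox (m K : ℕ) : Finset (Fin m → ℤ) := Fintype.piFinset fun _ => Finset.Icc (-(K : ℤ)) K

lemma mem_intBox {m K : ℕ} {y : Fin m → ℤ} : y ∈ intBox m K ↔ ‖intVec y‖ ≤ K := by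
  rw [pi_norm_le_iff_of_nonneg (Nat.cast_nonneg K)]
  simp only [intBox, Fintype.mem_piFinset, Finset.mem_Icc, intVec, Real.norm_eq_abs, abs_le]
  exact forall_congr' fun i => by norm_cast

lemma card_intBox (m K : ℕ) : (intBox m K).card = (2 * K + 1) ^ m := by
  simp only [intBox, Fintype.card_piFinset, Int.card_Icc, Finset.prod_const, Finset.card_univ, Fintype.card_fin]
  congr 1
  omega

/-- Comparison of the sum of a slowly varying function over a lattice with its integral. -/
lemma abs_sum_sub_integral_le {m : ℕ} {G : (Fin m → ℝ) → ℝ} (hG : Integrable G) {K : ℕ}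
    (hz : ∀ y, K ≤ ‖y‖ → G y = 0) {δ : ℝ} (hδ : ∀ y y', ‖y - y'‖ ≤ 1 → |G y - G y'| ≤ δ) :
    |∑ y ∈ intBox m K, G (intVec y) - ∫ y, G y| ≤ (2 * K + 1) ^ m * δ := by
  set cube : (Fin m → ℤ) → Set (Fin m → ℝ) := fun y => Set.univ.pi fun i => Set.Ico (y i : ℝ) (y i + 1)
  have hcube : ∀ y, MeasurableSet (cube y) := fun y => MeasurableSet.univ_pi fun i => measurableSet_Ico
  have hmem : ∀ y x, x ∈ cube y ↔ ∀ i, ⌊x i⌋ = y i := by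
    intro y x
    simp only [cube, Set.mem_univ_pi, Set.mem_Ico, Int.floor_eq_iff]
  have hvol : ∀ y, volume (cube y) = 1 := by
    intro y
    simp [cube, Real.volume_pi_Ico]
  have hU : ∫ y, G y = ∑ y ∈ intBox m K, ∫ x in cube y, G x := by
    rw [← integral_biUnion_finset _ (fun y _ => hcube y) ?_ (fun y _ => hG.integrableOn)]
    · refine (setIntegral_eq_integral_of_forall_compl_eq_zero fun x hx => hz x ?_).symm
      by_contra! hc
      refine hx (Set.mem_biUnion (x := fun i => ⌊x i⌋) ?_ ((hmem _ _).2 fun i => rfl))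
      rw [Finset.mem_coe, intBox, Fintype.mem_piFinset]
      intro i
      have := (norm_le_pi_norm x i).trans hc.le
      rw [Real.norm_eq_abs, abs_le] at this
      rw [Finset.mem_Icc]
      constructor
      · rw [Int.le_floor]; push_cast; exact this.1
      · have h2 : ((⌊x i⌋ : ℤ) : ℝ) ≤ K := (Int.floor_le _).trans this.2
        exact_mod_cast h2
    · intro y _ y' _ hne
      refine Set.disjoint_left.2 fun x hx hx' => hne ?_
      funext i
      rw [← (hmem y x).1 hx i, (hmem y' x).1 hx' i]
  rw [hU, ← Finset.sum_sub_distrib]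
  have hone : ∀ y, |G (intVec y) - ∫ x in cube y, G x| ≤ δ := by
    intro y
    have h1 : G (intVec y) = ∫ _x in cube y, G (intVec y) := by
      rw [setIntegral_const, Measure.real, hvol]; simp
    have hci : IntegrableOn (fun _ => G (intVec y)) (cube y) := integrableOn_const (by rw [hvol]; simp)
    rw [h1, ← integral_sub hci hG.integrableOn]
    have := norm_setIntegral_le_of_norm_le_const (μ := volume) (s := cube y)
      (f := fun x => G (intVec y) - G x) (C := δ) (by rw [hvol]; simp) (fun x hx => ?_)
    · rw [Real.norm_eq_abs, Measure.real, hvol] at this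
      simpa using this
    · refine hδ _ _ ?_
      rw [pi_norm_le_iff_of_nonneg zero_le_one]
      intro i
      have hx' := Set.mem_univ_pi.1 hx i
      rw [Pi.sub_apply, Real.norm_eq_abs, abs_le]
      simp only [intVec]
      constructor <;> linarith [hx'.1, hx'.2]
  calc _ ≤ ∑ y ∈ intBox m K, |G (intVec y) - ∫ x in cube y, G x| := Finset.abs_sum_le_sum_abs _ _
    _ ≤ ∑ y ∈ intBox m K, δ := Finset.sum_le_sum fun y _ => hone y
    _ = _ := by rw [Finset.sum_const, card_intBox, nsmul_eq_mul]; push_cast; rfl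

lemma measurePreserving_lineAt {m : ℕ} (j : Fin (m + 1)) :
    MeasurePreserving (fun q : ℝ × (Fin m → ℝ) => lineAt j q.1 q.2) :=
  (volume_preserving_piFinSuccAbove (fun _ : Fin (m + 1) => ℝ) j).symm

lemma measurableEmbedding_lineAt {m : ℕ} (j : Fin (m + 1)) :
    MeasurableEmbedding (fun q : ℝ × (Fin m → ℝ) => lineAt j q.1 q.2) :=
  (MeasurableEquiv.piFinSuccAbove (fun _ : Fin (m + 1) => ℝ) j).symm.measurableEmbedding

lemma integrable_of_bounded_support {n : ℕ} {f : (Fin n → ℝ) → ℝ} (hf : Measurable f) {B r : ℝ}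
    (hB : ∀ w, |f w| ≤ B) (hz : ∀ w, r ≤ ‖w‖ → f w = 0) : Integrable f := by
  have hsupp : Function.support f ⊆ Metric.closedBall 0 r := by
    intro w hw
    by_contra hc
    rw [mem_closedBall_zero_iff, not_le] at hc
    exact hw (hz w hc.le)
  rw [← integrableOn_iff_integrable_of_support_subset hsupp]
  refine Measure.integrableOn_of_bounded (M := B) (measure_closedBall_lt_top).ne hf.aestronglyMeasurable
    (Eventually.of_forall hB)

lemma integrable_shellFun {n : ℕ} (ε : Fin n → ℝ) (d : ℕ) (j : Fin n) {lam T : ℝ} (hl : 1 ≤ lam) (hT : 0 < T)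
    (h : Fin n → Fin n → ℝ) {I : Set ℝ} (hI : MeasurableSet I) : Integrable (shellFun ε d j lam T h I) :=
  integrable_of_bounded_support (measurable_shellFun ε d j lam T h hI) (B := 1)
    (fun w => abs_le.2 ⟨by linarith [shellFun_nonneg ε d j hl T h I w], shellFun_le_one ε d j hl T h I w⟩)
    (fun _ hw => shellFun_eq_zero ε d j hl hT h I hw)

lemma integrable_shellFun_prod {m : ℕ} (ε : Fin (m + 1) → ℝ) (d : ℕ) (j : Fin (m + 1)) {lam T : ℝ} (hl : 1 ≤ lam)
    (hT : 0 < T) (h : Fin (m + 1) → Fin (m + 1) → ℝ) {I : Set ℝ} (hI : MeasurableSet I) :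
    Integrable (fun q : ℝ × (Fin m → ℝ) => shellFun ε d j lam T h I (lineAt j q.1 q.2)) (volume.prod volume) :=
  (measurePreserving_lineAt j).integrable_comp_of_integrable (integrable_shellFun ε d j hl hT h hI)

lemma integrable_fiber {m : ℕ} (ε : Fin (m + 1) → ℝ) (d : ℕ) (j : Fin (m + 1)) {lam T : ℝ} (hl : 1 ≤ lam)
    (hT : 0 < T) (h : Fin (m + 1) → Fin (m + 1) → ℝ) {I : Set ℝ} (hI : MeasurableSet I) :
    Integrable (fiber ε d j lam T h I) :=
  (integrable_shellFun_prod ε d j hl hT h hI).integral_prod_right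

lemma integral_fiber {m : ℕ} (ε : Fin (m + 1) → ℝ) (d : ℕ) (j : Fin (m + 1)) {lam T : ℝ} (hl : 1 ≤ lam)
    (hT : 0 < T) (h : Fin (m + 1) → Fin (m + 1) → ℝ) {I : Set ℝ} (hI : MeasurableSet I) :
    ∫ y, fiber ε d j lam T h I y = ∫ w, shellFun ε d j lam T h I w := by
  rw [← (measurePreserving_lineAt j).integral_comp (measurableEmbedding_lineAt j)]
  exact (integral_prod_symm _ (integrable_shellFun_prod ε d j hl hT h hI)).symm

lemma abs_sum_fiber_sub_integral_le {m : ℕ} {ε : Fin (m + 1) → ℝ} (hε : ∀ i, ε i ≠ 0) {d : ℕ} (hd : 2 ≤ d)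
    (j : Fin (m + 1)) {R M : ℝ} (hR : 0 < R) (hM : 0 ≤ M) : ∃ C : ℝ, 1 ≤ C ∧ ∀ h ∈ boundedSL (m + 1) R,
      1 / R ≤ |∑ i, ε i * h j i ^ d| → ∀ lam T : ℝ, 1 ≤ lam → 1 / 2 ≤ T → ∀ I : Set ℝ,
      MeasurableSet I → I ⊆ Set.Icc (-M) M → ∀ K : ℕ, 2 * T ≤ K → K ≤ 4 * T →
      |∑ y ∈ intBox m K, fiber ε d j lam T h I (intVec y) - ∫ w, shellFun ε d j lam T h I w| ≤
        C * (volume I).toReal * (T ^ m * (T⁻¹ ^ d * (lam ^ 2 + lam * T ^ (1 - 1 / d : ℝ)))) := by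
  obtain ⟨C, hC, hb⟩ := abs_fiber_sub_le hε hd j hR hM
  refine ⟨10 ^ m * C, one_le_mul_of_one_le_of_one_le (one_le_pow₀ (by norm_num)) hC, ?_⟩
  intro h hh hA lam T hl hT I hI hIM K hK1 hK2
  have hT0 : 0 < T := by linarith
  rw [← integral_fiber ε d j hl hT0 h hI]
  refine (abs_sum_sub_integral_le (integrable_fiber ε d j hl hT0 h hI)
    (fun y hy => fiber_eq_zero ε d j hl hT0 h I (hK1.trans hy))
    (fun y y' hyy => hb h hh hA lam T hl hT I hI hIM y y' hyy)).trans ?_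
  have h1 : (2 * (K : ℝ) + 1) ^ m ≤ (10 * T) ^ m := by
    gcongr; linarith
  have hV : 0 ≤ (volume I).toReal := ENNReal.toReal_nonneg
  calc _ ≤ (10 * T) ^ m * (C * (volume I).toReal * (T⁻¹ ^ d * (lam ^ 2 + lam * T ^ (1 - 1 / d : ℝ)))) := by gcongr
    _ = _ := by rw [mul_pow]; ring

lemma abs_integral_le_of_forall_box {m : ℕ} {G : (Fin m → ℝ) → ℝ} {T B : ℝ} (hT : 0 < T) (hB : ∀ y, |G y| ≤ B)
    (hz : ∀ y, 2 * T ≤ ‖y‖ → G y = 0) : |∫ y, G y| ≤ (4 * T) ^ m * B := by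
  set s : Set (Fin m → ℝ) := Set.univ.pi fun _ => Set.Icc (-(2 * T)) (2 * T)
  have hs : volume s = ENNReal.ofReal ((4 * T) ^ m) := by
    rw [volume_pi_pi]
    simp only [Real.volume_Icc, Finset.prod_const, Finset.card_univ, Fintype.card_fin]
    rw [← ENNReal.ofReal_pow (by linarith)]; congr 2; ring
  rw [← setIntegral_eq_integral_of_forall_compl_eq_zero (s := s)]
  · have := norm_setIntegral_le_of_norm_le_const (μ := volume) (s := s) (f := G) (C := B) (by rw [hs]; simp)
      (fun y _ => hB y)
    rw [Real.norm_eq_abs, Measure.real, hs, ENNReal.toReal_ofReal (by positivity)] at this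
    refine this.trans (le_of_eq (by ring))
  · intro y hy
    refine hz y ?_
    by_contra! hc
    refine hy (Set.mem_univ_pi.2 fun i => ?_)
    have := (norm_le_pi_norm y i).trans hc.le
    exact abs_le.1 this

lemma abs_integral_shellFun_le {m : ℕ} {ε : Fin (m + 1) → ℝ} (hε : ∀ i, ε i ≠ 0) {d : ℕ} (hd : 2 ≤ d)
    (j : Fin (m + 1)) (R : ℝ) : ∃ C : ℝ, 1 ≤ C ∧ ∀ h ∈ boundedSL (m + 1) R,
      ∀ lam T : ℝ, 1 ≤ lam → 0 < T → ∀ I : Set ℝ,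
      MeasurableSet I → volume I ≠ ⊤ → |∫ w, shellFun ε d j lam T h I w| ≤
        C * lam * (volume I).toReal * (T ^ m * (T⁻¹ ^ d * T)) := by
  obtain ⟨C, hC, hb⟩ := abs_fiber_le hε hd j R
  refine ⟨4 ^ m * C, one_le_mul_of_one_le_of_one_le (one_le_pow₀ (by norm_num)) hC, ?_⟩
  intro h hh lam T hl hT I hI hf
  rw [← integral_fiber ε d j hl hT h hI]
  refine (abs_integral_le_of_forall_box hT (fun y => hb h hh lam T hl hT I hI hf y)
    fun y hy => fiber_eq_zero ε d j hl hT h I hy).trans (le_of_eq ?_)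
  rw [mul_pow]; ring

lemma abs_cumul_div_sub_le {I I' : Set ℝ} {M : ℝ} (hM : I ⊆ Set.Icc (-M) M) (hM' : I' ⊆ Set.Icc (-M) M)
    (h0 : volume I ≠ 0) (h0' : volume I' ≠ 0) (s : ℝ) :
    |cumul I s / (volume I).toReal - cumul I' s / (volume I').toReal| ≤ Set.indicator {s | |s| ≤ M} 1 s := by
  have hf : volume I ≠ ⊤ := ne_top_of_le_ne_top (by simp) (measure_mono hM)
  have hf' : volume I' ≠ ⊤ := ne_top_of_le_ne_top (by simp) (measure_mono hM')
  have p := ENNReal.toReal_pos h0 hf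
  have p' := ENNReal.toReal_pos h0' hf'
  by_cases h : |s| ≤ M
  · rw [Set.indicator_of_mem (show s ∈ {s | |s| ≤ M} from h), Pi.one_apply, abs_le]
    have c0 := div_nonneg (cumul_nonneg I s) p.le
    have c0' := div_nonneg (cumul_nonneg I' s) p'.le
    have c1 := (div_le_one p).2 (cumul_le hf s)
    have c1' := (div_le_one p').2 (cumul_le hf' s)
    constructor <;> linarith
  · rw [Set.indicator_of_notMem (show s ∉ {s | |s| ≤ M} from h)]
    rw [not_le, lt_abs] at h
    rcases h with h | h
    · rw [cumul_of_gt hM h.le, cumul_of_gt hM' h.le, div_self p.ne', div_self p'.ne']; simp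
    · rw [cumul_of_lt hM (by linarith), cumul_of_lt hM' (by linarith)]; simp

lemma abs_integral_shellFun_div_sub_le {m : ℕ} {ε : Fin (m + 1) → ℝ} (hε : ∀ i, ε i ≠ 0) {d : ℕ} (hd : 2 ≤ d)
    (j : Fin (m + 1)) {R M : ℝ} (hR : 0 < R) (hM : 0 ≤ M) : ∃ C : ℝ, 1 ≤ C ∧ ∀ h ∈ boundedSL (m + 1) R,
      1 / R ≤ |∑ i, ε i * h j i ^ d| → ∀ lam T : ℝ, 1 ≤ lam → 0 < T → ∀ I I' : Set ℝ,
      MeasurableSet I → I ⊆ Set.Icc (-M) M → MeasurableSet I' → I' ⊆ Set.Icc (-M) M →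
      volume I ≠ 0 → volume I' ≠ 0 →
      |(∫ w, shellFun ε d j lam T h I w) / (volume I).toReal -
        (∫ w, shellFun ε d j lam T h I' w) / (volume I').toReal| ≤ C * lam * (T ^ m * T⁻¹ ^ d) := by
  obtain ⟨C, hC, hb⟩ := exists_bound_annKer hε hd j R
  set Q := 2 * d * (M * R) ^ (1 / d : ℝ)
  have hQ : 0 ≤ Q := by positivity
  refine ⟨4 ^ m * (C * (Q + 1)), ?_, ?_⟩
  · exact one_le_mul_of_one_le_of_one_le (one_le_pow₀ (by norm_num))
      (one_le_mul_of_one_le_of_one_le hC (by linarith))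
  intro h hh hA lam T hl hT I I' hI hIM hI' hIM' h0 h0'
  have hf : volume I ≠ ⊤ := ne_top_of_le_ne_top (by simp) (measure_mono hIM)
  have hf' : volume I' ≠ ⊤ := ne_top_of_le_ne_top (by simp) (measure_mono hIM')
  rw [← integral_fiber ε d j hl hT h hI, ← integral_fiber ε d j hl hT h hI', ← integral_div, ← integral_div,
    ← integral_sub ((integrable_fiber ε d j hl hT h hI).div_const _) ((integrable_fiber ε d j hl hT h hI').div_const _)]
  have hpt : ∀ y, |fiber ε d j lam T h I y / (volume I).toReal - fiber ε d j lam T h I' y / (volume I').toReal| ≤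
      T⁻¹ ^ d * (C * lam * Q) := by
    intro y
    rw [fiber_eq hε hd j hl hT hh hI hf, fiber_eq hε hd j hl hT hh hI' hf']
    have e : ∀ a b V V' : ℝ, -(T⁻¹ ^ d * a) / V - -(T⁻¹ ^ d * b) / V' = - (T⁻¹ ^ d * (a / V - b / V')) :=
      fun a b V V' => by ring
    rw [e, abs_neg, abs_mul, abs_of_nonneg (by positivity : 0 ≤ T⁻¹ ^ d), ← integral_div, ← integral_div,
      ← integral_sub ((integrable_cumul_mul hε hd j hl hT hh hI hf y).div_const _)
        ((integrable_cumul_mul hε hd j hl hT hh hI' hf' y).div_const _)]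
    refine mul_le_mul_of_nonneg_left ?_ (by positivity)
    set S := {x : ℝ | |∑ i, ε i * (x * h j i + ∑ k, y k * h (j.succAbove k) i) ^ d| ≤ M}
    have hSv := volume_sublevel_le (ε := ε) (a := h j) (fun i => ∑ k, y k * h (j.succAbove k) i) (d := d) (by omega)
      (fun h0 => by rw [h0, abs_zero] at hA; exact absurd hA (not_le.2 (by positivity))) hM
    have hS : MeasurableSet S := by
      refine measurableSet_le ?_ measurable_const
      exact (Measurable.abs (by fun_prop))
    have hform : ∀ x, form ε d (Matrix.of h) (lineAt j x y) =
        ∑ i, ε i * (x * h j i + ∑ k, y k * h (j.succAbove k) i) ^ d := by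
      intro x; simp only [form, lineAt_vecMul, Matrix.of_apply]
    have hSr : volume.real S ≤ Q := by
      refine ENNReal.toReal_le_of_le_ofReal (by positivity) (hSv.trans (ENNReal.ofReal_le_ofReal ?_))
      have : M / |∑ i, ε i * h j i ^ d| ≤ M * R := by
        rw [div_eq_mul_inv]
        refine mul_le_mul_of_nonneg_left ?_ hM
        rw [inv_le_comm₀ (lt_of_lt_of_le (by positivity) hA) hR, ← one_div]
        exact hA
      change _ ≤ 2 * d * (M * R) ^ (1 / d : ℝ)
      gcongr
    have hSfin : volume S ≠ ⊤ := ne_top_of_le_ne_top ENNReal.ofReal_ne_top hSv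
    have hgi : Integrable (S.indicator (fun _ => C * lam)) :=
      (integrable_indicator_iff hS).2 (integrableOn_const hSfin)
    have := norm_integral_le_of_norm_le hgi (Eventually.of_forall (p := fun x => ‖cumul I (form ε d (Matrix.of h) (lineAt j x y)) *
        annKer' ε d j lam h (T⁻¹ • lineAt j x y) / (volume I).toReal - cumul I' (form ε d (Matrix.of h) (lineAt j x y)) *
        annKer' ε d j lam h (T⁻¹ • lineAt j x y) / (volume I').toReal‖ ≤ S.indicator (fun _ => C * lam) x) fun x => ?_)
    · rw [Real.norm_eq_abs, integral_indicator_const _ hS, smul_eq_mul] at this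
      refine this.trans ?_
      rw [mul_comm]
      gcongr
    · have e2 : ∀ a b c V V' : ℝ, a * c / V - b * c / V' = (a / V - b / V') * c := fun a b c V V' => by ring
      rw [e2, Real.norm_eq_abs, abs_mul]
      have b1 := abs_cumul_div_sub_le hIM hIM' h0 h0' (form ε d (Matrix.of h) (lineAt j x y))
      have b2 := (hb h hh lam hl (T⁻¹ • lineAt j x y) 0).1
      refine (mul_le_mul b1 b2 (abs_nonneg _) (Set.indicator_nonneg (fun _ _ => zero_le_one) _)).trans (le_of_eq ?_)
      simp only [Set.indicator, S, Set.mem_ofPred_eq, hform, Pi.one_apply]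
      split_ifs <;> simp
  refine (abs_integral_le_of_forall_box hT hpt fun y hy => ?_).trans ?_
  · rw [fiber_eq_zero ε d j hl hT h I hy, fiber_eq_zero ε d j hl hT h I' hy]; simp
  · have : C * lam * Q ≤ C * lam * (Q + 1) := by gcongr; linarith
    calc _ ≤ (4 * T) ^ m * (T⁻¹ ^ d * (C * lam * (Q + 1))) := by gcongr
      _ = _ := by rw [mul_pow]; ring

/-- The map `u ↦ (u ⬝ y, u ⬝ y')` to the two-dimensional torus, on the torus. -/
def torusPair {m : ℕ} (y y' : Fin m → ℤ) : (Fin m → UnitAddCircle) →+ UnitAddCircle × UnitAddCircle where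
  toFun θ := (∑ i, y i • θ i, ∑ i, y' i • θ i)
  map_zero' := by simp
  map_add' a b := by simp [Finset.sum_add_distrib]

lemma surjective_torusPair {m : ℕ} {y y' : Fin m → ℤ} {k l : Fin m} (hD : y k * y' l - y l * y' k ≠ 0) :
    Function.Surjective (torusPair y y') := by
  have hkl : k ≠ l := by rintro rfl; exact hD (by ring)
  have hDR : (y k : ℝ) * y' l - y l * y' k ≠ 0 := by exact_mod_cast hD
  rintro ⟨a, b⟩
  induction a using QuotientAddGroup.induction_on with | _ a => ?_
  induction b using QuotientAddGroup.induction_on with | _ b => ?_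
  set D : ℝ := (y k : ℝ) * y' l - y l * y' k with hDdef
  set s : ℝ := (a * y' l - b * y l) / D
  set r : ℝ := (b * y k - a * y' k) / D
  refine ⟨Pi.single k (s : UnitAddCircle) + Pi.single l (r : UnitAddCircle), ?_⟩
  have key : ∀ z : Fin m → ℤ, ∑ i, z i • ((Pi.single k (s : UnitAddCircle) + Pi.single l (r : UnitAddCircle) : Fin m → UnitAddCircle) i)
      = ((z k * s + z l * r : ℝ) : UnitAddCircle) := by
    intro z
    simp only [Pi.add_apply, smul_add, Finset.sum_add_distrib, Pi.single_apply, smul_ite, smul_zero,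
      Finset.sum_ite_eq', Finset.mem_univ, if_true]
    rw [← AddCircle.coe_zsmul, ← AddCircle.coe_zsmul, ← AddCircle.coe_add, zsmul_eq_mul, zsmul_eq_mul]
  change (_, _) = _
  rw [key, key]
  congr 2
  · simp only [s, r]; field_simp; rw [hDdef]; ring
  · simp only [s, r]; field_simp; rw [hDdef]; ring

lemma measurePreserving_torusPair {m : ℕ} {y y' : Fin m → ℤ} {k l : Fin m} (hD : y k * y' l - y l * y' k ≠ 0) :
    MeasurePreserving (torusPair y y') volume ((volume : Measure UnitAddCircle).prod volume) := by
  have : (volume : Measure UnitAddCircle).IsAddHaarMeasure := inferInstance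
  have : ((volume : Measure UnitAddCircle).prod (volume : Measure UnitAddCircle)).IsAddHaarMeasure :=
    Measure.prod.instIsAddHaarMeasure _ _
  have : (volume : Measure (Fin m → UnitAddCircle)).IsAddHaarMeasure := inferInstance
  refine AddMonoidHom.measurePreserving (f := torusPair y y') ?_ (surjective_torusPair hD) ?_
  · exact (continuous_finsetSum _ fun i _ => (continuous_apply i).zsmul _).prodMk
      (continuous_finsetSum _ fun i _ => (continuous_apply i).zsmul _)
  · rw [← Set.univ_prod_univ, Measure.prod_prod, ← Set.pi_univ Set.univ, volume_pi_pi]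
    simp

/-- The half-open unit cube. -/
def unitCube (m : ℕ) : Set (Fin m → ℝ) := Set.univ.pi fun _ => Set.Ioc 0 1

lemma volume_unitCube (m : ℕ) : volume (unitCube m) = 1 := by
  simp [unitCube, Real.volume_pi_Ioc]

lemma measurePreserving_unitCube {m : ℕ} :
    MeasurePreserving (fun (u : Fin m → ℝ) (i : Fin m) => (u i : UnitAddCircle)) (volume.restrict (unitCube m)) volume := by
  rw [unitCube, volume_pi, Measure.restrict_pi_pi]
  refine measurePreserving_pi _ _ fun i => ?_
  simpa using UnitAddCircle.measurePreserving_mk 0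

lemma measurable_lift {Φ : ℝ → ENNReal} (hΦ : Measurable Φ) (hp : Function.Periodic Φ 1) :
    Measurable (hp.lift : UnitAddCircle → ENNReal) := by
  have : (hp.lift : UnitAddCircle → ENNReal) = fun θ => Φ (AddCircle.equivIoc 1 0 θ) := by
    funext θ
    conv_lhs => rw [← (AddCircle.equivIoc (1:ℝ) 0).symm_apply_apply θ]
    rfl
  rw [this]
  exact hΦ.comp (measurable_subtype_coe.comp (AddCircle.measurableEquivIoc (1:ℝ) 0).measurable)

lemma lintegral_lift {Φ : ℝ → ENNReal} (hp : Function.Periodic Φ 1) :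
    ∫⁻ θ : UnitAddCircle, hp.lift θ = ∫⁻ s in Set.Ioc 0 1, Φ s := by
  have := UnitAddCircle.lintegral_preimage 0 hp.lift
  rw [← this]
  simp

/-- Independence of `u ⬝ y` and `u ⬝ y'` modulo one, for linearly independent integer vectors. -/
lemma lintegral_unitCube_mul {m : ℕ} {y y' : Fin m → ℤ} {k l : Fin m} (hD : y k * y' l - y l * y' k ≠ 0)
    {Φ Ψ : ℝ → ENNReal} (hΦ : Measurable Φ) (hΨ : Measurable Ψ) (hp : Function.Periodic Φ 1)
    (hq : Function.Periodic Ψ 1) :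
    ∫⁻ u in unitCube m, Φ (u ⬝ᵥ intVec y) * Ψ (u ⬝ᵥ intVec y')
      = (∫⁻ s in Set.Ioc 0 1, Φ s) * ∫⁻ s in Set.Ioc 0 1, Ψ s := by
  have hmp := (measurePreserving_torusPair hD).comp measurePreserving_unitCube
  rw [← lintegral_lift hp, ← lintegral_lift hq, ← lintegral_prod_mul (measurable_lift hΦ hp).aemeasurable
    (measurable_lift hΨ hq).aemeasurable, ← hmp.lintegral_comp]
  · refine lintegral_congr fun u => ?_
    have key : ∀ z : Fin m → ℤ, ∑ i, z i • ((u i : ℝ) : UnitAddCircle) = ((u ⬝ᵥ intVec z : ℝ) : UnitAddCircle) := by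
      intro z
      simp only [dotProduct, intVec, ← AddCircle.coe_zsmul]
      rw [← QuotientAddGroup.mk_sum]
      congr 1
      exact Finset.sum_congr rfl fun i _ => by rw [zsmul_eq_mul, mul_comm]
    simp only [Function.comp, torusPair, AddMonoidHom.coe_mk, ZeroHom.coe_mk, key, Function.Periodic.lift_coe]
  · exact ((measurable_lift hΦ hp).comp measurable_fst).mul ((measurable_lift hΨ hq).comp measurable_snd)

lemma lintegral_unitCube {m : ℕ} (hm : 2 ≤ m) {y : Fin m → ℤ} (hy : y ≠ 0)
    {Φ : ℝ → ENNReal} (hΦ : Measurable Φ) (hp : Function.Periodic Φ 1) :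
    ∫⁻ u in unitCube m, Φ (u ⬝ᵥ intVec y) = ∫⁻ s in Set.Ioc 0 1, Φ s := by
  obtain ⟨k, hk⟩ := Function.ne_iff.1 hy
  have : Nontrivial (Fin m) := Fin.nontrivial_iff_two_le.2 hm
  obtain ⟨l, hl⟩ := exists_ne k
  have := lintegral_unitCube_mul (y := y) (y' := Pi.single l 1) (k := k) (l := l) (by simpa [Pi.single_apply, hl.symm] using hk)
    (Ψ := fun _ => 1) hΦ measurable_const hp (fun _ => rfl)
  simpa using this

/-- The periodization of a nonnegative function on the line. -/
def wrap (f : ℝ → ℝ) (s : ℝ) : ENNReal := ∑' k : ℤ, ENNReal.ofReal (f (k + s))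

lemma measurable_wrap {f : ℝ → ℝ} (hf : Measurable f) : Measurable (wrap f) :=
  Measurable.tsum fun _ => (hf.comp (measurable_const.add measurable_id)).ennreal_ofReal

lemma periodic_wrap (f : ℝ → ℝ) : Function.Periodic (wrap f) 1 := by
  intro s
  rw [wrap, wrap, ← (Equiv.addRight (1:ℤ)).tsum_eq (fun k : ℤ => ENNReal.ofReal (f (k + s)))]
  refine tsum_congr fun k => ?_
  congr 2
  simp only [Equiv.coe_addRight, Int.cast_add, Int.cast_one]
  ring

lemma lintegral_wrap {f : ℝ → ℝ} (hf : Measurable f) :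
    ∫⁻ s in Set.Ioc 0 1, wrap f s = ∫⁻ x, ENNReal.ofReal (f x) := by
  have h1 : ∫⁻ x, ENNReal.ofReal (f x) = ∑' k : ℤ, ∫⁻ x in Set.Ioc (k:ℝ) (k + 1), ENNReal.ofReal (f x) := by
    rw [← lintegral_iUnion (fun _ => measurableSet_Ioc) (Set.pairwise_disjoint_Ioc_intCast ℝ), iUnion_Ioc_intCast, setLIntegral_univ]
  rw [h1]
  have hmeas : ∀ k : ℤ, AEMeasurable (fun s => ENNReal.ofReal (f (k + s))) (volume.restrict (Set.Ioc 0 1)) :=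
    fun k => (hf.comp (measurable_const.add measurable_id)).ennreal_ofReal.aemeasurable
  simp only [wrap]
  rw [lintegral_tsum hmeas]
  refine tsum_congr fun k => ?_
  have h2 := (measurePreserving_add_left volume (k:ℝ)).setLIntegral_comp_emb (measurableEmbedding_addLeft (k:ℝ))
    (fun x => ENNReal.ofReal (f x)) (Set.Ioc 0 1)
  rw [Set.image_const_add_Ioc, add_zero] at h2
  exact h2

lemma wrap_le {f : ℝ → ℝ} (h1 : ∀ x, f x ≤ 1) {s : ℝ} {F : Finset ℤ} (hF : ∀ k : ℤ, f (k + s) ≠ 0 → k ∈ F) :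
    wrap f s ≤ F.card := by
  rw [wrap, tsum_eq_sum (s := F)]
  · calc _ ≤ ∑ k ∈ F, (1 : ENNReal) := Finset.sum_le_sum fun k _ => by simpa using h1 _
      _ = _ := by simp
  · intro k hk
    by_contra hc
    exact hk (hF k fun h => hc (by simp [h]))

/-- Chebyshev's inequality for sums of variables most pairs of which are uncorrelated. -/
lemma measure_sum_sub_le {Ω ι : Type*} [DecidableEq ι] [MeasurableSpace Ω] (P : Measure Ω) [IsProbabilityMeasure P] (s : Finset ι)
    {X : ι → Ω → ℝ} (hX : ∀ i, Measurable (X i)) {B G : ℝ} (hX0 : ∀ i ω, 0 ≤ X i ω)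
    (hXB : ∀ i ω, X i ω ≤ B) {g : ι → ℝ} (hE : ∀ i ∈ s, ∫ ω, X i ω ∂P = g i) (hG : ∀ i ∈ s, g i ≤ G) (D : Finset (ι × ι))
    (hB : 0 ≤ B) (hG0 : 0 ≤ G) (hD : ∀ i ∈ s, ∀ j ∈ s, (i, j) ∉ D → ∫ ω, X i ω * X j ω ∂P = g i * g j) {τ : ℝ} (hτ : 0 < τ) :
    P {ω | τ ≤ |∑ i ∈ s, X i ω - ∑ i ∈ s, g i|} ≤ ENNReal.ofReal (D.card * (B * G) / τ ^ 2) := by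
  have hi : ∀ i, Integrable (X i) P := fun i =>
    Integrable.of_bound (hX i).aestronglyMeasurable B (ae_of_all _ fun ω => by
      rw [Real.norm_eq_abs, abs_of_nonneg (hX0 i ω)]; exact hXB i ω)
  have hij : ∀ i j, Integrable (fun ω => X i ω * X j ω) P := fun i j =>
    Integrable.of_bound ((hX i).mul (hX j)).aestronglyMeasurable (B * B) (ae_of_all _ fun ω => by
      rw [Real.norm_eq_abs, abs_of_nonneg (mul_nonneg (hX0 i ω) (hX0 j ω))]
      exact mul_le_mul (hXB i ω) (hXB j ω) (hX0 j ω) hB)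
  have hg : ∀ i ∈ s, 0 ≤ g i := fun i his => (hE i his) ▸ integral_nonneg (hX0 i)
  have hcov : ∀ i ∈ s, ∀ j ∈ s, ∫ ω, (X i ω - g i) * (X j ω - g j) ∂P = ∫ ω, X i ω * X j ω ∂P - g i * g j := by
    intro i his j hjs
    have : ∀ ω, (X i ω - g i) * (X j ω - g j) = X i ω * X j ω - (g i * X j ω + g j * X i ω - g i * g j) := fun ω => by ring
    simp_rw [this]
    have hA : Integrable (fun ω => g i * X j ω + g j * X i ω) P := ((hi j).const_mul _).add ((hi i).const_mul _)
    have hA' : Integrable (fun ω => g i * X j ω + g j * X i ω - g i * g j) P := hA.sub (integrable_const _)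
    rw [integral_sub (hij i j) hA', integral_sub hA (integrable_const _),
      integral_add ((hi j).const_mul _) ((hi i).const_mul _)]
    simp only [integral_const_mul, hE i his, hE j hjs, integral_const, probReal_univ, one_smul]
    ring
  have hcovI : ∀ i j, Integrable (fun ω => (X i ω - g i) * (X j ω - g j)) P := by
    intro i j
    have : (fun ω => (X i ω - g i) * (X j ω - g j)) = fun ω => X i ω * X j ω - (g i * X j ω + g j * X i ω - g i * g j) := by
      funext ω; ring
    rw [this]
    exact (hij i j).sub ((((hi j).const_mul _).add ((hi i).const_mul _)).sub (integrable_const _))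
  have hsq : ∀ ω, (∑ i ∈ s, X i ω - ∑ i ∈ s, g i) ^ 2 = ∑ i ∈ s, ∑ j ∈ s, (X i ω - g i) * (X j ω - g j) := by
    intro ω
    rw [← Finset.sum_sub_distrib, sq, Finset.sum_mul_sum]
  have hvar : ∫ ω, (∑ i ∈ s, X i ω - ∑ i ∈ s, g i) ^ 2 ∂P ≤ D.card * (B * G) := by
    simp_rw [hsq]
    rw [integral_finsetSum _ fun i _ => integrable_finsetSum _ fun j _ => hcovI i j]
    have h1 : ∀ i ∈ s, ∫ ω, ∑ j ∈ s, (X i ω - g i) * (X j ω - g j) ∂P ≤ ∑ j ∈ s, if (i, j) ∈ D then B * G else 0 := by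
      intro i his
      rw [integral_finsetSum _ fun j _ => hcovI i j]
      refine Finset.sum_le_sum fun j hjs => ?_
      rw [hcov i his j hjs]
      split_ifs with hd
      · have h2 : ∫ ω, X i ω * X j ω ∂P ≤ ∫ ω, B * X j ω ∂P :=
          integral_mono (hij i j) ((hi j).const_mul B) fun ω => mul_le_mul_of_nonneg_right (hXB i ω) (hX0 j ω)
        rw [integral_const_mul, hE j hjs] at h2
        have := mul_nonneg (hg i his) (hg j hjs)
        have := mul_le_mul_of_nonneg_left (hG j hjs) hB
        linarith
      · rw [hD i his j hjs hd, sub_self]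
    refine (Finset.sum_le_sum h1).trans ?_
    rw [← Finset.sum_product' (f := fun i j => if (i, j) ∈ D then B * G else 0), ← Finset.sum_filter, Finset.sum_const, nsmul_eq_mul]
    refine mul_le_mul_of_nonneg_right ?_ (mul_nonneg hB hG0)
    exact_mod_cast Finset.card_le_card fun x hx => (Finset.mem_filter.1 hx).2
  have hinteg : Integrable (fun ω => (∑ i ∈ s, X i ω - ∑ i ∈ s, g i) ^ 2) P := by
    simp_rw [hsq]
    exact integrable_finsetSum _ fun i _ => integrable_finsetSum _ fun j _ => hcovI i j
  have hch := mul_meas_ge_le_integral_of_nonneg (ae_of_all _ fun ω => sq_nonneg (∑ i ∈ s, X i ω - ∑ i ∈ s, g i)) hinteg (τ ^ 2)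
  have hset : {ω | τ ^ 2 ≤ (∑ i ∈ s, X i ω - ∑ i ∈ s, g i) ^ 2} = {ω | τ ≤ |∑ i ∈ s, X i ω - ∑ i ∈ s, g i|} := by
    ext ω
    rw [Set.mem_ofPred_eq, Set.mem_ofPred_eq, sq_le_sq, abs_of_pos hτ]
  rw [hset] at hch
  rw [← ofReal_measureReal]
  refine ENNReal.ofReal_le_ofReal ?_
  rw [le_div_iff₀ (by positivity), mul_comm]
  exact hch.trans hvar

/-- The pairs of nonzero proportional integer vectors in a box. -/
def parallelPairs (m K : ℕ) : Finset ((Fin m → ℤ) × (Fin m → ℤ)) :=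
  ((intBox m K).erase 0 ×ˢ (intBox m K).erase 0).filter fun p => ∀ k l, p.1 k * p.2 l = p.1 l * p.2 k

lemma exists_common_root {m : ℕ} {y y' : Fin m → ℤ} (hy : y ≠ 0) (hp : ∀ k l, y k * y' l = y l * y' k) :
    ∃ (e : Fin m → ℤ) (a b : ℤ), (∀ i, y i = a * e i) ∧ ∀ i, y' i = b * e i := by
  obtain ⟨i0, hi0⟩ := Function.ne_iff.1 hy
  rw [Pi.zero_apply] at hi0
  obtain ⟨e, he, hg⟩ := Finset.extract_gcd y (s := Finset.univ) ⟨i0, Finset.mem_univ _⟩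
  set a := Finset.univ.gcd y
  have ha : a ≠ 0 := by
    intro h0
    rw [he i0 (Finset.mem_univ _), h0, zero_mul] at hi0
    exact hi0 rfl
  have he0 : e i0 ≠ 0 := by
    intro h0
    rw [he i0 (Finset.mem_univ _), h0, mul_zero] at hi0
    exact hi0 rfl
  have hpe : ∀ k l, e k * y' l = e l * y' k := by
    intro k l
    have := hp k l
    rw [he k (Finset.mem_univ _), he l (Finset.mem_univ _), mul_assoc, mul_assoc] at this
    exact mul_left_cancel₀ ha this
  have hdvd : e i0 ∣ y' i0 := by
    have h1 : e i0 ∣ Finset.univ.gcd fun l => e l * y' i0 :=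
      Finset.dvd_gcd fun l _ => ⟨y' l, (hpe i0 l).symm⟩
    rw [Finset.gcd_mul_right, hg, one_mul] at h1
    exact h1.trans (normalize_associated _).dvd
  obtain ⟨b, hb⟩ := hdvd
  refine ⟨e, a, b, fun i => he i (Finset.mem_univ _), fun i => ?_⟩
  have := hpe i0 i
  rw [hb] at this
  exact mul_left_cancel₀ he0 (by rw [this]; ring)

lemma card_parallelPairs_le {m : ℕ} (hm : 2 ≤ m) {K : ℕ} (hK : 1 ≤ K) :
    ((parallelPairs m K).card : ℝ) ≤ 4 * 3 ^ m * (K : ℝ) ^ m * (1 + Real.log K) ^ 2 := by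
  set S : Finset ((ℕ × ℕ) × (ℤ × ℤ)) := (Finset.Icc 1 K ×ˢ Finset.Icc 1 K) ×ˢ (({1, -1} : Finset ℤ) ×ˢ ({1, -1} : Finset ℤ))
  have hsub : parallelPairs m K ⊆ S.biUnion fun p => (intBox m (K / max p.1.1 p.1.2)).image fun e =>
      ((fun i => p.2.1 * p.1.1 * e i), (fun i => p.2.2 * p.1.2 * e i)) := by
    rintro ⟨y, y'⟩ hyy
    simp only [parallelPairs, Finset.mem_filter, Finset.mem_product, Finset.mem_erase, intBox, Fintype.mem_piFinset,
      Finset.mem_Icc, ← abs_le] at hyy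
    obtain ⟨⟨⟨hy0, hy⟩, hy0', hy'⟩, hp⟩ := hyy
    obtain ⟨e, a, b, hya, hyb⟩ := exists_common_root hy0 hp
    have key : ∀ (z : Fin m → ℤ) (c : ℤ), z ≠ 0 → (∀ i, |z i| ≤ K) → (∀ i, z i = c * e i) →
        1 ≤ c.natAbs ∧ c.natAbs ≤ K ∧ ∀ i, c.natAbs * (e i).natAbs ≤ K := by
      intro z c hz hzK hzc
      have h1 : ∀ i, c.natAbs * (e i).natAbs ≤ K := by
        intro i
        have := hzK i
        rw [hzc i] at this
        rw [← Int.natAbs_mul]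
        rw [Int.abs_eq_natAbs] at this
        exact_mod_cast this
      obtain ⟨i0, hi0⟩ := Function.ne_iff.1 hz
      rw [Pi.zero_apply, hzc i0, mul_ne_zero_iff] at hi0
      have h2 : 1 ≤ (e i0).natAbs := Int.natAbs_pos.2 hi0.2
      exact ⟨Int.natAbs_pos.2 hi0.1, (Nat.le_mul_of_pos_right _ h2).trans (h1 i0), h1⟩
    obtain ⟨ha1, haK, hae⟩ := key y a hy0 hy hya
    obtain ⟨hb1, hbK, hbe⟩ := key y' b hy0' hy' hyb
    have hsign : ∀ c : ℤ, 1 ≤ c.natAbs → c.sign ∈ ({1, -1} : Finset ℤ) := by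
      intro c hc
      rcases lt_trichotomy c 0 with h | h | h
      · simp [Int.sign_eq_neg_one_of_neg h]
      · simp [h] at hc
      · simp [Int.sign_eq_one_of_pos h]
    rw [Finset.mem_biUnion]
    refine ⟨((a.natAbs, b.natAbs), (a.sign, b.sign)), ?_, ?_⟩
    · simp only [S, Finset.mem_product, Finset.mem_Icc]
      exact ⟨⟨⟨ha1, haK⟩, hb1, hbK⟩, hsign a ha1, hsign b hb1⟩
    · rw [Finset.mem_image]
      refine ⟨e, ?_, ?_⟩
      · simp only [intBox, Fintype.mem_piFinset, Finset.mem_Icc, ← abs_le]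
        intro i
        have h3 : (e i).natAbs ≤ K / max a.natAbs b.natAbs := by
          rw [Nat.le_div_iff_mul_le (by omega)]
          rcases max_choice a.natAbs b.natAbs with h | h <;> rw [h, mul_comm]
          · exact hae i
          · exact hbe i
        change |e i| ≤ ((K / max a.natAbs b.natAbs : ℕ) : ℤ)
        rw [Int.abs_eq_natAbs]
        exact_mod_cast h3
      · simp only [Int.sign_mul_natAbs, ← hya, ← hyb]
  have hcard : (parallelPairs m K).card ≤ ∑ p ∈ S, (2 * (K / max p.1.1 p.1.2) + 1) ^ m := by
    refine (Finset.card_le_card hsub).trans (Finset.card_biUnion_le.trans (Finset.sum_le_sum fun p _ => ?_))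
    exact Finset.card_image_le.trans (card_intBox _ _).le
  have hterm : ∀ p ∈ S, (((2 * (K / max p.1.1 p.1.2) + 1) ^ m : ℕ) : ℝ) ≤ 3 ^ m * (K:ℝ) ^ m * ((p.1.1 : ℝ)⁻¹ * (p.1.2 : ℝ)⁻¹) := by
    rintro ⟨⟨a, b⟩, σ⟩ hp
    simp only [S, Finset.mem_product, Finset.mem_Icc] at hp
    obtain ⟨⟨⟨ha1, haK⟩, hb1, hbK⟩, -⟩ := hp
    simp only
    set M := max a b
    have hM1 : 1 ≤ M := le_max_of_le_left ha1
    have hMK : M ≤ K := max_le haK hbK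
    have hr : 1 ≤ K / M := (Nat.one_le_div_iff (by omega)).2 hMK
    have hM0 : (0:ℝ) < M := by exact_mod_cast hM1
    have h1 : ((2 * (K / M) + 1 : ℕ) : ℝ) ≤ 3 * (K / M) := by
      calc ((2 * (K / M) + 1 : ℕ) : ℝ) ≤ ((3 * (K / M) : ℕ) : ℝ) := by exact_mod_cast (by omega)
        _ = 3 * ((K / M : ℕ) : ℝ) := by push_cast; ring
        _ ≤ 3 * (K / M) := by have := Nat.cast_div_le (α := ℝ) (m := K) (n := M); linarith
    have ha0 : (0:ℝ) < a := by exact_mod_cast ha1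
    have hb0 : (0:ℝ) < b := by exact_mod_cast hb1
    have h2 : (a:ℝ) * b ≤ (M:ℝ) ^ m := by
      calc (a:ℝ) * b ≤ M * M := mul_le_mul (by exact_mod_cast le_max_left a b) (by exact_mod_cast le_max_right a b) hb0.le hM0.le
        _ = (M:ℝ) ^ 2 := by ring
        _ ≤ _ := pow_le_pow_right₀ (by exact_mod_cast hM1) hm
    calc (((2 * (K / M) + 1) ^ m : ℕ) : ℝ) = ((2 * (K / M) + 1 : ℕ) : ℝ) ^ m := by push_cast; ring
      _ ≤ (3 * (K / M)) ^ m := by gcongr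
      _ = 3 ^ m * K ^ m * ((M:ℝ) ^ m)⁻¹ := by rw [mul_pow, div_pow]; field_simp
      _ ≤ 3 ^ m * K ^ m * ((a:ℝ) * b)⁻¹ := by gcongr
      _ = _ := by rw [mul_inv]
  have hharm : ∑ a ∈ Finset.Icc 1 K, ((a:ℝ))⁻¹ ≤ 1 + Real.log K := by
    have := harmonic_le_one_add_log K
    rw [harmonic_eq_sum_Icc] at this
    push_cast at this
    exact this
  calc ((parallelPairs m K).card : ℝ) ≤ ((∑ p ∈ S, (2 * (K / max p.1.1 p.1.2) + 1) ^ m : ℕ) : ℝ) := by exact_mod_cast hcard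
    _ = ∑ p ∈ S, (((2 * (K / max p.1.1 p.1.2) + 1) ^ m : ℕ) : ℝ) := by push_cast; rfl
    _ ≤ ∑ p ∈ S, 3 ^ m * (K:ℝ) ^ m * ((p.1.1 : ℝ)⁻¹ * (p.1.2 : ℝ)⁻¹) := Finset.sum_le_sum hterm
    _ = 4 * 3 ^ m * (K : ℝ) ^ m * (∑ a ∈ Finset.Icc 1 K, ((a:ℝ))⁻¹) ^ 2 := by
      rw [← Finset.mul_sum, Finset.sum_product]
      simp only [Finset.sum_const]
      rw [← Finset.smul_sum, Finset.sum_product, sq, Finset.sum_mul_sum]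
      simp
      ring
    _ ≤ _ := by
      have : (0:ℝ) ≤ ∑ a ∈ Finset.Icc 1 K, ((a:ℝ))⁻¹ := Finset.sum_nonneg fun _ _ => by positivity
      gcongr

/-- The sum of `shellFun` over the lattice `ℤⁿ` sheared by `u`. -/
def shellSum {m : ℕ} (ε : Fin (m + 1) → ℝ) (d : ℕ) (j : Fin (m + 1)) (lam T : ℝ)
    (h : Fin (m + 1) → Fin (m + 1) → ℝ) (I : Set ℝ) (u : Fin m → ℝ) : ENNReal :=
  ∑' v : Fin (m + 1) → ℤ, ENNReal.ofReal (shellFun ε d j lam T h I (intVec v ᵥ* shear j u))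

/-- The restriction of `shellFun` to a line in direction `e_j`. -/
def shellLine {m : ℕ} (ε : Fin (m + 1) → ℝ) (d : ℕ) (j : Fin (m + 1)) (lam T : ℝ)
    (h : Fin (m + 1) → Fin (m + 1) → ℝ) (I : Set ℝ) (y : Fin m → ℤ) (x : ℝ) : ℝ :=
  shellFun ε d j lam T h I (lineAt j x (intVec y))

lemma intVec_insertNth {m : ℕ} (j : Fin (m + 1)) (k : ℤ) (y : Fin m → ℤ) :
    intVec (j.insertNth k y : Fin (m + 1) → ℤ) = lineAt j k (intVec y) := by
  funext i
  refine Fin.succAboveCases j ?_ (fun l => ?_) i <;> simp [intVec]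

lemma tsum_lattice_shear {m : ℕ} (j : Fin (m + 1)) (u : Fin m → ℝ) (Φ : (Fin (m + 1) → ℝ) → ENNReal) :
    ∑' v : Fin (m + 1) → ℤ, Φ (intVec v ᵥ* shear j u)
      = ∑' y : Fin m → ℤ, ∑' k : ℤ, Φ (lineAt j (k + u ⬝ᵥ intVec y) (intVec y)) := by
  rw [ENNReal.tsum_comm, ← ENNReal.tsum_prod, ← (Fin.insertNthEquiv (fun _ => ℤ) j).tsum_eq]
  refine tsum_congr fun p => ?_
  change Φ (intVec (j.insertNth p.1 p.2 : Fin (m + 1) → ℤ) ᵥ* shear j u) = _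
  rw [intVec_insertNth, vecMul_shear]

lemma measurable_shellLine {m : ℕ} (ε : Fin (m + 1) → ℝ) (d : ℕ) (j : Fin (m + 1)) (lam T : ℝ)
    (h : Fin (m + 1) → Fin (m + 1) → ℝ) {I : Set ℝ} (hI : MeasurableSet I) (y : Fin m → ℤ) :
    Measurable (shellLine ε d j lam T h I y) :=
  (measurable_shellFun ε d j lam T h hI).comp (continuous_lineAt j _).measurable

lemma shellSum_eq {m : ℕ} (ε : Fin (m + 1) → ℝ) (d : ℕ) (j : Fin (m + 1)) {lam T : ℝ} (hl : 1 ≤ lam) (hT : 0 < T)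
    (h : Fin (m + 1) → Fin (m + 1) → ℝ) (I : Set ℝ) {K : ℕ} (hK : 2 * T ≤ K) (u : Fin m → ℝ) :
    shellSum ε d j lam T h I u = ∑ y ∈ intBox m K, wrap (shellLine ε d j lam T h I y) (u ⬝ᵥ intVec y) := by
  rw [shellSum, tsum_lattice_shear j u fun w => ENNReal.ofReal (shellFun ε d j lam T h I w)]
  refine tsum_eq_sum fun y hy => ?_
  rw [mem_intBox, not_le] at hy
  rw [ENNReal.tsum_eq_zero]
  intro k
  rw [shellFun_eq_zero ε d j hl hT h I ((hK.trans hy.le).trans (norm_le_norm_lineAt j _ _)), ENNReal.ofReal_zero]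

lemma wrap_shellLine_le {m : ℕ} (ε : Fin (m + 1) → ℝ) {d : ℕ} (hd : 2 ≤ d) (j : Fin (m + 1)) {R M : ℝ}
    (hR : 0 < R) (hM : 0 ≤ M) {h : Fin (m + 1) → Fin (m + 1) → ℝ} (hA : 1 / R ≤ |∑ i, ε i * h j i ^ d|)
    {lam : ℝ} (hl : 1 ≤ lam) (T : ℝ) {I : Set ℝ} (hIM : I ⊆ Set.Icc (-M) M) (y : Fin m → ℤ) (s : ℝ) :
    wrap (shellLine ε d j lam T h I y) s ≤ ENNReal.ofReal (d * (2 * (M * R) ^ (1 / d : ℝ) + 1)) := by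
  have hA0 : 0 < |∑ i, ε i * h j i ^ d| := lt_of_lt_of_le (by positivity) hA
  obtain ⟨F, hF, hk⟩ := ncard_sublevel_le (fun i => ∑ k, intVec y k * h (j.succAbove k) i) (by omega : 1 ≤ d)
    (abs_pos.1 hA0) hM s
  refine (wrap_le (fun x => shellFun_le_one ε d j hl T h I _) (F := F) fun k hne => hk k ?_).trans ?_
  · by_contra hc
    refine hne ?_
    change I.indicator 1 _ * _ = (0:ℝ)
    rw [Set.indicator_of_notMem, zero_mul]
    intro hmem
    refine hc (abs_le.2 ?_)
    have := hIM hmem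
    simp only [form, lineAt_vecMul] at this
    exact this
  · rw [← ENNReal.ofReal_natCast]
    refine ENNReal.ofReal_le_ofReal (hF.trans ?_)
    have h1 : M / |∑ i, ε i * h j i ^ d| ≤ M * R := by
      rw [div_le_iff₀ hA0, mul_assoc]
      have : 1 ≤ R * |∑ i, ε i * h j i ^ d| := by rwa [div_le_iff₀' hR] at hA
      nlinarith
    gcongr

lemma lintegral_shellLine {m : ℕ} (ε : Fin (m + 1) → ℝ) (d : ℕ) (j : Fin (m + 1)) {lam : ℝ} (hl : 1 ≤ lam) {T : ℝ} (hT : 0 < T)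
    (h : Fin (m + 1) → Fin (m + 1) → ℝ) {I : Set ℝ} (hI : MeasurableSet I) (y : Fin m → ℤ) :
    ∫⁻ s in Set.Ioc 0 1, wrap (shellLine ε d j lam T h I y) s = ENNReal.ofReal (fiber ε d j lam T h I (intVec y)) := by
  have hm := measurable_shellLine ε d j lam T h hI y
  rw [lintegral_wrap hm, fiber, ofReal_integral_eq_lintegral_ofReal]
  · rfl
  · refine Measure.integrableOn_of_bounded (s := Set.Icc (-(2*T)) (2*T)) (M := 1) (by simp) hm.aestronglyMeasurable
      (ae_of_all _ fun x => ?_) |>.integrable_of_forall_notMem_eq_zero fun x hx => ?_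
    · rw [Real.norm_eq_abs, shellLine, abs_of_nonneg (shellFun_nonneg ε d j hl T h I _)]
      exact shellFun_le_one ε d j hl T h I _
    · refine shellFun_eq_zero ε d j hl hT h I (le_trans ?_ (abs_le_norm_lineAt j _ _))
      rw [Set.mem_Icc, ← abs_le] at hx
      exact (not_le.1 hx).le
  · exact ae_of_all _ fun x => shellFun_nonneg ε d j hl T h I _

lemma measure_shellSum_le {m : ℕ} (hm : 2 ≤ m) {ε : Fin (m + 1) → ℝ} (hε : ∀ i, ε i ≠ 0) {d : ℕ} (hd : 2 ≤ d)
    (j : Fin (m + 1)) {R M : ℝ} (hR : 0 < R) (hM : 0 ≤ M) : ∃ C : ℝ, 1 ≤ C ∧ ∀ h ∈ boundedSL (m + 1) R,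
      1 / R ≤ |∑ i, ε i * h j i ^ d| → ∀ lam T : ℝ, 1 ≤ lam → 1 / 2 ≤ T → ∀ I : Set ℝ,
      MeasurableSet I → I ⊆ Set.Icc (-M) M → ∀ τ : ℝ, 0 < τ →
      volume.restrict (unitCube m) {u | τ + C * (volume I).toReal * (T ^ m * (T⁻¹ ^ d * (lam ^ 2 + lam * T ^ (1 - 1 / d : ℝ)))) + C
        ≤ |(shellSum ε d j lam T h I u).toReal - ∫ w, shellFun ε d j lam T h I w|} ≤
      ENNReal.ofReal (C * lam * (volume I).toReal * (T ^ m * (T⁻¹ ^ d * T)) * (1 + Real.log (4 * T)) ^ 2 / τ ^ 2) := by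
  obtain ⟨C1, hC1, hb1⟩ := abs_sum_fiber_sub_integral_le hε hd j hR hM
  obtain ⟨C2, hC2, hb2⟩ := abs_fiber_le hε hd j R
  set B : ℝ := d * (2 * (M * R) ^ (1 / d : ℝ) + 1)
  have hB0 : 0 ≤ B := by positivity
  set C : ℝ := C1 + 2 ^ m * C2 + B + 4 * 3 ^ m * 4 ^ m * B * C2
  refine ⟨C, by have : 0 ≤ 2 ^ m * C2 := by positivity
                have : 0 ≤ 4 * 3 ^ m * 4 ^ m * B * C2 := by positivity
                linarith, ?_⟩
  intro h hh hA lam T hl hT I hI hIM τ hτ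
  have hT0 : 0 < T := by linarith
  have hfin : volume I ≠ ⊤ := ((measure_mono hIM).trans_lt (by simp)).ne
  have hV : 0 ≤ (volume I).toReal := ENNReal.toReal_nonneg
  obtain ⟨K, hK1, hK2⟩ : ∃ K : ℕ, 2 * T ≤ K ∧ (K:ℝ) ≤ 4 * T :=
    ⟨⌈2 * T⌉₊, Nat.le_ceil _, by have := Nat.ceil_lt_add_one (a := 2 * T) (by linarith); linarith⟩
  have hK : 1 ≤ K := by
    have : (1:ℝ) ≤ K := by linarith
    exact_mod_cast this
  have : IsProbabilityMeasure (volume.restrict (unitCube m)) :=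
    ⟨by rw [Measure.restrict_apply_univ, volume_unitCube]⟩
  set Φ : (Fin m → ℤ) → ℝ → ENNReal := fun y => wrap (shellLine ε d j lam T h I y)
  have hΦm : ∀ y, Measurable (Φ y) := fun y => measurable_wrap (measurable_shellLine ε d j lam T h hI y)
  have hΦB : ∀ y s, Φ y s ≤ ENNReal.ofReal B := fun y s => wrap_shellLine_le ε hd j hR hM hA hl T hIM y s
  have hΦt : ∀ y s, Φ y s < ⊤ := fun y s => (hΦB y s).trans_lt ENNReal.ofReal_lt_top
  have hΦB' : ∀ y s, (Φ y s).toReal ≤ B := fun y s => ENNReal.toReal_le_of_le_ofReal hB0 (hΦB y s)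
  set g : (Fin m → ℤ) → ℝ := fun y => fiber ε d j lam T h I (intVec y)
  have hg0 : ∀ y, 0 ≤ g y := fun y => fiber_nonneg ε d j hl T h I _
  set G : ℝ := C2 * lam * (volume I).toReal * (T⁻¹ ^ d * T)
  have hG0 : 0 ≤ G := by positivity
  have hgG : ∀ y, g y ≤ G := fun y => (le_abs_self _).trans (hb2 h hh lam T hl hT0 I hI hfin _)
  have hΦi : ∀ y, ∫⁻ s in Set.Ioc 0 1, Φ y s = ENNReal.ofReal (g y) := fun y => lintegral_shellLine ε d j hl hT0 h hI y
  have hmdot : ∀ y : Fin m → ℤ, Measurable fun u : Fin m → ℝ => u ⬝ᵥ intVec y := fun y => by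
    simp only [dotProduct]; fun_prop
  have hcheb := measure_sum_sub_le (volume.restrict (unitCube m)) ((intBox m K).erase 0)
    (X := fun y u => (Φ y (u ⬝ᵥ intVec y)).toReal) (fun y => ((hΦm y).comp (hmdot y)).ennreal_toReal) (B := B) (G := G)
    (fun y u => ENNReal.toReal_nonneg) (fun y u => hΦB' _ _) (g := g) ?_ (fun y _ => hgG y) (parallelPairs m K) hB0 hG0 ?_ hτ
  rotate_left
  · intro y hy
    have hae : AEMeasurable (fun u => Φ y (u ⬝ᵥ intVec y)) (volume.restrict (unitCube m)) :=
      ((hΦm y).comp (hmdot y)).aemeasurable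
    rw [integral_toReal hae (ae_of_all _ fun u => hΦt _ _)]
    rw [lintegral_unitCube hm (Finset.ne_of_mem_erase hy) (hΦm y) (periodic_wrap _), hΦi, ENNReal.toReal_ofReal (hg0 y)]
  · intro y hy y' hy' hne
    obtain ⟨k, l, hkl⟩ : ∃ k l, y k * y' l ≠ y l * y' k := by
      by_contra! hc
      exact hne (Finset.mem_filter.2 ⟨Finset.mem_product.2 ⟨hy, hy'⟩, hc⟩)
    simp_rw [← ENNReal.toReal_mul]
    have hae : AEMeasurable (fun u => Φ y (u ⬝ᵥ intVec y) * Φ y' (u ⬝ᵥ intVec y')) (volume.restrict (unitCube m)) :=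
      (((hΦm y).comp (hmdot y)).mul ((hΦm y').comp (hmdot y'))).aemeasurable
    rw [integral_toReal hae
      (ae_of_all _ fun u => ENNReal.mul_lt_top (hΦt _ _) (hΦt _ _)),
      lintegral_unitCube_mul (sub_ne_zero.2 hkl) (hΦm y) (hΦm y') (periodic_wrap _) (periodic_wrap _), hΦi, hΦi,
      ENNReal.toReal_mul, ENNReal.toReal_ofReal (hg0 y), ENNReal.toReal_ofReal (hg0 y')]
  refine (measure_mono fun u hu => ?_).trans (hcheb.trans (ENNReal.ofReal_le_ofReal ?_))
  · rw [Set.mem_ofPred_eq] at hu ⊢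
    have hs : (shellSum ε d j lam T h I u).toReal = ∑ y ∈ intBox m K, (Φ y (u ⬝ᵥ intVec y)).toReal := by
      rw [shellSum_eq ε d j hl hT0 h I hK1, ENNReal.toReal_sum fun y _ => (hΦt _ _).ne]
    have h0 : (0 : Fin m → ℤ) ∈ intBox m K := by
      rw [mem_intBox]
      have : intVec (0 : Fin m → ℤ) = 0 := by funext i; simp [intVec]
      rw [this, norm_zero]; positivity
    have hD := hb1 h hh hA lam T hl hT I hI hIM K hK1 hK2
    rw [← Finset.add_sum_erase _ _ h0] at hs
    rw [← Finset.add_sum_erase _ _ h0] at hD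
    have e1 : (Φ 0 (u ⬝ᵥ intVec 0)).toReal ≤ B := hΦB' _ _
    have e2 : 0 ≤ (Φ 0 (u ⬝ᵥ intVec 0)).toReal := ENNReal.toReal_nonneg
    have e3 := hgG 0
    have e4 := hg0 0
    set E : ℝ := (volume I).toReal * (T ^ m * (T⁻¹ ^ d * (lam ^ 2 + lam * T ^ (1 - 1 / d : ℝ))))
    have hE0 : 0 ≤ E := by positivity
    have hGE : G ≤ 2 ^ m * C2 * E := by
      have hT' : T ≤ 2 ^ m * T ^ m := by
        rw [← mul_pow]
        calc T ≤ 2 * T := by linarith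
          _ = (2 * T) ^ 1 := (pow_one _).symm
          _ ≤ (2 * T) ^ m := pow_le_pow_right₀ (by linarith) (by omega)
      have hl2 : lam ≤ lam ^ 2 + lam * T ^ (1 - 1 / d : ℝ) := by
        have : 0 ≤ lam * T ^ (1 - 1 / d : ℝ) := by positivity
        nlinarith
      calc G = C2 * (volume I).toReal * (T⁻¹ ^ d * (T * lam)) := by simp only [G]; ring
        _ ≤ C2 * (volume I).toReal * (T⁻¹ ^ d * (2 ^ m * T ^ m * (lam ^ 2 + lam * T ^ (1 - 1 / d : ℝ)))) := by gcongr
        _ = _ := by simp only [E]; ring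
    have hCE : C * (volume I).toReal * (T ^ m * (T⁻¹ ^ d * (lam ^ 2 + lam * T ^ (1 - 1 / d : ℝ)))) = C * E := by
      simp only [E]; ring
    have hC1E : C1 * (volume I).toReal * (T ^ m * (T⁻¹ ^ d * (lam ^ 2 + lam * T ^ (1 - 1 / d : ℝ)))) = C1 * E := by
      simp only [E]; ring
    have hP1 : 0 ≤ 4 * 3 ^ m * 4 ^ m * B * C2 := by positivity
    have hP2 : 0 ≤ 2 ^ m * C2 := by positivity
    have hCE2 : C1 * E + 2 ^ m * C2 * E ≤ C * E := by
      rw [← add_mul]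
      exact mul_le_mul_of_nonneg_right (by simp only [C]; linarith) hE0
    have hCB : B ≤ C := by simp only [C]; linarith
    rw [hs, hCE] at hu
    rw [hC1E] at hD
    have htri := abs_sub_le ((Φ 0 (u ⬝ᵥ intVec 0)).toReal + ∑ y ∈ (intBox m K).erase 0, (Φ y (u ⬝ᵥ intVec y)).toReal)
      (fiber ε d j lam T h I (intVec 0) + ∑ y ∈ (intBox m K).erase 0, fiber ε d j lam T h I (intVec y))
      (∫ w, shellFun ε d j lam T h I w)
    have htri2 := abs_add_le ((Φ 0 (u ⬝ᵥ intVec 0)).toReal - g 0)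
      (∑ y ∈ (intBox m K).erase 0, (Φ y (u ⬝ᵥ intVec y)).toReal - ∑ y ∈ (intBox m K).erase 0, g y)
    have e5 : |(Φ 0 (u ⬝ᵥ intVec 0)).toReal - g 0| ≤ B + G := by
      rw [abs_le]; constructor <;> linarith
    have e6 : (Φ 0 (u ⬝ᵥ intVec 0)).toReal + ∑ y ∈ (intBox m K).erase 0, (Φ y (u ⬝ᵥ intVec y)).toReal -
      (fiber ε d j lam T h I (intVec 0) + ∑ y ∈ (intBox m K).erase 0, fiber ε d j lam T h I (intVec y)) =
      ((Φ 0 (u ⬝ᵥ intVec 0)).toReal - g 0) + 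
      (∑ y ∈ (intBox m K).erase 0, (Φ y (u ⬝ᵥ intVec y)).toReal - ∑ y ∈ (intBox m K).erase 0, g y) := by
      simp only [g]; ring
    rw [e6] at htri
    linarith
  · have hcard := card_parallelPairs_le hm hK
    have hlog : 1 + Real.log K ≤ 1 + Real.log (4 * T) := by
      have := Real.log_le_log (by exact_mod_cast hK) hK2
      linarith
    have hlog0 : 0 ≤ 1 + Real.log K := by
      have := Real.log_nonneg (x := K) (by exact_mod_cast hK)
      linarith
    have hcard2 : ((parallelPairs m K).card : ℝ) ≤ 4 * 3 ^ m * (4 * T) ^ m * (1 + Real.log (4 * T)) ^ 2 :=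
      hcard.trans (by gcongr)
    refine div_le_div_of_nonneg_right ?_ (by positivity)
    have hCC : 4 * 3 ^ m * 4 ^ m * B * C2 ≤ C := by
      have hP2 : 0 ≤ 2 ^ m * C2 := by positivity
      simp only [C]; linarith
    calc _ ≤ 4 * 3 ^ m * (4 * T) ^ m * (1 + Real.log (4 * T)) ^ 2 * (B * G) := by gcongr
      _ = (4 * 3 ^ m * 4 ^ m * B * C2) * lam * (volume I).toReal * (T ^ m * (T⁻¹ ^ d * T)) * (1 + Real.log (4 * T)) ^ 2 := by
        simp only [G]; rw [mul_pow]; ring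
      _ ≤ _ := by gcongr

/-- The smooth weight of the ball of radius `T` attached to the direction `e_j`, restricted to
the region where the form takes values in `I`. -/
def ballFun {n : ℕ} (ε : Fin n → ℝ) (d : ℕ) (j : Fin n) (lam T : ℝ) (h : Fin n → Fin n → ℝ) (I : Set ℝ)
    (w : Fin n → ℝ) : ℝ :=
  I.indicator 1 (form ε d (Matrix.of h) w) * (cutoff lam (T⁻¹ • w) * gradWeight ε d (Matrix.of h) j w)

/-- The sum of `ballFun` over the lattice `ℤⁿ` sheared by `u`. -/
def ballSum {m : ℕ} (ε : Fin (m + 1) → ℝ) (d : ℕ) (j : Fin (m + 1)) (lam T : ℝ)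
    (h : Fin (m + 1) → Fin (m + 1) → ℝ) (I : Set ℝ) (u : Fin m → ℝ) : ENNReal :=
  ∑' v : Fin (m + 1) → ℤ, ENNReal.ofReal (ballFun ε d j lam T h I (intVec v ᵥ* shear j u))

lemma ballFun_nonneg {n : ℕ} (ε : Fin n → ℝ) (d : ℕ) (j : Fin n) (lam T : ℝ)
    (h : Fin n → Fin n → ℝ) (I : Set ℝ) (w : Fin n → ℝ) : 0 ≤ ballFun ε d j lam T h I w :=
  mul_nonneg (Set.indicator_nonneg (fun _ _ => zero_le_one) _)
    (mul_nonneg (cutoff_nonneg _ _) (gradWeight_nonneg _ _ _ _ _))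

lemma ballFun_le_one {n : ℕ} (ε : Fin n → ℝ) (d : ℕ) (j : Fin n) (lam T : ℝ)
    (h : Fin n → Fin n → ℝ) (I : Set ℝ) (w : Fin n → ℝ) : ballFun ε d j lam T h I w ≤ 1 := by
  refine mul_le_one₀ ?_ (mul_nonneg (cutoff_nonneg _ _) (gradWeight_nonneg _ _ _ _ _))
    (mul_le_one₀ (cutoff_le_one _ _) (gradWeight_nonneg _ _ _ _ _) (gradWeight_le_one _ _ _ _ _))
  exact Set.indicator_le' (fun _ _ => le_rfl) (fun _ _ => zero_le_one) _

lemma measurable_ballFun {n : ℕ} (ε : Fin n → ℝ) (d : ℕ) (j : Fin n) (lam T : ℝ)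
    (h : Fin n → Fin n → ℝ) {I : Set ℝ} (hI : MeasurableSet I) : Measurable (ballFun ε d j lam T h I) := by
  refine Measurable.mul ?_ (Measurable.mul ?_ ?_)
  · exact (measurable_one.indicator hI).comp (continuous_form_right ε d (Matrix.of h)).measurable
  · exact ((continuous_cutoff lam).comp (continuous_const_smul T⁻¹)).measurable
  · exact measurable_gradWeight_right ε d j (Matrix.of h)

lemma ballFun_eq_zero {n : ℕ} (ε : Fin n → ℝ) (d : ℕ) (j : Fin n) {lam : ℝ} (hl : 1 ≤ lam) {T : ℝ} (hT : 0 < T)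
    (h : Fin n → Fin n → ℝ) (I : Set ℝ) {w : Fin n → ℝ} (hw : 2 * T ^ 2 ≤ sqNorm w) :
    ballFun ε d j lam T h I w = 0 := by
  rw [ballFun, cutoff_eq_zero_of_two_le hl, zero_mul, mul_zero]
  rw [sqNorm_smul, inv_pow, ← div_eq_inv_mul, le_div_iff₀ (by positivity)]
  exact hw

lemma ballFun_eq_zero_of_norm {n : ℕ} (ε : Fin n → ℝ) (d : ℕ) (j : Fin n) {lam : ℝ} (hl : 1 ≤ lam) {T : ℝ} (hT : 0 < T)
    (h : Fin n → Fin n → ℝ) (I : Set ℝ) {w : Fin n → ℝ} (hw : 2 * T ≤ ‖w‖) :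
    ballFun ε d j lam T h I w = 0 := by
  refine ballFun_eq_zero ε d j hl hT h I ?_
  by_contra! hc
  have h1 : ‖w‖ ≤ Real.sqrt 2 * T := norm_le_of_sqNorm (by positivity) (by
    rw [mul_pow, Real.sq_sqrt (by norm_num)]; exact hc.le)
  have h2 : Real.sqrt 2 < 2 := by rw [Real.sqrt_lt' (by norm_num)]; norm_num
  nlinarith

lemma integrable_ballFun {n : ℕ} (ε : Fin n → ℝ) (d : ℕ) (j : Fin n) {lam T : ℝ} (hl : 1 ≤ lam) (hT : 0 < T)
    (h : Fin n → Fin n → ℝ) {I : Set ℝ} (hI : MeasurableSet I) : Integrable (ballFun ε d j lam T h I) := by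
  refine integrable_of_bounded_support (measurable_ballFun ε d j lam T h hI) (B := 1) (r := 2 * T) (fun w => ?_)
    (fun w hw => ballFun_eq_zero_of_norm ε d j hl hT h I hw)
  rw [abs_of_nonneg (ballFun_nonneg _ _ _ _ _ _ _ _)]
  exact ballFun_le_one _ _ _ _ _ _ _ _

lemma sum_shellFun {n : ℕ} (ε : Fin n → ℝ) (d : ℕ) (j : Fin n) (lam T : ℝ)
    (h : Fin n → Fin n → ℝ) (I : Set ℝ) (w : Fin n → ℝ) (q : ℕ) :
    ∑ i ∈ Finset.range q, shellFun ε d j lam (T / 2 ^ i) h I w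
      = ballFun ε d j lam T h I w - ballFun ε d j lam (T / 2 ^ q) h I w := by
  induction q with
  | zero => simp
  | succ q ih =>
    have h1 : (2 : ℝ) • (T / 2 ^ q)⁻¹ • w = (T / 2 ^ (q + 1))⁻¹ • w := by
      rw [smul_smul]; congr 1; rw [pow_succ]; field_simp
    rw [Finset.sum_range_succ, ih, shellFun, shellWeight, annulus, h1]
    simp only [ballFun]
    ring

lemma one_le_sqNorm_intVec_shear {m : ℕ} (j : Fin (m + 1)) (u : Fin m → ℝ) {v : Fin (m + 1) → ℤ} (hv : v ≠ 0) :
    1 ≤ sqNorm (intVec v ᵥ* shear j u) := by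
  have h0 : v = (j.insertNth (v j) (fun k => v (j.succAbove k)) : Fin (m + 1) → ℤ) := by
    funext i
    refine Fin.succAboveCases j ?_ (fun l => ?_) i <;> simp
  have hinteg : ∀ z : ℤ, z ≠ 0 → (1:ℝ) ≤ (z:ℝ) ^ 2 := by
    intro z hz
    have : 1 ≤ z ^ 2 := by have := sq_pos_of_ne_zero hz; omega
    exact_mod_cast this
  rw [h0, intVec_insertNth, vecMul_shear]
  by_cases hy : ∃ k, v (j.succAbove k) ≠ 0
  · obtain ⟨k, hk⟩ := hy
    have := sq_le_sqNorm (lineAt j (((v j : ℤ) : ℝ) + u ⬝ᵥ intVec fun k => v (j.succAbove k)) (intVec fun k => v (j.succAbove k))) (j.succAbove k)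
    rw [lineAt_succAbove] at this
    exact (hinteg _ hk).trans this
  · push Not at hy
    have hvj : v j ≠ 0 := by
      intro h1
      refine hv ?_
      funext i
      refine Fin.succAboveCases j ?_ (fun l => ?_) i
      · exact h1
      · exact hy l
    have h2 : (intVec fun k => v (j.succAbove k)) = 0 := by
      funext k; simp [intVec, hy k]
    rw [h2, dotProduct_zero, add_zero]
    have := sq_le_sqNorm (lineAt j ((v j : ℤ) : ℝ) (0 : Fin m → ℝ)) j
    rw [lineAt_self] at this
    exact (hinteg _ hvj).trans this

lemma gradWeight_zero {n : ℕ} (ε : Fin n → ℝ) {d : ℕ} (hd : 2 ≤ d) (h : Matrix (Fin n) (Fin n) ℝ) (j : Fin n) :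
    gradWeight ε d h j 0 = 0 := by
  have : formGrad ε d h 0 j = 0 := by
    simp [formGrad, Matrix.zero_vecMul, zero_pow (by omega : d - 1 ≠ 0)]
  rw [gradWeight, this]; simp

lemma ballFun_intVec_eq_zero {m : ℕ} (ε : Fin (m + 1) → ℝ) {d : ℕ} (hd : 2 ≤ d) (j : Fin (m + 1)) {lam T : ℝ} (hl : 1 ≤ lam)
    (hT : 0 < T) (hT2 : T < 1 / 2) (h : Fin (m + 1) → Fin (m + 1) → ℝ) (I : Set ℝ) (u : Fin m → ℝ) (v : Fin (m + 1) → ℤ) :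
    ballFun ε d j lam T h I (intVec v ᵥ* shear j u) = 0 := by
  by_cases hv : v = 0
  · have : intVec v = 0 := by subst hv; funext i; simp [intVec]
    rw [this, Matrix.zero_vecMul, ballFun, gradWeight_zero ε hd, mul_zero, mul_zero]
  · refine ballFun_eq_zero ε d j hl hT h I (le_trans ?_ (one_le_sqNorm_intVec_shear j u hv))
    nlinarith

lemma ballSum_eq {m : ℕ} (ε : Fin (m + 1) → ℝ) {d : ℕ} (hd : 2 ≤ d) (j : Fin (m + 1)) {lam T : ℝ} (hl : 1 ≤ lam)
    (hT : 0 < T) {q : ℕ} (hq : T / 2 ^ q < 1 / 2) (h : Fin (m + 1) → Fin (m + 1) → ℝ) (I : Set ℝ) (u : Fin m → ℝ) :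
    ballSum ε d j lam T h I u = ∑ i ∈ Finset.range q, shellSum ε d j lam (T / 2 ^ i) h I u := by
  simp only [ballSum, shellSum]
  rw [← Summable.tsum_finsetSum fun _ _ => ENNReal.summable]
  refine tsum_congr fun v => ?_
  rw [← ENNReal.ofReal_sum_of_nonneg fun i _ => shellFun_nonneg ε d j hl _ h I _, sum_shellFun,
    ballFun_intVec_eq_zero ε hd j hl (by positivity) hq, sub_zero]

lemma integral_ballFun_le {n : ℕ} (ε : Fin n → ℝ) (d : ℕ) (j : Fin n) {lam T : ℝ} (hl : 1 ≤ lam) (hT : 0 < T)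
    (h : Fin n → Fin n → ℝ) {I : Set ℝ} : ∫ w, ballFun ε d j lam T h I w ≤ (4 * T) ^ n := by
  have h1 := abs_integral_le_of_forall_box (G := ballFun ε d j lam T h I) (B := 1) hT (fun w => by
    rw [abs_of_nonneg (ballFun_nonneg _ _ _ _ _ _ _ _)]
    exact ballFun_le_one _ _ _ _ _ _ _ _) (fun w hw => ballFun_eq_zero_of_norm ε d j hl hT h I hw)
  rw [mul_one] at h1
  exact (le_abs_self _).trans h1

lemma shellSum_ne_top {m : ℕ} (ε : Fin (m + 1) → ℝ) {d : ℕ} (hd : 2 ≤ d) (j : Fin (m + 1)) {R M : ℝ}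
    (hR : 0 < R) (hM : 0 ≤ M) {h : Fin (m + 1) → Fin (m + 1) → ℝ} (hA : 1 / R ≤ |∑ i, ε i * h j i ^ d|)
    {lam : ℝ} (hl : 1 ≤ lam) {T : ℝ} (hT : 0 < T) {I : Set ℝ} (hIM : I ⊆ Set.Icc (-M) M) (u : Fin m → ℝ) :
    shellSum ε d j lam T h I u ≠ ⊤ := by
  rw [shellSum_eq ε d j hl hT h I (Nat.le_ceil _)]
  exact ENNReal.sum_ne_top.2 fun y _ =>
    ((wrap_shellLine_le ε hd j hR hM hA hl T hIM y _).trans_lt ENNReal.ofReal_lt_top).ne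

lemma measure_ballSum_le {m : ℕ} (hm : 2 ≤ m) {ε : Fin (m + 1) → ℝ} (hε : ∀ i, ε i ≠ 0) {d : ℕ} (hd : 2 ≤ d) (hdm : d ≤ m)
    (j : Fin (m + 1)) {R M : ℝ} (hR : 0 < R) (hM : 0 ≤ M) : ∃ C : ℝ, 1 ≤ C ∧ ∀ h ∈ boundedSL (m + 1) R,
      1 / R ≤ |∑ i, ε i * h j i ^ d| → ∀ lam T : ℝ, 1 ≤ lam → 1 / 2 ≤ T → ∀ I : Set ℝ,
      MeasurableSet I → I ⊆ Set.Icc (-M) M → ∀ τ : ℝ, 0 < τ →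
      volume.restrict (unitCube m) {u | C * (1 + Real.log (4 * T)) * (τ + (volume I).toReal * (T ^ m * (T⁻¹ ^ d * (lam ^ 2 + lam * T ^ (1 - 1 / d : ℝ)))) + 1)
        ≤ |(ballSum ε d j lam T h I u).toReal - ∫ w, ballFun ε d j lam T h I w|} ≤
      ENNReal.ofReal (C * lam * (volume I).toReal * (T ^ m * (T⁻¹ ^ d * T)) * (1 + Real.log (4 * T)) ^ 3 / τ ^ 2) := by
  obtain ⟨C, hC, hb⟩ := measure_shellSum_le hm hε hd j hR hM
  set C' : ℝ := 2 * C + 2 * 4 ^ (m + 1)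
  refine ⟨C', by have : (0:ℝ) ≤ 2 * 4 ^ (m + 1) := by positivity
                 simp only [C']; linarith, ?_⟩
  intro h hh hA lam T hl hT I hI hIM τ hτ
  have hT0 : 0 < T := by linarith
  have hV : 0 ≤ (volume I).toReal := ENNReal.toReal_nonneg
  have hex : ∃ q : ℕ, T / 2 ^ q < 1 / 2 := by
    obtain ⟨q, hq⟩ := pow_unbounded_of_one_lt (2 * T) (one_lt_two)
    refine ⟨q, ?_⟩
    rw [div_lt_iff₀ (by positivity)]
    linarith
  classical
  set q := Nat.find hex
  have hq : T / 2 ^ q < 1 / 2 := Nat.find_spec hex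
  have hqmin : ∀ i < q, 1 / 2 ≤ T / 2 ^ i := fun i hi => not_lt.1 (Nat.find_min hex hi)
  have hq1 : 1 ≤ q := by
    by_contra hc
    have : q = 0 := by omega
    rw [this] at hq
    simp at hq
    linarith
  have hlog : 0 ≤ Real.log (4 * T) := Real.log_nonneg (by linarith)
  set Lg := 1 + Real.log (4 * T)
  have hqL : (q : ℝ) ≤ 2 * Lg := by
    have h1 := hqmin (q - 1) (by omega)
    rw [le_div_iff₀ (by positivity)] at h1
    have h2 : (2:ℝ) ^ q ≤ 4 * T := by
      have : (2:ℝ) ^ q = 2 ^ (q - 1) * 2 := by rw [← pow_succ]; congr 1; omega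
      rw [this]; linarith
    have h3 := Real.log_le_log (by positivity) h2
    rw [Real.log_pow] at h3
    have h4 := Real.log_two_gt_d9
    have h5 : (q:ℝ) * (1 / 2) ≤ q * Real.log 2 := by gcongr; linarith
    simp only [Lg]
    linarith
  set E := (volume I).toReal * (T ^ m * (T⁻¹ ^ d * (lam ^ 2 + lam * T ^ (1 - 1 / d : ℝ))))
  have hE0 : 0 ≤ E := by positivity
  have hpow : ∀ S : ℝ, 0 < S → S ^ m * S⁻¹ ^ d = S ^ (m - d) := by
    intro S hS
    rw [inv_pow, ← div_eq_mul_inv, pow_sub₀ _ hS.ne' hdm, div_eq_mul_inv]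
  have hTi : ∀ i, 0 < T / 2 ^ i ∧ T / 2 ^ i ≤ T := fun i =>
    ⟨by positivity, div_le_self hT0.le (one_le_pow₀ one_le_two)⟩
  have hd' : (0:ℝ) ≤ 1 - 1 / d := by
    have : (1:ℝ) ≤ d := by exact_mod_cast (by omega : 1 ≤ d)
    rw [sub_nonneg, div_le_one (by linarith)]; exact this
  have hEi : ∀ i, C * (volume I).toReal * ((T / 2 ^ i) ^ m * ((T / 2 ^ i)⁻¹ ^ d * (lam ^ 2 + lam * (T / 2 ^ i) ^ (1 - 1 / d : ℝ)))) ≤ C * E := by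
    intro i
    obtain ⟨h1, h2⟩ := hTi i
    rw [← mul_assoc ((T / 2 ^ i) ^ m), hpow _ h1]
    simp only [E]
    rw [← mul_assoc (T ^ m), hpow _ hT0, mul_assoc]
    gcongr
  set p := C * lam * (volume I).toReal * (T ^ m * (T⁻¹ ^ d * T)) * Lg ^ 2 / τ ^ 2
  have hpi : ∀ i < q, C * lam * (volume I).toReal * ((T / 2 ^ i) ^ m * ((T / 2 ^ i)⁻¹ ^ d * (T / 2 ^ i))) * (1 + Real.log (4 * (T / 2 ^ i))) ^ 2 / τ ^ 2 ≤ p := by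
    intro i hi
    obtain ⟨h1, h2⟩ := hTi i
    have h3 := hqmin i hi
    have h4 : 0 ≤ Real.log (4 * (T / 2 ^ i)) := Real.log_nonneg (by linarith)
    have h5 : Real.log (4 * (T / 2 ^ i)) ≤ Real.log (4 * T) := Real.log_le_log (by linarith) (by linarith)
    rw [← mul_assoc ((T / 2 ^ i) ^ m), hpow _ h1]
    simp only [p, Lg]
    rw [← mul_assoc (T ^ m), hpow _ hT0]
    gcongr
  have hinteg : ∫ w, ballFun ε d j lam T h I w
      = (∑ i ∈ Finset.range q, ∫ w, shellFun ε d j lam (T / 2 ^ i) h I w) + ∫ w, ballFun ε d j lam (T / 2 ^ q) h I w := by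
    rw [← integral_finsetSum _ fun i _ => integrable_shellFun ε d j hl (hTi i).1 h hI, ← integral_add]
    · congr 1
      funext w
      rw [sum_shellFun]; ring
    · exact integrable_finsetSum _ fun i _ => integrable_shellFun ε d j hl (hTi i).1 h hI
    · exact integrable_ballFun ε d j hl (hTi q).1 h hI
  have hrem : ∫ w, ballFun ε d j lam (T / 2 ^ q) h I w ≤ 4 ^ (m + 1) :=
    (integral_ballFun_le ε d j hl (hTi q).1 h).trans (pow_le_pow_left₀ (by linarith [(hTi q).1]) (by linarith) _)
  have hrem0 : 0 ≤ ∫ w, ballFun ε d j lam (T / 2 ^ q) h I w := integral_nonneg fun w => ballFun_nonneg _ _ _ _ _ _ _ _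
  have hsub : {u | C' * Lg * (τ + E + 1) ≤ |(ballSum ε d j lam T h I u).toReal - ∫ w, ballFun ε d j lam T h I w|}
      ⊆ ⋃ i ∈ Finset.range q, {u | τ + C * (volume I).toReal * ((T / 2 ^ i) ^ m * ((T / 2 ^ i)⁻¹ ^ d * (lam ^ 2 + lam * (T / 2 ^ i) ^ (1 - 1 / d : ℝ)))) + C
        ≤ |(shellSum ε d j lam (T / 2 ^ i) h I u).toReal - ∫ w, shellFun ε d j lam (T / 2 ^ i) h I w|} := by
    intro u hu
    by_contra hc
    simp only [Set.mem_iUnion, not_exists, Set.mem_ofPred_eq, not_le] at hc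
    rw [Set.mem_ofPred_eq, ballSum_eq ε hd j hl hT0 hq, ENNReal.toReal_sum fun i _ => shellSum_ne_top ε hd j hR hM hA hl (hTi i).1 hIM u,
      hinteg] at hu
    have h1 : |∑ i ∈ Finset.range q, ((shellSum ε d j lam (T / 2 ^ i) h I u).toReal - ∫ w, shellFun ε d j lam (T / 2 ^ i) h I w)|
        < ∑ i ∈ Finset.range q, (τ + C * E + C) := by
      refine (Finset.abs_sum_le_sum_abs _ _).trans_lt (Finset.sum_lt_sum_of_nonempty (by simpa using by omega) fun i hi => ?_)
      exact (hc i hi).trans_le (by have := hEi i; linarith)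
    rw [Finset.sum_const, Finset.card_range, nsmul_eq_mul, Finset.sum_sub_distrib] at h1
    have h2 : (q:ℝ) * (τ + C * E + C) ≤ 2 * Lg * (C * (τ + E + 1)) := by
      refine mul_le_mul hqL ?_ (by positivity) (by positivity)
      nlinarith
    have h3 : (4:ℝ) ^ (m + 1) ≤ 2 * 4 ^ (m + 1) * Lg * (τ + E + 1) := by
      have : (1:ℝ) ≤ Lg * (τ + E + 1) := one_le_mul_of_one_le_of_one_le (by simp only [Lg]; linarith) (by linarith)
      have h4 : (0:ℝ) < 4 ^ (m + 1) := by positivity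
      nlinarith
    have h5 : C' * Lg * (τ + E + 1) = 2 * Lg * (C * (τ + E + 1)) + 2 * 4 ^ (m + 1) * Lg * (τ + E + 1) := by
      simp only [C']; ring
    have h6 : |∑ i ∈ Finset.range q, (shellSum ε d j lam (T / 2 ^ i) h I u).toReal -
        ((∑ i ∈ Finset.range q, ∫ w, shellFun ε d j lam (T / 2 ^ i) h I w) + ∫ w, ballFun ε d j lam (T / 2 ^ q) h I w)|
        < q * (τ + C * E + C) + 4 ^ (m + 1) := by
      rw [abs_lt] at h1 ⊢
      constructor <;> linarith [h1.1, h1.2]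
    linarith
  refine (measure_mono hsub).trans ((measure_biUnion_finset_le _ _).trans ?_)
  calc _ ≤ ∑ i ∈ Finset.range q, ENNReal.ofReal p := Finset.sum_le_sum fun i hi =>
        (hb h hh hA lam (T / 2 ^ i) hl (hqmin i (Finset.mem_range.1 hi)) I hI hIM τ hτ).trans
          (ENNReal.ofReal_le_ofReal (hpi i (Finset.mem_range.1 hi)))
    _ = ENNReal.ofReal (q * p) := by
        rw [Finset.sum_const, Finset.card_range, nsmul_eq_mul, ENNReal.ofReal_mul (Nat.cast_nonneg q), ENNReal.ofReal_natCast]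
    _ ≤ _ := by
        refine ENNReal.ofReal_le_ofReal ?_
        have hp0 : 0 ≤ p := by positivity
        calc (q:ℝ) * p ≤ 2 * Lg * p := by gcongr
          _ = 2 * C * lam * (volume I).toReal * (T ^ m * (T⁻¹ ^ d * T)) * Lg ^ 3 / τ ^ 2 := by simp only [p]; ring
          _ ≤ _ := by
            have : 2 * C ≤ C' := by
              have : (0:ℝ) ≤ 2 * 4 ^ (m + 1) := by positivity
              simp only [C']; linarith
            have hL0 : 0 ≤ Lg := by positivity
            gcongr

lemma pow_mul_inv_pow_of_le {m d : ℕ} (hdm : d ≤ m) {T : ℝ} (hT : T ≠ 0) :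
    T ^ m * T⁻¹ ^ d = T ^ (m - d) := by
  rw [inv_pow, pow_sub₀ T hT hdm]

lemma volume_mul_pow_le {m d : ℕ} (hdm : d ≤ m) {a β c K T V : ℝ} (hc : 1 ≤ c)
    (hK : 1 ≤ K) (hT0 : 0 < T) (hT : T ≤ c * K ^ a) (hV0 : 0 ≤ V)
    (hV : V ≤ c * K ^ (β - a * ((m : ℝ) + 1 - d))) :
    V * (T ^ m * T⁻¹ ^ d) ≤ c ^ (m - d + 1) * K ^ (β - a) := by
  have hK0 : 0 < K := by linarith
  rw [pow_mul_inv_pow_of_le hdm hT0.ne']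
  calc V * T ^ (m - d) ≤ (c * K ^ (β - a * ((m : ℝ) + 1 - d))) * (c * K ^ a) ^ (m - d) := by gcongr
    _ = c ^ (m - d + 1) * (K ^ (β - a * ((m : ℝ) + 1 - d)) * (K ^ a) ^ (m - d)) := by ring
    _ = _ := by
        rw [← Real.rpow_natCast (K ^ a), ← Real.rpow_mul hK0.le, ← Real.rpow_add hK0, Nat.cast_sub hdm]
        congr 2; ring

lemma volume_mul_pow_le_main {m d : ℕ} (hdm : d ≤ m) {a β c K T V : ℝ} (hc : 1 ≤ c)
    (hK : 1 ≤ K) (hT0 : 0 < T) (hT : T ≤ c * K ^ a) (hV0 : 0 ≤ V)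
    (hV : V ≤ c * K ^ (β - a * ((m : ℝ) + 1 - d))) :
    V * (T ^ m * (T⁻¹ ^ d * T)) ≤ c ^ (m - d + 2) * K ^ β := by
  have hK0 : 0 < K := by linarith
  calc V * (T ^ m * (T⁻¹ ^ d * T)) = V * (T ^ m * T⁻¹ ^ d) * T := by ring
    _ ≤ (c ^ (m - d + 1) * K ^ (β - a)) * (c * K ^ a) :=
        mul_le_mul (volume_mul_pow_le hdm hc hK hT0 hT hV0 hV) hT hT0.le (by positivity)
    _ = c ^ (m - d + 2) * (K ^ (β - a) * K ^ a) := by ring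
    _ = _ := by rw [← Real.rpow_add hK0]; ring_nf

lemma volume_mul_pow_le_error {m d : ℕ} (hd : 2 ≤ d) (hdm : d ≤ m) {a β c K T V : ℝ} (hc : 1 ≤ c)
    (ha3 : 3 ≤ a) (had : 2 * d ≤ a)
    (hK : 1 ≤ K) (hT0 : 0 < T) (hT : T ≤ c * K ^ a) (hV0 : 0 ≤ V)
    (hV : V ≤ c * K ^ (β - a * ((m : ℝ) + 1 - d))) :
    V * (T ^ m * (T⁻¹ ^ d * (K ^ 2 + K * T ^ (1 - 1 / d : ℝ)))) ≤ 2 * c ^ (m - d + 2) * K ^ (β - 1) := by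
  have hK0 : 0 < K := by linarith
  have hdR : (2:ℝ) ≤ d := by exact_mod_cast hd
  have hd1 : (1:ℝ) / d ≤ 1 := by rw [div_le_one (by linarith)]; linarith
  have h1 : T ^ (1 - 1 / d : ℝ) ≤ c * K ^ (a - 2) := by
    calc T ^ (1 - 1 / d : ℝ) ≤ (c * K ^ a) ^ (1 - 1 / d : ℝ) := by
          exact Real.rpow_le_rpow hT0.le hT (by linarith)
      _ = c ^ (1 - 1 / d : ℝ) * K ^ (a * (1 - 1 / d : ℝ)) := by
          rw [Real.mul_rpow (by linarith) (by positivity), ← Real.rpow_mul hK0.le]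
      _ ≤ c ^ (1:ℝ) * K ^ (a - 2) := by
          have h6 : 2 ≤ a * (1 / d) := by
            rw [mul_one_div, le_div_iff₀ (by linarith)]; exact had
          have h7 : (0:ℝ) ≤ 1 / d := by positivity
          exact mul_le_mul (Real.rpow_le_rpow_of_exponent_le hc (by linarith))
            (Real.rpow_le_rpow_of_exponent_le hK (by linarith)) (by positivity) (by positivity)
      _ = _ := by rw [Real.rpow_one]
  have h2 : K ^ 2 + K * T ^ (1 - 1 / d : ℝ) ≤ 2 * c * K ^ (a - 1) := by
    have h3 : K ^ 2 ≤ K ^ (a - 1) := by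
      rw [← Real.rpow_natCast]
      exact Real.rpow_le_rpow_of_exponent_le hK (by push_cast; linarith)
    have h4 : K * T ^ (1 - 1 / d : ℝ) ≤ c * K ^ (a - 1) := by
      calc K * T ^ (1 - 1 / d : ℝ) ≤ K * (c * K ^ (a - 2)) := by gcongr
        _ = c * (K ^ (a - 2) * K ^ (1:ℝ)) := by rw [Real.rpow_one]; ring
        _ = _ := by rw [← Real.rpow_add hK0]; ring_nf
    have h5 : (0:ℝ) < K ^ (a - 1) := by positivity
    nlinarith
  calc V * (T ^ m * (T⁻¹ ^ d * (K ^ 2 + K * T ^ (1 - 1 / d : ℝ))))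
      = V * (T ^ m * T⁻¹ ^ d) * (K ^ 2 + K * T ^ (1 - 1 / d : ℝ)) := by ring
    _ ≤ (c ^ (m - d + 1) * K ^ (β - a)) * (2 * c * K ^ (a - 1)) :=
        mul_le_mul (volume_mul_pow_le hdm hc hK hT0 hT hV0 hV) h2 (by positivity) (by positivity)
    _ = 2 * c ^ (m - d + 2) * (K ^ (β - a) * K ^ (a - 1)) := by ring
    _ = _ := by rw [← Real.rpow_add hK0]; ring_nf

lemma exists_one_add_log_le {a c δ : ℝ} (ha : 0 ≤ a) (hc : 1 ≤ c) (hδ : 0 < δ) :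
    ∃ C : ℝ, 1 ≤ C ∧ ∀ K T : ℝ, 1 ≤ K → 0 < T → T ≤ c * K ^ a → 1 + Real.log (4 * T) ≤ C * K ^ δ := by
  have h0 : 0 ≤ Real.log (4 * c) := Real.log_nonneg (by linarith)
  have h5 : 0 ≤ a / δ := by positivity
  refine ⟨1 + Real.log (4 * c) + a / δ, by linarith, fun K T hK hT0 hT => ?_⟩
  have hK0 : 0 < K := by linarith
  have h1 : Real.log (4 * T) ≤ Real.log (4 * c) + a * Real.log K := by
    rw [← Real.log_rpow hK0, ← Real.log_mul (by positivity) (by positivity)]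
    exact Real.log_le_log (by positivity) (by nlinarith)
  have h2 : Real.log K ≤ K ^ δ / δ := Real.log_le_rpow_div hK0.le hδ
  have h3 : (1:ℝ) ≤ K ^ δ := Real.one_le_rpow hK hδ.le
  have h4 : a * Real.log K ≤ a / δ * K ^ δ := by
    calc a * Real.log K ≤ a * (K ^ δ / δ) := by gcongr
      _ = _ := by ring
  nlinarith

/-- The grid of points `r` with coordinates in `{0, …, k - 1}`. -/
def natGrid (m k : ℕ) : Finset (Fin m → ℕ) := Fintype.piFinset fun _ => Finset.range k

lemma card_natGrid (m k : ℕ) : (natGrid m k).card = k ^ m := by simp [natGrid]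

lemma exists_natGrid {m k : ℕ} (hk : 0 < k) {u : Fin m → ℝ} (hu : u ∈ unitCube m) :
    ∃ r ∈ natGrid m k, ∀ i, 0 < u i - r i / k ∧ u i - r i / k ≤ 1 / k := by
  have hk' : (0:ℝ) < k := by exact_mod_cast hk
  rw [unitCube, Set.mem_univ_pi] at hu
  have hpos : ∀ i, 0 < ⌈u i * k⌉₊ := fun i => Nat.ceil_pos.2 (mul_pos (hu i).1 hk')
  refine ⟨fun i => ⌈u i * k⌉₊ - 1, ?_, fun i => ?_⟩
  · simp only [natGrid, Fintype.mem_piFinset, Finset.mem_range]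
    intro i
    have h1 : ⌈u i * k⌉₊ ≤ k := by
      rw [Nat.ceil_le]
      have := (hu i).2
      nlinarith
    have := hpos i
    omega
  · have h1 := Nat.ceil_lt_add_one (mul_pos (hu i).1 hk').le
    have h2 := Nat.le_ceil (u i * k)
    have h3 : ((⌈u i * k⌉₊ - 1 : ℕ) : ℝ) = ⌈u i * k⌉₊ - 1 := by
      rw [Nat.cast_sub (hpos i)]; simp
    rw [h3]
    constructor
    · rw [sub_pos, div_lt_iff₀ hk']; linarith
    · rw [sub_le_iff_le_add, ← add_div, le_div_iff₀ hk']; linarith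

lemma measurableSet_unitCube (m : ℕ) : MeasurableSet (unitCube m) :=
  MeasurableSet.univ_pi fun _ => measurableSet_Ioc

lemma ae_eventually_exists_natGrid {m : ℕ} {bad : ℕ → (Fin m → ℕ) → Set (Fin m → ℝ)} {p : ℕ → ℝ}
    (hp0 : ∀ k, 0 ≤ p k) (hp : Summable fun k : ℕ => (k:ℝ) ^ m * p k)
    (hbad : ∀ k, 1 ≤ k → ∀ r ∈ natGrid m k, volume.restrict (unitCube m) (bad k r) ≤ ENNReal.ofReal (p k)) :
    ∀ᵐ u ∂volume.restrict (unitCube m), ∃ k0 : ℕ, ∀ k ≥ k0, ∃ r : Fin m → ℕ, r ∈ natGrid m k ∧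
      (∀ i, 0 < u i - (r i : ℝ) / k ∧ u i - (r i : ℝ) / k ≤ 1 / (k : ℝ)) ∧ (fun i => u i - (r i : ℝ) / k) ∉ bad k r := by
  set E : ℕ → Set (Fin m → ℝ) := fun k => ⋃ r ∈ natGrid m k,
    (fun u : Fin m → ℝ => u + -(fun i => (r i : ℝ) / k)) ⁻¹' (bad k r ∩ unitCube m)
  have hE : ∀ k, 1 ≤ k → volume (E k) ≤ ENNReal.ofReal ((k:ℝ) ^ m * p k) := by
    intro k hk
    refine (measure_biUnion_finset_le _ _).trans ?_
    calc _ ≤ ∑ r ∈ natGrid m k, ENNReal.ofReal (p k) := by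
          refine Finset.sum_le_sum fun r hr => ?_
          rw [measure_preimage_add_right, ← Measure.restrict_apply' (measurableSet_unitCube m)]
          exact hbad k hk r hr
      _ = _ := by
          rw [Finset.sum_const, card_natGrid, nsmul_eq_mul, ENNReal.ofReal_mul (by positivity)]
          congr 1
          rw [← Nat.cast_pow, ENNReal.ofReal_natCast]
  have hsum : ∑' k, volume.restrict (unitCube m) (E (k + 1)) ≠ ⊤ := by
    have h1 : Summable fun k : ℕ => ((k + 1 : ℕ):ℝ) ^ m * p (k + 1) := (summable_nat_add_iff 1).2 hp
    refine ne_top_of_le_ne_top h1.tsum_ofReal_ne_top (ENNReal.tsum_le_tsum fun k => ?_)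
    exact (Measure.restrict_apply_le _ _).trans (hE (k + 1) (by omega))
  filter_upwards [ae_eventually_notMem hsum, ae_restrict_mem (measurableSet_unitCube m)] with u hu huc
  obtain ⟨k0, hk0⟩ := eventually_atTop.1 hu
  refine ⟨k0 + 1, fun k hk => ?_⟩
  have hk1 := hk0 (k - 1) (by omega)
  rw [Nat.sub_add_cancel (by omega)] at hk1
  obtain ⟨r, hr, hru⟩ := exists_natGrid (k := k) (by omega) huc
  refine ⟨r, hr, hru, fun hb => hk1 ?_⟩
  refine Set.mem_biUnion hr ?_
  have h1 : u + -(fun i => (r i : ℝ) / k) = fun i => u i - r i / k := by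
    funext i; simp [sub_eq_add_neg]
  rw [Set.mem_preimage, h1]
  refine ⟨hb, ?_⟩
  rw [unitCube, Set.mem_univ_pi]
  refine fun i => ⟨(hru i).1, (hru i).2.trans ?_⟩
  rw [div_le_one (by have : 0 < k := by omega
                     exact_mod_cast this)]
  have : 1 ≤ k := by omega
  exact_mod_cast this

lemma abs_shear_mul_le {m : ℕ} (j : Fin (m + 1)) {u : Fin m → ℝ} (hu : ∀ i, |u i| ≤ 1)
    {h : Matrix (Fin (m + 1)) (Fin (m + 1)) ℝ} {R : ℝ} (hR : ∀ i k, |h i k| ≤ R) (i k : Fin (m + 1)) :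
    |(shear j u * h) i k| ≤ 2 * R := by
  have hR0 : 0 ≤ R := (abs_nonneg _).trans (hR i k)
  have : (shear j u * h) i k = (shear j u *ᵥ fun l => h l k) i := by
    simp [Matrix.mul_apply, Matrix.mulVec, dotProduct]
  rw [this, shear_mulVec]
  refine Fin.succAboveCases j ?_ (fun l => ?_) i
  · rw [lineAt_self]; linarith [hR j k]
  · rw [lineAt_succAbove]
    refine (abs_add_le _ _).trans ?_
    rw [abs_mul]
    have := mul_le_mul (hu l) (hR j k) (abs_nonneg _) zero_le_one
    linarith [hR (j.succAbove l) k]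

lemma ae_abs_ballSum_sub_le {m : ℕ} (hm : 2 ≤ m) {ε : Fin (m + 1) → ℝ} (hε : ∀ i, ε i ≠ 0) {d : ℕ}
    (hd : 2 ≤ d) (hdm : d ≤ m) (j : Fin (m + 1)) {h : Matrix (Fin (m + 1)) (Fin (m + 1)) ℝ}
    (hh : h.det = 1) (hA : ∑ i, ε i * h j i ^ d ≠ 0) {M a β c θ : ℝ} (hM : 0 ≤ M) (hc : 1 ≤ c)
    (ha3 : 3 ≤ a) (had : 2 * d ≤ a) (hβ : m + 6 ≤ β) (hθ0 : 0 ≤ θ) (hθ : θ < 1)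
    {T : ℕ → ℝ} {J : ℕ → Set ℝ} (hT0 : ∀ k, 1 ≤ k → 1 / 2 ≤ T k) (hT : ∀ k, 1 ≤ k → T k ≤ c * (k:ℝ) ^ a)
    (hJm : ∀ k, 1 ≤ k → MeasurableSet (J k)) (hJM : ∀ k, 1 ≤ k → J k ⊆ Set.Icc (-M) M)
    (hJ : ∀ k, 1 ≤ k → (volume (J k)).toReal ≤ c * (k:ℝ) ^ (β - a * ((m : ℝ) + 1 - d))) :
    ∃ C : ℝ, 1 ≤ C ∧ ∀ᵐ u ∂volume.restrict (unitCube m), ∃ k0 : ℕ, ∀ k ≥ k0, ∃ u' : Fin m → ℝ,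
      (∀ i, 0 < u' i ∧ u' i ≤ 1 / k) ∧
      |(ballSum ε d j k (T k) (shear j (u - u') * h) (J k) u').toReal
        - ∫ w, ballFun ε d j k (T k) (shear j (u - u') * h) (J k) w| ≤ C * (k:ℝ) ^ (β - θ) := by
  obtain ⟨R0, hR0⟩ : ∃ R0 : ℝ, ∀ i k, |h i k| ≤ R0 :=
    ⟨∑ i, ∑ k, |h i k|, fun i k => (Finset.single_le_sum (f := fun k => |h i k|) (fun _ _ => abs_nonneg _)
      (Finset.mem_univ k)).trans (Finset.single_le_sum (f := fun i => ∑ k, |h i k|)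
      (fun _ _ => Finset.sum_nonneg fun _ _ => abs_nonneg _) (Finset.mem_univ i))⟩
  have hR0' : 0 ≤ R0 := (abs_nonneg _).trans (hR0 0 0)
  have hA' : 0 < |∑ i, ε i * h j i ^ d| := abs_pos.2 hA
  set R : ℝ := 2 * R0 + 1 / |∑ i, ε i * h j i ^ d|
  have hRpos : 0 < R := by positivity
  obtain ⟨C, hC, hb⟩ := measure_ballSum_le hm hε hd hdm j hRpos hM
  set δ : ℝ := (1 - θ) / 3
  have hδ : 0 < δ := by simp only [δ]; linarith
  obtain ⟨B, hB, hlog⟩ := exists_one_add_log_le (a := a) (c := c) (by linarith) hc hδ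
  set D : ℝ := c ^ (m - d + 2)
  have hD : 1 ≤ D := one_le_pow₀ hc
  set H : ℕ → (Fin m → ℕ) → Matrix (Fin (m + 1)) (Fin (m + 1)) ℝ := fun k r => shear j (fun i => (r i : ℝ) / k) * h
  have hH : ∀ k, 1 ≤ k → ∀ r ∈ natGrid m k, (H k r : Fin (m + 1) → Fin (m + 1) → ℝ) ∈ boundedSL (m + 1) R := by
    intro k hk r hr
    refine ⟨?_, fun i l => ?_⟩
    · change (H k r).det = 1
      simp only [H, Matrix.det_mul, det_shear, hh, one_mul]
    · refine (abs_shear_mul_le j (fun i => ?_) hR0 i l).trans (by simp only [R]; have : 0 ≤ 1 / |∑ i, ε i * h j i ^ d| := by positivity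
                                                                  linarith)
      have hk' : (0:ℝ) < k := by exact_mod_cast hk
      simp only [natGrid, Fintype.mem_piFinset, Finset.mem_range] at hr
      rw [abs_of_nonneg (by positivity), div_le_one hk']
      exact_mod_cast (hr i).le
  have hrow : ∀ k r, 1 / R ≤ |∑ i, ε i * (H k r : Fin (m + 1) → Fin (m + 1) → ℝ) j i ^ d| := by
    intro k r
    have : (H k r : Fin (m + 1) → Fin (m + 1) → ℝ) j = h j := shear_mul_row _ _ _
    rw [this, one_div, inv_le_comm₀ hRpos hA']
    simp only [R, one_div]; linarith
  set bad : ℕ → (Fin m → ℕ) → Set (Fin m → ℝ) := fun k r =>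
    {u | C * (1 + Real.log (4 * T k)) * ((k:ℝ) ^ (β - 1) + (volume (J k)).toReal * (T k ^ m * ((T k)⁻¹ ^ d * ((k:ℝ) ^ 2 + k * T k ^ (1 - 1 / d : ℝ)))) + 1)
        ≤ |(ballSum ε d j k (T k) (H k r) (J k) u).toReal - ∫ w, ballFun ε d j k (T k) (H k r) (J k) w|}
  set p : ℕ → ℝ := fun k => C * D * B ^ 3 * (k:ℝ) ^ (-((m : ℝ) + 2))
  have hp0 : ∀ k, 0 ≤ p k := fun k => by positivity
  have hbad : ∀ k, 1 ≤ k → ∀ r ∈ natGrid m k, volume.restrict (unitCube m) (bad k r) ≤ ENNReal.ofReal (p k) := by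
    intro k hk r hr
    have hk1 : (1:ℝ) ≤ k := by exact_mod_cast hk
    have hk0 : (0:ℝ) < k := by linarith
    refine (hb (H k r) (hH k hk r hr) (hrow k r) k (T k) hk1 (hT0 k hk) (J k) (hJm k hk) (hJM k hk)
      ((k:ℝ) ^ (β - 1)) (by positivity)).trans (ENNReal.ofReal_le_ofReal ?_)
    have hTp : 0 < T k := by linarith [hT0 k hk]
    have h1 := volume_mul_pow_le_main hdm hc hk1 hTp (hT k hk) ENNReal.toReal_nonneg (hJ k hk)
    have h2 := hlog k (T k) hk1 hTp (hT k hk)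
    have h3 : 0 ≤ 1 + Real.log (4 * T k) := by
      have := Real.log_nonneg (x := 4 * T k) (by linarith [hT0 k hk]); linarith
    have h4 : (1 + Real.log (4 * T k)) ^ 3 ≤ B ^ 3 * k := by
      calc (1 + Real.log (4 * T k)) ^ 3 ≤ (B * (k:ℝ) ^ δ) ^ 3 := by gcongr
        _ = B ^ 3 * (k:ℝ) ^ (δ * 3) := by rw [mul_pow, Real.rpow_mul hk0.le]; norm_cast
        _ ≤ B ^ 3 * (k:ℝ) ^ (1:ℝ) := mul_le_mul_of_nonneg_left
            (Real.rpow_le_rpow_of_exponent_le hk1 (by simp only [δ]; linarith)) (by positivity)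
        _ = _ := by rw [Real.rpow_one]
    have h5 : ((k:ℝ) ^ (β - 1)) ^ 2 = (k:ℝ) ^ (2 * β - 2) := by
      rw [← Real.rpow_natCast, ← Real.rpow_mul hk0.le]; congr 1; push_cast; ring
    rw [h5, div_le_iff₀ (by positivity)]
    calc C * k * (volume (J k)).toReal * (T k ^ m * ((T k)⁻¹ ^ d * T k)) * (1 + Real.log (4 * T k)) ^ 3
        = C * k * ((volume (J k)).toReal * (T k ^ m * ((T k)⁻¹ ^ d * T k))) * (1 + Real.log (4 * T k)) ^ 3 := by ring
      _ ≤ C * k * (D * (k:ℝ) ^ β) * (B ^ 3 * k) := by gcongr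
      _ = C * D * B ^ 3 * ((k:ℝ) ^ β * (k:ℝ) ^ (2:ℝ)) := by rw [Real.rpow_two]; ring
      _ ≤ C * D * B ^ 3 * ((k:ℝ) ^ (-((m : ℝ) + 2)) * (k:ℝ) ^ (2 * β - 2)) := by
          rw [← Real.rpow_add hk0, ← Real.rpow_add hk0]
          exact mul_le_mul_of_nonneg_left (Real.rpow_le_rpow_of_exponent_le hk1 (by linarith)) (by positivity)
      _ = _ := by simp only [p]; ring
  have hsum : Summable fun k : ℕ => (k:ℝ) ^ m * p k := by
    have h1 : Summable fun k : ℕ => C * D * B ^ 3 * (k:ℝ) ^ (-2:ℝ) :=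
      (Real.summable_nat_rpow.2 (by norm_num)).mul_left _
    refine h1.congr fun k => ?_
    rcases Nat.eq_zero_or_pos k with rfl | hk
    · have : m ≠ 0 := by omega
      simp [this]
    · have hk0 : (0:ℝ) < k := by exact_mod_cast hk
      simp only [p]
      rw [← Real.rpow_natCast (k:ℝ) m, mul_left_comm, ← Real.rpow_add hk0]
      congr 2; ring
  refine ⟨C * B * (2 + 2 * D), ?_, ?_⟩
  · have := one_le_mul_of_one_le_of_one_le hC hB
    nlinarith
  filter_upwards [ae_eventually_exists_natGrid hp0 hsum hbad] with u hu
  obtain ⟨k0, hk0⟩ := hu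
  refine ⟨max k0 1, fun k hk => ?_⟩
  have hk1' : 1 ≤ k := le_of_max_le_right hk
  obtain ⟨r, hr, hru, hgood⟩ := hk0 k (le_of_max_le_left hk)
  refine ⟨fun i => u i - r i / k, hru, ?_⟩
  have hH' : shear j (u - fun i => u i - (r i : ℝ) / k) * h = H k r := by
    simp only [H]; congr 2; funext i; simp
  rw [hH']
  simp only [bad, Set.mem_ofPred_eq, not_le] at hgood
  refine hgood.le.trans ?_
  have hk1 : (1:ℝ) ≤ k := by exact_mod_cast hk1'
  have hk0 : (0:ℝ) < k := by linarith
  have hTp : 0 < T k := by linarith [hT0 k hk1']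
  have h1 := volume_mul_pow_le_error hd hdm hc ha3 had hk1 hTp (hT k hk1') ENNReal.toReal_nonneg (hJ k hk1')
  have h2 := hlog k (T k) hk1 hTp (hT k hk1')
  have hm0 : (0:ℝ) ≤ m := Nat.cast_nonneg m
  have h3 : (1:ℝ) ≤ (k:ℝ) ^ (β - 1) := Real.one_le_rpow hk1 (by linarith)
  have h4 : 0 ≤ 1 + Real.log (4 * T k) := by
    have := Real.log_nonneg (x := 4 * T k) (by linarith [hT0 k hk1']); linarith
  calc _ ≤ C * (B * (k:ℝ) ^ δ) * ((k:ℝ) ^ (β - 1) + 2 * D * (k:ℝ) ^ (β - 1) + (k:ℝ) ^ (β - 1)) := by gcongr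
    _ = C * B * (2 + 2 * D) * ((k:ℝ) ^ δ * (k:ℝ) ^ (β - 1)) := by ring
    _ ≤ C * B * (2 + 2 * D) * (k:ℝ) ^ (β - θ) := by
        rw [← Real.rpow_add hk0]
        exact mul_le_mul_of_nonneg_left
          (Real.rpow_le_rpow_of_exponent_le hk1 (by simp only [δ]; linarith)) (by positivity)

/-- The weight of `w` in the count of points in the ball of radius `s` at which the form takes a
value in `J`. -/
def sharpFun {n : ℕ} (ε : Fin n → ℝ) (d : ℕ) (j : Fin n) (s : ℝ) (g : Matrix (Fin n) (Fin n) ℝ)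
    (J : Set ℝ) (w : Fin n → ℝ) : ℝ :=
  J.indicator 1 (form ε d g w) * ((Set.Iic (s ^ 2)).indicator 1 (sqNorm w) * gradWeight ε d g j w)

/-- The sum of `sharpFun` over the integer lattice. -/
def sharpSum {n : ℕ} (ε : Fin n → ℝ) (d : ℕ) (j : Fin n) (s : ℝ) (g : Matrix (Fin n) (Fin n) ℝ)
    (J : Set ℝ) : ENNReal :=
  ∑' v : Fin n → ℤ, ENNReal.ofReal (sharpFun ε d j s g J (intVec v))

/-- The integral of `sharpFun`. -/
def sharpVol {n : ℕ} (ε : Fin n → ℝ) (d : ℕ) (j : Fin n) (s : ℝ) (g : Matrix (Fin n) (Fin n) ℝ)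
    (J : Set ℝ) : ENNReal :=
  ∫⁻ w : Fin n → ℝ, ENNReal.ofReal (sharpFun ε d j s g J w)

lemma sqNorm_lineAt {m : ℕ} (j : Fin (m + 1)) (x : ℝ) (y : Fin m → ℝ) :
    sqNorm (lineAt j x y) = x ^ 2 + ∑ k, y k ^ 2 := by
  simp [sqNorm, Fin.sum_univ_succAbove _ j]

lemma sqNorm_shear_mulVec_le {m : ℕ} (hm : 1 ≤ m) (j : Fin (m + 1)) {u : Fin m → ℝ} {ρ : ℝ} (hρ1 : ρ ≤ 1)
    (hρ : 0 ≤ ρ) (hu : ∀ i, |u i| ≤ ρ) (b : Fin (m + 1) → ℝ) :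
    sqNorm (shear j u *ᵥ b) ≤ (1 + m * ρ) ^ 2 * sqNorm b := by
  rw [← lineAt_removeNth j b, shear_mulVec, sqNorm_lineAt, sqNorm_lineAt]
  simp only [lineAt_self, lineAt_succAbove]
  set x := b j
  set y := fun k => b (j.succAbove k)
  have hmR : (1:ℝ) ≤ m := by exact_mod_cast hm
  have h1 : ∀ k, (b (j.succAbove k) + u k * x) ^ 2 ≤ (1 + ρ) * b (j.succAbove k) ^ 2 + (ρ + ρ ^ 2) * x ^ 2 := by
    intro k
    have h2 : u k * (b (j.succAbove k) * x) ≤ ρ * ((b (j.succAbove k) ^ 2 + x ^ 2) / 2) := by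
      refine (le_abs_self _).trans ?_
      rw [abs_mul]
      refine mul_le_mul (hu k) ?_ (abs_nonneg _) hρ
      rw [abs_le]; constructor <;> nlinarith [sq_nonneg (b (j.succAbove k) - x), sq_nonneg (b (j.succAbove k) + x)]
    have h3 : u k ^ 2 ≤ ρ ^ 2 := sq_le_sq' (by linarith [(abs_le.1 (hu k)).1]) (abs_le.1 (hu k)).2
    nlinarith [mul_le_mul_of_nonneg_right h3 (sq_nonneg x)]
  have h4 := Finset.sum_le_sum fun k (_ : k ∈ Finset.univ) => h1 k
  rw [Finset.sum_add_distrib, ← Finset.mul_sum, Finset.sum_const, Finset.card_univ, Fintype.card_fin, nsmul_eq_mul] at h4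
  have h5 : 0 ≤ ∑ k, b (j.succAbove k) ^ 2 := Finset.sum_nonneg fun _ _ => sq_nonneg _
  have hx := sq_nonneg x
  have h6 : ρ ^ 2 ≤ ρ := by nlinarith
  have h7 : ρ ≤ m * ρ := by nlinarith
  have h8 : (m:ℝ) * (ρ + ρ ^ 2) * x ^ 2 ≤ (2 * (m * ρ)) * x ^ 2 := by
    refine mul_le_mul_of_nonneg_right ?_ hx
    nlinarith
  have h9 : (1 + ρ) * ∑ k, b (j.succAbove k) ^ 2 ≤ (1 + m * ρ) * ∑ k, b (j.succAbove k) ^ 2 :=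
    mul_le_mul_of_nonneg_right (by linarith) h5
  nlinarith [mul_nonneg (sq_nonneg ((m:ℝ) * ρ)) hx, mul_nonneg (sq_nonneg ((m:ℝ) * ρ)) h5,
    mul_nonneg (mul_nonneg (Nat.cast_nonneg (α := ℝ) m) hρ) h5]

lemma sqNorm_vecMul_shear_le {m : ℕ} (hm : 1 ≤ m) (j : Fin (m + 1)) {u : Fin m → ℝ} {ρ : ℝ} (hρ1 : ρ ≤ 1)
    (hρ : 0 ≤ ρ) (hu : ∀ i, |u i| ≤ ρ) (v : Fin (m + 1) → ℝ) :
    sqNorm (v ᵥ* shear j u) ≤ (1 + m * ρ) ^ 2 * sqNorm v := by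
  rw [← lineAt_removeNth j v, vecMul_shear, sqNorm_lineAt, sqNorm_lineAt]
  set x := v j
  have hmR : (1:ℝ) ≤ m := by exact_mod_cast hm
  set y : Fin m → ℝ := fun k => v (j.succAbove k)
  have h5 : 0 ≤ ∑ k, y k ^ 2 := Finset.sum_nonneg fun _ _ => sq_nonneg _
  have h1 : |u ⬝ᵥ y| ≤ ρ * ∑ k, |y k| := by
    rw [dotProduct, Finset.mul_sum]
    refine (Finset.abs_sum_le_sum_abs _ _).trans (Finset.sum_le_sum fun k _ => ?_)
    rw [abs_mul]
    exact mul_le_mul_of_nonneg_right (hu k) (abs_nonneg _)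
  have h2 : (∑ k, |y k|) ^ 2 ≤ m * ∑ k, y k ^ 2 := by
    have := sq_sum_le_card_mul_sum_sq (s := Finset.univ) (f := fun k => |y k|)
    simpa using this
  have h0 : 0 ≤ ∑ k, |y k| := Finset.sum_nonneg fun _ _ => abs_nonneg _
  set S := ∑ k, |y k|
  set Q := ∑ k, y k ^ 2
  have h3 : (u ⬝ᵥ y) ^ 2 ≤ ρ ^ 2 * S ^ 2 := by
    rw [← mul_pow]; exact sq_le_sq' (by linarith [(abs_le.1 h1).1]) (abs_le.1 h1).2
  have h4 : x * (u ⬝ᵥ y) ≤ ρ * (|x| * S) := by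
    refine (le_abs_self _).trans ?_
    rw [abs_mul]
    nlinarith [mul_le_mul_of_nonneg_left h1 (abs_nonneg x)]
  have h6 : 2 * (|x| * S) ≤ m * x ^ 2 + Q := by
    have : 2 * (|x| * S) = ∑ k, 2 * (|x| * |y k|) := by
      simp only [S, Finset.mul_sum]
    rw [this]
    have h8 : (m:ℝ) * x ^ 2 + Q = ∑ k, (x ^ 2 + y k ^ 2) := by
      simp [Q, Finset.sum_add_distrib]
    rw [h8]
    refine Finset.sum_le_sum fun k _ => ?_
    nlinarith [sq_nonneg (|x| - |y k|), sq_abs x, sq_abs (y k)]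
  have hx := sq_nonneg x
  have h7 : 2 * (ρ * (|x| * S)) ≤ ρ * (m * x ^ 2 + Q) := by nlinarith
  have h8 : ρ ^ 2 * S ^ 2 ≤ ρ ^ 2 * (m * Q) := mul_le_mul_of_nonneg_left h2 (sq_nonneg _)
  have h9 : ρ ^ 2 * (m * Q) ≤ ρ * (m * Q) := mul_le_mul_of_nonneg_right (by nlinarith) (by positivity)
  have h10 : ρ * Q ≤ m * (ρ * Q) := le_mul_of_one_le_left (by positivity) hmR
  nlinarith [mul_nonneg (sq_nonneg ((m:ℝ) * ρ)) hx, mul_nonneg (sq_nonneg ((m:ℝ) * ρ)) h5,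
    mul_nonneg (mul_nonneg (Nat.cast_nonneg (α := ℝ) m) hρ) hx]

lemma shear_mul_shear_neg {m : ℕ} (j : Fin (m + 1)) (u : Fin m → ℝ) : shear j u * shear j (-u) = 1 := by
  rw [← shear_add, add_neg_cancel, shear_zero]

lemma shear_neg_mul_shear {m : ℕ} (j : Fin (m + 1)) (u : Fin m → ℝ) : shear j (-u) * shear j u = 1 := by
  rw [← shear_add, neg_add_cancel, shear_zero]

lemma sqNorm_le_shear_mulVec {m : ℕ} (hm : 1 ≤ m) (j : Fin (m + 1)) {u : Fin m → ℝ} {ρ : ℝ} (hρ1 : ρ ≤ 1)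
    (hρ : 0 ≤ ρ) (hu : ∀ i, |u i| ≤ ρ) (b : Fin (m + 1) → ℝ) :
    sqNorm b ≤ (1 + m * ρ) ^ 2 * sqNorm (shear j u *ᵥ b) := by
  have := sqNorm_shear_mulVec_le hm j hρ1 hρ (u := -u) (by simpa using hu) (shear j u *ᵥ b)
  rwa [Matrix.mulVec_mulVec, shear_neg_mul_shear, Matrix.one_mulVec] at this

lemma sqNorm_le_vecMul_shear {m : ℕ} (hm : 1 ≤ m) (j : Fin (m + 1)) {u : Fin m → ℝ} {ρ : ℝ} (hρ1 : ρ ≤ 1)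
    (hρ : 0 ≤ ρ) (hu : ∀ i, |u i| ≤ ρ) (v : Fin (m + 1) → ℝ) :
    sqNorm v ≤ (1 + m * ρ) ^ 2 * sqNorm (v ᵥ* shear j u) := by
  have := sqNorm_vecMul_shear_le hm j hρ1 hρ (u := -u) (by simpa using hu) (v ᵥ* shear j u)
  rwa [Matrix.vecMul_vecMul, shear_mul_shear_neg, Matrix.vecMul_one] at this

lemma shear_mulVec_apply_self {m : ℕ} (j : Fin (m + 1)) (u : Fin m → ℝ) (b : Fin (m + 1) → ℝ) :
    (shear j u *ᵥ b) j = b j := by rw [shear_mulVec, lineAt_self]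

lemma div_le_mul_div {x p q Γ : ℝ} (hx : 0 ≤ x) (hp : 0 ≤ p) (hq : 0 ≤ q) (hΓ : 0 ≤ Γ) (h : q ≤ Γ * p)
    (hxq : q = 0 → x = 0) : x / p ≤ Γ * (x / q) := by
  rcases hq.eq_or_lt' with h0 | h0
  · simp [hxq h0, h0]
  rcases hp.eq_or_lt' with h1 | h1
  · simp only [h1, div_zero]; positivity
  rw [← mul_div_assoc, div_le_div_iff₀ h1 h0]
  nlinarith

lemma gradWeight_shear_le {m : ℕ} (hm : 1 ≤ m) (ε : Fin (m + 1) → ℝ) (d : ℕ) (j : Fin (m + 1)) {u : Fin m → ℝ} {ρ : ℝ} (hρ1 : ρ ≤ 1)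
    (hρ : 0 ≤ ρ) (hu : ∀ i, |u i| ≤ ρ) (h : Matrix (Fin (m + 1)) (Fin (m + 1)) ℝ) (v : Fin (m + 1) → ℝ) :
    gradWeight ε d (shear j u * h) j v ≤ (1 + m * ρ) ^ 2 * gradWeight ε d h j (v ᵥ* shear j u) := by
  rw [gradWeight, gradWeight, formGrad_mul, shear_mulVec_apply_self]
  refine div_le_mul_div (sq_nonneg _) (sqNorm_nonneg _) (sqNorm_nonneg _) (sq_nonneg _)
    (sqNorm_le_shear_mulVec hm j hρ1 hρ hu _) fun h0 => ?_
  rw [sqNorm_eq_zero] at h0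
  simp [h0]

lemma le_gradWeight_shear {m : ℕ} (hm : 1 ≤ m) (ε : Fin (m + 1) → ℝ) (d : ℕ) (j : Fin (m + 1)) {u : Fin m → ℝ} {ρ : ℝ} (hρ1 : ρ ≤ 1)
    (hρ : 0 ≤ ρ) (hu : ∀ i, |u i| ≤ ρ) (h : Matrix (Fin (m + 1)) (Fin (m + 1)) ℝ) (v : Fin (m + 1) → ℝ) :
    gradWeight ε d h j (v ᵥ* shear j u) ≤ (1 + m * ρ) ^ 2 * gradWeight ε d (shear j u * h) j v := by
  rw [gradWeight, gradWeight, formGrad_mul, shear_mulVec_apply_self]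
  refine div_le_mul_div (sq_nonneg _) (sqNorm_nonneg _) (sqNorm_nonneg _) (sq_nonneg _)
    (sqNorm_shear_mulVec_le hm j hρ1 hρ hu _) fun h0 => ?_
  have := (sq_le_sqNorm (shear j u *ᵥ formGrad ε d h (v ᵥ* shear j u)) j).trans_eq h0
  rw [shear_mulVec_apply_self] at this
  exact le_antisymm this (sq_nonneg _)

lemma ballFun_matrix {n : ℕ} (ε : Fin n → ℝ) (d : ℕ) (j : Fin n) (lam T : ℝ) (h : Matrix (Fin n) (Fin n) ℝ)
    (I : Set ℝ) (w : Fin n → ℝ) : ballFun ε d j lam T h I w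
      = I.indicator 1 (form ε d h w) * (cutoff lam (T⁻¹ • w) * gradWeight ε d h j w) := rfl

lemma ballSum_matrix {m : ℕ} (ε : Fin (m + 1) → ℝ) (d : ℕ) (j : Fin (m + 1)) (lam T : ℝ)
    (h : Matrix (Fin (m + 1)) (Fin (m + 1)) ℝ) (I : Set ℝ) (u : Fin m → ℝ) : ballSum ε d j lam T h I u
      = ∑' v : Fin (m + 1) → ℤ, ENNReal.ofReal (ballFun ε d j lam T h I (intVec v ᵥ* shear j u)) := rfl

lemma sharpFun_nonneg {n : ℕ} (ε : Fin n → ℝ) (d : ℕ) (j : Fin n) (s : ℝ) (g : Matrix (Fin n) (Fin n) ℝ)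
    (J : Set ℝ) (w : Fin n → ℝ) : 0 ≤ sharpFun ε d j s g J w :=
  mul_nonneg (Set.indicator_nonneg (fun _ _ => zero_le_one) _)
    (mul_nonneg (Set.indicator_nonneg (fun _ _ => zero_le_one) _) (gradWeight_nonneg _ _ _ _ _))

lemma sharpFun_eq_zero {n : ℕ} (ε : Fin n → ℝ) (d : ℕ) (j : Fin n) {s : ℝ} (g : Matrix (Fin n) (Fin n) ℝ)
    (J : Set ℝ) {w : Fin n → ℝ} (hw : s ^ 2 < sqNorm w) : sharpFun ε d j s g J w = 0 := by
  rw [sharpFun, Set.indicator_of_notMem (show sqNorm w ∉ Set.Iic (s ^ 2) by simpa using hw), zero_mul, mul_zero]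

lemma sharpFun_mono {n : ℕ} (ε : Fin n → ℝ) (d : ℕ) (j : Fin n) {s s' : ℝ} (hs : 0 ≤ s) (hss : s ≤ s')
    (g : Matrix (Fin n) (Fin n) ℝ) {J J' : Set ℝ} (hJ : J ⊆ J') (w : Fin n → ℝ) :
    sharpFun ε d j s g J w ≤ sharpFun ε d j s' g J' w := by
  have h1 : Set.Iic (s ^ 2) ⊆ Set.Iic (s' ^ 2) := Set.Iic_subset_Iic.2 (by gcongr)
  refine mul_le_mul (Set.indicator_le_indicator_of_subset hJ (fun _ => zero_le_one) _)
    (mul_le_mul_of_nonneg_right (Set.indicator_le_indicator_of_subset h1 (fun _ => zero_le_one) _)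
      (gradWeight_nonneg _ _ _ _ _))
    (mul_nonneg (Set.indicator_nonneg (fun _ _ => zero_le_one) _) (gradWeight_nonneg _ _ _ _ _))
    (Set.indicator_nonneg (fun _ _ => zero_le_one) _)

lemma sharpSum_mono {n : ℕ} (ε : Fin n → ℝ) (d : ℕ) (j : Fin n) {s s' : ℝ} (hs : 0 ≤ s) (hss : s ≤ s')
    (g : Matrix (Fin n) (Fin n) ℝ) {J J' : Set ℝ} (hJ : J ⊆ J') :
    sharpSum ε d j s g J ≤ sharpSum ε d j s' g J' :=
  ENNReal.tsum_le_tsum fun _ => ENNReal.ofReal_le_ofReal (sharpFun_mono ε d j hs hss g hJ _)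

lemma sharpFun_le_ballFun {m : ℕ} (hm : 1 ≤ m) (ε : Fin (m + 1) → ℝ) (d : ℕ) (j : Fin (m + 1))
    {u : Fin m → ℝ} {ρ : ℝ} (hρ1 : ρ ≤ 1) (hρ : 0 ≤ ρ) (hu : ∀ i, |u i| ≤ ρ)
    (h : Matrix (Fin (m + 1)) (Fin (m + 1)) ℝ) (J : Set ℝ) {s lam : ℝ} (hs : 0 < s) (hl : 0 ≤ lam)
    (v : Fin (m + 1) → ℝ) :
    sharpFun ε d j s (shear j u * h) J v
      ≤ (1 + m * ρ) ^ 2 * ballFun ε d j lam ((1 + m * ρ) * s) h J (v ᵥ* shear j u) := by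
  have hT : 0 < (1 + m * ρ) * s := by positivity
  rcases le_or_gt (sqNorm v) (s ^ 2) with hv | hv
  · have h1 : cutoff lam (((1 + m * ρ) * s)⁻¹ • (v ᵥ* shear j u)) = 1 := by
      refine cutoff_eq_one hl ?_
      rw [sqNorm_smul, inv_pow, ← div_eq_inv_mul, div_le_one (by positivity), mul_pow]
      exact (sqNorm_vecMul_shear_le hm j hρ1 hρ hu v).trans (by gcongr)
    rw [sharpFun, ballFun_matrix, h1, form_mul, Set.indicator_of_mem (show sqNorm v ∈ Set.Iic (s ^ 2) from hv), Pi.one_apply, one_mul,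
      mul_left_comm ((1 + m * ρ) ^ 2)]
    refine mul_le_mul_of_nonneg_left ?_ (Set.indicator_nonneg (f := (1 : ℝ → ℝ)) (fun _ _ => zero_le_one) _)
    rw [one_mul]
    exact gradWeight_shear_le hm ε d j hρ1 hρ hu h v
  · rw [sharpFun_eq_zero ε d j _ _ hv]
    exact mul_nonneg (sq_nonneg _) (ballFun_nonneg _ _ _ _ _ _ _ _)

lemma ballFun_le_sharpFun {m : ℕ} (hm : 1 ≤ m) (ε : Fin (m + 1) → ℝ) (d : ℕ) (j : Fin (m + 1))
    {u : Fin m → ℝ} {ρ : ℝ} (hρ1 : ρ ≤ 1) (hρ : 0 ≤ ρ) (hu : ∀ i, |u i| ≤ ρ)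
    (h : Matrix (Fin (m + 1)) (Fin (m + 1)) ℝ) (J : Set ℝ) {s lam : ℝ} (hs : 0 < s) (hl : 1 ≤ lam)
    (hlρ : 1 / lam ≤ m * ρ) (v : Fin (m + 1) → ℝ) :
    ballFun ε d j lam ((1 + m * ρ) * s) h J (v ᵥ* shear j u)
      ≤ (1 + m * ρ) ^ 2 * sharpFun ε d j ((1 + m * ρ) ^ 3 * s) (shear j u * h) J v := by
  have hT : 0 < (1 + m * ρ) * s := by positivity
  have hγ : 1 ≤ 1 + m * ρ := by have : 0 ≤ m * ρ := by positivity
                                linarith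
  rcases le_or_gt (sqNorm v) (((1 + m * ρ) ^ 3 * s) ^ 2) with hv | hv
  · rw [sharpFun, ballFun_matrix, form_mul, Set.indicator_of_mem (show sqNorm v ∈ Set.Iic _ from hv), Pi.one_apply, one_mul,
      mul_left_comm ((1 + m * ρ) ^ 2)]
    refine mul_le_mul_of_nonneg_left ?_ (Set.indicator_nonneg (f := (1 : ℝ → ℝ)) (fun _ _ => zero_le_one) _)
    exact (mul_le_of_le_one_left (gradWeight_nonneg _ _ _ _ _) (cutoff_le_one _ _)).trans
      (le_gradWeight_shear hm ε d j hρ1 hρ hu h v)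
  · have h1 : cutoff lam (((1 + m * ρ) * s)⁻¹ • (v ᵥ* shear j u)) = 0 := by
      refine cutoff_eq_zero hl ?_
      rw [sqNorm_smul, inv_pow, ← div_eq_inv_mul, le_div_iff₀ (by positivity)]
      have h2 := (hv.trans_le (sqNorm_le_vecMul_shear hm j hρ1 hρ hu v)).le
      have h3 : ((1 + m * ρ) ^ 3 * s) ^ 2 = (1 + m * ρ) ^ 2 * ((1 + m * ρ) ^ 2 * ((1 + m * ρ) * s) ^ 2) := by ring
      rw [h3] at h2
      refine le_trans ?_ (le_of_mul_le_mul_left h2 (by positivity))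
      refine mul_le_mul_of_nonneg_right ?_ (by positivity)
      nlinarith
    rw [ballFun_matrix, h1, zero_mul, mul_zero]
    exact mul_nonneg (sq_nonneg _) (sharpFun_nonneg _ _ _ _ _ _ _)

lemma sharpSum_ne_top {n : ℕ} (ε : Fin n → ℝ) (d : ℕ) (j : Fin n) (s : ℝ) (g : Matrix (Fin n) (Fin n) ℝ)
    (J : Set ℝ) : sharpSum ε d j s g J ≠ ⊤ := by
  rw [sharpSum, tsum_eq_sum (s := intBox n ⌈|s|⌉₊)]
  · exact ENNReal.sum_ne_top.2 fun _ _ => ENNReal.ofReal_ne_top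
  · intro v hv
    rw [sharpFun_eq_zero, ENNReal.ofReal_zero]
    by_contra! hc
    rw [mem_intBox, not_le] at hv
    have := norm_le_of_sqNorm (abs_nonneg s) (z := intVec v) (by rwa [sq_abs])
    linarith [Nat.le_ceil |s|]

lemma lintegral_vecMul {n : ℕ} {A : Matrix (Fin n) (Fin n) ℝ} (hA : A.det = 1) {f : (Fin n → ℝ) → ENNReal}
    (hf : Measurable f) : ∫⁻ v, f (v ᵥ* A) = ∫⁻ v, f v := by
  have h1 := Real.map_matrix_volume_pi_eq_smul_volume_pi (M := Aᵀ) (by rw [det_transpose, hA]; exact one_ne_zero)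
  rw [det_transpose, hA] at h1
  simp only [inv_one, abs_one, ENNReal.ofReal_one, one_smul] at h1
  conv_rhs => rw [← h1]
  rw [lintegral_map hf (LinearMap.continuous_of_finiteDimensional _).measurable]
  simp [Matrix.mulVec_transpose]

lemma sharpSum_le_ballSum {m : ℕ} (hm : 1 ≤ m) (ε : Fin (m + 1) → ℝ) (d : ℕ) (j : Fin (m + 1))
    {u : Fin m → ℝ} {ρ : ℝ} (hρ1 : ρ ≤ 1) (hρ : 0 ≤ ρ) (hu : ∀ i, |u i| ≤ ρ)
    (h : Matrix (Fin (m + 1)) (Fin (m + 1)) ℝ) (J : Set ℝ) {s lam : ℝ} (hs : 0 < s) (hl : 0 ≤ lam) :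
    sharpSum ε d j s (shear j u * h) J
      ≤ ENNReal.ofReal ((1 + m * ρ) ^ 2) * ballSum ε d j lam ((1 + m * ρ) * s) h J u := by
  rw [sharpSum, ballSum_matrix, ← ENNReal.tsum_mul_left]
  refine ENNReal.tsum_le_tsum fun v => ?_
  rw [← ENNReal.ofReal_mul (sq_nonneg _)]
  exact ENNReal.ofReal_le_ofReal (sharpFun_le_ballFun hm ε d j hρ1 hρ hu h J hs hl _)

lemma ballSum_le_sharpSum {m : ℕ} (hm : 1 ≤ m) (ε : Fin (m + 1) → ℝ) (d : ℕ) (j : Fin (m + 1))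
    {u : Fin m → ℝ} {ρ : ℝ} (hρ1 : ρ ≤ 1) (hρ : 0 ≤ ρ) (hu : ∀ i, |u i| ≤ ρ)
    (h : Matrix (Fin (m + 1)) (Fin (m + 1)) ℝ) (J : Set ℝ) {s lam : ℝ} (hs : 0 < s) (hl : 1 ≤ lam)
    (hlρ : 1 / lam ≤ m * ρ) :
    ballSum ε d j lam ((1 + m * ρ) * s) h J u
      ≤ ENNReal.ofReal ((1 + m * ρ) ^ 2) * sharpSum ε d j ((1 + m * ρ) ^ 3 * s) (shear j u * h) J := by
  rw [sharpSum, ballSum_matrix, ← ENNReal.tsum_mul_left]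
  refine ENNReal.tsum_le_tsum fun v => ?_
  rw [← ENNReal.ofReal_mul (sq_nonneg _)]
  exact ENNReal.ofReal_le_ofReal (ballFun_le_sharpFun hm ε d j hρ1 hρ hu h J hs hl hlρ _)

lemma sharpVol_le_integral {m : ℕ} (hm : 1 ≤ m) (ε : Fin (m + 1) → ℝ) (d : ℕ) (j : Fin (m + 1))
    {u : Fin m → ℝ} {ρ : ℝ} (hρ1 : ρ ≤ 1) (hρ : 0 ≤ ρ) (hu : ∀ i, |u i| ≤ ρ)
    (h : Matrix (Fin (m + 1)) (Fin (m + 1)) ℝ) {J : Set ℝ} (hJ : MeasurableSet J) {s lam : ℝ} (hs : 0 < s) (hl : 1 ≤ lam) :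
    sharpVol ε d j s (shear j u * h) J
      ≤ ENNReal.ofReal ((1 + m * ρ) ^ 2) * ENNReal.ofReal (∫ w, ballFun ε d j lam ((1 + m * ρ) * s) h J w) := by
  rw [ofReal_integral_eq_lintegral_ofReal (integrable_ballFun ε d j hl (by positivity) h hJ)
    (ae_of_all _ fun w => ballFun_nonneg _ _ _ _ _ _ _ _), sharpVol,
    ← lintegral_vecMul (det_shear j u) (measurable_ballFun ε d j lam _ h hJ).ennreal_ofReal,
    ← lintegral_const_mul' _ _ ENNReal.ofReal_ne_top]
  refine lintegral_mono fun v => ?_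
  simp only
  rw [← ENNReal.ofReal_mul (sq_nonneg _)]
  exact ENNReal.ofReal_le_ofReal (sharpFun_le_ballFun hm ε d j hρ1 hρ hu h J hs (by linarith) _)

lemma integral_le_sharpVol {m : ℕ} (hm : 1 ≤ m) (ε : Fin (m + 1) → ℝ) (d : ℕ) (j : Fin (m + 1))
    {u : Fin m → ℝ} {ρ : ℝ} (hρ1 : ρ ≤ 1) (hρ : 0 ≤ ρ) (hu : ∀ i, |u i| ≤ ρ)
    (h : Matrix (Fin (m + 1)) (Fin (m + 1)) ℝ) {J : Set ℝ} (hJ : MeasurableSet J) {s lam : ℝ} (hs : 0 < s) (hl : 1 ≤ lam)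
    (hlρ : 1 / lam ≤ m * ρ) :
    ENNReal.ofReal (∫ w, ballFun ε d j lam ((1 + m * ρ) * s) h J w)
      ≤ ENNReal.ofReal ((1 + m * ρ) ^ 2) * sharpVol ε d j ((1 + m * ρ) ^ 3 * s) (shear j u * h) J := by
  rw [ofReal_integral_eq_lintegral_ofReal (integrable_ballFun ε d j hl (by positivity) h hJ)
    (ae_of_all _ fun w => ballFun_nonneg _ _ _ _ _ _ _ _), sharpVol,
    ← lintegral_vecMul (det_shear j u) (measurable_ballFun ε d j lam _ h hJ).ennreal_ofReal,
    ← lintegral_const_mul' _ _ ENNReal.ofReal_ne_top]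
  refine lintegral_mono fun v => ?_
  simp only
  rw [← ENNReal.ofReal_mul (sq_nonneg _)]
  exact ENNReal.ofReal_le_ofReal (ballFun_le_sharpFun hm ε d j hρ1 hρ hu h J hs hl hlρ _)

/-- The lattice sums and the volumes along the sequences `s`, `J` agree up to a power saving. -/
def LatticeBalanced {n : ℕ} (ε : Fin n → ℝ) (d : ℕ) (j : Fin n) (s : ℕ → ℝ) (J : ℕ → Set ℝ) (e : ℝ)
    (g : Matrix (Fin n) (Fin n) ℝ) : Prop :=
  ∃ C k0 : ℕ, ∀ k ≥ k0,
    sharpSum ε d j (s k) g (J k) ≤ ENNReal.ofReal ((1 + n * (1 / k : ℝ)) ^ 4)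
      * sharpVol ε d j ((1 + n * (1 / k : ℝ)) ^ 3 * s k) g (J k) + ENNReal.ofReal (C * (k:ℝ) ^ e) ∧
    sharpVol ε d j (s k) g (J k) ≤ ENNReal.ofReal ((1 + n * (1 / k : ℝ)) ^ 4)
      * sharpSum ε d j ((1 + n * (1 / k : ℝ)) ^ 3 * s k) g (J k) + ENNReal.ofReal (C * (k:ℝ) ^ e)

lemma sharpVol_mono {n : ℕ} (ε : Fin n → ℝ) (d : ℕ) (j : Fin n) {s s' : ℝ} (hs : 0 ≤ s) (hss : s ≤ s')
    (g : Matrix (Fin n) (Fin n) ℝ) {J J' : Set ℝ} (hJ : J ⊆ J') :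
    sharpVol ε d j s g J ≤ sharpVol ε d j s' g J' :=
  lintegral_mono fun _ => ENNReal.ofReal_le_ofReal (sharpFun_mono ε d j hs hss g hJ _)

lemma ae_balanced_shear {m : ℕ} (hm : 2 ≤ m) {ε : Fin (m + 1) → ℝ} (hε : ∀ i, ε i ≠ 0) {d : ℕ}
    (hd : 2 ≤ d) (hdm : d ≤ m) (j : Fin (m + 1)) {h : Matrix (Fin (m + 1)) (Fin (m + 1)) ℝ}
    (hh : h.det = 1) (hA : ∑ i, ε i * h j i ^ d ≠ 0) {M a β c θ : ℝ} (hM : 0 ≤ M) (hc : 1 ≤ c)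
    (ha3 : 3 ≤ a) (had : 2 * d ≤ a) (hβ : m + 6 ≤ β) (hθ0 : 0 ≤ θ) (hθ : θ < 1)
    {s : ℕ → ℝ} {J : ℕ → Set ℝ} (hs0 : ∀ k, 1 ≤ k → 1 / 2 ≤ s k) (hs : ∀ k, 1 ≤ k → s k ≤ c * (k:ℝ) ^ a)
    (hJm : ∀ k, 1 ≤ k → MeasurableSet (J k)) (hJM : ∀ k, 1 ≤ k → J k ⊆ Set.Icc (-M) M)
    (hJ : ∀ k, 1 ≤ k → (volume (J k)).toReal ≤ c * (k:ℝ) ^ (β - a * ((m : ℝ) + 1 - d))) :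
    ∀ᵐ u ∂volume.restrict (unitCube m), LatticeBalanced ε d j s J (β - θ) (shear j u * h) := by
  have hρ : ∀ k : ℕ, 1 ≤ k → (1:ℝ) / k ≤ 1 := fun k hk => by
    rw [div_le_one (by exact_mod_cast hk)]; exact_mod_cast hk
  have hm0 : (0:ℝ) ≤ m := Nat.cast_nonneg m
  obtain ⟨C, hC, hae⟩ := ae_abs_ballSum_sub_le hm hε hd hdm j hh hA hM (c := (1 + m) * c) (by nlinarith) ha3 had hβ hθ0 hθ
    (T := fun k => (1 + m * (1 / k : ℝ)) * s k) (J := J)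
    (by
      intro k hk
      refine (hs0 k hk).trans (le_mul_of_one_le_left (by linarith [hs0 k hk]) ?_)
      have : (0:ℝ) ≤ m * (1 / k : ℝ) := by positivity
      linarith)
    (by
      intro k hk
      rw [mul_assoc]
      refine mul_le_mul ?_ (hs k hk) (by linarith [hs0 k hk]) (by positivity)
      have := mul_le_mul_of_nonneg_left (hρ k hk) hm0
      linarith) hJm hJM
    (by
      intro k hk
      refine (hJ k hk).trans ?_
      refine mul_le_mul_of_nonneg_right ?_ (by positivity)
      nlinarith)
  filter_upwards [hae] with u hu
  obtain ⟨k0, hk0⟩ := hu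
  refine ⟨⌈(1 + m) ^ 2 * C⌉₊, max k0 1, fun k hk => ?_⟩
  have hk1 : 1 ≤ k := le_of_max_le_right hk
  have hkR : (1:ℝ) ≤ k := by exact_mod_cast hk1
  obtain ⟨u', hu', hb⟩ := hk0 k (le_of_max_le_left hk)
  have hg : shear j u * h = shear j u' * (shear j (u - u') * h) := by
    rw [← Matrix.mul_assoc, ← shear_add]; congr 2; abel
  rw [hg]
  set h' := shear j (u - u') * h
  set ρ : ℝ := 1 / k
  have hρ0 : 0 ≤ ρ := by positivity
  have hu'' : ∀ i, |u' i| ≤ ρ := fun i => by rw [abs_of_pos (hu' i).1]; exact (hu' i).2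
  have hm1 : 1 ≤ m := by omega
  have hmR : (1:ℝ) ≤ m := by exact_mod_cast hm1
  have hlρ : 1 / (k:ℝ) ≤ m * ρ := le_mul_of_one_le_left hρ0 hmR
  have hsk : 0 < s k := by linarith [hs0 k hk1]
  have hγ1 : 1 ≤ 1 + m * ρ := by nlinarith
  have hγm : 1 + m * ρ ≤ 1 + (m + 1 : ℕ) * ρ := by push_cast; nlinarith
  set B := ballSum ε d j k ((1 + m * ρ) * s k) h' (J k) u'
  set Z := ∫ w, ballFun ε d j k ((1 + m * ρ) * s k) h' (J k) w
  set err := C * (k:ℝ) ^ (β - θ)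
  have herr : 0 ≤ err := by positivity
  have hZ : 0 ≤ Z := integral_nonneg fun w => ballFun_nonneg _ _ _ _ _ _ _ _
  have hBtop : B ≠ ⊤ := ne_top_of_le_ne_top (ENNReal.mul_ne_top ENNReal.ofReal_ne_top (sharpSum_ne_top _ _ _ _ _ _))
    (ballSum_le_sharpSum hm1 ε d j (hρ k hk1) hρ0 hu'' h' (J k) hsk hkR hlρ)
  have hBZ : B ≤ ENNReal.ofReal Z + ENNReal.ofReal err := by
    rw [← ENNReal.ofReal_add hZ herr, ← ENNReal.ofReal_toReal hBtop]
    exact ENNReal.ofReal_le_ofReal (by linarith [(abs_le.1 hb).2])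
  have hZB : ENNReal.ofReal Z ≤ B + ENNReal.ofReal err := by
    rw [← ENNReal.ofReal_toReal hBtop, ← ENNReal.ofReal_add ENNReal.toReal_nonneg herr]
    exact ENNReal.ofReal_le_ofReal (by linarith [(abs_le.1 hb).1])
  have hmul : ∀ x : ENNReal, ENNReal.ofReal ((1 + m * ρ) ^ 2) * (ENNReal.ofReal ((1 + m * ρ) ^ 2) * x + ENNReal.ofReal err)
      ≤ ENNReal.ofReal ((1 + (m + 1 : ℕ) * ρ) ^ 4) * x + ENNReal.ofReal (⌈(1 + m) ^ 2 * C⌉₊ * (k:ℝ) ^ (β - θ)) := by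
    intro x
    rw [mul_add, ← mul_assoc, ← ENNReal.ofReal_mul (sq_nonneg _), ← ENNReal.ofReal_mul (sq_nonneg _), ← pow_add]
    refine add_le_add (mul_le_mul_left (ENNReal.ofReal_le_ofReal (by gcongr)) _) (ENNReal.ofReal_le_ofReal ?_)
    rw [← mul_assoc]
    refine mul_le_mul_of_nonneg_right ?_ (by positivity)
    refine le_trans ?_ (Nat.le_ceil _)
    have : 1 + m * ρ ≤ 1 + m := by nlinarith [hρ k hk1]
    gcongr
  constructor
  · refine (sharpSum_le_ballSum (lam := k) hm1 ε d j (hρ k hk1) hρ0 hu'' h' (J k) hsk (by linarith)).trans ?_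
    refine (mul_le_mul_right (hBZ.trans (add_le_add_left (integral_le_sharpVol hm1 ε d j (hρ k hk1) hρ0 hu'' h' (hJm k hk1) hsk hkR hlρ) _)) _).trans ?_
    refine (hmul _).trans (add_le_add_left (mul_le_mul_right (sharpVol_mono ε d j (by positivity) (by gcongr) _ subset_rfl) _) _)
  · refine (sharpVol_le_integral hm1 ε d j (hρ k hk1) hρ0 hu'' h' (hJm k hk1) hsk hkR).trans ?_
    refine (mul_le_mul_right (hZB.trans (add_le_add_left (ballSum_le_sharpSum hm1 ε d j (hρ k hk1) hρ0 hu'' h' (J k) hsk hkR hlρ) _)) _).trans ?_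
    refine (hmul _).trans (add_le_add_left (mul_le_mul_right (sharpSum_mono ε d j (by positivity) (by gcongr) _ subset_rfl) _) _)

instance (n : ℕ) : BorelSpace (SLR n) := ⟨rfl⟩
lemma isClosedEmbedding_coe (n : ℕ) :
    Topology.IsClosedEmbedding (fun g : SLR n => (g : Matrix (Fin n) (Fin n) ℝ)) := by
  refine ⟨⟨⟨rfl⟩, Subtype.val_injective⟩, ?_⟩
  have : Set.range (fun g : SLR n => (g : Matrix (Fin n) (Fin n) ℝ)) = {A | A.det = 1} := by
    ext A
    exact ⟨fun ⟨g, hg⟩ => hg ▸ g.2, fun h => ⟨⟨A, h⟩, rfl⟩⟩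
  rw [this]
  exact isClosed_eq (continuous_id.matrix_det) continuous_const
instance (n : ℕ) : IsTopologicalGroup (SLR n) := Matrix.SpecialLinearGroup.topologicalGroup
instance (n : ℕ) : SecondCountableTopology (SLR n) :=
  have : SecondCountableTopology (Matrix (Fin n) (Fin n) ℝ) := inferInstanceAs (SecondCountableTopology (Fin n → Fin n → ℝ))
  (isClosedEmbedding_coe n).isEmbedding.secondCountableTopology
instance (n : ℕ) : SigmaCompactSpace (SLR n) :=
  have : SigmaCompactSpace (Matrix (Fin n) (Fin n) ℝ) := inferInstanceAs (SigmaCompactSpace (Fin n → Fin n → ℝ))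
  (isClosedEmbedding_coe n).sigmaCompactSpace
lemma measurable_SLR_iff {α : Type*} [MeasurableSpace α] {n : ℕ} {f : α → SLR n} :
    Measurable f ↔ ∀ i k, Measurable fun a => (f a : Matrix (Fin n) (Fin n) ℝ) i k := by
  have h1 : (inferInstance : MeasurableSpace (SLR n)) = MeasurableSpace.comap (fun g : SLR n => ((fun i k => (g : Matrix (Fin n) (Fin n) ℝ) i k) : Fin n → Fin n → ℝ)) inferInstance := by
    have h2 : (inferInstance : MeasurableSpace (Fin n → Fin n → ℝ)) = borel _ := BorelSpace.measurable_eq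
    rw [h2, ← borel_comap]; rfl
  have h3 : Measurable f ↔ Measurable fun a => ((fun i k => (f a : Matrix (Fin n) (Fin n) ℝ) i k) : Fin n → Fin n → ℝ) := by
    constructor
    · intro hf
      have h4 : Measurable[MeasurableSpace.comap _ _, _] fun g : SLR n => ((fun i k => (g : Matrix (Fin n) (Fin n) ℝ) i k) : Fin n → Fin n → ℝ) := comap_measurable _
      rw [← h1] at h4
      exact h4.comp hf
    · intro hf
      have := (measurable_comap_iff (g := fun g : SLR n => ((fun i k => (g : Matrix (Fin n) (Fin n) ℝ) i k) : Fin n → Fin n → ℝ)) (f := f)).2 hf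
      rw [← h1] at this; exact this
  rw [h3, measurable_pi_iff]
  exact forall_congr' fun i => measurable_pi_iff

lemma measurable_SLR_apply {n : ℕ} (i k : Fin n) : Measurable fun g : SLR n => (g : Matrix (Fin n) (Fin n) ℝ) i k :=
  measurable_SLR_iff.1 measurable_id i k

lemma measure_eq_zero_of_forall_ae {α G : Type*} [MeasurableSpace α] [MeasurableSpace G] {κ : Measure α} [SFinite κ]
    [NeZero κ] {μ : Measure G} [SFinite μ] {Φ : α → G → G} (hΦ : Measurable fun x : α × G => Φ x.1 x.2)
    {E : Set G} (hE : MeasurableSet E) (hnull : ∀ a, μ {g | Φ a g ∈ E} = 0 → μ E = 0)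
    (h : ∀ᵐ g ∂μ, ∀ᵐ a ∂κ, Φ a g ∉ E) : μ E = 0 := by
  have h1 : ∀ᵐ a ∂κ, ∀ᵐ g ∂μ, Φ a g ∉ E := by
    rw [Measure.ae_ae_comm]
    · exact h
    · exact (hΦ hE).compl
  obtain ⟨a, ha⟩ := h1.exists
  refine hnull a ?_
  rw [ae_iff] at ha
  simpa using ha

lemma measurable_sharpFun {α : Type*} [MeasurableSpace α] {n : ℕ} (ε : Fin n → ℝ) (d : ℕ) (j : Fin n) (s : ℝ)
    {A : α → Matrix (Fin n) (Fin n) ℝ} {w : α → Fin n → ℝ} (hA : ∀ i k, Measurable fun a => A a i k)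
    (hw : Measurable w) {J : Set ℝ} (hJ : MeasurableSet J) : Measurable fun a => sharpFun ε d j s (A a) J (w a) := by
  refine Measurable.mul ?_ (Measurable.mul ?_ (measurable_gradWeight ε d hA hw j))
  · exact (measurable_one.indicator hJ).comp (measurable_form ε d hA hw)
  · exact (measurable_one.indicator measurableSet_Iic).comp (continuous_sqNorm.measurable.comp hw)

lemma measurable_sharpSum {n : ℕ} (ε : Fin n → ℝ) (d : ℕ) (j : Fin n) (s : ℝ) {J : Set ℝ} (hJ : MeasurableSet J) :
    Measurable fun g : SLR n => sharpSum ε d j s (g : Matrix (Fin n) (Fin n) ℝ) J := by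
  unfold sharpSum
  exact Measurable.tsum fun v => (measurable_sharpFun ε d j s measurable_SLR_apply measurable_const hJ).ennreal_ofReal

lemma measurable_sharpVol {n : ℕ} (ε : Fin n → ℝ) (d : ℕ) (j : Fin n) (s : ℝ) {J : Set ℝ} (hJ : MeasurableSet J) :
    Measurable fun g : SLR n => sharpVol ε d j s (g : Matrix (Fin n) (Fin n) ℝ) J := by
  unfold sharpVol
  refine Measurable.lintegral_prod_right' (f := fun x : SLR n × (Fin n → ℝ) =>
    ENNReal.ofReal (sharpFun ε d j s (x.1 : Matrix (Fin n) (Fin n) ℝ) J x.2)) ?_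
  exact (measurable_sharpFun ε d j s (fun i k => (measurable_SLR_apply i k).comp measurable_fst) measurable_snd hJ).ennreal_ofReal

lemma measurableSet_latticeBalanced {n : ℕ} (ε : Fin n → ℝ) (d : ℕ) (j : Fin n) (s : ℕ → ℝ) {J : ℕ → Set ℝ}
    (hJ : ∀ k, 1 ≤ k → MeasurableSet (J k)) (e : ℝ) :
    MeasurableSet {g : SLR n | LatticeBalanced ε d j s J e (g : Matrix (Fin n) (Fin n) ℝ)} := by
  have h1 : {g : SLR n | LatticeBalanced ε d j s J e (g : Matrix (Fin n) (Fin n) ℝ)} =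
      {g : SLR n | ∃ C k0 : ℕ, ∀ k : ℕ, max k0 1 ≤ k →
    sharpSum ε d j (s k) (g : Matrix (Fin n) (Fin n) ℝ) (J k) ≤ ENNReal.ofReal ((1 + n * (1 / k : ℝ)) ^ 4)
      * sharpVol ε d j ((1 + n * (1 / k : ℝ)) ^ 3 * s k) (g : Matrix (Fin n) (Fin n) ℝ) (J k) + ENNReal.ofReal (C * (k:ℝ) ^ e) ∧
    sharpVol ε d j (s k) (g : Matrix (Fin n) (Fin n) ℝ) (J k) ≤ ENNReal.ofReal ((1 + n * (1 / k : ℝ)) ^ 4)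
      * sharpSum ε d j ((1 + n * (1 / k : ℝ)) ^ 3 * s k) (g : Matrix (Fin n) (Fin n) ℝ) (J k) + ENNReal.ofReal (C * (k:ℝ) ^ e)} := by
    ext g
    constructor
    · rintro ⟨C, k0, h⟩
      exact ⟨C, k0, fun k hk => h k (le_of_max_le_left hk)⟩
    · rintro ⟨C, k0, h⟩
      exact ⟨C, max k0 1, fun k hk => h k hk⟩
  rw [h1]
  simp only [Set.ofPred_exists, Set.ofPred_forall]
  refine MeasurableSet.iUnion fun C => MeasurableSet.iUnion fun k0 => MeasurableSet.iInter fun k =>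
    MeasurableSet.iInter fun hk => MeasurableSet.inter ?_ ?_
  · exact measurableSet_le (measurable_sharpSum ε d j _ (hJ k (le_of_max_le_right hk)))
      (((measurable_sharpVol ε d j _ (hJ k (le_of_max_le_right hk))).const_mul _).add_const _)
  · exact measurableSet_le (measurable_sharpVol ε d j _ (hJ k (le_of_max_le_right hk)))
      (((measurable_sharpSum ε d j _ (hJ k (le_of_max_le_right hk))).const_mul _).add_const _)

lemma measurable_shear {m : ℕ} (j : Fin (m + 1)) (i k : Fin (m + 1)) : Measurable fun u : Fin m → ℝ => shear j u i k := by
  refine Fin.succAboveCases j ?_ (fun l => ?_) i <;> simp only [shear, Matrix.updateCol_apply] <;> split_ifs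
  · simp
  · exact measurable_const
  · simpa using measurable_pi_apply l
  · exact measurable_const

/-- The shear as an element of the special linear group. -/
def shearSL {m : ℕ} (j : Fin (m + 1)) (u : Fin m → ℝ) : SLR (m + 1) := ⟨shear j u, det_shear j u⟩

lemma ae_latticeBalanced {m : ℕ} (hm : 2 ≤ m) {ε : Fin (m + 1) → ℝ} (hε : ∀ i, ε i ≠ 0) {d : ℕ}
    (hd : 2 ≤ d) (hdm : d ≤ m) (j : Fin (m + 1)) (μ : Measure (SLR (m + 1))) [μ.IsHaarMeasure]
    (hA : ∀ᵐ g : SLR (m + 1) ∂μ, ∑ i, ε i * (g : Matrix (Fin (m + 1)) (Fin (m + 1)) ℝ) j i ^ d ≠ 0)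
    {M a β c θ : ℝ} (hM : 0 ≤ M) (hc : 1 ≤ c)
    (ha3 : 3 ≤ a) (had : 2 * d ≤ a) (hβ : m + 6 ≤ β) (hθ0 : 0 ≤ θ) (hθ : θ < 1)
    {s : ℕ → ℝ} {J : ℕ → Set ℝ} (hs0 : ∀ k, 1 ≤ k → 1 / 2 ≤ s k) (hs : ∀ k, 1 ≤ k → s k ≤ c * (k:ℝ) ^ a)
    (hJm : ∀ k, 1 ≤ k → MeasurableSet (J k)) (hJM : ∀ k, 1 ≤ k → J k ⊆ Set.Icc (-M) M)
    (hJ : ∀ k, 1 ≤ k → (volume (J k)).toReal ≤ c * (k:ℝ) ^ (β - a * ((m : ℝ) + 1 - d))) :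
    ∀ᵐ g : SLR (m + 1) ∂μ, LatticeBalanced ε d j s J (β - θ) (g : Matrix (Fin (m + 1)) (Fin (m + 1)) ℝ) := by
  have hprob : IsProbabilityMeasure (volume.restrict (unitCube m)) :=
    ⟨by rw [Measure.restrict_apply_univ, volume_unitCube]⟩
  rw [ae_iff]
  have hf : Measurable fun x : (Fin m → ℝ) × SLR (m + 1) => shearSL j x.1 * x.2 := by
    refine Measurable.mul ?_ measurable_snd
    exact measurable_SLR_iff.2 fun i k => (measurable_shear j i k).comp measurable_fst
  refine measure_eq_zero_of_forall_ae (κ := volume.restrict (unitCube m)) (Φ := fun u g => shearSL j u * g) hf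
    (measurableSet_latticeBalanced ε d j s hJm (β - θ)).compl (fun u hu => ?_) ?_
  · rwa [← measure_preimage_mul μ (shearSL j u)]
  · filter_upwards [hA] with g hg
    filter_upwards [ae_balanced_shear hm hε hd hdm j (h := (g : Matrix (Fin (m + 1)) (Fin (m + 1)) ℝ)) g.2 hg hM hc ha3 had hβ hθ0 hθ hs0 hs hJm hJM hJ] with u hu
    exact fun hn => hn hu

/-- The diagonal one-parameter subgroup with exponents `εᵢ`, normalised to have determinant one. -/
def diagSL {n : ℕ} (ε : Fin n → ℝ) (τ : ℝ) : SLR n :=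
  ⟨Matrix.diagonal fun i => Real.exp (τ * (ε i - (∑ k, ε k) / n)), by
    rw [Matrix.det_diagonal, ← Real.exp_sum, ← Finset.mul_sum]
    rcases Nat.eq_zero_or_pos n with rfl | hn
    · simp
    · have : (n : ℝ) ≠ 0 := by positivity
      simp [Finset.sum_sub_distrib, mul_div_cancel₀ _ this]⟩

lemma measurable_diagSL {n : ℕ} (ε : Fin n → ℝ) : Measurable (diagSL ε) := by
  refine measurable_SLR_iff.2 fun i k => ?_
  simp only [diagSL, Matrix.diagonal_apply]
  split_ifs
  · fun_prop
  · exact measurable_const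

lemma strictMono_sum_exp {n : ℕ} {ε : Fin n → ℝ} (hε : ∀ i, ε i ≠ 0) {d : ℕ} (hd : 0 < d) (hde : Even d)
    {x : Fin n → ℝ} (hx : x ≠ 0) : StrictMono fun τ : ℝ => ∑ i, ε i * x i ^ d * Real.exp (d * (τ * ε i)) := by
  have hd' : (0:ℝ) < d := by exact_mod_cast hd
  intro τ τ' h
  have key : ∀ i, ε i * Real.exp (d * (τ * ε i)) < ε i * Real.exp (d * (τ' * ε i)) := by
    intro i
    rcases lt_or_gt_of_ne (hε i) with h0 | h0
    · refine mul_lt_mul_of_neg_left (Real.exp_lt_exp.2 (mul_lt_mul_of_pos_left ?_ hd')) h0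
      exact mul_lt_mul_of_neg_right h h0
    · refine mul_lt_mul_of_pos_left (Real.exp_lt_exp.2 (mul_lt_mul_of_pos_left ?_ hd')) h0
      exact mul_lt_mul_of_pos_right h h0
  obtain ⟨i, hi⟩ := Function.ne_iff.1 hx
  refine Finset.sum_lt_sum (fun k _ => ?_) ⟨i, Finset.mem_univ i, ?_⟩
  · have := mul_le_mul_of_nonneg_left (key k).le (hde.pow_nonneg (x k))
    nlinarith
  · have := mul_lt_mul_of_pos_left (key i) (hde.pow_pos hi)
    nlinarith

/-- Almost surely the form does not vanish at a given row. -/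
lemma ae_sum_row_ne_zero {n : ℕ} {ε : Fin n → ℝ} (hε : ∀ i, ε i ≠ 0) {d : ℕ} (hd : 0 < d) (hde : Even d)
    (j : Fin n) (μ : Measure (SLR n)) [μ.IsHaarMeasure] :
    ∀ᵐ g : SLR n ∂μ, ∑ i, ε i * (g : Matrix (Fin n) (Fin n) ℝ) j i ^ d ≠ 0 := by
  have hprob : IsProbabilityMeasure (volume.restrict (Set.Icc (0:ℝ) 1)) :=
    ⟨by rw [Measure.restrict_apply_univ]; simp⟩
  have hf : Measurable fun x : ℝ × SLR n => x.2 * diagSL ε x.1 :=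
    measurable_snd.mul ((measurable_diagSL ε).comp measurable_fst)
  have hE : MeasurableSet {g : SLR n | ∑ i, ε i * (g : Matrix (Fin n) (Fin n) ℝ) j i ^ d ≠ 0} := by
    refine (measurableSet_eq_fun (Finset.measurable_sum _ fun i _ => ?_) measurable_const).compl
    exact ((measurable_SLR_apply j i).pow_const d).const_mul _
  rw [ae_iff]
  refine measure_eq_zero_of_forall_ae (κ := volume.restrict (Set.Icc (0:ℝ) 1)) (Φ := fun τ g => g * diagSL ε τ)
    hf hE.compl (fun τ hτ => (measure_mul_right_null μ (diagSL ε τ)).1 hτ) (Eventually.of_forall fun g => ?_)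
  have hrow : (g : Matrix (Fin n) (Fin n) ℝ) j ≠ 0 := fun h0 => by
    have := Matrix.det_eq_zero_of_row_eq_zero (A := (g : Matrix (Fin n) (Fin n) ℝ)) j (fun i => congrFun h0 i)
    rw [g.2] at this
    exact one_ne_zero this
  have hinj := (strictMono_sum_exp hε hd hde hrow).injective
  refine ae_restrict_of_ae ?_
  refine measure_mono_null (t := {τ : ℝ | ∑ i, ε i * (g : Matrix (Fin n) (Fin n) ℝ) j i ^ d * Real.exp (d * (τ * ε i)) = 0}) ?_ ?_
  · intro τ hτ
    have h0 : ∑ i, ε i * ((g * diagSL ε τ : SLR n) : Matrix (Fin n) (Fin n) ℝ) j i ^ d = 0 := by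
      by_contra hne
      exact hτ fun hn => hn hne
    have h1 : ∀ i, ε i * ((g * diagSL ε τ : SLR n) : Matrix (Fin n) (Fin n) ℝ) j i ^ d
        = Real.exp (-(d * (τ * ((∑ k, ε k) / n)))) * (ε i * (g : Matrix (Fin n) (Fin n) ℝ) j i ^ d * Real.exp (d * (τ * ε i))) := by
      intro i
      have h2 : ((g * diagSL ε τ : SLR n) : Matrix (Fin n) (Fin n) ℝ) j i
          = (g : Matrix (Fin n) (Fin n) ℝ) j i * Real.exp (τ * (ε i - (∑ k, ε k) / n)) := by
        rw [Matrix.SpecialLinearGroup.coe_mul]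
        exact Matrix.mul_diagonal _ _ _ _
      rw [h2, mul_pow, ← Real.exp_nat_mul, show (d:ℝ) * (τ * (ε i - (∑ k, ε k) / n))
        = -(d * (τ * ((∑ k, ε k) / n))) + d * (τ * ε i) by ring, Real.exp_add]
      ring
    rw [Finset.sum_congr rfl fun i _ => h1 i, ← Finset.mul_sum] at h0
    exact (mul_eq_zero.1 h0).resolve_left (Real.exp_ne_zero _)
  · refine Set.Subsingleton.measure_zero (fun τ hτ τ' hτ' => hinj ?_) _
    exact (Eq.trans hτ (Eq.symm hτ') :)

lemma one_add_pow_le {x : ℝ} (hx0 : 0 ≤ x) (hx1 : x ≤ 1) (N : ℕ) : (1 + x) ^ N ≤ 1 + 3 ^ N * x := by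
  induction N with
  | zero => simp; exact hx0
  | succ N ih =>
    have h2 : (1:ℝ) ≤ 3 ^ N := one_le_pow₀ (by norm_num)
    calc (1 + x) ^ (N + 1) = (1 + x) ^ N * (1 + x) := pow_succ _ _
      _ ≤ (1 + 3 ^ N * x) * (1 + x) := by gcongr
      _ ≤ _ := by rw [pow_succ]; nlinarith [mul_nonneg hx0 hx0, mul_le_mul_of_nonneg_left hx1 hx0, mul_le_mul_of_nonneg_left (mul_le_mul_of_nonneg_left hx1 hx0) (zero_le_one.trans h2)]

lemma sq_rpow_quarter {t : ℝ} (ht : 0 ≤ t) : (t ^ (1 / 4 : ℝ)) ^ 2 = Real.sqrt t := by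
  rw [← Real.rpow_natCast, ← Real.rpow_mul ht, Real.sqrt_eq_rpow]
  norm_num

/-- Convergence with a rate for a family which is almost monotone under dilation. -/
lemma exists_limit_of_dilation {ι : Type*} (X : ℝ → ι → ℝ) (k0 : ι) (hX : ∀ s i, 0 ≤ X s i) {N : ℕ} {C : ℝ}
    (hC : 0 ≤ C)
    (h1 : ∀ lam s : ℝ, 1 ≤ lam → 0 < s → ∀ i i',
      X s i ≤ (1 + 1 / lam) ^ N * X (Real.sqrt (1 + 1 / lam) * s) i' + C * lam / Real.sqrt s)
    (h2 : ∀ ρ s : ℝ, 1 ≤ ρ → 0 < s → ∃ i, X (ρ * s) k0 = X s i) :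
    ∃ c : ℝ, 0 ≤ c ∧ ∃ C' : ℝ, 0 ≤ C' ∧ ∀ t : ℝ, 2 ≤ t → ∀ i, |X t i - c| ≤ C' * t ^ (-(1 / 4) : ℝ) := by
  have h2' : ∀ s τ : ℝ, 0 < s → s ≤ τ → ∃ i, X τ k0 = X s i := by
    intro s τ hs hsτ
    obtain ⟨i, hi⟩ := h2 (τ / s) s ((one_le_div hs).2 hsτ) hs
    exact ⟨i, by rw [← hi, div_mul_cancel₀ _ hs.ne']⟩
  have hs2 : (1:ℝ) ≤ Real.sqrt 2 := Real.one_le_sqrt.2 (by norm_num)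
  have hs2' : Real.sqrt 2 ≤ 2 := by rw [Real.sqrt_le_left (by norm_num)]; norm_num
  have hb1 : ∀ s : ℝ, 1 ≤ s → ∀ i, X s i ≤ 2 ^ N * X (Real.sqrt 2 * s) k0 + C := by
    intro s hs i
    have := h1 1 s le_rfl (by linarith) i k0
    norm_num at this
    refine this.trans (add_le_add_right (div_le_self hC (Real.one_le_sqrt.2 hs)) _)
  set B := 2 ^ N * (2 ^ N * X (Real.sqrt 2) k0 + C) + C
  have hB : ∀ s : ℝ, 1 ≤ s → ∀ i, X s i ≤ B := by
    intro s hs i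
    refine (hb1 s hs i).trans ?_
    obtain ⟨i', hi'⟩ := h2' 1 (Real.sqrt 2 * s) one_pos (by nlinarith)
    have h3 := hb1 1 le_rfl i'
    rw [mul_one] at h3
    rw [hi']
    have : (0:ℝ) ≤ 2 ^ N := by positivity
    simp only [B]
    gcongr
  have hB0 : 0 ≤ B := (hX 1 k0).trans (hB 1 le_rfl k0)
  set C3 := 3 ^ N * B + 2 * C
  have hC3 : 0 ≤ C3 := by positivity
  have hu : ∀ t : ℝ, 2 ≤ t → 1 ≤ t ^ (1 / 4 : ℝ) := fun t ht => Real.one_le_rpow (by linarith) (by norm_num)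
  have hinv : ∀ t : ℝ, 2 ≤ t → t ^ (-(1 / 4) : ℝ) = 1 / t ^ (1 / 4 : ℝ) := fun t ht => by
    rw [Real.rpow_neg (by linarith), one_div (t ^ _)]
  have gen : ∀ t s : ℝ, 2 ≤ t → 1 ≤ s → t ≤ 2 * s → ∀ i i',
      1 ≤ Real.sqrt (1 + 1 / t ^ (1 / 4 : ℝ)) * s →
      X s i ≤ X (Real.sqrt (1 + 1 / t ^ (1 / 4 : ℝ)) * s) i' + C3 * t ^ (-(1 / 4) : ℝ) := by
    intro t s ht hs hts i i' h4
    have hut := hu t ht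
    have hut0 : 0 < t ^ (1 / 4 : ℝ) := by linarith
    have h5 := h1 (t ^ (1 / 4 : ℝ)) s hut (by linarith) i i'
    have h6 := hB _ h4 i'
    have h7 := one_add_pow_le (x := 1 / t ^ (1 / 4 : ℝ)) (by positivity) ((div_le_one hut0).2 hut) N
    have h8 : C * t ^ (1 / 4 : ℝ) / Real.sqrt s ≤ 2 * C * (1 / t ^ (1 / 4 : ℝ)) := by
      have h9 : (t ^ (1 / 4 : ℝ)) ^ 2 ≤ 2 * Real.sqrt s := by
        rw [sq_rpow_quarter (by linarith)]
        calc Real.sqrt t ≤ Real.sqrt (2 * s) := Real.sqrt_le_sqrt hts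
          _ = Real.sqrt 2 * Real.sqrt s := Real.sqrt_mul (by norm_num) _
          _ ≤ _ := by gcongr
      rw [mul_one_div, div_le_div_iff₀ (Real.sqrt_pos.2 (by linarith)) hut0]
      nlinarith [mul_le_mul_of_nonneg_left h9 hC]
    rw [hinv t ht]
    calc X s i ≤ (1 + 3 ^ N * (1 / t ^ (1 / 4 : ℝ))) * X (Real.sqrt (1 + 1 / t ^ (1 / 4 : ℝ)) * s) i'
          + 2 * C * (1 / t ^ (1 / 4 : ℝ)) :=
          h5.trans (add_le_add (mul_le_mul_of_nonneg_right h7 (hX _ _)) h8)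
      _ ≤ _ := by
          have h10 : 0 ≤ 3 ^ N * (1 / t ^ (1 / 4 : ℝ)) := by positivity
          have := mul_le_mul_of_nonneg_left h6 h10
          simp only [C3]
          linarith
  have hr1 : ∀ t : ℝ, 2 ≤ t → 1 ≤ Real.sqrt (1 + 1 / t ^ (1 / 4 : ℝ)) := fun t ht => by
    have := hu t ht
    exact Real.one_le_sqrt.2 (by simp; linarith)
  have hr2 : ∀ t : ℝ, 2 ≤ t → Real.sqrt (1 + 1 / t ^ (1 / 4 : ℝ)) ≤ 2 := fun t ht => by
    have h3 := hu t ht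
    have : 1 / t ^ (1 / 4 : ℝ) ≤ 1 := (div_le_one (by linarith)).2 h3
    rw [Real.sqrt_le_left (by norm_num)]
    linarith
  have main : ∀ t τ : ℝ, 2 ≤ t → 2 * t ≤ τ → ∀ i, |X t i - X τ k0| ≤ C3 * t ^ (-(1 / 4) : ℝ) := by
    intro t τ ht hτ i
    have e1 := hr1 t ht
    have e2 := hr2 t ht
    set r := Real.sqrt (1 + 1 / t ^ (1 / 4 : ℝ)) with hr
    rw [abs_le]
    constructor
    · have hs1 : 1 ≤ t / r := by rw [le_div_iff₀ (by linarith)]; linarith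
      obtain ⟨i', hi'⟩ := h2' (t / r) τ (by linarith) (by rw [div_le_iff₀ (by linarith)]; nlinarith)
      have hts : r * (t / r) = t := mul_div_cancel₀ _ (by linarith)
      have := gen t (t / r) ht hs1 (by rw [← mul_div_assoc, le_div_iff₀ (by linarith)]; nlinarith) i' i
        (by rw [← hr, hts]; linarith)
      rw [← hr, hts, ← hi'] at this
      linarith
    · obtain ⟨i', hi'⟩ := h2' (r * t) τ (by positivity) (by nlinarith)
      have := gen t t ht (by linarith) (by linarith) i i' (by rw [← hr]; nlinarith)
      rw [← hr, ← hi'] at this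
      linarith
  have ht0 : Tendsto (fun t : ℝ => C3 * t ^ (-(1 / 4) : ℝ)) atTop (nhds 0) := by
    have := (tendsto_rpow_neg_atTop (y := 1 / 4) (by norm_num)).const_mul C3
    rwa [mul_zero] at this
  have hcau : CauchySeq fun τ : ℝ => X τ k0 := by
    rw [Metric.cauchySeq_iff]
    intro η hη
    obtain ⟨t, ht, ht2⟩ := ((ht0.eventually (gt_mem_nhds (half_pos hη))).and (eventually_ge_atTop 2)).exists
    refine ⟨2 * t, fun τ hτ τ' hτ' => ?_⟩
    have e1 := main t τ ht2 hτ k0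
    have e2 := main t τ' ht2 hτ' k0
    rw [Real.dist_eq]
    rw [abs_lt]
    rw [abs_le] at e1 e2
    constructor <;> linarith
  obtain ⟨c, hc⟩ := cauchySeq_tendsto_of_complete hcau
  refine ⟨c, ge_of_tendsto' hc fun τ => hX τ k0, C3, hC3, fun t ht i => ?_⟩
  refine le_of_tendsto ((hc.const_sub (X t i)).abs) ?_
  filter_upwards [eventually_ge_atTop (2 * t)] with τ hτ
  exact main t τ ht hτ i

lemma abs_integral_shellFun_div_sub_le_sqrt {m : ℕ} {ε : Fin (m + 1) → ℝ} (hε : ∀ i, ε i ≠ 0) {d : ℕ} (hd : 2 ≤ d)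
    (hdm : d ≤ m) (j : Fin (m + 1)) {g : Matrix (Fin (m + 1)) (Fin (m + 1)) ℝ} (hg : g.det = 1)
    (hgj : ∑ i, ε i * g j i ^ d ≠ 0) {M : ℝ} (hM : 0 ≤ M) : ∃ C : ℝ, 0 ≤ C ∧
      ∀ lam T : ℝ, 1 ≤ lam → 0 < T → ∀ I I' : Set ℝ,
      MeasurableSet I → I ⊆ Set.Icc (-M) M → MeasurableSet I' → I' ⊆ Set.Icc (-M) M →
      volume I ≠ 0 → volume I' ≠ 0 →
      |(∫ w, shellFun ε d j lam T g I w) / (volume I).toReal -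
        (∫ w, shellFun ε d j lam T g I' w) / (volume I').toReal| ≤ C * lam * (T ^ (m - d) * Real.sqrt T) := by
  set R : ℝ := 1 / |∑ i, ε i * g j i ^ d| + ∑ i, ∑ k, |g i k| with hR
  have hpos : 0 < |∑ i, ε i * g j i ^ d| := abs_pos.2 hgj
  have hS : 0 ≤ ∑ i, ∑ k, |g i k| := Finset.sum_nonneg fun i _ => Finset.sum_nonneg fun k _ => abs_nonneg _
  have hR0 : 0 < R := by positivity
  have hgR : g ∈ boundedSL (m + 1) R := by
    refine ⟨hg, fun i k => ?_⟩
    have e1 : |g i k| ≤ ∑ k, |g i k| := Finset.single_le_sum (f := fun k => |g i k|) (fun _ _ => abs_nonneg _) (Finset.mem_univ k)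
    have e2 : ∑ k, |g i k| ≤ ∑ i, ∑ k, |g i k| := Finset.single_le_sum (f := fun i => ∑ k, |g i k|)
      (fun i _ => Finset.sum_nonneg fun _ _ => abs_nonneg _) (Finset.mem_univ i)
    have : 0 < 1 / |∑ i, ε i * g j i ^ d| := by positivity
    linarith
  have hgj' : 1 / R ≤ |∑ i, ε i * g j i ^ d| := by
    rw [div_le_iff₀ hR0, hR, mul_add, mul_one_div_cancel hpos.ne']
    nlinarith
  obtain ⟨C1, hC1, h1⟩ := abs_integral_shellFun_le hε hd j R
  obtain ⟨C2, hC2, h2⟩ := abs_integral_shellFun_div_sub_le hε hd j hR0 hM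
  refine ⟨2 * C1 + C2, by linarith, fun lam T hl hT I I' hI hIM hI' hIM' hI0 hI0' => ?_⟩
  have hdiv : ∀ A : Set ℝ, MeasurableSet A → A ⊆ Set.Icc (-M) M → volume A ≠ 0 →
      |(∫ w, shellFun ε d j lam T g A w) / (volume A).toReal| ≤ C1 * lam * (T ^ (m - d) * T) := by
    intro A hA hAM hA0
    have hf : volume A ≠ ⊤ := ((measure_mono hAM).trans_lt (by simp)).ne
    have hv : 0 < (volume A).toReal := ENNReal.toReal_pos hA0 hf
    have := h1 g hgR lam T hl hT A hA hf
    rw [← mul_assoc (T ^ m), pow_mul_inv_pow_of_le hdm hT.ne'] at this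
    rw [abs_div, abs_of_pos hv, div_le_iff₀ hv]
    linarith
  have b2 := h2 g hgR hgj' lam T hl hT I I' hI hIM hI' hIM' hI0 hI0'
  rw [pow_mul_inv_pow_of_le hdm hT.ne'] at b2
  have hTp : 0 ≤ T ^ (m - d) := by positivity
  have hl0 : 0 ≤ lam := by linarith
  have hA : 0 ≤ lam * T ^ (m - d) := by positivity
  rcases le_total T 1 with hT1 | hT1
  · have hs : T ≤ Real.sqrt T := Real.le_sqrt_of_sq_le (by nlinarith)
    have e1 := hdiv I hI hIM hI0
    have e2 := hdiv I' hI' hIM' hI0'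
    have e3 := abs_sub ((∫ w, shellFun ε d j lam T g I w) / (volume I).toReal) ((∫ w, shellFun ε d j lam T g I' w) / (volume I').toReal)
    have e4 : (lam * T ^ (m - d)) * T ≤ (lam * T ^ (m - d)) * Real.sqrt T := mul_le_mul_of_nonneg_left hs hA
    have e5 : 0 ≤ (lam * T ^ (m - d)) * Real.sqrt T := by positivity
    nlinarith
  · have hs : 1 ≤ Real.sqrt T := Real.one_le_sqrt.2 hT1
    have e4 : (lam * T ^ (m - d)) * 1 ≤ (lam * T ^ (m - d)) * Real.sqrt T := mul_le_mul_of_nonneg_left hs hA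
    have e5 : 0 ≤ (lam * T ^ (m - d)) * Real.sqrt T := by positivity
    nlinarith

lemma sum_sqrt_div_two_pow_le {T : ℝ} (hT : 0 ≤ T) (q : ℕ) :
    ∑ i ∈ Finset.range q, Real.sqrt (T / 2 ^ i) ≤ 4 * Real.sqrt T := by
  have hx : ∀ i : ℕ, Real.sqrt (T / 2 ^ i) ≤ Real.sqrt T * (3 / 4) ^ i := by
    intro i
    rw [Real.sqrt_le_left (by positivity), mul_pow, Real.sq_sqrt hT, div_eq_mul_inv]
    refine mul_le_mul_of_nonneg_left ?_ hT
    rw [← pow_mul, mul_comm i 2, pow_mul, ← inv_pow]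
    gcongr
    norm_num
  calc ∑ i ∈ Finset.range q, Real.sqrt (T / 2 ^ i) ≤ ∑ i ∈ Finset.range q, Real.sqrt T * (3 / 4) ^ i :=
        Finset.sum_le_sum fun i _ => hx i
    _ = Real.sqrt T * ∑ i ∈ Finset.range q, (3 / 4 : ℝ) ^ i := by rw [Finset.mul_sum]
    _ ≤ Real.sqrt T * 4 := by
        refine mul_le_mul_of_nonneg_left ?_ (Real.sqrt_nonneg _)
        have := (summable_geometric_of_lt_one (r := (3 / 4 : ℝ)) (by norm_num) (by norm_num)).sum_le_tsum
          (Finset.range q) (fun _ _ => by positivity)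
        rw [tsum_geometric_of_lt_one (by norm_num) (by norm_num)] at this
        norm_num at this ⊢
        exact this
    _ = _ := by ring

lemma abs_integral_ballFun_div_sub_le {m : ℕ} {ε : Fin (m + 1) → ℝ} (hε : ∀ i, ε i ≠ 0) {d : ℕ} (hd : 2 ≤ d)
    (hdm : d ≤ m) (j : Fin (m + 1)) {g : Matrix (Fin (m + 1)) (Fin (m + 1)) ℝ} (hg : g.det = 1)
    (hgj : ∑ i, ε i * g j i ^ d ≠ 0) {M : ℝ} (hM : 0 ≤ M) : ∃ C : ℝ, 0 ≤ C ∧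
      ∀ lam T : ℝ, 1 ≤ lam → 0 < T → ∀ I I' : Set ℝ,
      MeasurableSet I → I ⊆ Set.Icc (-M) M → MeasurableSet I' → I' ⊆ Set.Icc (-M) M →
      volume I ≠ 0 → volume I' ≠ 0 →
      |(∫ w, ballFun ε d j lam T g I w) / (volume I).toReal -
        (∫ w, ballFun ε d j lam T g I' w) / (volume I').toReal| ≤ C * lam * (T ^ (m - d) * Real.sqrt T) := by
  obtain ⟨C, hC, h⟩ := abs_integral_shellFun_div_sub_le_sqrt hε hd hdm j hg hgj hM
  refine ⟨4 * C, by linarith, fun lam T hl hT I I' hI hIM hI' hIM' hI0 hI0' => ?_⟩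
  set V := (volume I).toReal
  set V' := (volume I').toReal
  have hV : 0 ≤ V := ENNReal.toReal_nonneg
  have hV' : 0 ≤ V' := ENNReal.toReal_nonneg
  have hsum : ∀ q : ℕ, ∀ A : Set ℝ, MeasurableSet A → ∑ i ∈ Finset.range q, ∫ w, shellFun ε d j lam (T / 2 ^ i) g A w
      = (∫ w, ballFun ε d j lam T g A w) - ∫ w, ballFun ε d j lam (T / 2 ^ q) g A w := by
    intro q A hA
    rw [← integral_finsetSum _ fun i _ => integrable_shellFun ε d j hl (by positivity) g hA,
      ← integral_sub (integrable_ballFun ε d j hl hT g hA) (integrable_ballFun ε d j hl (by positivity) g hA)]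
    exact integral_congr_ae (Eventually.of_forall fun w => sum_shellFun ε d j lam T g A w q)
  have hrem : ∀ q : ℕ, ∀ A : Set ℝ, |∫ w, ballFun ε d j lam (T / 2 ^ q) g A w| ≤ (4 * (T / 2 ^ q)) ^ (m + 1) := by
    intro q A
    rw [abs_of_nonneg (integral_nonneg fun w => ballFun_nonneg _ _ _ _ _ _ _ _)]
    exact integral_ballFun_le ε d j hl (by positivity) g
  have hq : ∀ q : ℕ, |(∫ w, ballFun ε d j lam T g I w) / V - (∫ w, ballFun ε d j lam T g I' w) / V'|
      ≤ 4 * C * lam * (T ^ (m - d) * Real.sqrt T) + (4 * (T / 2 ^ q)) ^ (m + 1) * (1 / V + 1 / V') := by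
    intro q
    have e1 : (∫ w, ballFun ε d j lam T g I w) / V - (∫ w, ballFun ε d j lam T g I' w) / V'
        = (∑ i ∈ Finset.range q, ((∫ w, shellFun ε d j lam (T / 2 ^ i) g I w) / V
          - (∫ w, shellFun ε d j lam (T / 2 ^ i) g I' w) / V'))
          + ((∫ w, ballFun ε d j lam (T / 2 ^ q) g I w) / V - (∫ w, ballFun ε d j lam (T / 2 ^ q) g I' w) / V') := by
      rw [Finset.sum_sub_distrib, ← Finset.sum_div, ← Finset.sum_div, hsum q I hI, hsum q I' hI']
      ring
    rw [e1]
    refine (abs_add_le _ _).trans (add_le_add ?_ ?_)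
    · refine (Finset.abs_sum_le_sum_abs _ _).trans ?_
      calc _ ≤ ∑ i ∈ Finset.range q, C * lam * (T ^ (m - d) * Real.sqrt (T / 2 ^ i)) := by
            refine Finset.sum_le_sum fun i _ => (h lam (T / 2 ^ i) hl (by positivity) I I' hI hIM hI' hIM' hI0 hI0').trans ?_
            have : T / 2 ^ i ≤ T := div_le_self hT.le (one_le_pow₀ (by norm_num))
            gcongr
        _ = C * lam * T ^ (m - d) * ∑ i ∈ Finset.range q, Real.sqrt (T / 2 ^ i) := by
            rw [Finset.mul_sum]; exact Finset.sum_congr rfl fun i _ => by ring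
        _ ≤ C * lam * T ^ (m - d) * (4 * Real.sqrt T) := by
            gcongr
            exact sum_sqrt_div_two_pow_le hT.le q
        _ = _ := by ring
    · refine (abs_sub _ _).trans ?_
      rw [abs_div, abs_div, abs_of_nonneg hV, abs_of_nonneg hV', mul_add, mul_one_div, mul_one_div]
      gcongr
      · exact hrem q I
      · exact hrem q I'
  have hlim : Tendsto (fun q : ℕ => 4 * C * lam * (T ^ (m - d) * Real.sqrt T) + (4 * (T / 2 ^ q)) ^ (m + 1) * (1 / V + 1 / V'))
      atTop (nhds (4 * C * lam * (T ^ (m - d) * Real.sqrt T) + (4 * 0) ^ (m + 1) * (1 / V + 1 / V'))) := by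
    have h0 : Tendsto (fun q : ℕ => T / 2 ^ q) atTop (nhds 0) :=
      tendsto_const_nhds.div_atTop (tendsto_pow_atTop_atTop_of_one_lt (by norm_num))
    exact (((h0.const_mul 4).pow (m + 1)).mul_const _).const_add _
  have := ge_of_tendsto' hlim hq
  simpa using this

lemma sharpFun_le_one {n : ℕ} (ε : Fin n → ℝ) (d : ℕ) (j : Fin n) (s : ℝ) (g : Matrix (Fin n) (Fin n) ℝ)
    (J : Set ℝ) (w : Fin n → ℝ) : sharpFun ε d j s g J w ≤ 1 := by
  have hi : ∀ (A : Set ℝ) x, A.indicator (1 : ℝ → ℝ) x ≤ 1 := fun A x =>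
    Set.indicator_le' (fun _ _ => le_rfl) (fun _ _ => zero_le_one) _
  have h0 : ∀ (A : Set ℝ) x, 0 ≤ A.indicator (1 : ℝ → ℝ) x := fun A x =>
    Set.indicator_nonneg (f := (1:ℝ→ℝ)) (fun _ _ => zero_le_one) _
  exact mul_le_one₀ (hi _ _) (mul_nonneg (h0 _ _) (gradWeight_nonneg _ _ _ _ _))
    (mul_le_one₀ (hi _ _) (gradWeight_nonneg _ _ _ _ _) (gradWeight_le_one _ _ _ _ _))

lemma measurable_sharpFun_right {n : ℕ} (ε : Fin n → ℝ) (d : ℕ) (j : Fin n) (s : ℝ) (g : Matrix (Fin n) (Fin n) ℝ)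
    {J : Set ℝ} (hJ : MeasurableSet J) : Measurable (sharpFun ε d j s g J) :=
  measurable_sharpFun ε d j s (A := fun _ => g) (fun _ _ => measurable_const) measurable_id hJ

lemma integrable_sharpFun {n : ℕ} (ε : Fin n → ℝ) (d : ℕ) (j : Fin n) {s : ℝ} (hs : 0 < s) (g : Matrix (Fin n) (Fin n) ℝ)
    {J : Set ℝ} (hJ : MeasurableSet J) : Integrable (sharpFun ε d j s g J) := by
  refine integrable_of_bounded_support (measurable_sharpFun_right ε d j s g hJ) (B := 1) (r := 2 * s) (fun w => ?_)
    (fun w hw => ?_)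
  · rw [abs_of_nonneg (sharpFun_nonneg _ _ _ _ _ _ _)]
    exact sharpFun_le_one _ _ _ _ _ _ _
  · refine sharpFun_eq_zero ε d j g J ?_
    by_contra! hc
    have := norm_le_of_sqNorm hs.le hc
    linarith

lemma toReal_sharpVol {n : ℕ} (ε : Fin n → ℝ) (d : ℕ) (j : Fin n) (s : ℝ) (g : Matrix (Fin n) (Fin n) ℝ)
    {J : Set ℝ} (hJ : MeasurableSet J) : (sharpVol ε d j s g J).toReal = ∫ w, sharpFun ε d j s g J w := by
  rw [integral_eq_lintegral_of_nonneg_ae (Eventually.of_forall fun w => sharpFun_nonneg _ _ _ _ _ _ _)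
    (measurable_sharpFun_right ε d j s g hJ).aestronglyMeasurable]
  rfl

lemma sharpVol_ne_top {n : ℕ} (ε : Fin n → ℝ) (d : ℕ) (j : Fin n) {s : ℝ} (hs : 0 < s) (g : Matrix (Fin n) (Fin n) ℝ)
    {J : Set ℝ} (hJ : MeasurableSet J) : sharpVol ε d j s g J ≠ ⊤ := by
  rw [sharpVol, ← ofReal_integral_eq_lintegral_ofReal (integrable_sharpFun ε d j hs g hJ)
    (Eventually.of_forall fun w => sharpFun_nonneg _ _ _ _ _ _ _)]
  exact ENNReal.ofReal_ne_top

lemma sharpFun_le_ballFun_self {n : ℕ} (ε : Fin n → ℝ) (d : ℕ) (j : Fin n) {s lam : ℝ} (hs : 0 < s) (hl : 0 ≤ lam)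
    (g : Matrix (Fin n) (Fin n) ℝ) (J : Set ℝ) (w : Fin n → ℝ) :
    sharpFun ε d j s g J w ≤ ballFun ε d j lam s g J w := by
  rw [ballFun_matrix, sharpFun]
  refine mul_le_mul_of_nonneg_left (mul_le_mul_of_nonneg_right ?_ (gradWeight_nonneg _ _ _ _ _))
    (Set.indicator_nonneg (f := (1:ℝ→ℝ)) (fun _ _ => zero_le_one) _)
  by_cases hw : sqNorm w ≤ s ^ 2
  · rw [cutoff_eq_one hl]
    · exact Set.indicator_le' (fun _ _ => le_rfl) (fun _ _ => zero_le_one) _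
    · rw [sqNorm_smul, inv_pow, ← div_eq_inv_mul]
      exact div_le_one_of_le₀ hw (by positivity)
  · rw [Set.indicator_of_notMem (by simpa using hw)]
    exact cutoff_nonneg _ _

lemma ballFun_le_sharpFun_sqrt {n : ℕ} (ε : Fin n → ℝ) (d : ℕ) (j : Fin n) {s lam : ℝ} (hs : 0 < s) (hl : 1 ≤ lam)
    (g : Matrix (Fin n) (Fin n) ℝ) (J : Set ℝ) (w : Fin n → ℝ) :
    ballFun ε d j lam s g J w ≤ sharpFun ε d j (Real.sqrt (1 + 1 / lam) * s) g J w := by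
  rw [ballFun_matrix, sharpFun]
  refine mul_le_mul_of_nonneg_left (mul_le_mul_of_nonneg_right ?_ (gradWeight_nonneg _ _ _ _ _))
    (Set.indicator_nonneg (f := (1:ℝ→ℝ)) (fun _ _ => zero_le_one) _)
  have hsq : (Real.sqrt (1 + 1 / lam) * s) ^ 2 = (1 + 1 / lam) * s ^ 2 := by
    rw [mul_pow, Real.sq_sqrt (by positivity)]
  by_cases hw : sqNorm w ≤ (Real.sqrt (1 + 1 / lam) * s) ^ 2
  · rw [Set.indicator_of_mem (by simpa using hw)]
    exact cutoff_le_one _ _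
  · rw [cutoff_eq_zero hl]
    · exact Set.indicator_nonneg (f := (1:ℝ→ℝ)) (fun _ _ => zero_le_one) _
    · rw [hsq] at hw
      rw [sqNorm_smul, inv_pow, ← div_eq_inv_mul, le_div_iff₀ (by positivity)]
      linarith

/-- The density of `sharpVol`, normalised by its expected size. -/
def sharpDensity {n : ℕ} (ε : Fin n → ℝ) (d : ℕ) (j : Fin n) (g : Matrix (Fin n) (Fin n) ℝ) (s : ℝ) (J : Set ℝ) : ℝ :=
  (∫ w, sharpFun ε d j s g J w) / ((volume J).toReal * |s| ^ (n - d))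

lemma sharpDensity_nonneg {n : ℕ} (ε : Fin n → ℝ) (d : ℕ) (j : Fin n) (g : Matrix (Fin n) (Fin n) ℝ) (s : ℝ) (J : Set ℝ) :
    0 ≤ sharpDensity ε d j g s J :=
  div_nonneg (integral_nonneg fun w => sharpFun_nonneg _ _ _ _ _ _ _) (by positivity)

lemma sharpDensity_mul {n : ℕ} (ε : Fin n → ℝ) {d : ℕ} (hdn : d ≤ n) (j : Fin n) (g : Matrix (Fin n) (Fin n) ℝ) {M : ℝ}
    (hM : 0 ≤ M) {ρ s : ℝ} (hρ : 0 < ρ) :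
    sharpDensity ε d j g (ρ * s) (Set.Icc (-M) M) = sharpDensity ε d j g s (Set.Icc (-(M / ρ ^ d)) (M / ρ ^ d)) := by
  have h1 : ∀ w, sharpFun ε d j (ρ * s) g (Set.Icc (-M) M) (ρ • w) = sharpFun ε d j s g (Set.Icc (-(M / ρ ^ d)) (M / ρ ^ d)) w := by
    intro w
    have hρd : 0 < ρ ^ d := by positivity
    have e1 : ρ ^ d * form ε d g w ∈ Set.Icc (-M) M ↔ form ε d g w ∈ Set.Icc (-(M / ρ ^ d)) (M / ρ ^ d) := by
      rw [Set.mem_Icc, Set.mem_Icc, le_div_iff₀ hρd, ← neg_div, div_le_iff₀ hρd, mul_comm]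
    have e2 : ρ ^ 2 * sqNorm w ∈ Set.Iic ((ρ * s) ^ 2) ↔ sqNorm w ∈ Set.Iic (s ^ 2) := by
      rw [Set.mem_Iic, Set.mem_Iic, mul_pow]
      exact mul_le_mul_iff_right₀ (by positivity)
    rw [sharpFun, sharpFun, form_smul, sqNorm_smul, gradWeight_smul _ _ _ _ hρ.ne']
    congr 1
    · by_cases h : form ε d g w ∈ Set.Icc (-(M / ρ ^ d)) (M / ρ ^ d)
      · rw [Set.indicator_of_mem h, Set.indicator_of_mem (e1.2 h)]; rfl
      · rw [Set.indicator_of_notMem h, Set.indicator_of_notMem (fun h' => h (e1.1 h'))]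
    · congr 1
      by_cases h : sqNorm w ∈ Set.Iic (s ^ 2)
      · rw [Set.indicator_of_mem h, Set.indicator_of_mem (e2.2 h)]; rfl
      · rw [Set.indicator_of_notMem h, Set.indicator_of_notMem (fun h' => h (e2.1 h'))]
  have h2 := Measure.integral_comp_smul (volume : Measure (Fin n → ℝ)) (sharpFun ε d j (ρ * s) g (Set.Icc (-M) M)) ρ
  simp only [h1, Module.finrank_fin_fun, smul_eq_mul] at h2
  rw [abs_of_nonneg (by positivity)] at h2
  have hvol : (volume (Set.Icc (-(M / ρ ^ d)) (M / ρ ^ d))).toReal * ρ ^ d = (volume (Set.Icc (-M) M)).toReal := by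
    rw [Real.volume_Icc, Real.volume_Icc, sub_neg_eq_add, sub_neg_eq_add, ENNReal.toReal_ofReal (by positivity),
      ENNReal.toReal_ofReal (by positivity)]
    field_simp
  rw [sharpDensity, sharpDensity, h2, ← hvol, abs_mul, abs_of_pos hρ, mul_pow, inv_mul_eq_div, div_div]
  congr 1
  rw [← pow_sub_mul_pow ρ hdn]
  ring

lemma sharpDensity_le {m : ℕ} {ε : Fin (m + 1) → ℝ} (hε : ∀ i, ε i ≠ 0) {d : ℕ} (hd : 2 ≤ d)
    (hdm : d ≤ m) (j : Fin (m + 1)) {g : Matrix (Fin (m + 1)) (Fin (m + 1)) ℝ} (hg : g.det = 1)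
    (hgj : ∑ i, ε i * g j i ^ d ≠ 0) {M : ℝ} (hM : 0 ≤ M) : ∃ C : ℝ, 0 ≤ C ∧
      ∀ lam s : ℝ, 1 ≤ lam → 0 < s → ∀ I I' : Set ℝ,
      MeasurableSet I → I ⊆ Set.Icc (-M) M → MeasurableSet I' → I' ⊆ Set.Icc (-M) M →
      volume I ≠ 0 → volume I' ≠ 0 →
      sharpDensity ε d j g s I ≤ (1 + 1 / lam) ^ (m + 1 - d) * sharpDensity ε d j g (Real.sqrt (1 + 1 / lam) * s) I'
        + C * lam / Real.sqrt s := by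
  obtain ⟨C, hC, h⟩ := abs_integral_ballFun_div_sub_le hε hd hdm j hg hgj hM
  refine ⟨C, hC, fun lam s hl hs I I' hI hIM hI' hIM' hI0 hI0' => ?_⟩
  have h1 := (abs_le.1 (h lam s hl hs I I' hI hIM hI' hIM' hI0 hI0')).2
  have e1 : (∫ w, sharpFun ε d j s g I w) ≤ ∫ w, ballFun ε d j lam s g I w :=
    integral_mono (integrable_sharpFun ε d j hs g hI) (integrable_ballFun ε d j hl hs g hI)
      fun w => sharpFun_le_ballFun_self ε d j hs (by linarith) g I w
  have hr1 : 1 ≤ Real.sqrt (1 + 1 / lam) := Real.one_le_sqrt.2 (by have : 0 ≤ 1 / lam := by positivity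
                                                                   linarith)
  have e2 : (∫ w, ballFun ε d j lam s g I' w) ≤ ∫ w, sharpFun ε d j (Real.sqrt (1 + 1 / lam) * s) g I' w :=
    integral_mono (integrable_ballFun ε d j hl hs g hI') (integrable_sharpFun ε d j (by positivity) g hI')
      fun w => ballFun_le_sharpFun_sqrt ε d j hs hl g I' w
  set V := (volume I).toReal
  set V' := (volume I').toReal
  have hV : 0 ≤ V := ENNReal.toReal_nonneg
  have hV' : 0 ≤ V' := ENNReal.toReal_nonneg
  set r := Real.sqrt (1 + 1 / lam) with hr
  have hr0 : 0 < r := by linarith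
  have hsp : 0 < s ^ (m + 1 - d) := by positivity
  have e3 : (∫ w, sharpFun ε d j s g I w) / V ≤ (∫ w, sharpFun ε d j (r * s) g I' w) / V' + C * lam * (s ^ (m - d) * Real.sqrt s) := by
    have := div_le_div_of_nonneg_right e1 hV
    have := div_le_div_of_nonneg_right e2 hV'
    linarith
  have e4 := div_le_div_of_nonneg_right e3 hsp.le
  rw [sharpDensity, abs_of_pos hs, ← div_div]
  refine e4.trans ?_
  rw [add_div]
  refine add_le_add ?_ ?_
  · have e5 : (∫ w, sharpFun ε d j (r * s) g I' w) / V' / s ^ (m + 1 - d) = r ^ (m + 1 - d) * sharpDensity ε d j g (r * s) I' := by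
      rw [sharpDensity, abs_of_pos (by positivity), ← div_div, mul_pow]
      field_simp
      rfl
    rw [e5]
    refine mul_le_mul_of_nonneg_right ?_ (sharpDensity_nonneg _ _ _ _ _ _)
    refine pow_le_pow_left₀ hr0.le ?_ _
    calc r ≤ r ^ 2 := by nlinarith
      _ = _ := Real.sq_sqrt (by positivity)
  · rw [show m + 1 - d = m - d + 1 by omega, pow_succ]
    have hss : Real.sqrt s * Real.sqrt s = s := Real.mul_self_sqrt hs.le
    have : 0 < Real.sqrt s := Real.sqrt_pos.2 hs
    refine le_of_eq ?_
    have hsp : s ^ (m - d) ≠ 0 := by positivity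
    rw [div_eq_div_iff (by positivity) (by positivity)]
    calc _ = C * lam * s ^ (m - d) * (Real.sqrt s * Real.sqrt s) := by ring
      _ = _ := by rw [hss]; ring

/-- The volume asymptotics with a power saving. -/
lemma exists_sharpDensity_limit {m : ℕ} {ε : Fin (m + 1) → ℝ} (hε : ∀ i, ε i ≠ 0) {d : ℕ} (hd : 2 ≤ d)
    (hdm : d ≤ m) (j : Fin (m + 1)) {g : Matrix (Fin (m + 1)) (Fin (m + 1)) ℝ} (hg : g.det = 1)
    (hgj : ∑ i, ε i * g j i ^ d ≠ 0) {M : ℝ} (hM : 0 < M) : ∃ c : ℝ, 0 ≤ c ∧ ∃ C : ℝ, 0 ≤ C ∧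
      ∀ s : ℝ, 2 ≤ s → ∀ I : Set ℝ, MeasurableSet I → I ⊆ Set.Icc (-M) M → volume I ≠ 0 →
      |sharpDensity ε d j g s I - c| ≤ C * s ^ (-(1 / 4) : ℝ) := by
  obtain ⟨C, hC, h⟩ := sharpDensity_le hε hd hdm j hg hgj hM.le
  have hpos : ∀ x : ℝ, 0 < x → volume (Set.Icc (-x) x) ≠ 0 := fun x hx => by
    rw [Real.volume_Icc]; simp; exact hx
  let ι := {I : Set ℝ // MeasurableSet I ∧ I ⊆ Set.Icc (-M) M ∧ volume I ≠ 0}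
  obtain ⟨c, hc, C', hC', h'⟩ := exists_limit_of_dilation (ι := ι) (fun s i => sharpDensity ε d j g s i.1)
    ⟨Set.Icc (-M) M, measurableSet_Icc, subset_rfl, hpos M hM⟩ (fun s i => sharpDensity_nonneg _ _ _ _ _ _) hC
    (fun lam s hl hs i i' => h lam s hl hs i.1 i'.1 i.2.1 i.2.2.1 i'.2.1 i'.2.2.1 i.2.2.2 i'.2.2.2)
    (fun ρ s hρ hs => by
      have hρd : 1 ≤ ρ ^ d := one_le_pow₀ hρ
      refine ⟨⟨Set.Icc (-(M / ρ ^ d)) (M / ρ ^ d), measurableSet_Icc, ?_, hpos _ (by positivity)⟩,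
        sharpDensity_mul ε (by omega) j g hM.le (by linarith)⟩
      have := div_le_self hM.le hρd
      exact Set.Icc_subset_Icc (by linarith) this)
  exact ⟨c, hc, C', hC', fun s hs I hI hIM hI0 => h' s hs ⟨I, hI, hIM, hI0⟩⟩

lemma ofReal_div_le_volume_of_sign_change {φ : ℝ → ℝ} (hφ : ContinuousOn φ (Set.Icc 0 1)) {K η : ℝ} (hK : 0 < K)
    (hη : 0 < η) (hηK : η ≤ K) (h0 : φ 0 ≤ 0) (h1 : 0 ≤ φ 1)
    (hlip : ∀ t ∈ Set.Icc (0:ℝ) 1, ∀ t' ∈ Set.Icc (0:ℝ) 1, |φ t - φ t'| ≤ K * |t - t'|) :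
    ENNReal.ofReal (η / K) ≤ volume {t ∈ Set.Icc (0:ℝ) 1 | |φ t| ≤ η} := by
  obtain ⟨t0, ht0, hz⟩ := intermediate_value_Icc zero_le_one hφ ⟨h0, h1⟩
  have hr : 0 < η / K := by positivity
  have hr1 : η / K ≤ 1 := (div_le_one hK).2 hηK
  have hmem : ∀ t ∈ Set.Icc (0:ℝ) 1, |t - t0| ≤ η / K → t ∈ {t ∈ Set.Icc (0:ℝ) 1 | |φ t| ≤ η} := by
    intro t ht htt
    refine ⟨ht, ?_⟩
    have := hlip t ht t0 ht0
    rw [hz, sub_zero] at this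
    calc |φ t| ≤ K * (η / K) := this.trans (by gcongr)
      _ = η := mul_div_cancel₀ _ hK.ne'
  rcases le_total t0 (1 - η / K) with h | h
  · calc ENNReal.ofReal (η / K) = volume (Set.Icc t0 (t0 + η / K)) := by rw [Real.volume_Icc]; congr 1; ring
      _ ≤ _ := measure_mono fun t ht => hmem t ⟨ht0.1.trans ht.1, by linarith [ht.2]⟩
        (abs_le.2 ⟨by linarith [ht.1], by linarith [ht.2]⟩)
  · calc ENNReal.ofReal (η / K) = volume (Set.Icc (1 - η / K) 1) := by rw [Real.volume_Icc]; congr 1; ring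
      _ ≤ _ := measure_mono fun t ht => hmem t ⟨by linarith [ht.1], ht.2⟩
        (abs_le.2 ⟨by linarith [ht.1, ht0.2], by linarith [ht.2]⟩)

lemma mul_volume_ball_le_of_sign_change {n : ℕ} {H : (Fin n → ℝ) → ℝ} (hH : Continuous H) {P D : Fin n → ℝ}
    {ρ K η : ℝ} (hK : 0 < K) (hη : 0 < η) (hηK : η ≤ K)
    (h0 : ∀ z ∈ Metric.ball (0 : Fin n → ℝ) ρ, H (P + z) ≤ 0)
    (h1 : ∀ z ∈ Metric.ball (0 : Fin n → ℝ) ρ, 0 ≤ H (P + D + z))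
    (hlip : ∀ z ∈ Metric.ball (0 : Fin n → ℝ) ρ, ∀ t ∈ Set.Icc (0:ℝ) 1, ∀ t' ∈ Set.Icc (0:ℝ) 1,
      |H (P + t • D + z) - H (P + t' • D + z)| ≤ K * |t - t'|)
    {S : Set (Fin n → ℝ)} (hS : MeasurableSet S)
    (hPS : ∀ z ∈ Metric.ball (0 : Fin n → ℝ) ρ, ∀ t ∈ Set.Icc (0:ℝ) 1, P + t • D + z ∈ S) :
    ENNReal.ofReal (η / K) * volume (Metric.ball (0 : Fin n → ℝ) ρ) ≤ volume {w ∈ S | |H w| ≤ η} := by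
  set A := {w ∈ S | |H w| ≤ η} with hA
  have hAm : MeasurableSet A := hS.inter (measurableSet_le hH.abs.measurable measurable_const)
  have hc : Continuous fun x : (Fin n → ℝ) × ℝ => P + x.2 • D + x.1 := by fun_prop
  have hmeas : Measurable fun x : (Fin n → ℝ) × ℝ => A.indicator (1 : (Fin n → ℝ) → ENNReal) (P + x.2 • D + x.1) :=
    (measurable_one.indicator hAm).comp hc.measurable
  have hlow : ∀ z ∈ Metric.ball (0 : Fin n → ℝ) ρ, ENNReal.ofReal (η / K)
      ≤ ∫⁻ t in Set.Icc (0:ℝ) 1, A.indicator (1 : (Fin n → ℝ) → ENNReal) (P + t • D + z) := by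
    intro z hz
    have hcz : Continuous fun t : ℝ => P + t • D + z := by fun_prop
    refine (ofReal_div_le_volume_of_sign_change (φ := fun t => H (P + t • D + z)) (hH.comp hcz).continuousOn hK hη hηK
      (by simpa using h0 z hz) (by simpa using h1 z hz) (hlip z hz)).trans ?_
    have hBm : MeasurableSet {t ∈ Set.Icc (0:ℝ) 1 | |H (P + t • D + z)| ≤ η} :=
      measurableSet_Icc.inter (measurableSet_le (hH.comp hcz).abs.measurable measurable_const)
    rw [← lintegral_indicator_one hBm, ← lintegral_indicator measurableSet_Icc]
    refine lintegral_mono fun t => ?_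
    refine Set.indicator_le (fun t ht => ?_) t
    rw [Set.indicator_of_mem ht.1, Set.indicator_of_mem]
    · rfl
    · exact ⟨hPS z hz t ht.1, ht.2⟩
  calc ENNReal.ofReal (η / K) * volume (Metric.ball (0 : Fin n → ℝ) ρ)
      = ∫⁻ _ in Metric.ball (0 : Fin n → ℝ) ρ, ENNReal.ofReal (η / K) := by rw [setLIntegral_const]
    _ ≤ ∫⁻ z in Metric.ball (0 : Fin n → ℝ) ρ, ∫⁻ t in Set.Icc (0:ℝ) 1,
        A.indicator (1 : (Fin n → ℝ) → ENNReal) (P + t • D + z) := setLIntegral_mono' Metric.isOpen_ball.measurableSet hlow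
    _ = ∫⁻ t in Set.Icc (0:ℝ) 1, ∫⁻ z in Metric.ball (0 : Fin n → ℝ) ρ,
        A.indicator (1 : (Fin n → ℝ) → ENNReal) (P + t • D + z) := lintegral_lintegral_swap hmeas.aemeasurable
    _ ≤ ∫⁻ _ in Set.Icc (0:ℝ) 1, volume A := by
        refine lintegral_mono fun t => (setLIntegral_le_lintegral _ _).trans ?_
        rw [lintegral_add_left_eq_self (fun z => A.indicator (1 : (Fin n → ℝ) → ENNReal) z) (P + t • D),
          lintegral_indicator_one hAm]
    _ = volume A := by rw [setLIntegral_const]; simp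

lemma form_single_vecMul {n : ℕ} (ε : Fin n → ℝ) {d : ℕ} (hd : d ≠ 0) {g : Matrix (Fin n) (Fin n) ℝ} (hg : IsUnit g.det)
    (i : Fin n) : form ε d g (Pi.single i 1 ᵥ* g⁻¹) = ε i := by
  rw [form, Matrix.vecMul_vecMul, Matrix.nonsing_inv_mul _ hg, Matrix.vecMul_one]
  rw [Finset.sum_eq_single i (fun k _ hk => by simp [hk, hd]) (by simp)]
  simp

lemma sqNorm_le_of_norm_le {n : ℕ} {w : Fin n → ℝ} {r : ℝ} (hw : ‖w‖ ≤ r) : sqNorm w ≤ n * r ^ 2 := by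
  have : ∀ i ∈ Finset.univ, w i ^ 2 ≤ r ^ 2 := fun i _ =>
    sq_le_sq' (by linarith [abs_le.1 ((norm_le_pi_norm w i).trans hw)]) (abs_le.1 ((norm_le_pi_norm w i).trans hw)).2
  simpa [sqNorm] using Finset.sum_le_card_nsmul _ _ _ this

/-- The region where an indefinite form is small has volume at least proportional to the threshold. -/
lemma exists_le_volume_abs_form_le {n : ℕ} {ε : Fin n → ℝ} {d : ℕ} (hd : d ≠ 0)
    {g : Matrix (Fin n) (Fin n) ℝ} (hg : IsUnit g.det) (hneg : ∃ i, ε i < 0) (hpos : ∃ i, 0 < ε i) :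
    ∃ b η0 : ℝ, 0 < b ∧ 0 < η0 ∧ ∀ η, 0 < η → η ≤ η0 →
      ENNReal.ofReal (b * η) ≤ volume {w ∈ {w : Fin n → ℝ | sqNorm w ≤ 1} | |form ε d g w| ≤ η} := by
  obtain ⟨i1, h1⟩ := hneg
  obtain ⟨i2, h2⟩ := hpos
  have hn : 0 < n := i1.pos
  set P0 := (Pi.single i1 1 : Fin n → ℝ) ᵥ* g⁻¹
  set Q0 := (Pi.single i2 1 : Fin n → ℝ) ᵥ* g⁻¹
  have hP0 : form ε d g P0 = ε i1 := form_single_vecMul ε hd hg i1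
  have hQ0 : form ε d g Q0 = ε i2 := form_single_vecMul ε hd hg i2
  set r0 : ℝ := 1 / (4 * n) with hr0
  have hnR : (1:ℝ) ≤ n := by exact_mod_cast hn
  have hr0p : 0 < r0 := by positivity
  set r : ℝ := r0 / (1 + ‖P0‖ + ‖Q0‖) with hr
  have hrp : 0 < r := by positivity
  set P := r • P0
  set Q := r • Q0
  have hrr : r * (1 + ‖P0‖ + ‖Q0‖) = r0 := div_mul_cancel₀ _ (by positivity)
  have hPn : ‖P‖ ≤ r0 := by
    rw [norm_smul, Real.norm_of_nonneg hrp.le]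
    nlinarith [norm_nonneg P0, norm_nonneg Q0, mul_nonneg hrp.le (norm_nonneg Q0)]
  have hQn : ‖Q‖ ≤ r0 := by
    rw [norm_smul, Real.norm_of_nonneg hrp.le]
    nlinarith [norm_nonneg P0, norm_nonneg Q0, mul_nonneg hrp.le (norm_nonneg P0)]
  have hP : form ε d g P < 0 := by
    rw [form_smul, hP0]; exact mul_neg_of_pos_of_neg (by positivity) h1
  have hQ : 0 < form ε d g Q := by
    rw [form_smul, hQ0]; exact mul_pos (by positivity) h2
  have hcont := continuous_form_right ε d g
  obtain ⟨ρ1, hρ1, hb1⟩ := Metric.eventually_nhds_iff_ball.1 (hcont.continuousAt.eventually (gt_mem_nhds hP))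
  obtain ⟨ρ2, hρ2, hb2⟩ := Metric.eventually_nhds_iff_ball.1 (hcont.continuousAt.eventually (lt_mem_nhds hQ))
  set ρ := min r0 (min ρ1 ρ2) with hρ
  have hρp : 0 < ρ := by positivity
  have hball : ∀ z ∈ Metric.ball (0 : Fin n → ℝ) ρ, ‖z‖ < r0 ∧ ‖z‖ < ρ1 ∧ ‖z‖ < ρ2 := by
    intro z hz
    rw [mem_ball_zero_iff] at hz
    exact ⟨hz.trans_le (min_le_left _ _), hz.trans_le ((min_le_right _ _).trans (min_le_left _ _)),
      hz.trans_le ((min_le_right _ _).trans (min_le_right _ _))⟩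
  have hseg : ∀ z ∈ Metric.ball (0 : Fin n → ℝ) ρ, ∀ t ∈ Set.Icc (0:ℝ) 1, ‖P + t • (Q - P) + z‖ ≤ 4 * r0 := by
    intro z hz t ht
    have e1 := norm_add_le (P + t • (Q - P)) z
    have e2 := norm_add_le P (t • (Q - P))
    have e3 := norm_sub_le Q P
    have e4 : ‖t • (Q - P)‖ ≤ ‖Q - P‖ := by
      rw [norm_smul, Real.norm_of_nonneg ht.1]
      exact mul_le_of_le_one_left (norm_nonneg _) ht.2
    linarith [(hball z hz).1]
  set R := ∑ i, ∑ k, |g i k| with hR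
  have hgR : ∀ i k, |g i k| ≤ R := fun i k =>
    (Finset.single_le_sum (f := fun k => |g i k|) (fun _ _ => abs_nonneg _) (Finset.mem_univ k)).trans
      (Finset.single_le_sum (f := fun i => ∑ k, |g i k|)
        (fun i _ => Finset.sum_nonneg fun _ _ => abs_nonneg _) (Finset.mem_univ i))
  have hR0 : 0 ≤ R := Finset.sum_nonneg fun i _ => Finset.sum_nonneg fun k _ => abs_nonneg _
  set K : ℝ := 1 + (∑ i, |ε i|) * (n * R * ‖Q - P‖ * d * (n * R * (4 * r0)) ^ (d - 1)) with hKdef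
  have hε0 : 0 ≤ ∑ i, |ε i| := Finset.sum_nonneg fun _ _ => abs_nonneg _
  have hK0 : 0 ≤ (∑ i, |ε i|) * (n * R * ‖Q - P‖ * d * (n * R * (4 * r0)) ^ (d - 1)) := by positivity
  have hK : 0 < K := by linarith
  have hv : volume (Metric.ball (0 : Fin n → ℝ) ρ) ≠ ⊤ := measure_ball_lt_top.ne
  have hv0 : 0 < (volume (Metric.ball (0 : Fin n → ℝ) ρ)).toReal :=
    ENNReal.toReal_pos (Metric.measure_ball_pos volume _ hρp).ne' hv
  refine ⟨(volume (Metric.ball (0 : Fin n → ℝ) ρ)).toReal / K, K, by positivity, hK, fun η hη hηK => ?_⟩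
  have := mul_volume_ball_le_of_sign_change hcont (P := P) (D := Q - P) (ρ := ρ) hK hη hηK (fun z hz => ?_) (fun z hz => ?_)
    (fun z hz t ht t' ht' => ?_) (S := {w | sqNorm w ≤ 1}) ?_ (fun z hz t ht => ?_)
  · refine le_trans (le_of_eq ?_) this
    rw [show (volume (Metric.ball (0 : Fin n → ℝ) ρ)).toReal / K * η = η / K * (volume (Metric.ball (0 : Fin n → ℝ) ρ)).toReal by ring,
      ENNReal.ofReal_mul (by positivity), ENNReal.ofReal_toReal hv]
  · exact (hb1 (P + z) (by simpa [Metric.mem_ball, dist_eq_norm] using (hball z hz).2.1)).le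
  · rw [add_sub_cancel]
    exact (hb2 (Q + z) (by simpa [Metric.mem_ball, dist_eq_norm] using (hball z hz).2.2)).le
  · refine (abs_form_sub_le ε d (h := g) hgR (hseg z hz t ht) (hseg z hz t' ht')).trans ?_
    rw [show P + t • (Q - P) + z - (P + t' • (Q - P) + z) = (t - t') • (Q - P) by rw [sub_smul]; abel, norm_smul, Real.norm_eq_abs]
    rw [hKdef, add_mul, one_mul]
    refine le_trans (le_of_eq ?_) (le_add_of_nonneg_left (abs_nonneg _))
    ring
  · exact measurableSet_le continuous_sqNorm.measurable measurable_const
  · refine (sqNorm_le_of_norm_le (hseg z hz t ht)).trans ?_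
    rw [hr0]
    field_simp
    nlinarith

lemma sum_sharpFun {n : ℕ} {ε : Fin n → ℝ} (hε : ∀ i, ε i ≠ 0) {d : ℕ} (hd : 2 ≤ d)
    {g : Matrix (Fin n) (Fin n) ℝ} (hg : g.det ≠ 0) (s : ℝ) (J : Set ℝ) {w : Fin n → ℝ} (hw : w ≠ 0) :
    ∑ j, sharpFun ε d j s g J w = J.indicator 1 (form ε d g w) * (Set.Iic (s ^ 2)).indicator 1 (sqNorm w) := by
  simp only [sharpFun]
  rw [← Finset.mul_sum, ← Finset.mul_sum, sum_gradWeight hε hd hg hw, mul_one]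

lemma exists_le_sum_sharpDensity {m : ℕ} {ε : Fin (m + 1) → ℝ} (hε : ∀ i, ε i ≠ 0) {d : ℕ} (hd : 2 ≤ d) (hdm : d ≤ m)
    {g : Matrix (Fin (m + 1)) (Fin (m + 1)) ℝ} (hg : g.det = 1) (hneg : ∃ i, ε i < 0) (hpos : ∃ i, 0 < ε i)
    {M : ℝ} (hM : 0 < M) :
    ∃ δ s0 : ℝ, 0 < δ ∧ ∀ s, s0 ≤ s → δ ≤ ∑ j, sharpDensity ε d j g s (Set.Icc (-M) M) := by
  obtain ⟨b, η0, hb, hη0, h⟩ := exists_le_volume_abs_form_le (ε := ε) (d := d) (by omega) (g := g) (by rw [hg]; exact isUnit_one) hneg hpos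
  refine ⟨b / 2, max 1 (M / η0), by positivity, fun s hs => ?_⟩
  have hs1 : 1 ≤ s := (le_max_left _ _).trans hs
  have hs2 : M / η0 ≤ s := (le_max_right _ _).trans hs
  have hsd : s ≤ s ^ d := le_self_pow₀ hs1 (by omega)
  set η := M / s ^ d with hη
  have hηp : 0 < η := by positivity
  have hηle : η ≤ η0 := by
    rw [hη, div_le_iff₀ (by positivity)]
    rw [div_le_iff₀ hη0] at hs2
    nlinarith
  have e1 : ∀ j, sharpDensity ε d j g s (Set.Icc (-M) M) = (∫ w, sharpFun ε d j 1 g (Set.Icc (-η) η) w) / (2 * η) := by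
    intro j
    have := sharpDensity_mul ε (d := d) (by omega) j g hM.le (ρ := s) (s := 1) (by linarith)
    rw [mul_one] at this
    rw [this, sharpDensity, abs_one, one_pow, mul_one, Real.volume_Icc, ENNReal.toReal_ofReal (by linarith)]
    congr 1
    ring
  simp only [e1]
  rw [← Finset.sum_div, ← integral_finsetSum _ fun j _ => integrable_sharpFun ε d j one_pos g measurableSet_Icc,
    le_div_iff₀ (by positivity)]
  set A := {w ∈ {w : Fin (m + 1) → ℝ | sqNorm w ≤ 1} | |form ε d g w| ≤ η} with hA
  have hAm : MeasurableSet A := (measurableSet_le continuous_sqNorm.measurable measurable_const).inter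
    (measurableSet_le (continuous_form_right ε d g).abs.measurable measurable_const)
  have hAf : volume A ≠ ⊤ := by
    refine ((measure_mono (t := Metric.closedBall 0 1) fun w hw => ?_).trans_lt measure_closedBall_lt_top).ne
    rw [mem_closedBall_zero_iff]
    exact norm_le_of_sqNorm zero_le_one (by simpa using hw.1)
  have e2 : ∫ w, ∑ j, sharpFun ε d j 1 g (Set.Icc (-η) η) w = (volume A).toReal := by
    have h0 : ∀ᵐ w : Fin (m + 1) → ℝ, w ≠ 0 := Measure.ae_ne volume 0
    have : ∫ w, ∑ j, sharpFun ε d j 1 g (Set.Icc (-η) η) w = ∫ w, A.indicator (1 : (Fin (m + 1) → ℝ) → ℝ) w := by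
      refine integral_congr_ae ?_
      filter_upwards [h0] with w hw
      rw [sum_sharpFun hε hd (by rw [hg]; exact one_ne_zero) 1 _ hw]
      by_cases h1 : sqNorm w ≤ 1
      · rw [Set.indicator_of_mem (s := Set.Iic _) (by simpa using h1), Pi.one_apply, mul_one]
        by_cases h2 : |form ε d g w| ≤ η
        · rw [Set.indicator_of_mem (show form ε d g w ∈ Set.Icc (-η) η from abs_le.1 h2), Set.indicator_of_mem (show w ∈ A from ⟨h1, h2⟩)]; rfl
        · rw [Set.indicator_of_notMem (show form ε d g w ∉ Set.Icc (-η) η from fun h3 => h2 (abs_le.2 h3)), Set.indicator_of_notMem (fun h' => h2 h'.2)]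
      · rw [Set.indicator_of_notMem (s := Set.Iic _) (by simpa using h1), mul_zero, Set.indicator_of_notMem (fun h' => h1 h'.1)]
    rw [this, integral_indicator_one hAm]
    rfl
  rw [e2]
  have := (ENNReal.ofReal_le_iff_le_toReal hAf).1 (h η hηp hηle)
  linarith

lemma exists_sharpVol_asymptotic {m : ℕ} {ε : Fin (m + 1) → ℝ} (hε : ∀ i, ε i ≠ 0) {d : ℕ} (hd : 2 ≤ d) (hdm : d ≤ m)
    {g : Matrix (Fin (m + 1)) (Fin (m + 1)) ℝ} (hg : g.det = 1) (hneg : ∃ i, ε i < 0) (hpos : ∃ i, 0 < ε i)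
    (hgj : ∀ j, ∑ i, ε i * g j i ^ d ≠ 0) {M : ℝ} (hM : 0 < M) :
    ∃ c : Fin (m + 1) → ℝ, (∀ j, 0 ≤ c j) ∧ 0 < ∑ j, c j ∧ ∃ C : ℝ, 0 ≤ C ∧
      ∀ s : ℝ, 2 ≤ s → ∀ I : Set ℝ, MeasurableSet I → I ⊆ Set.Icc (-M) M → volume I ≠ 0 → ∀ j,
      |(sharpVol ε d j s g I).toReal - c j * ((volume I).toReal * s ^ (m + 1 - d))|
        ≤ C * s ^ (-(1 / 4) : ℝ) * ((volume I).toReal * s ^ (m + 1 - d)) := by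
  choose c hc C hC h using fun j => exists_sharpDensity_limit hε hd hdm j hg (hgj j) hM
  obtain ⟨δ, s0, hδ, hle⟩ := exists_le_sum_sharpDensity hε hd hdm hg hneg hpos hM
  refine ⟨c, hc, ?_, ∑ j, C j, Finset.sum_nonneg fun j _ => hC j, ?_⟩
  · have hvol : volume (Set.Icc (-M) M) ≠ 0 := by rw [Real.volume_Icc]; simp; exact hM
    have hlim : ∀ j, Tendsto (fun s => sharpDensity ε d j g s (Set.Icc (-M) M)) atTop (nhds (c j)) := by
      intro j
      rw [tendsto_iff_norm_sub_tendsto_zero]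
      refine squeeze_zero' (Eventually.of_forall fun s => norm_nonneg _)
        (g := fun s : ℝ => C j * s ^ (-(1 / 4) : ℝ)) ?_ ?_
      · filter_upwards [eventually_ge_atTop 2] with s hs
        exact h j s hs _ measurableSet_Icc subset_rfl hvol
      · have := (tendsto_rpow_neg_atTop (y := 1 / 4) (by norm_num)).const_mul (C j)
        rwa [mul_zero] at this
    have := tendsto_finsetSum Finset.univ fun j _ => hlim j
    refine hδ.trans_le (ge_of_tendsto this ?_)
    filter_upwards [eventually_ge_atTop s0] with s hs
    exact hle s hs
  · intro s hs I hI hIM hI0 j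
    have hV : 0 < (volume I).toReal := ENNReal.toReal_pos hI0 ((measure_mono hIM).trans_lt (by simp)).ne
    have hs0 : 0 < s := by linarith
    have hN : 0 < (volume I).toReal * s ^ (m + 1 - d) := by positivity
    have e1 : (sharpVol ε d j s g I).toReal = sharpDensity ε d j g s I * ((volume I).toReal * s ^ (m + 1 - d)) := by
      rw [toReal_sharpVol ε d j s g hI, sharpDensity, abs_of_pos hs0, div_mul_cancel₀ _ hN.ne']
    rw [e1, ← sub_mul, abs_mul, abs_of_pos hN]
    refine mul_le_mul_of_nonneg_right ((h j s hs I hI hIM hI0).trans ?_) hN.le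
    exact mul_le_mul_of_nonneg_right (Finset.single_le_sum (fun j _ => hC j) (Finset.mem_univ j)) (by positivity)

lemma one_add_mul_pow_le (n P : ℕ) {x : ℝ} (hx0 : 0 ≤ x) (hx1 : x ≤ 1) :
    (1 + n * x) ^ P ≤ 1 + 3 ^ (n * P) * x := by
  have h : 1 + n * x ≤ (1 + x) ^ n := one_add_mul_le_pow (by linarith) n
  calc (1 + n * x) ^ P ≤ ((1 + x) ^ n) ^ P := pow_le_pow_left₀ (by positivity) h P
    _ = (1 + x) ^ (n * P) := (pow_mul _ _ _).symm
    _ ≤ _ := one_add_pow_le hx0 hx1 _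

lemma add_one_rpow_le {n A : ℕ} (hn : 1 ≤ n) {a : ℝ} (ha : 0 ≤ a) (haA : a ≤ A) {k : ℕ} (hk : 1 ≤ k) :
    ((k : ℝ) + 1) ^ a ≤ (1 + n * (1 / k : ℝ)) ^ A * (k:ℝ) ^ a := by
  have hk0 : (0:ℝ) < k := by exact_mod_cast hk
  have hn1 : (1:ℝ) ≤ n := by exact_mod_cast hn
  have hx : (0:ℝ) < 1 / k := by positivity
  have h1 : (k:ℝ) + 1 ≤ (1 + n * (1 / k : ℝ)) * k := by
    have : (1 + n * (1 / k : ℝ)) * k = k + n := by field_simp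
    linarith
  have hw : 1 ≤ 1 + n * (1 / k : ℝ) := by nlinarith
  calc ((k : ℝ) + 1) ^ a ≤ ((1 + n * (1 / k : ℝ)) * k) ^ a := Real.rpow_le_rpow (by positivity) h1 ha
    _ = (1 + n * (1 / k : ℝ)) ^ a * (k:ℝ) ^ a := Real.mul_rpow (by positivity) hk0.le
    _ ≤ (1 + n * (1 / k : ℝ)) ^ (A:ℝ) * (k:ℝ) ^ a := by
      refine mul_le_mul_of_nonneg_right (Real.rpow_le_rpow_of_exponent_le hw haA) (by positivity)
    _ = _ := by rw [Real.rpow_natCast]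

lemma rpow_neg_quarter_le {a w s : ℝ} (ha : 4 ≤ a) {k : ℕ} (hk : 1 ≤ k) (hw : 1 ≤ w) (hs : (k:ℝ) ^ a ≤ w ^ 3 * s) :
    s ^ (-(1 / 4) : ℝ) ≤ w * (1 / k) := by
  have hk1 : (1:ℝ) ≤ k := by exact_mod_cast hk
  have hk0 : (0:ℝ) < k := by linarith
  have hs0 : 0 < s := by
    by_contra h
    have : (0:ℝ) < (k:ℝ) ^ a := by positivity
    have : w ^ 3 * s ≤ 0 := mul_nonpos_of_nonneg_of_nonpos (by positivity) (by linarith)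
    linarith
  have h4 : ((k:ℝ) / w) ^ 4 ≤ s := by
    rw [div_pow, div_le_iff₀ (by positivity)]
    calc (k:ℝ) ^ 4 = (k:ℝ) ^ (4:ℝ) := by norm_cast
      _ ≤ (k:ℝ) ^ a := Real.rpow_le_rpow_of_exponent_le hk1 ha
      _ ≤ w ^ 3 * s := hs
      _ ≤ w ^ 4 * s := mul_le_mul_of_nonneg_right (pow_le_pow_right₀ hw (by norm_num)) hs0.le
      _ = _ := by ring
  have hkw : 0 < (k:ℝ) / w := by positivity
  calc s ^ (-(1 / 4) : ℝ) ≤ (((k:ℝ) / w) ^ 4) ^ (-(1 / 4) : ℝ) :=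
        Real.rpow_le_rpow_of_nonpos (by positivity) h4 (by norm_num)
    _ = ((k:ℝ) / w) ^ (-1 : ℝ) := by
      rw [← Real.rpow_natCast, ← Real.rpow_mul hkw.le]; norm_num
    _ = w * (1 / k) := by rw [Real.rpow_neg_one, inv_div]; ring

lemma rpow_neg_mul_pow {a κ : ℝ} (l : ℕ) {k : ℕ} (hk : 1 ≤ k) :
    ((k:ℝ) ^ a) ^ (-κ) * ((k:ℝ) ^ a) ^ l = (k:ℝ) ^ (a * (l - κ)) := by
  have hk0 : (0:ℝ) < k := by exact_mod_cast hk
  rw [← Real.rpow_natCast ((k:ℝ) ^ a) l, ← Real.rpow_add (by positivity), ← Real.rpow_mul hk0.le]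
  congr 1; ring

lemma one_div_mul_rpow_le {β θ : ℝ} (hθ : θ ≤ 1) {k : ℕ} (hk : 1 ≤ k) :
    (1 / k : ℝ) * (k:ℝ) ^ β ≤ (k:ℝ) ^ (β - θ) := by
  have hk1 : (1:ℝ) ≤ k := by exact_mod_cast hk
  have hk0 : (0:ℝ) < k := by linarith
  have : (1 / k : ℝ) * (k:ℝ) ^ β = (k:ℝ) ^ (β - 1) := by
    rw [Real.rpow_sub hk0, Real.rpow_one]; ring
  rw [this]
  exact Real.rpow_le_rpow_of_exponent_le hk1 (by linarith)

/-- Upper counting bound along the sequence of radii `(k+1)^a`. -/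
lemma le_main_add_error {n l : ℕ} (hn : 1 ≤ n) {a κ c b C C' θ : ℝ} (ha : 4 ≤ a) (hc : 0 ≤ c) (hb : 0 ≤ b)
    (hC' : 0 ≤ C') (hθ : θ ≤ 1) :
    ∃ K : ℝ, ∀ k : ℕ, 1 ≤ k → ∀ S V : ℝ,
      S ≤ (1 + n * (1 / k : ℝ)) ^ 4 * V + C * (k:ℝ) ^ (a * (l - κ) - θ) →
      |V - b * (c * ((k:ℝ) ^ a) ^ (-κ) * ((1 + n * (1 / k : ℝ)) ^ 3 * ((k:ℝ) + 1) ^ a) ^ l)|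
        ≤ C' * ((1 + n * (1 / k : ℝ)) ^ 3 * ((k:ℝ) + 1) ^ a) ^ (-(1 / 4) : ℝ)
          * (c * ((k:ℝ) ^ a) ^ (-κ) * ((1 + n * (1 / k : ℝ)) ^ 3 * ((k:ℝ) + 1) ^ a) ^ l) →
      S ≤ b * c * (k:ℝ) ^ (a * (l - κ)) + K * (k:ℝ) ^ (a * (l - κ) - θ) := by
  obtain ⟨A, hA⟩ := exists_nat_ge a
  set P := (3 + A) * l + 5
  set K : ℝ := 3 ^ (n * P)
  refine ⟨(C' + K * b + K * C') * c + C, fun k hk S V h1 h2 => ?_⟩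
  have hk1 : (1:ℝ) ≤ k := by exact_mod_cast hk
  have hk0 : (0:ℝ) < k := by linarith
  have hn1 : (1:ℝ) ≤ n := by exact_mod_cast hn
  set x : ℝ := 1 / k with hx
  have hx0 : 0 < x := by positivity
  have hx1 : x ≤ 1 := by rw [hx, div_le_one hk0]; exact hk1
  have hs1 := add_one_rpow_le hn (by linarith) hA hk
  have hwP := one_add_mul_pow_le n P hx0.le hx1
  rw [← hx] at hs1
  set w : ℝ := 1 + n * x with hw
  have hw1 : 1 ≤ w := by nlinarith
  set s : ℝ := w ^ 3 * ((k:ℝ) + 1) ^ a with hs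
  have hs0 : 0 < s := by positivity
  have hks : (k:ℝ) ^ a ≤ s := by
    calc (k:ℝ) ^ a ≤ ((k:ℝ) + 1) ^ a := Real.rpow_le_rpow hk0.le (by linarith) (by linarith)
      _ ≤ s := le_mul_of_one_le_left (by positivity) (one_le_pow₀ hw1)
  have hq : s ^ (-(1 / 4) : ℝ) ≤ x := by
    simpa [hx] using rpow_neg_quarter_le ha hk le_rfl (s := s) (by simpa using hks)
  set B : ℝ := (k:ℝ) ^ (a * (l - κ)) with hB
  have hB0 : 0 < B := by positivity
  set T : ℝ := c * ((k:ℝ) ^ a) ^ (-κ) * s ^ l with hT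
  have hT0 : 0 ≤ T := by positivity
  have hTle : T ≤ w ^ ((3 + A) * l) * (c * B) := by
    have : s ^ l ≤ (w ^ (3 + A) * (k:ℝ) ^ a) ^ l := by
      refine pow_le_pow_left₀ hs0.le ?_ l
      calc s ≤ w ^ 3 * (w ^ A * (k:ℝ) ^ a) := mul_le_mul_of_nonneg_left hs1 (by positivity)
        _ = _ := by ring
    calc T ≤ c * ((k:ℝ) ^ a) ^ (-κ) * (w ^ (3 + A) * (k:ℝ) ^ a) ^ l := mul_le_mul_of_nonneg_left this (by positivity)
      _ = w ^ ((3 + A) * l) * (c * (((k:ℝ) ^ a) ^ (-κ) * ((k:ℝ) ^ a) ^ l)) := by rw [mul_pow, ← pow_mul]; ring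
      _ = _ := by rw [rpow_neg_mul_pow l hk]
  have hV : V ≤ (b + C' * x) * T := by
    have h3 := (abs_le.1 h2).2
    have h4 : C' * s ^ (-(1 / 4) : ℝ) * T ≤ C' * x * T :=
      mul_le_mul_of_nonneg_right (mul_le_mul_of_nonneg_left hq hC') hT0
    linarith
  have h5 : w ^ 4 * V ≤ (1 + K * x) * ((b + C' * x) * (c * B)) := by
    calc w ^ 4 * V ≤ w ^ 4 * ((b + C' * x) * (w ^ ((3 + A) * l) * (c * B))) := by
          refine mul_le_mul_of_nonneg_left (hV.trans ?_) (by positivity)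
          exact mul_le_mul_of_nonneg_left hTle (by positivity)
      _ = w ^ ((3 + A) * l + 4) * ((b + C' * x) * (c * B)) := by ring
      _ ≤ w ^ P * ((b + C' * x) * (c * B)) :=
          mul_le_mul_of_nonneg_right (pow_le_pow_right₀ hw1 (by omega)) (by positivity)
      _ ≤ _ := mul_le_mul_of_nonneg_right hwP (by positivity)
  have h6 : x * B ≤ (k:ℝ) ^ (a * (l - κ) - θ) := one_div_mul_rpow_le hθ hk
  have hK : 0 ≤ K := by positivity
  have h7 : (1 + K * x) * ((b + C' * x) * (c * B)) ≤ b * c * B + (C' + K * b + K * C') * c * (x * B) := by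
    have : K * C' * c * (x * B) * x ≤ K * C' * c * (x * B) * 1 := mul_le_mul_of_nonneg_left hx1 (by positivity)
    linarith
  have h8 : (C' + K * b + K * C') * c * (x * B) ≤ (C' + K * b + K * C') * c * (k:ℝ) ^ (a * (l - κ) - θ) :=
    mul_le_mul_of_nonneg_left h6 (by positivity)
  linarith

/-- Lower counting bound along the sequence of radii `k^a`. -/
lemma main_sub_error_le {n l : ℕ} (hn : 1 ≤ n) {a κ c b C C' θ : ℝ} (ha : 4 ≤ a) (hκ : 0 < κ) (hc : 0 ≤ c) (hb : 0 ≤ b)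
    (hC : 0 ≤ C) (hC' : 0 ≤ C') (hθ : θ ≤ 1) :
    ∃ K : ℝ, ∀ k : ℕ, 1 ≤ k → ∀ S V : ℝ,
      V ≤ (1 + n * (1 / k : ℝ)) ^ 4 * S + C * (k:ℝ) ^ (a * (l - κ) - θ) →
      |V - b * (c * (((k:ℝ) + 1) ^ a) ^ (-κ) * ((k:ℝ) ^ a / (1 + n * (1 / k : ℝ)) ^ 3) ^ l)|
        ≤ C' * ((k:ℝ) ^ a / (1 + n * (1 / k : ℝ)) ^ 3) ^ (-(1 / 4) : ℝ)
          * (c * (((k:ℝ) + 1) ^ a) ^ (-κ) * ((k:ℝ) ^ a / (1 + n * (1 / k : ℝ)) ^ 3) ^ l) →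
      b * c * (k:ℝ) ^ (a * (l - κ)) - K * (k:ℝ) ^ (a * (l - κ) - θ) ≤ S := by
  obtain ⟨A, hA⟩ := exists_nat_ge a
  obtain ⟨Q, hQ⟩ := exists_nat_ge κ
  set P1 := A * Q + 3 * l
  set K : ℝ := 3 ^ (n * (P1 + 4))
  refine ⟨K * b * c + C' * c * (1 + n) + C, fun k hk S V h1 h2 => ?_⟩
  have hk1 : (1:ℝ) ≤ k := by exact_mod_cast hk
  have hk0 : (0:ℝ) < k := by linarith
  have hn1 : (1:ℝ) ≤ n := by exact_mod_cast hn
  set x : ℝ := 1 / k with hx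
  have hx0 : 0 < x := by positivity
  have hx1 : x ≤ 1 := by rw [hx, div_le_one hk0]; exact hk1
  have hs1 := add_one_rpow_le hn (by linarith) hA hk
  have hwP := one_add_mul_pow_le n (P1 + 4) hx0.le hx1
  rw [← hx] at hs1
  set w : ℝ := 1 + n * x with hw
  have hw1 : 1 ≤ w := by nlinarith
  have hwn : w ≤ 1 + n := by nlinarith
  set s : ℝ := (k:ℝ) ^ a / w ^ 3 with hs
  have hs0 : 0 < s := by positivity
  have hws : w ^ 3 * s = (k:ℝ) ^ a := by rw [hs]; field_simp
  have hq : s ^ (-(1 / 4) : ℝ) ≤ (1 + n) * x :=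
    (rpow_neg_quarter_le ha hk hw1 hws.ge).trans (mul_le_mul_of_nonneg_right hwn hx0.le)
  set B : ℝ := (k:ℝ) ^ (a * (l - κ)) with hB
  have hB0 : 0 < B := by positivity
  set T : ℝ := c * (((k:ℝ) + 1) ^ a) ^ (-κ) * s ^ l with hT
  have hT0 : 0 ≤ T := by positivity
  have hka : (0:ℝ) < (k:ℝ) ^ a := by positivity
  have hsl : w ^ (3 * l) * s ^ l = ((k:ℝ) ^ a) ^ l := by rw [pow_mul, ← mul_pow, hws]
  have hTle : T ≤ c * B := by
    have e1 : (((k:ℝ) + 1) ^ a) ^ (-κ) ≤ ((k:ℝ) ^ a) ^ (-κ) :=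
      Real.rpow_le_rpow_of_nonpos hka (Real.rpow_le_rpow hk0.le (by linarith) (by linarith)) (by linarith)
    have e2 : s ^ l ≤ ((k:ℝ) ^ a) ^ l := by
      rw [← hsl]; exact le_mul_of_one_le_left (by positivity) (one_le_pow₀ hw1)
    calc T = c * ((((k:ℝ) + 1) ^ a) ^ (-κ) * s ^ l) := by rw [hT]; ring
      _ ≤ c * (((k:ℝ) ^ a) ^ (-κ) * ((k:ℝ) ^ a) ^ l) :=
        mul_le_mul_of_nonneg_left (mul_le_mul e1 e2 (by positivity) (by positivity)) hc
      _ = _ := by rw [rpow_neg_mul_pow l hk]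
  have hTge : c * B ≤ w ^ P1 * T := by
    have e1 : ((k:ℝ) ^ a) ^ (-κ) ≤ w ^ (A * Q) * (((k:ℝ) + 1) ^ a) ^ (-κ) := by
      have e3 : (((k:ℝ) + 1) ^ a) ^ κ ≤ w ^ (A * Q) * ((k:ℝ) ^ a) ^ κ := by
        calc (((k:ℝ) + 1) ^ a) ^ κ ≤ (w ^ A * (k:ℝ) ^ a) ^ κ := Real.rpow_le_rpow (by positivity) hs1 hκ.le
          _ = (w ^ A) ^ κ * ((k:ℝ) ^ a) ^ κ := Real.mul_rpow (by positivity) hka.le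
          _ ≤ (w ^ A) ^ (Q:ℝ) * ((k:ℝ) ^ a) ^ κ :=
            mul_le_mul_of_nonneg_right (Real.rpow_le_rpow_of_exponent_le (one_le_pow₀ hw1) hQ) (by positivity)
          _ = _ := by rw [Real.rpow_natCast, ← pow_mul]
      rw [Real.rpow_neg hka.le, Real.rpow_neg (by positivity), ← div_eq_mul_inv, le_div_iff₀ (by positivity),
        inv_mul_le_iff₀ (by positivity), mul_comm]
      exact e3
    calc c * B = c * (((k:ℝ) ^ a) ^ (-κ) * ((k:ℝ) ^ a) ^ l) := by rw [rpow_neg_mul_pow l hk]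
      _ ≤ c * ((w ^ (A * Q) * (((k:ℝ) + 1) ^ a) ^ (-κ)) * ((k:ℝ) ^ a) ^ l) :=
        mul_le_mul_of_nonneg_left (mul_le_mul_of_nonneg_right e1 (by positivity)) hc
      _ = w ^ P1 * T := by rw [← hsl, hT, pow_add]; ring
  set D : ℝ := (k:ℝ) ^ (a * (l - κ) - θ)
  have hD0 : 0 < D := by positivity
  have h6 : x * B ≤ D := one_div_mul_rpow_le hθ hk
  have hV : b * T - C' * c * (1 + n) * D ≤ V := by
    have h3 := (abs_le.1 h2).1
    have h4 : C' * s ^ (-(1 / 4) : ℝ) * T ≤ C' * ((1 + n) * x) * (c * B) :=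
      mul_le_mul (mul_le_mul_of_nonneg_left hq hC') hTle hT0 (by positivity)
    have h5 : C' * c * (1 + n) * (x * B) ≤ C' * c * (1 + n) * D := mul_le_mul_of_nonneg_left h6 (by positivity)
    linarith
  set E : ℝ := C' * c * (1 + n) * D + C * D with hEdef
  have hE : 0 ≤ E := by positivity
  have h7 : b * T - E ≤ w ^ 4 * S := by linarith
  have h8 : b * (c * B) - w ^ P1 * E ≤ w ^ (P1 + 4) * S := by
    have := mul_le_mul_of_nonneg_left h7 (pow_nonneg (zero_le_one.trans hw1) P1)
    have h9 := mul_le_mul_of_nonneg_left hTge hb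
    have h10 : w ^ (P1 + 4) * S = w ^ P1 * (w ^ 4 * S) := by ring
    rw [h10]
    linarith
  have hK : 0 ≤ K := by positivity
  replace hwP : w ^ (P1 + 4) ≤ 1 + K * x := hwP
  clear_value K P1 w D E B T
  by_contra! hcon
  have h10 : S < b * c * B - K * b * c * D - E := by linarith
  have hwp : w ^ P1 ≤ w ^ (P1 + 4) := pow_le_pow_right₀ hw1 (by omega)
  have h12 : w ^ (P1 + 4) * S < w ^ (P1 + 4) * (b * c * B - K * b * c * (x * B) - E) := by
    refine mul_lt_mul_of_pos_left (h10.trans_le ?_) (by positivity)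
    have : K * b * c * (x * B) ≤ K * b * c * D := mul_le_mul_of_nonneg_left h6 (by positivity)
    linarith
  have h13 : w ^ P1 * E ≤ w ^ (P1 + 4) * E := mul_le_mul_of_nonneg_right hwp hE
  have h14 : w ^ (P1 + 4) * (b * c * B * (1 - K * x)) ≤ b * c * B := by
    have e1 : w ^ (P1 + 4) * (1 - K * x) ≤ 1 := by
      rcases le_total (1 - K * x) 0 with h | h
      · exact (mul_nonpos_of_nonneg_of_nonpos (by positivity) h).trans zero_le_one
      · calc w ^ (P1 + 4) * (1 - K * x) ≤ (1 + K * x) * (1 - K * x) := mul_le_mul_of_nonneg_right hwP h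
          _ = 1 - (K * x) ^ 2 := by ring
          _ ≤ 1 := sub_le_self _ (sq_nonneg _)
    have := mul_le_mul_of_nonneg_left e1 (show 0 ≤ b * c * B by positivity)
    linarith
  linarith

/-- Integer vectors of norm at most `s` at which the form takes values in `J`. -/
def latticeSet {n : ℕ} (ε : Fin n → ℝ) (d : ℕ) (s : ℝ) (g : Matrix (Fin n) (Fin n) ℝ) (J : Set ℝ) : Set (Fin n → ℤ) :=
  {v | form ε d g (intVec v) ∈ J ∧ sqNorm (intVec v) ≤ s ^ 2}

lemma intVec_eq_zero {n : ℕ} {v : Fin n → ℤ} (h : intVec v = 0) : v = 0 := by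
  ext i; simpa [intVec] using congrFun h i

lemma sum_sharpSum {m : ℕ} {ε : Fin (m + 1) → ℝ} (hε : ∀ i, ε i ≠ 0) {d : ℕ} (hd : 2 ≤ d)
    {g : Matrix (Fin (m + 1)) (Fin (m + 1)) ℝ} (hg : g.det ≠ 0) (s : ℝ) (J : Set ℝ) :
    ∑ j, sharpSum ε d j s g J = (latticeSet ε d s g J \ {0}).encard := by
  unfold sharpSum
  rw [← Summable.tsum_finsetSum fun _ _ => ENNReal.summable, ← ENNReal.tsum_set_one, tsum_subtype (f := fun _ => 1)]
  refine tsum_congr fun v => ?_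
  rw [← ENNReal.ofReal_sum_of_nonneg fun j _ => sharpFun_nonneg ε d j s g J _]
  by_cases hv : v = 0
  · have h0 : intVec v = 0 := by subst hv; ext i; simp [intVec]
    rw [Set.indicator_of_notMem (fun h => h.2 hv), h0]
    simp [sharpFun, gradWeight_zero ε hd]
  · rw [sum_sharpFun hε hd hg s J fun h => hv (intVec_eq_zero h)]
    by_cases h1 : form ε d g (intVec v) ∈ J
    · by_cases h2 : sqNorm (intVec v) ≤ s ^ 2
      · rw [Set.indicator_of_mem h1, Set.indicator_of_mem (show sqNorm (intVec v) ∈ Set.Iic (s ^ 2) from h2),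
          Set.indicator_of_mem (show v ∈ latticeSet ε d s g J \ {0} from ⟨⟨h1, h2⟩, hv⟩)]
        simp
      · rw [Set.indicator_of_notMem (show sqNorm (intVec v) ∉ Set.Iic (s ^ 2) from h2),
          Set.indicator_of_notMem (fun h : v ∈ latticeSet ε d s g J \ {0} => h2 h.1.2)]
        simp
    · rw [Set.indicator_of_notMem h1, Set.indicator_of_notMem (fun h : v ∈ latticeSet ε d s g J \ {0} => h1 h.1.1)]
      simp

lemma sum_toReal_sharpSum {m : ℕ} {ε : Fin (m + 1) → ℝ} (hε : ∀ i, ε i ≠ 0) {d : ℕ} (hd : 2 ≤ d)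
    {g : Matrix (Fin (m + 1)) (Fin (m + 1)) ℝ} (hg : g.det ≠ 0) (s : ℝ) (J : Set ℝ) :
    (latticeSet ε d s g J).Finite ∧
      ∑ j, (sharpSum ε d j s g J).toReal ≤ (latticeSet ε d s g J).ncard ∧
      ((latticeSet ε d s g J).ncard : ℝ) ≤ (∑ j, (sharpSum ε d j s g J).toReal) + 1 := by
  have h := sum_sharpSum hε hd hg s J
  have hfin : (latticeSet ε d s g J \ {0}).Finite := by
    rw [← Set.encard_ne_top_iff]
    intro htop
    rw [htop] at h
    exact (ENNReal.sum_lt_top.2 fun j _ => (sharpSum_ne_top ε d j s g J).lt_top).ne (by rw [h]; rfl)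
  have hfin' : (latticeSet ε d s g J).Finite := by
    refine (hfin.union (Set.finite_singleton 0)).subset fun v hv => ?_
    by_cases h0 : v = 0
    · exact Or.inr h0
    · exact Or.inl ⟨hv, h0⟩
  have heq : ∑ j, (sharpSum ε d j s g J).toReal = ((latticeSet ε d s g J \ {0}).ncard : ℝ) := by
    rw [← ENNReal.toReal_sum fun j _ => sharpSum_ne_top ε d j s g J, h, ← hfin.cast_ncard_eq]
    simp
  refine ⟨hfin', ?_, ?_⟩
  · rw [heq]
    exact_mod_cast Set.ncard_le_ncard Set.sdiff_subset hfin'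
  · rw [heq]
    have := Set.le_ncard_sdiff {0} (latticeSet ε d s g J)
    rw [Set.ncard_singleton] at this
    exact_mod_cast (show _ ≤ _ by omega)

lemma latticeSet_subset {n : ℕ} (ε : Fin n → ℝ) (d : ℕ) {s s' : ℝ} (hs : 0 ≤ s) (hss : s ≤ s')
    (g : Matrix (Fin n) (Fin n) ℝ) {J J' : Set ℝ} (hJ : J ⊆ J') : latticeSet ε d s g J ⊆ latticeSet ε d s' g J' :=
  fun _ hv => ⟨hJ hv.1, hv.2.trans (pow_le_pow_left₀ hs hss 2)⟩

lemma exists_abs_sub_rpow_le {N : ℝ → ℝ} {a β θ G K : ℝ} {k0 : ℕ} (ha : 0 < a) (hβ : 0 ≤ β) (hθ : θ ≤ 1) (hβθ : 0 ≤ β - θ)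
    (hG : 0 ≤ G) (hK : 0 ≤ K)
    (h : ∀ k : ℕ, k0 ≤ k → ∀ t, (k:ℝ) ^ a ≤ t → t ≤ ((k:ℝ) + 1) ^ a →
      N t ≤ G * (k:ℝ) ^ β + K * (k:ℝ) ^ (β - θ) ∧ G * (k:ℝ) ^ β - K * (k:ℝ) ^ (β - θ) ≤ N t) :
    ∃ C > (0:ℝ), ∃ t₀ : ℝ, ∀ t ≥ t₀, |N t - G * t ^ (β / a)| ≤ C * t ^ ((β - θ) / a) := by
  obtain ⟨A, hA⟩ := exists_nat_ge β
  refine ⟨K + G * 3 ^ A + 1, by positivity, ((k0:ℝ) + 1) ^ a, fun t ht => ?_⟩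
  have ht0 : 0 < t := (by positivity : (0:ℝ) < ((k0:ℝ) + 1) ^ a).trans_le ht
  set u := t ^ (1 / a) with hu
  have hu0 : 0 < u := by positivity
  have hut : u ^ a = t := by rw [hu, ← Real.rpow_mul ht0.le, one_div_mul_cancel ha.ne', Real.rpow_one]
  have hk0u : (k0:ℝ) + 1 ≤ u := by
    rw [ge_iff_le, ← hut] at ht
    exact (Real.rpow_le_rpow_iff (by positivity) hu0.le ha).1 ht
  have e : ∀ b : ℝ, t ^ (b / a) = u ^ b := fun b => by
    rw [hu, ← Real.rpow_mul ht0.le]; congr 1; ring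
  rw [e, e]
  set k := ⌊u⌋₊ with hk
  have hku : (k:ℝ) ≤ u := Nat.floor_le hu0.le
  have huk : u ≤ (k:ℝ) + 1 := (Nat.lt_floor_add_one u).le
  have hkk : k0 + 1 ≤ k := Nat.le_floor (by exact_mod_cast hk0u)
  have hk1 : 1 ≤ k := by omega
  obtain ⟨h1, h2⟩ := h k (by omega) t (by rw [← hut]; exact Real.rpow_le_rpow (by positivity) hku ha.le)
    (by rw [← hut]; exact Real.rpow_le_rpow hu0.le huk ha.le)
  have e1 : (k:ℝ) ^ β ≤ u ^ β := Real.rpow_le_rpow (by positivity) hku hβ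
  have e2 : (k:ℝ) ^ (β - θ) ≤ u ^ (β - θ) := Real.rpow_le_rpow (by positivity) hku hβθ
  have e3 : u ^ β ≤ (k:ℝ) ^ β + 3 ^ A * (k:ℝ) ^ (β - θ) := by
    have hk1R : (1:ℝ) ≤ k := by exact_mod_cast hk1
    have hx1 : (1 / k : ℝ) ≤ 1 := by rw [div_le_one (by linarith)]; exact hk1R
    have f1 := add_one_rpow_le (n := 1) le_rfl hβ hA hk1
    have f2 := one_add_mul_pow_le 1 A (x := 1 / k) (by positivity) hx1
    have f3 := one_div_mul_rpow_le (β := β) hθ hk1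
    rw [one_mul] at f2
    calc u ^ β ≤ ((k:ℝ) + 1) ^ β := Real.rpow_le_rpow hu0.le huk hβ
      _ ≤ _ := f1
      _ ≤ (1 + 3 ^ A * (1 / k)) * (k:ℝ) ^ β := mul_le_mul_of_nonneg_right f2 (by positivity)
      _ = (k:ℝ) ^ β + 3 ^ A * ((1 / k) * (k:ℝ) ^ β) := by ring
      _ ≤ _ := by gcongr
  have g1 := mul_le_mul_of_nonneg_left e1 hG
  have g2 := mul_le_mul_of_nonneg_left e2 hK
  have g3 := mul_le_mul_of_nonneg_left e3 hG
  have g4 := mul_le_mul_of_nonneg_left e2 (by positivity : 0 ≤ G * 3 ^ A)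
  have g5 : 0 ≤ u ^ (β - θ) := by positivity
  have g6 : 0 ≤ G * 3 ^ A * u ^ (β - θ) := by positivity
  rw [abs_le]
  constructor <;> linarith

lemma toReal_le_of_le_ofReal_mul_add {S V : ENNReal} {x y : ℝ} (hx : 0 ≤ x) (hy : 0 ≤ y) (hV : V ≠ ⊤)
    (h : S ≤ ENNReal.ofReal x * V + ENNReal.ofReal y) : S.toReal ≤ x * V.toReal + y := by
  have := ENNReal.toReal_mono (by finiteness) h
  rwa [ENNReal.toReal_add (by finiteness) (by finiteness), ENNReal.toReal_mul, ENNReal.toReal_ofReal hx,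
    ENNReal.toReal_ofReal hy] at this

/-- The family of targets: measurable, decreasing, of measure `c t^{-κ}`. -/
structure ShrinkingTargets (I : ℝ → Set ℝ) (c κ M : ℝ) : Prop where
  measurableSet : ∀ t > (0 : ℝ), MeasurableSet (I t)
  anti : ∀ s t : ℝ, 0 < s → s ≤ t → I t ⊆ I s
  volume_eq : ∀ t > (0 : ℝ), volume (I t) = ENNReal.ofReal (c * t ^ (-κ))
  subset : ∀ t ≥ (1 : ℝ), I t ⊆ Set.Icc (-M) M

/-- The smoothed volumes are asymptotic to `b j * vol(I) * s^l`. -/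
def VolAsymptotic {n : ℕ} (ε : Fin n → ℝ) (d l : ℕ) (g : Matrix (Fin n) (Fin n) ℝ) (M : ℝ) (b : Fin n → ℝ) (C' : ℝ) : Prop :=
  ∀ s : ℝ, 2 ≤ s → ∀ I : Set ℝ, MeasurableSet I → I ⊆ Set.Icc (-M) M → volume I ≠ 0 → ∀ j,
    |(sharpVol ε d j s g I).toReal - b j * ((volume I).toReal * s ^ l)|
      ≤ C' * s ^ (-(1 / 4) : ℝ) * ((volume I).toReal * s ^ l)

lemma VolAsymptotic.apply {n : ℕ} {ε : Fin n → ℝ} {d l : ℕ} {g : Matrix (Fin n) (Fin n) ℝ} {M C' c κ : ℝ} {b : Fin n → ℝ}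
    (h : VolAsymptotic ε d l g M b C') {I : ℝ → Set ℝ} (hI : ShrinkingTargets I c κ M) (hc : 0 < c)
    {s t : ℝ} (hs : 2 ≤ s) (ht : 1 ≤ t) (j : Fin n) :
    |(sharpVol ε d j s g (I t)).toReal - b j * (c * t ^ (-κ) * s ^ l)| ≤ C' * s ^ (-(1 / 4) : ℝ) * (c * t ^ (-κ) * s ^ l) := by
  have ht0 : 0 < t := by linarith
  have hp : 0 < c * t ^ (-κ) := by positivity
  have := h s hs (I t) (hI.measurableSet t ht0) (hI.subset t ht)
    (by rw [hI.volume_eq t ht0]; exact (ENNReal.ofReal_pos.2 hp).ne') j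
  rwa [hI.volume_eq t ht0, ENNReal.toReal_ofReal hp.le] at this

lemma one_le_rpow_natCast {a : ℝ} (ha : 0 ≤ a) {k : ℕ} (hk : 1 ≤ k) : (1:ℝ) ≤ (k:ℝ) ^ a :=
  Real.one_le_rpow (by exact_mod_cast hk) ha

lemma toReal_sharpSum_le {m : ℕ} {ε : Fin (m + 1) → ℝ} {d l : ℕ} {g : Matrix (Fin (m + 1)) (Fin (m + 1)) ℝ}
    {M C' c κ a θ : ℝ} {b : Fin (m + 1) → ℝ} (hb : ∀ j, 0 ≤ b j) (hC' : 0 ≤ C') (h : VolAsymptotic ε d l g M b C')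
    {I : ℝ → Set ℝ} (hI : ShrinkingTargets I c κ M) (hc : 0 < c) (ha : 4 ≤ a) (hθ : θ ≤ 1) (j : Fin (m + 1))
    (hbal : LatticeBalanced ε d j (fun k => ((k:ℝ) + 1) ^ a) (fun k => I ((k:ℝ) ^ a)) (a * (l - κ) - θ) g) :
    ∃ (K : ℝ) (k0 : ℕ), ∀ k : ℕ, k0 ≤ k → (sharpSum ε d j (((k:ℝ) + 1) ^ a) g (I ((k:ℝ) ^ a))).toReal
      ≤ b j * c * (k:ℝ) ^ (a * (l - κ)) + K * (k:ℝ) ^ (a * (l - κ) - θ) := by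
  obtain ⟨C, k0, hC⟩ := hbal
  obtain ⟨K, hK⟩ := le_main_add_error (n := m + 1) (l := l) (κ := κ) (C := C) (by omega) ha hc.le (hb j) hC' hθ
  refine ⟨K, max k0 1, fun k hk => ?_⟩
  have hk1 : 1 ≤ k := le_of_max_le_right hk
  have hk1R : (1:ℝ) ≤ k := by exact_mod_cast hk1
  have hw : (1:ℝ) ≤ 1 + (m + 1 : ℕ) * (1 / k : ℝ) := le_add_of_nonneg_right (by positivity)
  have hs : (2:ℝ) ≤ (1 + (m + 1 : ℕ) * (1 / k : ℝ)) ^ 3 * ((k:ℝ) + 1) ^ a := by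
    calc (2:ℝ) ≤ ((k:ℝ) + 1) ^ (1:ℝ) := by rw [Real.rpow_one]; linarith
      _ ≤ ((k:ℝ) + 1) ^ a := Real.rpow_le_rpow_of_exponent_le (by linarith) (by linarith)
      _ ≤ _ := le_mul_of_one_le_left (by positivity) (one_le_pow₀ hw)
  refine hK k hk1 _ _ (toReal_le_of_le_ofReal_mul_add (by positivity) (by positivity) ?_ (hC k (le_of_max_le_left hk)).1)
    (h.apply hI hc hs (one_le_rpow_natCast (by linarith) hk1) j)
  exact sharpVol_ne_top ε d j (by linarith) g (hI.measurableSet _ (by positivity))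

lemma le_toReal_sharpSum {m : ℕ} {ε : Fin (m + 1) → ℝ} {d l : ℕ} {g : Matrix (Fin (m + 1)) (Fin (m + 1)) ℝ}
    {M C' c κ a θ : ℝ} {b : Fin (m + 1) → ℝ} (hb : ∀ j, 0 ≤ b j) (hC' : 0 ≤ C') (h : VolAsymptotic ε d l g M b C')
    {I : ℝ → Set ℝ} (hI : ShrinkingTargets I c κ M) (hc : 0 < c) (hκ : 0 < κ) (ha : 4 ≤ a) (hθ : θ ≤ 1) (j : Fin (m + 1))
    (hbal : LatticeBalanced ε d j (fun k => max 1 ((k:ℝ) ^ a / (1 + (m + 1 : ℕ) * (1 / k : ℝ)) ^ 3))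
      (fun k => I (((k:ℝ) + 1) ^ a)) (a * (l - κ) - θ) g) :
    ∃ (K : ℝ) (k0 : ℕ), ∀ k : ℕ, k0 ≤ k → b j * c * (k:ℝ) ^ (a * (l - κ)) - K * (k:ℝ) ^ (a * (l - κ) - θ) ≤
      (sharpSum ε d j ((k:ℝ) ^ a) g (I (((k:ℝ) + 1) ^ a))).toReal := by
  obtain ⟨C, k0, hC⟩ := hbal
  obtain ⟨K, hK⟩ := main_sub_error_le (n := m + 1) (l := l) (C := C) (by omega) ha hκ hc.le (hb j) (Nat.cast_nonneg C) hC' hθ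
  refine ⟨K, max k0 (2 * (m + 2) ^ 3), fun k hk => ?_⟩
  have hkm : 2 * (m + 2) ^ 3 ≤ k := le_of_max_le_right hk
  have hkmR : (2:ℝ) * (m + 2) ^ 3 ≤ k := by exact_mod_cast hkm
  have hk1 : 1 ≤ k := (by positivity : 0 < 2 * (m + 2) ^ 3).trans_le hkm
  have hk1R : (1:ℝ) ≤ k := by exact_mod_cast hk1
  have hw : (1:ℝ) ≤ 1 + (m + 1 : ℕ) * (1 / k : ℝ) := le_add_of_nonneg_right (by positivity)
  have hwm : 1 + (m + 1 : ℕ) * (1 / k : ℝ) ≤ m + 2 := by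
    have : (1 / k : ℝ) ≤ 1 := by rw [div_le_one (by linarith)]; exact hk1R
    have := mul_le_mul_of_nonneg_left this (Nat.cast_nonneg (m + 1) : (0:ℝ) ≤ (m + 1 : ℕ))
    push_cast at this ⊢
    linarith
  have hs : (2:ℝ) ≤ (k:ℝ) ^ a / (1 + (m + 1 : ℕ) * (1 / k : ℝ)) ^ 3 := by
    rw [le_div_iff₀ (by positivity)]
    calc (2:ℝ) * (1 + (m + 1 : ℕ) * (1 / k : ℝ)) ^ 3 ≤ 2 * (m + 2) ^ 3 := by gcongr
      _ ≤ (k:ℝ) := hkmR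
      _ = (k:ℝ) ^ (1:ℝ) := (Real.rpow_one _).symm
      _ ≤ _ := Real.rpow_le_rpow_of_exponent_le hk1R (by linarith)
  have h2 := (hC k (le_of_max_le_left hk)).2
  simp only [] at h2
  rw [max_eq_right (by linarith), mul_div_cancel₀ _ (by positivity)] at h2
  exact hK k hk1 _ _ (toReal_le_of_le_ofReal_mul_add (by positivity) (by positivity) (sharpSum_ne_top _ _ _ _ _ _) h2)
    (h.apply hI hc hs (Real.one_le_rpow (by linarith) (by linarith)) j)

/-- Counting asymptotics from lattice-volume comparison along two sequences. -/
lemma exists_abs_ncard_sub_le {m : ℕ} {ε : Fin (m + 1) → ℝ} (hε : ∀ i, ε i ≠ 0) {d l : ℕ} (hd : 2 ≤ d)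
    {g : Matrix (Fin (m + 1)) (Fin (m + 1)) ℝ} (hg : g.det ≠ 0)
    {M C' c κ a θ : ℝ} {b : Fin (m + 1) → ℝ} (hb : ∀ j, 0 ≤ b j) (hC' : 0 ≤ C') (h : VolAsymptotic ε d l g M b C')
    {I : ℝ → Set ℝ} (hI : ShrinkingTargets I c κ M) (hc : 0 < c) (hκ : 0 < κ) (ha : 4 ≤ a) (hθ : θ ≤ 1)
    (hβ : 1 ≤ a * (l - κ))
    (hup : ∀ j, LatticeBalanced ε d j (fun k => ((k:ℝ) + 1) ^ a) (fun k => I ((k:ℝ) ^ a)) (a * (l - κ) - θ) g)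
    (hlow : ∀ j, LatticeBalanced ε d j (fun k => max 1 ((k:ℝ) ^ a / (1 + (m + 1 : ℕ) * (1 / k : ℝ)) ^ 3))
      (fun k => I (((k:ℝ) + 1) ^ a)) (a * (l - κ) - θ) g) :
    ∃ C > (0:ℝ), ∃ t₀ : ℝ, ∀ t ≥ t₀, |((latticeSet ε d t g (I t)).ncard : ℝ) - (∑ j, b j) * c * t ^ ((l - κ) : ℝ)|
      ≤ C * t ^ ((a * (l - κ) - θ) / a) := by
  choose K k0 hK using fun j => toReal_sharpSum_le hb hC' h hI hc ha hθ j (hup j)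
  choose K' k0' hK' using fun j => le_toReal_sharpSum hb hC' h hI hc hκ ha hθ j (hlow j)
  set β : ℝ := a * (l - κ) with hβdef
  set X : ℝ := (∑ j, |K j|) + (∑ j, |K' j|) + 1
  have hG : 0 ≤ (∑ j, b j) * c := mul_nonneg (Finset.sum_nonneg fun j _ => hb j) hc.le
  have hX1 : ∀ (k : ℕ), ∑ j, (b j * c * (k:ℝ) ^ β + K j * (k:ℝ) ^ (β - θ)) = (∑ j, b j) * c * (k:ℝ) ^ β + (∑ j, K j) * (k:ℝ) ^ (β - θ) := by
    intro k; rw [Finset.sum_add_distrib, Finset.sum_mul, Finset.sum_mul, Finset.sum_mul]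
  have hX2 : ∀ (k : ℕ), ∑ j, (b j * c * (k:ℝ) ^ β - K' j * (k:ℝ) ^ (β - θ)) = (∑ j, b j) * c * (k:ℝ) ^ β - (∑ j, K' j) * (k:ℝ) ^ (β - θ) := by
    intro k; rw [Finset.sum_sub_distrib, Finset.sum_mul, Finset.sum_mul, Finset.sum_mul]
  have hKX : ∑ j, K j ≤ ∑ j, |K j| := Finset.sum_le_sum fun j _ => le_abs_self _
  have hKX' : ∑ j, K' j ≤ ∑ j, |K' j| := Finset.sum_le_sum fun j _ => le_abs_self _
  have p1 : 0 ≤ ∑ j, |K j| := Finset.sum_nonneg fun j _ => abs_nonneg _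
  have p2 : 0 ≤ ∑ j, |K' j| := Finset.sum_nonneg fun j _ => abs_nonneg _
  have := exists_abs_sub_rpow_le (N := fun t => ((latticeSet ε d t g (I t)).ncard : ℝ)) (a := a) (β := β) (θ := θ)
    (G := (∑ j, b j) * c) (K := X)
    (k0 := max 1 (max (Finset.univ.sup k0) (Finset.univ.sup k0'))) (by linarith) (by linarith) hθ (by linarith) hG (by positivity) ?_
  · obtain ⟨C, hC, t₀, ht⟩ := this
    refine ⟨C, hC, t₀, fun t h => ?_⟩
    have := ht t h
    rwa [show β / a = l - κ by rw [hβdef]; field_simp] at this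
  intro k hk t hkt htk
  have hk1 : 1 ≤ k := le_of_max_le_left hk
  have hk1R : (1:ℝ) ≤ k := by exact_mod_cast hk1
  have hka : (0:ℝ) < (k:ℝ) ^ a := by positivity
  have ht0 : 0 < t := hka.trans_le hkt
  have hkj : ∀ j, k0 j ≤ k := fun j => (Finset.le_sup (Finset.mem_univ j)).trans ((le_max_left _ _).trans (le_of_max_le_right hk))
  have hkj' : ∀ j, k0' j ≤ k := fun j => (Finset.le_sup (Finset.mem_univ j)).trans ((le_max_right _ _).trans (le_of_max_le_right hk))
  have hD : 1 ≤ (k:ℝ) ^ (β - θ) := one_le_rpow_natCast (by linarith) hk1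
  have q1 := mul_le_mul_of_nonneg_right hKX (zero_le_one.trans hD)
  have q2 := mul_le_mul_of_nonneg_right hKX' (zero_le_one.trans hD)
  have q3 := mul_nonneg p1 (zero_le_one.trans hD)
  have q4 := mul_nonneg p2 (zero_le_one.trans hD)
  obtain ⟨f1, -, u1⟩ := sum_toReal_sharpSum hε hd hg (((k:ℝ) + 1) ^ a) (I ((k:ℝ) ^ a))
  obtain ⟨f0, -, -⟩ := sum_toReal_sharpSum hε hd hg t (I t)
  obtain ⟨-, u2, -⟩ := sum_toReal_sharpSum hε hd hg ((k:ℝ) ^ a) (I (((k:ℝ) + 1) ^ a))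
  have n1 : ((latticeSet ε d t g (I t)).ncard : ℝ) ≤ (latticeSet ε d (((k:ℝ) + 1) ^ a) g (I ((k:ℝ) ^ a))).ncard := by
    exact_mod_cast Set.ncard_le_ncard (latticeSet_subset ε d ht0.le htk g (hI.anti _ _ hka hkt)) f1
  have n2 : ((latticeSet ε d ((k:ℝ) ^ a) g (I (((k:ℝ) + 1) ^ a))).ncard : ℝ) ≤ (latticeSet ε d t g (I t)).ncard := by
    exact_mod_cast Set.ncard_le_ncard (latticeSet_subset ε d hka.le hkt g (hI.anti _ _ ht0 htk)) f0
  have s1 := Finset.sum_le_sum fun j (_ : j ∈ Finset.univ) => hK j k (hkj j)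
  have s2 := Finset.sum_le_sum fun j (_ : j ∈ Finset.univ) => hK' j k (hkj' j)
  rw [hX1] at s1
  rw [hX2] at s2
  have hXD : X * (k:ℝ) ^ (β - θ) = (∑ j, |K j|) * (k:ℝ) ^ (β - θ) + (∑ j, |K' j|) * (k:ℝ) ^ (β - θ) + (k:ℝ) ^ (β - θ) := by
    simp only [X]; ring
  rw [hXD]
  constructor <;> linarith

lemma scale_bounds {n d κ ν : ℝ} (hn : 3 ≤ n) (hκ : 0 < κ) (hL : 0 < n - d - κ) (hd : 2 ≤ d)
    (hν0 : 0 < ν) (hν : ν < 2 * (n - d - κ) / (n ^ 2 + n + 4)) :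
    4 ≤ 1 / ν ∧ 2 * d ≤ 1 / ν ∧ n + 5 ≤ 1 / ν * (n - d - κ) := by
  have hq : 0 < n ^ 2 + n + 4 := by positivity
  rw [lt_div_iff₀ hq] at hν
  set a := 1 / ν with ha
  have ha0 : 0 < a := by positivity
  have hνa : ν * a = 1 := by rw [ha]; field_simp
  have h1 : n ^ 2 + n + 4 < a * (2 * (n - d - κ)) := by
    have := mul_lt_mul_of_pos_left hν ha0
    calc n ^ 2 + n + 4 = (ν * a) * (n ^ 2 + n + 4) := by rw [hνa, one_mul]
      _ = a * (ν * (n ^ 2 + n + 4)) := by ring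
      _ < _ := this
  refine ⟨?_, ?_, ?_⟩
  · by_contra! h
    have : a * (2 * (n - d - κ)) ≤ 4 * (2 * (n - d - κ)) := mul_le_mul_of_nonneg_right h.le (by linarith)
    nlinarith [sq_nonneg (n - 7 / 2)]
  · by_contra! h
    have : a * (2 * (n - d - κ)) ≤ (2 * d) * (2 * (n - d - κ)) := mul_le_mul_of_nonneg_right h.le (by linarith)
    nlinarith [sq_nonneg (n - 2 * d), mul_pos (show 0 < d by linarith) hκ]
  · nlinarith

/-- Counting asymptotics for the signed diagonal form, in terms of `latticeSet`. -/
theorem ae_exists_abs_ncard_sub_le {m : ℕ} {ε : Fin (m + 1) → ℝ} (hε : ∀ i, ε i ≠ 0) (hneg : ∃ i, ε i < 0)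
    (hpos : ∃ i, 0 < ε i) {d : ℕ} (hd : 2 ≤ d) (hde : Even d) (hdm : d ≤ m) {κ : ℝ} (hκ : 0 < κ)
    (hκL : κ < (m + 1 : ℝ) - d) {I : ℝ → Set ℝ} {c M : ℝ} (hc : 0 < c) (hM : 0 < M) (hI : ShrinkingTargets I c κ M)
    (μ : Measure (SLR (m + 1))) [μ.IsHaarMeasure] {ν : ℝ} (hν0 : 0 < ν)
    (hν : ν < 2 * ((m + 1 : ℝ) - d - κ) / ((m + 1 : ℝ) ^ 2 + (m + 1 : ℝ) + 4)) :
    ∀ᵐ g : SLR (m + 1) ∂μ, ∃ cF > (0 : ℝ), ∃ C > (0 : ℝ), ∃ t₀ : ℝ, ∀ t ≥ t₀,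
      |((latticeSet ε d t (g : Matrix (Fin (m + 1)) (Fin (m + 1)) ℝ) (I t)).ncard : ℝ)
        - cF * c * t ^ ((m + 1 : ℝ) - d - κ)| ≤ C * t ^ ((m + 1 : ℝ) - d - κ - ν) := by
  obtain ⟨ν1, hνν, hν1⟩ := exists_between hν
  have hν10 : 0 < ν1 := hν0.trans hνν
  have hdR : (2:ℝ) ≤ d := by exact_mod_cast hd
  have hdmR : (d:ℝ) ≤ m := by exact_mod_cast hdm
  obtain ⟨ha4, ha2d, haβ⟩ := scale_bounds (by linarith) hκ (by linarith) hdR hν10 hν1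
  set a := 1 / ν1 with ha
  set L : ℝ := (m + 1 : ℝ) - d - κ with hL
  have hL0 : 0 < L := by linarith
  have hθ1 : a * ν < 1 := by
    rw [ha, one_div_mul_eq_div, div_lt_one hν10]; exact hνν
  have hθ0 : 0 ≤ a * ν := by positivity
  have hβ : (m:ℝ) + 6 ≤ a * L := by linarith
  have hcast : ((m + 1 - d : ℕ) : ℝ) = (m + 1 : ℝ) - d := by rw [Nat.cast_sub (by omega)]; push_cast; ring
  have hexp : a * L - a * ((m:ℝ) + 1 - d) = a * (-κ) := by rw [hL]; ring
  have h2a : (1:ℝ) ≤ 2 ^ a := Real.one_le_rpow (by norm_num) (by linarith)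
  have hk1 : ∀ k : ℕ, 1 ≤ k → (1:ℝ) ≤ k := fun k hk => by exact_mod_cast hk
  have hvol : ∀ t : ℝ, 0 < t → (volume (I t)).toReal = c * t ^ (-κ) := fun t ht => by
    rw [hI.volume_eq t ht, ENNReal.toReal_ofReal (by positivity)]
  have hvolk : ∀ k : ℕ, 1 ≤ k → c * ((k:ℝ) ^ a) ^ (-κ) ≤ (2 ^ a + c) * (k:ℝ) ^ (a * L - a * ((m:ℝ) + 1 - d)) := by
    intro k hk
    have := hk1 k hk
    rw [hexp, Real.rpow_mul (by linarith)]
    exact mul_le_mul_of_nonneg_right (by linarith) (by positivity)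
  have hA := fun j => ae_sum_row_ne_zero hε (by omega : 0 < d) hde j μ
  have hup := ae_all_iff.2 fun j => ae_latticeBalanced (by omega) hε hd hdm j μ (hA j) hM.le (c := 2 ^ a + c) (by linarith)
    (by linarith) ha2d hβ hθ0 hθ1 (s := fun k => ((k:ℝ) + 1) ^ a) (J := fun k => I ((k:ℝ) ^ a))
    (by
      intro k hk
      exact le_trans (by norm_num) (Real.one_le_rpow (by linarith [hk1 k hk]) (by linarith : 0 ≤ a)))
    (by
      intro k hk
      have := hk1 k hk
      calc ((k:ℝ) + 1) ^ a ≤ (2 * k) ^ a := Real.rpow_le_rpow (by linarith) (by linarith) (by linarith)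
        _ = 2 ^ a * (k:ℝ) ^ a := Real.mul_rpow (by norm_num) (by linarith)
        _ ≤ _ := mul_le_mul_of_nonneg_right (by linarith) (by positivity))
    (fun k hk => hI.measurableSet _ (zero_lt_one.trans_le (one_le_rpow_natCast (by linarith) hk)))
    (fun k hk => hI.subset _ (one_le_rpow_natCast (by linarith) hk))
    (by
      intro k hk
      rw [hvol _ (zero_lt_one.trans_le (one_le_rpow_natCast (by linarith) hk))]
      exact hvolk k hk)
  have hlow := ae_all_iff.2 fun j => ae_latticeBalanced (by omega) hε hd hdm j μ (hA j) hM.le (c := 2 ^ a + c) (by linarith)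
    (by linarith) ha2d hβ hθ0 hθ1 (s := fun k => max 1 ((k:ℝ) ^ a / (1 + (m + 1 : ℕ) * (1 / k : ℝ)) ^ 3))
    (J := fun k => I (((k:ℝ) + 1) ^ a))
    (fun k hk => le_max_of_le_left (by norm_num))
    (by
      intro k hk
      have h1 := one_le_rpow_natCast (a := a) (by linarith) hk
      have hw : (1:ℝ) ≤ 1 + (m + 1 : ℕ) * (1 / k : ℝ) := le_add_of_nonneg_right (by positivity)
      refine (max_le h1 (div_le_self (by linarith) (one_le_pow₀ hw))).trans ?_
      exact le_mul_of_one_le_left (by linarith) (by linarith))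
    (fun k hk => hI.measurableSet _ (by positivity))
    (fun k hk => hI.subset _ (Real.one_le_rpow (by linarith [hk1 k hk]) (by linarith)))
    (by
      intro k hk
      have := hk1 k hk
      rw [hvol _ (by positivity)]
      refine le_trans (mul_le_mul_of_nonneg_left ?_ hc.le) (hvolk k hk)
      exact Real.rpow_le_rpow_of_nonpos (by positivity)
        (Real.rpow_le_rpow (by linarith) (by linarith) (by linarith)) (by linarith))
  filter_upwards [hup, hlow, ae_all_iff.2 hA] with g h1 h2 h3
  have hdet : (g : Matrix (Fin (m + 1)) (Fin (m + 1)) ℝ).det = 1 := g.2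
  obtain ⟨b, hb, hbs, C', hC', hV⟩ := exists_sharpVol_asymptotic hε hd hdm hdet hneg hpos h3 hM
  have hL' : ((m + 1 - d : ℕ) : ℝ) - κ = L := by rw [hcast]
  obtain ⟨C, hC, t₀, h⟩ := exists_abs_ncard_sub_le (θ := a * ν) (l := m + 1 - d) (a := a) hε hd (by rw [hdet]; exact one_ne_zero) hb hC' hV hI hc hκ ha4 hθ1.le
    (by rw [hL']; linarith [(Nat.cast_nonneg m : (0:ℝ) ≤ m)]) (by rwa [hL']) (by rwa [hL'])
  refine ⟨∑ j, b j, hbs, C, hC, t₀, fun t ht => ?_⟩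
  have := h t ht
  rwa [hL', show (a * L - a * ν) / a = L - ν by field_simp] at this

/-- Version for a dimension of the form `n = m + 1` given propositionally. -/
lemma ae_exists_abs_ncard_sub_le_of_pos {n : ℕ} {ε : Fin n → ℝ} (hε : ∀ i, ε i ≠ 0) (hneg : ∃ i, ε i < 0)
    (hpos : ∃ i, 0 < ε i) {d : ℕ} (hd : 2 ≤ d) (hde : Even d) (hdn : d < n) {κ : ℝ} (hκ : 0 < κ)
    (hκL : κ < (n : ℝ) - d) {I : ℝ → Set ℝ} {c M : ℝ} (hc : 0 < c) (hM : 0 < M) (hI : ShrinkingTargets I c κ M)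
    (μ : Measure (SLR n)) [μ.IsHaarMeasure] {ν : ℝ} (hν0 : 0 < ν)
    (hν : ν < 2 * ((n : ℝ) - d - κ) / ((n : ℝ) ^ 2 + (n : ℝ) + 4)) :
    ∀ᵐ g : SLR n ∂μ, ∃ cF > (0 : ℝ), ∃ C > (0 : ℝ), ∃ t₀ : ℝ, ∀ t ≥ t₀,
      |((latticeSet ε d t (g : Matrix (Fin n) (Fin n) ℝ) (I t)).ncard : ℝ)
        - cF * c * t ^ ((n : ℝ) - d - κ)| ≤ C * t ^ ((n : ℝ) - d - κ - ν) := by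
  obtain ⟨m, rfl⟩ : ∃ m, n = m + 1 := ⟨n - 1, by omega⟩
  push_cast at *
  exact ae_exists_abs_ncard_sub_le hε hneg hpos hd hde (by omega) hκ hκL hc hM hI μ hν0 hν

lemma NF_eq_ncard (p q d : ℕ) (g : SLR (p + q)) (J : Set ℝ) {t : ℝ} (ht : 0 ≤ t) :
    NF p q d g J t = (latticeSet (fun i : Fin (p + q) => if (i : ℕ) < p then (1 : ℝ) else -1) d t
      (g : Matrix (Fin (p + q)) (Fin (p + q)) ℝ) J).ncard := by
  unfold NF latticeSet
  rw [Nat.card_coe_set_eq]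
  congr 1
  ext v
  simp only [Set.mem_ofPred_eq, Fg, F0, form, eucNorm, sqNorm, Real.sqrt_le_left ht]

/-- Theorem 1 of the paper: effective counting for shrinking targets, for almost all
forms `F = g·F₀ ∈ Y_{p,q}^{(d)}`. -/
theorem counting_shrinking_targets_explicit_exponent
    (p q d : ℕ) (hp : 1 ≤ p) (hq : 1 ≤ q) (hd2 : 2 ≤ d) (hdeven : Even d)
    (hnd : d < p + q)
    (κ : ℝ) (hκ0 : 0 < κ) (hκ : κ < (p + q : ℝ) - d)
    (I : ℝ → Set ℝ) (c : ℝ) (hc : 0 < c)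
    (hImeas : ∀ t > (0 : ℝ), MeasurableSet (I t))
    (hIbdd : ∀ t > (0 : ℝ), Bornology.IsBounded (I t))
    (hIdec : ∀ s t : ℝ, 0 < s → s ≤ t → I t ⊆ I s)
    (hIvol : ∀ t > (0 : ℝ), volume (I t) = ENNReal.ofReal (c * t ^ (-κ)))
    (μ : Measure (SLR (p + q))) [μ.IsHaarMeasure]
    (ν : ℝ) (hν0 : 0 < ν)
    (hν : ν < 2 * ((p + q : ℝ) - d - κ) / ((p + q : ℝ) ^ 2 + (p + q : ℝ) + 4)) :
    ∀ᵐ g ∂μ, ∃ cF > (0 : ℝ), ∃ CF > (0 : ℝ), ∃ t₀ : ℝ, ∀ t ≥ t₀,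
      |(NF p q d g (I t) t : ℝ) - cF * (volume (I t)).toReal * t ^ ((p + q : ℝ) - d)|
        ≤ CF * t ^ ((p + q : ℝ) - d - κ - ν) := by
  obtain ⟨M, hM, hIM⟩ := (hIbdd 1 one_pos).subset_closedBall_lt 0 0
  rw [Real.closedBall_eq_Icc, zero_sub, zero_add] at hIM
  have hI : ShrinkingTargets I c κ M :=
    ⟨hImeas, hIdec, hIvol, fun t ht => (hIdec 1 t one_pos ht).trans hIM⟩
  have hcast : ((p + q : ℕ) : ℝ) = p + q := by push_cast; rfl
  have key := ae_exists_abs_ncard_sub_le_of_pos (n := p + q) (ε := fun i : Fin (p + q) => if (i : ℕ) < p then (1 : ℝ) else -1)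
    (fun i => by split_ifs <;> norm_num)
    ⟨⟨p, by omega⟩, by simp⟩ ⟨⟨0, by omega⟩, by rw [if_pos (show 0 < p from hp)]; exact one_pos⟩ hd2 hdeven hnd hκ0 (by rwa [hcast]) hc hM hI μ hν0 (by rwa [hcast])
  rw [hcast] at key
  filter_upwards [key] with g hg
  obtain ⟨cF, hcF, C, hC, t₀, h⟩ := hg
  refine ⟨cF, hcF, C, hC, max t₀ 1, fun t ht => ?_⟩
  have ht1 : 1 ≤ t := (le_max_right _ _).trans ht
  have ht0 : 0 < t := by linarith
  have := h t ((le_max_left _ _).trans ht)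
  rw [NF_eq_ncard p q d g (I t) ht0.le, hIvol t ht0, ENNReal.toReal_ofReal (by positivity)]
  convert this using 3
  rw [mul_assoc, mul_assoc, mul_assoc, ← Real.rpow_add ht0]
  congr 3
  ring

end
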